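/- (Gradient estimate in the backward variable.) Assume σ satisfies hypothesis (H^σ_α) for some α ∈ (0,1] and b satisfies hypothesis (H^b_0). Fix T > 0 and (s,t) ∈ 𝔻^T_0. Let (ℙ_{s,x})_{x∈ℝ^d} be a family of solutions of the martingale problem for (b,σ) started at (s,x), and let p(s,·,t,·) : ℝ^d×ℝ^d → ℝ be jointly continuous and such that for every x, p(s,x,t,·) is a density of the law of X_t under ℙ_{s,x}. Then for every y ∈ ℝ^d the map x ↦ p(s,x,t,y) is continuously differentiable, and there exist constants λ₁ ∈ (0,1] and C₁ ≥ 1 depending only on Θ = (T,α,0,κ₀,κ₁,d) such that |∇_x p(s,x,t,y)| ≤ C₁·(t−s)^{−1/2}·g_{λ₁}(t−s, θ^{(1)}_{t,s}(x)−y) for all x,y ∈ ℝ^d. -/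

import Mathlib

noncomputable section

open MeasureTheory Matrix Set

/-- The state space `ℝ^d`. -/
abbrev Vec (d : ℕ) := EuclideanSpace ℝ (Fin d)

/-- Hypothesis (H^b_β): `b` is measurable, bounded at the origin uniformly in time
and Hölder/Lipschitz in space uniformly in time. -/
def HolderDrift (d : ℕ) (b : ℝ → Vec d → Vec d) (κ₁ β : ℝ) : Prop :=
  Measurable (Function.uncurry b) ∧
  (∀ t : ℝ, 0 ≤ t → ‖b t 0‖ ≤ κ₁) ∧
  (∀ t : ℝ, 0 ≤ t → ∀ x y : Vec d, ‖b t x - b t y‖ ≤ κ₁ * max (‖x - y‖ ^ β) ‖x - y‖)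

/-- A smooth nonnegative mollifier supported in the closed unit ball with total mass one. -/
structure IsMollifier (d : ℕ) (ρ : Vec d → ℝ) : Prop where
  smooth : ContDiff ℝ (⊤ : ℕ∞) ρ
  nonneg : ∀ x, 0 ≤ ρ x
  support_subset : Function.support ρ ⊆ Metric.closedBall 0 1
  integral_eq_one : ∫ x, ρ x = 1

/-- The spatially mollified drift `b_ε(t,x) = ∫ b(t,y) ρ_ε(x-y) dy`. -/
def mollifiedDrift (d : ℕ) (ρ : Vec d → ℝ) (ε : ℝ) (b : ℝ → Vec d → Vec d)
    (t : ℝ) (x : Vec d) : Vec d :=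
  ∫ y : Vec d, (ε ^ (-(d : ℝ)) * ρ (ε⁻¹ • (x - y))) • b t y

/-- `θ` is the flow of the (time-dependent) vector field `f`:
`θ t s x = x + ∫_s^t f(r, θ r s x) dr` for all nonnegative times. -/
def IsFlow (d : ℕ) (f : ℝ → Vec d → Vec d) (θ : ℝ → ℝ → Vec d → Vec d) : Prop :=
  ∀ s t : ℝ, 0 ≤ s → 0 ≤ t → ∀ x : Vec d,
    θ t s x = x + ∫ r in s..t, f r (θ r s x)

/-- The Gaussian kernel `g_λ(t,x) = t^{-d/2} exp(-λ |x|²/t)`. -/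
def gaussk (d : ℕ) (l t : ℝ) (x : Vec d) : ℝ :=
  t ^ (-(d : ℝ) / 2) * Real.exp (-l * ‖x‖ ^ 2 / t)

/-- A drift which is measurable, bounded at the origin uniformly in time, and Lipschitz in
space with constant `κ` uniformly in time. -/
def LipschitzDrift (d : ℕ) (b : ℝ → Vec d → Vec d) (κ : ℝ) : Prop :=
  Measurable (Function.uncurry b) ∧
  (∃ M : ℝ, ∀ t : ℝ, 0 ≤ t → ‖b t 0‖ ≤ M) ∧
  (∀ t : ℝ, 0 ≤ t → ∀ x y : Vec d, ‖b t x - b t y‖ ≤ κ * ‖x - y‖)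

/-- The diffusion matrix `σσ*`. -/
def sqMat (d : ℕ) (σ : ℝ → Vec d → Matrix (Fin d) (Fin d) ℝ) (t : ℝ) (x : Vec d) :
    Matrix (Fin d) (Fin d) ℝ :=
  σ t x * (σ t x)ᵀ

/-- Hypothesis (H^σ_α): measurability, uniform ellipticity with constant `κ₀`
and spatial α-Hölder continuity with constant `κ₀`. -/
def EllipticHolder (d : ℕ) (σ : ℝ → Vec d → Matrix (Fin d) (Fin d) ℝ) (κ₀ α : ℝ) : Prop :=
  (∀ i j : Fin d, Measurable fun p : ℝ × Vec d => σ p.1 p.2 i j) ∧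
  (∀ t : ℝ, 0 ≤ t → ∀ x : Vec d, ∀ ξ : Fin d → ℝ,
    κ₀⁻¹ * (ξ ⬝ᵥ ξ) ≤ (sqMat d σ t x).mulVec ξ ⬝ᵥ ξ ∧
      (sqMat d σ t x).mulVec ξ ⬝ᵥ ξ ≤ κ₀ * (ξ ⬝ᵥ ξ)) ∧
  (∀ t : ℝ, 0 ≤ t → ∀ x y : Vec d, ∀ i j : Fin d,
    |σ t x i j - σ t y i j| ≤ κ₀ * ‖x - y‖ ^ α)

/-- `b` is smooth in the space variable, with spatial derivatives of every order
bounded uniformly in time and space. -/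
def SmoothVecBounded (d : ℕ) (b : ℝ → Vec d → Vec d) : Prop :=
  (∀ t : ℝ, ContDiff ℝ (⊤ : ℕ∞) (b t)) ∧
  ∀ n : ℕ, 1 ≤ n → ∃ M : ℝ, ∀ t : ℝ, 0 ≤ t → ∀ x : Vec d,
    ‖iteratedFDeriv ℝ n (b t) x‖ ≤ M

/-- `σ` is smooth in the space variable, with spatial derivatives of every order
bounded uniformly in time and space. -/
def SmoothMatBounded (d : ℕ) (σ : ℝ → Vec d → Matrix (Fin d) (Fin d) ℝ) : Prop :=
  (∀ t : ℝ, ∀ i j : Fin d, ContDiff ℝ (⊤ : ℕ∞) fun x => σ t x i j) ∧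
  ∀ n : ℕ, 1 ≤ n → ∃ M : ℝ, ∀ t : ℝ, 0 ≤ t → ∀ x : Vec d, ∀ i j : Fin d,
    ‖iteratedFDeriv ℝ n (fun z => σ t z i j) x‖ ≤ M

/-- The mean shift `ϑ^{(τ,ξ)}_{t,s} = ∫_s^t b(r, θ_{r,τ}(ξ)) dr` of the frozen process. -/
def freezeMean (d : ℕ) (b : ℝ → Vec d → Vec d) (θ : ℝ → ℝ → Vec d → Vec d)
    (τ : ℝ) (ξ : Vec d) (s t : ℝ) : Vec d :=
  ∫ r in s..t, b r (θ r τ ξ)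

/-- The covariance `𝒞^{(τ,ξ)}_{t,s} = ∫_s^t (σσ*)(r, θ_{r,τ}(ξ)) dr` of the frozen process. -/
def freezeCov (d : ℕ) (σ : ℝ → Vec d → Matrix (Fin d) (Fin d) ℝ)
    (θ : ℝ → ℝ → Vec d → Vec d) (τ : ℝ) (ξ : Vec d) (s t : ℝ) :
    Matrix (Fin d) (Fin d) ℝ :=
  Matrix.of fun i j => ∫ r in s..t, sqMat d σ r (θ r τ ξ) i j

/-- The frozen Gaussian density
`p̃^{(τ,ξ)}(s,x,t,y) = ((2π)^d det 𝒞)^{-1/2} exp(−½ ⟨𝒞⁻¹ m, m⟩)`, `m = ϑ + x − y`. -/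
def frozenDensity (d : ℕ) (b : ℝ → Vec d → Vec d)
    (σ : ℝ → Vec d → Matrix (Fin d) (Fin d) ℝ) (θ : ℝ → ℝ → Vec d → Vec d)
    (τ : ℝ) (ξ : Vec d) (s : ℝ) (x : Vec d) (t : ℝ) (y : Vec d) : ℝ :=
  (Real.sqrt ((2 * Real.pi) ^ d * (freezeCov d σ θ τ ξ s t).det))⁻¹ *
    Real.exp (-(1 / 2) *
      ((freezeCov d σ θ τ ξ s t)⁻¹.mulVec (fun i => (freezeMean d b θ τ ξ s t + x - y) i) ⬝ᵥ
        fun i => (freezeMean d b θ τ ξ s t + x - y) i))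

/-- The generator `L_{r} f(z) = ⟨b(r,z), ∇f(z)⟩ + ½ tr(σσ*(r,z) ∇²f(z))`. -/
def genApply (d : ℕ) (b : ℝ → Vec d → Vec d)
    (σ : ℝ → Vec d → Matrix (Fin d) (Fin d) ℝ) (r : ℝ) (f : Vec d → ℝ) (z : Vec d) : ℝ :=
  (∑ i, b r z i * fderiv ℝ f z (EuclideanSpace.single i (1 : ℝ))) +
    (1 / 2) * ∑ i, ∑ j, sqMat d σ r z i j *
      iteratedFDeriv ℝ 2 f z
        ![EuclideanSpace.single i (1 : ℝ), EuclideanSpace.single j (1 : ℝ)]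

/-- The natural σ-algebra of the process `X` on the time interval `[s,u]`. -/
def pathSigma (d : ℕ) {Ω : Type*} [MeasurableSpace Ω] (X : ℝ → Ω → Vec d)
    (s u : ℝ) : MeasurableSpace Ω :=
  ⨆ r ∈ Set.Icc s u, MeasurableSpace.comap (X r) inferInstance

/-- A solution of the martingale problem for `(b,σ)` started at `(s,x)`:
a probability measure `P` together with a process `X` with continuous paths on `[s,∞)`,
`X_s = x` a.s., such that for every `f ∈ C_c^∞(ℝ^d)` the process
`t ↦ f(X_t) − ∫_s^t (L_r f)(X_r) dr` is a martingale w.r.t. the natural filtration. -/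
structure MartingaleProblemSolution (d : ℕ) (b : ℝ → Vec d → Vec d)
    (σ : ℝ → Vec d → Matrix (Fin d) (Fin d) ℝ) (s : ℝ) (x : Vec d)
    {Ω : Type*} [MeasurableSpace Ω] (P : MeasureTheory.Measure Ω)
    (X : ℝ → Ω → Vec d) : Prop where
  isProb : MeasureTheory.IsProbabilityMeasure P
  measurable_X : ∀ t : ℝ, Measurable (X t)
  cont_paths : ∀ ω : Ω, ContinuousOn (fun t => X t ω) (Set.Ici s)
  start : ∀ᵐ ω ∂P, X s ω = x
  integrable : ∀ f : Vec d → ℝ, ContDiff ℝ (⊤ : ℕ∞) f → HasCompactSupport f →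
    ∀ t : ℝ, s ≤ t →
      MeasureTheory.Integrable
        (fun ω => f (X t ω) - ∫ r in s..t, genApply d b σ r f (X r ω)) P
  martingale : ∀ f : Vec d → ℝ, ContDiff ℝ (⊤ : ℕ∞) f → HasCompactSupport f →
    ∀ u v : ℝ, s ≤ u → u ≤ v → ∀ A : Set Ω, MeasurableSet[pathSigma d X s u] A →
      ∫ ω in A, (f (X v ω) - ∫ r in s..v, genApply d b σ r f (X r ω)) ∂P =
      ∫ ω in A, (f (X u ω) - ∫ r in s..u, genApply d b σ r f (X r ω)) ∂P

/-! ### Uniformly elliptic symmetric matrices -/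

/-- `A` is symmetric with spectrum in `[κ⁻¹ τ, κ τ]`. -/
structure IsElliptic {d : ℕ} (κ τ : ℝ) (A : Matrix (Fin d) (Fin d) ℝ) : Prop where
  symm : Aᵀ = A
  lower : ∀ ξ : Fin d → ℝ, κ⁻¹ * τ * (ξ ⬝ᵥ ξ) ≤ A *ᵥ ξ ⬝ᵥ ξ
  upper : ∀ ξ : Fin d → ℝ, A *ᵥ ξ ⬝ᵥ ξ ≤ κ * τ * (ξ ⬝ᵥ ξ)

lemma dotProduct_self_ofLp {d : ℕ} (z : Vec d) : z.ofLp ⬝ᵥ z.ofLp = ‖z‖ ^ 2 := by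
  rw [EuclideanSpace.norm_sq_eq]
  simp [dotProduct, sq]

lemma dotProduct_sq_le {d : ℕ} (x y : Fin d → ℝ) : (x ⬝ᵥ y) ^ 2 ≤ (x ⬝ᵥ x) * (y ⬝ᵥ y) := by
  have := Finset.sum_mul_sq_le_sq_mul_sq Finset.univ x y
  simpa [dotProduct, sq] using this

lemma abs_apply_le_norm {d : ℕ} (z : Vec d) (i : Fin d) : |z i| ≤ ‖z‖ := by
  simpa using PiLp.norm_apply_le z i

namespace IsElliptic

variable {d : ℕ} {κ τ : ℝ} {A : Matrix (Fin d) (Fin d) ℝ}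

lemma posDef (h : IsElliptic κ τ A) (hκ : 1 ≤ κ) (hτ : 0 < τ) : A.PosDef := by
  refine Matrix.PosDef.of_dotProduct_mulVec_pos ?_ ?_
  · rw [Matrix.IsHermitian, conjTranspose_eq_transpose_of_trivial, h.symm]
  · intro x hx
    have h1 := h.lower x
    have h2 : 0 < x ⬝ᵥ x := by
      have : 0 < star x ⬝ᵥ x := dotProduct_star_self_pos_iff.2 hx
      simpa using this
    have : 0 < κ⁻¹ * τ * (x ⬝ᵥ x) := by positivity
    rw [dotProduct_comm]
    simpa using lt_of_lt_of_le this h1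

lemma det_pos (h : IsElliptic κ τ A) (hκ : 1 ≤ κ) (hτ : 0 < τ) : 0 < A.det :=
  (h.posDef hκ hτ).det_pos

lemma isUnit_det (h : IsElliptic κ τ A) (hκ : 1 ≤ κ) (hτ : 0 < τ) : IsUnit A.det :=
  (h.det_pos hκ hτ).ne'.isUnit

lemma eigenvalue_bounds (h : IsElliptic κ τ A) (hA : A.IsHermitian) (i : Fin d) :
    κ⁻¹ * τ ≤ hA.eigenvalues i ∧ hA.eigenvalues i ≤ κ * τ := by
  have h1 := hA.eigenvalues_eq i
  have h2 : (hA.eigenvectorBasis i).ofLp ⬝ᵥ (hA.eigenvectorBasis i).ofLp = 1 := by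
    rw [dotProduct_self_ofLp, hA.eigenvectorBasis.orthonormal.1 i]; norm_num
  have h3 := h.lower (hA.eigenvectorBasis i).ofLp
  have h4 := h.upper (hA.eigenvectorBasis i).ofLp
  rw [h2, mul_one, dotProduct_comm] at h3 h4
  rw [h1]
  simpa using ⟨h3, h4⟩

lemma det_lower (h : IsElliptic κ τ A) (hκ : 1 ≤ κ) (hτ : 0 < τ) : (κ⁻¹ * τ) ^ d ≤ A.det := by
  have hA := (h.posDef hκ hτ).1
  rw [hA.det_eq_prod_eigenvalues]
  calc (κ⁻¹ * τ) ^ d = ∏ _i : Fin d, (κ⁻¹ * τ) := by simp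
    _ ≤ _ := by
      refine Finset.prod_le_prod (fun i _ => by positivity) (fun i _ => ?_)
      simpa using (h.eigenvalue_bounds hA i).1

lemma det_upper (h : IsElliptic κ τ A) (hκ : 1 ≤ κ) (hτ : 0 < τ) : A.det ≤ (κ * τ) ^ d := by
  have hA := (h.posDef hκ hτ).1
  rw [hA.det_eq_prod_eigenvalues]
  calc _ ≤ ∏ _i : Fin d, (κ * τ) := by
        refine Finset.prod_le_prod (fun i _ => ?_) (fun i _ => ?_)
        · exact le_trans (by positivity) (h.eigenvalue_bounds hA i).1
        · simpa using (h.eigenvalue_bounds hA i).2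
    _ = _ := by simp

lemma mulVec_inv_mulVec (h : IsElliptic κ τ A) (hκ : 1 ≤ κ) (hτ : 0 < τ) (z : Fin d → ℝ) :
    A *ᵥ (A⁻¹ *ᵥ z) = z := by
  rw [mulVec_mulVec, mul_nonsing_inv _ (h.isUnit_det hκ hτ), one_mulVec]

lemma inv_symm (h : IsElliptic κ τ A) : (A⁻¹)ᵀ = A⁻¹ := by
  rw [transpose_nonsing_inv, h.symm]

lemma mulVec_dotProduct_comm (h : IsElliptic κ τ A) (x y : Fin d → ℝ) :
    A *ᵥ x ⬝ᵥ y = A *ᵥ y ⬝ᵥ x := by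
  rw [dotProduct_comm, dotProduct_mulVec, ← mulVec_transpose, h.symm]

lemma inv_quadForm_lower (h : IsElliptic κ τ A) (hκ : 1 ≤ κ) (hτ : 0 < τ) (z : Fin d → ℝ) :
    (κ * τ)⁻¹ * (z ⬝ᵥ z) ≤ A⁻¹ *ᵥ z ⬝ᵥ z := by
  set w := A⁻¹ *ᵥ z with hw
  have hAw : A *ᵥ w = z := h.mulVec_inv_mulVec hκ hτ z
  set t := (κ * τ)⁻¹ with ht
  have h0 : 0 ≤ A *ᵥ (w - t • z) ⬝ᵥ (w - t • z) := by
    refine le_trans ?_ (h.lower _)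
    have : 0 ≤ (w - t • z) ⬝ᵥ (w - t • z) := Finset.sum_nonneg fun i _ => mul_self_nonneg _
    positivity
  have e : A *ᵥ (w - t • z) ⬝ᵥ (w - t • z)
      = w ⬝ᵥ z - 2 * t * (z ⬝ᵥ z) + t ^ 2 * (A *ᵥ z ⬝ᵥ z) := by
    rw [mulVec_sub, mulVec_smul, hAw]
    simp only [sub_dotProduct, dotProduct_sub, smul_dotProduct, dotProduct_smul, smul_eq_mul]
    rw [h.mulVec_dotProduct_comm z w, hAw, dotProduct_comm z w]
    ring
  have hu := h.upper z
  have h3 : t ^ 2 * (A *ᵥ z ⬝ᵥ z) ≤ t * (z ⬝ᵥ z) := by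
    calc t ^ 2 * (A *ᵥ z ⬝ᵥ z) ≤ t ^ 2 * (κ * τ * (z ⬝ᵥ z)) := by gcongr
      _ = t * (z ⬝ᵥ z) := by rw [ht]; field_simp
  rw [e] at h0
  linarith

lemma inv_mulVec_sq_le (h : IsElliptic κ τ A) (hκ : 1 ≤ κ) (hτ : 0 < τ) (z : Fin d → ℝ) :
    (A⁻¹ *ᵥ z) ⬝ᵥ (A⁻¹ *ᵥ z) ≤ (κ / τ) ^ 2 * (z ⬝ᵥ z) := by
  set w := A⁻¹ *ᵥ z with hw
  have hAw : A *ᵥ w = z := h.mulVec_inv_mulVec hκ hτ z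
  have h1 := h.lower w
  rw [hAw] at h1
  have h2 := dotProduct_sq_le z w
  have hww : 0 ≤ w ⬝ᵥ w := Finset.sum_nonneg fun i _ => mul_self_nonneg _
  have hzz : 0 ≤ z ⬝ᵥ z := Finset.sum_nonneg fun i _ => mul_self_nonneg _
  rcases hww.eq_or_lt with h0 | h0
  · rw [← h0]; positivity
  have h3 : (κ⁻¹ * τ * (w ⬝ᵥ w)) ^ 2 ≤ (z ⬝ᵥ z) * (w ⬝ᵥ w) :=
    le_trans (pow_le_pow_left₀ (by positivity) h1 2) h2
  have h4 : (κ⁻¹ * τ) ^ 2 * (w ⬝ᵥ w) ≤ z ⬝ᵥ z := by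
    refine le_of_mul_le_mul_right ?_ h0
    calc _ = (κ⁻¹ * τ * (w ⬝ᵥ w)) ^ 2 := by ring
      _ ≤ _ := h3
  calc w ⬝ᵥ w = (κ / τ) ^ 2 * ((κ⁻¹ * τ) ^ 2 * (w ⬝ᵥ w)) := by field_simp
    _ ≤ _ := by gcongr

lemma inv_quadForm_upper (h : IsElliptic κ τ A) (hκ : 1 ≤ κ) (hτ : 0 < τ) (z : Fin d → ℝ) :
    A⁻¹ *ᵥ z ⬝ᵥ z ≤ κ / τ * (z ⬝ᵥ z) := by
  have h1 := h.inv_mulVec_sq_le hκ hτ z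
  have h2 := dotProduct_sq_le (A⁻¹ *ᵥ z) z
  have hzz : 0 ≤ z ⬝ᵥ z := Finset.sum_nonneg fun i _ => mul_self_nonneg _
  refine abs_le_of_sq_le_sq' ?_ (by positivity) |>.2
  calc _ ≤ _ := h2
    _ ≤ (κ / τ) ^ 2 * (z ⬝ᵥ z) * (z ⬝ᵥ z) := by gcongr
    _ = _ := by ring

lemma abs_inv_mulVec_le (h : IsElliptic κ τ A) (hκ : 1 ≤ κ) (hτ : 0 < τ) (z : Vec d) (i : Fin d) :
    |(A⁻¹ *ᵥ z.ofLp) i| ≤ κ / τ * ‖z‖ := by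
  have h1 := h.inv_mulVec_sq_le hκ hτ z.ofLp
  have e := dotProduct_self_ofLp z
  rw [e] at h1
  refine abs_le_of_sq_le_sq ?_ (by positivity)
  calc (A⁻¹ *ᵥ z.ofLp) i ^ 2 ≤ (A⁻¹ *ᵥ z.ofLp) ⬝ᵥ (A⁻¹ *ᵥ z.ofLp) := by
        rw [sq]
        exact Finset.single_le_sum (f := fun i => (A⁻¹ *ᵥ z.ofLp) i * (A⁻¹ *ᵥ z.ofLp) i)
          (fun i _ => mul_self_nonneg _) (Finset.mem_univ i)
    _ ≤ _ := h1
    _ = _ := by ring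

lemma abs_inv_apply_le (h : IsElliptic κ τ A) (hκ : 1 ≤ κ) (hτ : 0 < τ) (i j : Fin d) :
    |A⁻¹ i j| ≤ κ / τ := by
  have := h.abs_inv_mulVec_le hκ hτ (EuclideanSpace.single j 1) i
  simpa using this

lemma add_smul_one (h : IsElliptic κ τ A) (hκ : 1 ≤ κ) {ε : ℝ} (hε : 0 ≤ ε) :
    IsElliptic κ (τ + ε) (A + ε • (1 : Matrix (Fin d) (Fin d) ℝ)) := by
  have hκ' : κ⁻¹ ≤ 1 := inv_le_one_of_one_le₀ hκ
  refine ⟨by simp [h.symm], fun ξ => ?_, fun ξ => ?_⟩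
  · have := h.lower ξ
    have hx : 0 ≤ ξ ⬝ᵥ ξ := Finset.sum_nonneg fun i _ => mul_self_nonneg _
    rw [add_mulVec, smul_mulVec, one_mulVec, add_dotProduct, smul_dotProduct, smul_eq_mul]
    nlinarith [mul_nonneg hε hx, mul_nonneg (sub_nonneg.2 hκ') (mul_nonneg hε hx)]
  · have := h.upper ξ
    have hx : 0 ≤ ξ ⬝ᵥ ξ := Finset.sum_nonneg fun i _ => mul_self_nonneg _
    rw [add_mulVec, smul_mulVec, one_mulVec, add_dotProduct, smul_dotProduct, smul_eq_mul]
    nlinarith [mul_nonneg hε hx, mul_nonneg (sub_nonneg.2 hκ) (mul_nonneg hε hx)]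

/-- An elliptic matrix has entries bounded by the upper spectral bound. -/
lemma abs_apply_le (h : IsElliptic κ τ A) (hκ : 1 ≤ κ) (hτ : 0 < τ) (i j : Fin d) :
    |A i j| ≤ κ * τ := by
  have hi := h.upper (Pi.single i 1)
  have hj := h.upper (Pi.single j 1)
  have hp := h.lower (Pi.single i 1 + Pi.single j 1)
  have hm := h.lower (Pi.single i 1 - Pi.single j 1)
  have hs : A j i = A i j := congrFun (congrFun h.symm i) j
  have n1 : 0 ≤ κ⁻¹ * τ * ((Pi.single i 1 + Pi.single j 1 : Fin d → ℝ) ⬝ᵥ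
      (Pi.single i 1 + Pi.single j 1)) := by
    have : 0 ≤ (Pi.single i 1 + Pi.single j 1 : Fin d → ℝ) ⬝ᵥ (Pi.single i 1 + Pi.single j 1) :=
      Finset.sum_nonneg fun i _ => mul_self_nonneg _
    positivity
  have n2 : 0 ≤ κ⁻¹ * τ * ((Pi.single i 1 - Pi.single j 1 : Fin d → ℝ) ⬝ᵥ
      (Pi.single i 1 - Pi.single j 1)) := by
    have : 0 ≤ (Pi.single i 1 - Pi.single j 1 : Fin d → ℝ) ⬝ᵥ (Pi.single i 1 - Pi.single j 1) :=
      Finset.sum_nonneg fun i _ => mul_self_nonneg _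
    positivity
  have hp' := n1.trans hp
  have hm' := n2.trans hm
  simp only [mulVec_add, mulVec_sub, dotProduct_add, dotProduct_sub, mulVec_single_one,
    dotProduct_single_one, col_apply, Pi.single_eq_same, mul_one, Pi.add_apply, Pi.sub_apply]
    at hi hj hp' hm'
  rw [hs] at hp' hm'
  rw [abs_le]
  constructor <;> linarith

end IsElliptic

/-! ### Gaussian kernels -/

lemma rpow_le_mul_exp (q : ℝ) (hq : 0 ≤ q) : ∃ C : ℝ, 1 ≤ C ∧ ∀ v : ℝ, 0 ≤ v → v ^ q ≤ C * Real.exp v := by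
  set n := ⌈q⌉₊
  have hn : (1 : ℝ) ≤ (n.factorial : ℝ) := by exact_mod_cast Nat.succ_le_of_lt n.factorial_pos
  refine ⟨n.factorial * Real.exp 1, ?_, fun v hv => ?_⟩
  · nlinarith [Real.add_one_le_exp (1 : ℝ)]
  · have h1 := Real.pow_div_factorial_le_exp (1 + v) (by positivity) n
    rw [div_le_iff₀ (by positivity), Real.exp_add] at h1
    calc v ^ q ≤ (1 + v) ^ q := Real.rpow_le_rpow hv (by linarith) hq
      _ ≤ (1 + v) ^ (n : ℝ) := Real.rpow_le_rpow_of_exponent_le (by linarith) (Nat.le_ceil q)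
      _ = (1 + v) ^ n := Real.rpow_natCast _ _
      _ ≤ _ := by linarith

lemma gaussk_nonneg {d : ℕ} {l t : ℝ} (ht : 0 ≤ t) (z : Vec d) : 0 ≤ gaussk d l t z := by
  unfold gaussk; positivity

lemma gaussk_le_rpow {d : ℕ} {l t : ℝ} (hl : 0 ≤ l) (ht : 0 ≤ t) (z : Vec d) :
    gaussk d l t z ≤ t ^ (-(d : ℝ) / 2) := by
  unfold gaussk
  refine mul_le_of_le_one_right (by positivity) (Real.exp_le_one_iff.2 ?_)
  have : 0 ≤ l * ‖z‖ ^ 2 / t := by positivity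
  have e : -l * ‖z‖ ^ 2 / t = -(l * ‖z‖ ^ 2 / t) := by ring
  linarith

lemma gaussk_mono {d : ℕ} {l l' t : ℝ} (hl : l' ≤ l) (ht : 0 ≤ t) (z : Vec d) :
    gaussk d l t z ≤ gaussk d l' t z := by
  unfold gaussk
  gcongr

/-- Powers of the space variable are absorbed by halving the Gaussian exponent. -/
lemma rpow_mul_gaussk_le (d : ℕ) {l p : ℝ} (hl : 0 < l) (hp : 0 ≤ p) :
    ∃ C : ℝ, 1 ≤ C ∧ ∀ t : ℝ, 0 < t → ∀ z : Vec d,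
      ‖z‖ ^ p * gaussk d l t z ≤ C * t ^ (p / 2) * gaussk d (l / 2) t z := by
  obtain ⟨C, hC, h⟩ := rpow_le_mul_exp (p / 2) (by positivity)
  have h2 : 0 < (2 / l) ^ (p / 2) := by positivity
  refine ⟨C * (1 + (2 / l) ^ (p / 2)), by nlinarith, fun t ht z => ?_⟩
  set v := l / 2 * ‖z‖ ^ 2 / t with hv
  have hv0 : 0 ≤ v := by positivity
  have e1 : ‖z‖ ^ p = v ^ (p / 2) * ((2 / l) ^ (p / 2) * t ^ (p / 2)) := by
    rw [← Real.mul_rpow (by positivity) ht.le, ← Real.mul_rpow hv0 (by positivity)]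
    have : v * (2 / l * t) = ‖z‖ ^ 2 := by rw [hv]; field_simp
    rw [this, ← Real.rpow_natCast, ← Real.rpow_mul (norm_nonneg _)]
    congr 1; push_cast; ring
  have e2 : gaussk d (l / 2) t z = gaussk d l t z * Real.exp v := by
    unfold gaussk
    rw [mul_assoc, ← Real.exp_add]
    congr 2; rw [hv]; ring
  have hg := gaussk_nonneg (l := l) ht.le z
  rw [e1, e2]
  calc v ^ (p / 2) * ((2 / l) ^ (p / 2) * t ^ (p / 2)) * gaussk d l t z
      ≤ (C * Real.exp v) * ((1 + (2 / l) ^ (p / 2)) * t ^ (p / 2)) * gaussk d l t z := by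
        gcongr
        · exact h v hv0
        · linarith
    _ = _ := by ring

/-- The centred Gaussian density with covariance `A`. -/
def gaussDens {d : ℕ} (A : Matrix (Fin d) (Fin d) ℝ) (z : Vec d) : ℝ :=
  (Real.sqrt ((2 * Real.pi) ^ d * A.det))⁻¹ * Real.exp (-(1 / 2) * (A⁻¹ *ᵥ z.ofLp ⬝ᵥ z.ofLp))

/-- The first order partial derivatives of `gaussDens A`. -/
def gaussDens₁ {d : ℕ} (A : Matrix (Fin d) (Fin d) ℝ) (z : Vec d) (i : Fin d) : ℝ :=
  -(A⁻¹ *ᵥ z.ofLp) i * gaussDens A z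

/-- The second order partial derivatives of `gaussDens A`. -/
def gaussDens₂ {d : ℕ} (A : Matrix (Fin d) (Fin d) ℝ) (z : Vec d) (i j : Fin d) : ℝ :=
  ((A⁻¹ *ᵥ z.ofLp) i * (A⁻¹ *ᵥ z.ofLp) j - A⁻¹ i j) * gaussDens A z

section GaussBounds

variable {d : ℕ} {κ τ : ℝ} {A : Matrix (Fin d) (Fin d) ℝ}

lemma gaussDens_nonneg (A : Matrix (Fin d) (Fin d) ℝ) (z : Vec d) : 0 ≤ gaussDens A z := by
  unfold gaussDens; positivity

lemma sqrt_pow_eq_rpow {x : ℝ} (hx : 0 ≤ x) : Real.sqrt (x ^ d) = x ^ ((d : ℝ) / 2) := by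
  rw [Real.sqrt_eq_rpow, ← Real.rpow_natCast, ← Real.rpow_mul hx]
  congr 1; ring

lemma gaussDens_le (h : IsElliptic κ τ A) (hκ : 1 ≤ κ) (hτ : 0 < τ) (z : Vec d) :
    gaussDens A z ≤ κ ^ ((d : ℝ) / 2) * gaussk d (1 / (2 * κ)) τ z := by
  have hdet := h.det_lower hκ hτ
  have h0 : 0 < (κ⁻¹ * τ) ^ d := by positivity
  have hpi : (1 : ℝ) ≤ (2 * Real.pi) ^ d := one_le_pow₀ (by linarith [Real.pi_gt_three])
  have h1 : (κ⁻¹ * τ) ^ d ≤ (2 * Real.pi) ^ d * A.det := by nlinarith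
  have h2 := h.inv_quadForm_lower hκ hτ z.ofLp
  have e := dotProduct_self_ofLp z
  rw [e] at h2
  have h3 : (Real.sqrt ((2 * Real.pi) ^ d * A.det))⁻¹ ≤ κ ^ ((d : ℝ) / 2) * τ ^ (-(d : ℝ) / 2) := by
    calc _ ≤ (Real.sqrt ((κ⁻¹ * τ) ^ d))⁻¹ := by gcongr
      _ = _ := by
        rw [sqrt_pow_eq_rpow (by positivity), ← Real.rpow_neg (by positivity),
          Real.mul_rpow (by positivity) hτ.le, Real.inv_rpow (by positivity),
          Real.rpow_neg (by positivity), inv_inv, neg_div]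
  unfold gaussDens gaussk
  rw [← mul_assoc]
  refine mul_le_mul h3 (Real.exp_le_exp.2 ?_) (by positivity) (by positivity)
  calc _ ≤ -(1 / 2) * ((κ * τ)⁻¹ * ‖z‖ ^ 2) := by linarith
    _ = _ := by field_simp

lemma gaussDens_ge (h : IsElliptic κ τ A) (hκ : 1 ≤ κ) (hτ : 0 < τ) (z : Vec d) :
    (2 * Real.pi * κ) ^ (-(d : ℝ) / 2) * gaussk d (κ / 2) τ z ≤ gaussDens A z := by
  have hdet := h.det_upper hκ hτ
  have hdet0 := h.det_pos hκ hτ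
  have h1 : (2 * Real.pi) ^ d * A.det ≤ (2 * Real.pi * κ * τ) ^ d := by
    calc _ ≤ (2 * Real.pi) ^ d * (κ * τ) ^ d := by gcongr
      _ = _ := by rw [← mul_pow]; ring
  have h2 := h.inv_quadForm_upper hκ hτ z.ofLp
  have e := dotProduct_self_ofLp z
  rw [e] at h2
  have h3 : (2 * Real.pi * κ) ^ (-(d : ℝ) / 2) * τ ^ (-(d : ℝ) / 2)
      ≤ (Real.sqrt ((2 * Real.pi) ^ d * A.det))⁻¹ := by
    calc _ = (Real.sqrt ((2 * Real.pi * κ * τ) ^ d))⁻¹ := by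
          rw [sqrt_pow_eq_rpow (by positivity), ← Real.rpow_neg (by positivity),
            ← Real.mul_rpow (by positivity) hτ.le, neg_div]
      _ ≤ _ := by gcongr
  unfold gaussDens gaussk
  rw [← mul_assoc]
  refine mul_le_mul h3 (Real.exp_le_exp.2 ?_) (by positivity) (by positivity)
  calc _ = -(1 / 2) * (κ / τ * ‖z‖ ^ 2) := by ring
    _ ≤ _ := by linarith

lemma abs_gaussDens₁_le (h : IsElliptic κ τ A) (hκ : 1 ≤ κ) (hτ : 0 < τ) (z : Vec d) (i : Fin d) :
    |gaussDens₁ A z i| ≤ κ / τ * ‖z‖ * gaussDens A z := by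
  unfold gaussDens₁
  rw [abs_mul, abs_neg, abs_of_nonneg (gaussDens_nonneg A z)]
  exact mul_le_mul_of_nonneg_right (h.abs_inv_mulVec_le hκ hτ z i) (gaussDens_nonneg A z)

lemma abs_gaussDens₂_le (h : IsElliptic κ τ A) (hκ : 1 ≤ κ) (hτ : 0 < τ) (z : Vec d)
    (i j : Fin d) :
    |gaussDens₂ A z i j| ≤ ((κ / τ) ^ 2 * ‖z‖ ^ 2 + κ / τ) * gaussDens A z := by
  unfold gaussDens₂
  rw [abs_mul, abs_of_nonneg (gaussDens_nonneg A z)]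
  refine mul_le_mul_of_nonneg_right ?_ (gaussDens_nonneg A z)
  refine (abs_sub _ _).trans ?_
  have h1 := h.abs_inv_mulVec_le hκ hτ z i
  have h2 := h.abs_inv_mulVec_le hκ hτ z j
  have h3 := h.abs_inv_apply_le hκ hτ i j
  rw [abs_mul]
  calc _ ≤ κ / τ * ‖z‖ * (κ / τ * ‖z‖) + κ / τ := by gcongr
    _ = _ := by ring

end GaussBounds

lemma gaussDens₁_weighted (d : ℕ) {κ p : ℝ} (hκ : 1 ≤ κ) (hp : 0 ≤ p) :
    ∃ C : ℝ, 1 ≤ C ∧ ∀ (τ : ℝ) (A : Matrix (Fin d) (Fin d) ℝ), 0 < τ → IsElliptic κ τ A →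
      ∀ (z : Vec d) (i : Fin d),
        ‖z‖ ^ p * |gaussDens₁ A z i| ≤ C * τ ^ ((p - 1) / 2) * gaussk d (1 / (4 * κ)) τ z := by
  obtain ⟨C, hC, h⟩ := rpow_mul_gaussk_le d (l := 1 / (2 * κ)) (p := p + 1) (by positivity)
    (by positivity)
  have k1 : 1 ≤ κ ^ ((d : ℝ) / 2) := Real.one_le_rpow hκ (by positivity)
  refine ⟨κ * κ ^ ((d : ℝ) / 2) * C, by
    nlinarith [mul_le_mul hκ k1 zero_le_one (by linarith)], fun τ A hτ hA z i => ?_⟩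
  have hz : ‖z‖ ^ p * ‖z‖ = ‖z‖ ^ (p + 1) := by
    rw [Real.rpow_add_one' (norm_nonneg _) (by linarith)]
  calc ‖z‖ ^ p * |gaussDens₁ A z i|
      ≤ ‖z‖ ^ p * (κ / τ * ‖z‖ * (κ ^ ((d : ℝ) / 2) * gaussk d (1 / (2 * κ)) τ z)) := by
        have := gaussk_nonneg (l := 1 / (2 * κ)) hτ.le z
        gcongr
        exact (abs_gaussDens₁_le hA hκ hτ z i).trans (by gcongr; exact gaussDens_le hA hκ hτ z)
    _ = κ / τ * κ ^ ((d : ℝ) / 2) * (‖z‖ ^ (p + 1) * gaussk d (1 / (2 * κ)) τ z) := by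
        rw [← hz]; ring
    _ ≤ κ / τ * κ ^ ((d : ℝ) / 2) *
        (C * τ ^ ((p + 1) / 2) * gaussk d (1 / (2 * κ) / 2) τ z) := by
        exact mul_le_mul_of_nonneg_left (h τ hτ z) (by positivity)
    _ = _ := by
        have e : τ ^ ((p + 1) / 2) = τ * τ ^ ((p - 1) / 2) := by
          rw [← Real.rpow_one_add' hτ.le (by linarith)]; congr 1; ring
        rw [e, show 1 / (2 * κ) / 2 = 1 / (4 * κ) by field_simp; norm_num]
        field_simp

lemma gaussDens₂_weighted (d : ℕ) {κ p : ℝ} (hκ : 1 ≤ κ) (hp : 0 ≤ p) :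
    ∃ C : ℝ, 1 ≤ C ∧ ∀ (τ : ℝ) (A : Matrix (Fin d) (Fin d) ℝ), 0 < τ → IsElliptic κ τ A →
      ∀ (z : Vec d) (i j : Fin d),
        ‖z‖ ^ p * |gaussDens₂ A z i j| ≤ C * τ ^ (p / 2 - 1) * gaussk d (1 / (4 * κ)) τ z := by
  obtain ⟨C, hC, h⟩ := rpow_mul_gaussk_le d (l := 1 / (2 * κ)) (p := p + 2) (by positivity)
    (by positivity)
  obtain ⟨C', hC', h'⟩ := rpow_mul_gaussk_le d (l := 1 / (2 * κ)) (p := p) (by positivity) hp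
  have k1 : 1 ≤ κ ^ ((d : ℝ) / 2) := Real.one_le_rpow hκ (by positivity)
  have k3 : 1 ≤ κ ^ 2 := one_le_pow₀ hκ
  refine ⟨κ ^ ((d : ℝ) / 2) * (κ ^ 2 * C + κ * C'), by
    nlinarith [mul_le_mul k3 hC zero_le_one (by positivity),
      mul_le_mul hκ hC' zero_le_one (by positivity)], fun τ A hτ hA z i j => ?_⟩
  have hz : ‖z‖ ^ p * ‖z‖ ^ 2 = ‖z‖ ^ (p + 2) := by
    rw [← Real.rpow_natCast ‖z‖ 2, ← Real.rpow_add' (norm_nonneg _) (by push_cast; linarith)]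
    norm_num
  calc ‖z‖ ^ p * |gaussDens₂ A z i j|
      ≤ ‖z‖ ^ p * (((κ / τ) ^ 2 * ‖z‖ ^ 2 + κ / τ) *
          (κ ^ ((d : ℝ) / 2) * gaussk d (1 / (2 * κ)) τ z)) := by
        have := gaussk_nonneg (l := 1 / (2 * κ)) hτ.le z
        gcongr
        exact (abs_gaussDens₂_le hA hκ hτ z i j).trans
          (by gcongr; exact gaussDens_le hA hκ hτ z)
    _ = κ ^ ((d : ℝ) / 2) * ((κ / τ) ^ 2 * (‖z‖ ^ (p + 2) * gaussk d (1 / (2 * κ)) τ z) +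
          κ / τ * (‖z‖ ^ p * gaussk d (1 / (2 * κ)) τ z)) := by
        rw [← hz]; ring
    _ ≤ κ ^ ((d : ℝ) / 2) * ((κ / τ) ^ 2 *
          (C * τ ^ ((p + 2) / 2) * gaussk d (1 / (2 * κ) / 2) τ z) +
          κ / τ * (C' * τ ^ (p / 2) * gaussk d (1 / (2 * κ) / 2) τ z)) := by
        have i1 := mul_le_mul_of_nonneg_left (h τ hτ z) (by positivity : 0 ≤ (κ / τ) ^ 2)
        have i2 := mul_le_mul_of_nonneg_left (h' τ hτ z) (by positivity : 0 ≤ κ / τ)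
        exact mul_le_mul_of_nonneg_left (add_le_add i1 i2) (by positivity)
    _ = _ := by
        have e : τ ^ ((p + 2) / 2) = τ * τ * τ ^ (p / 2 - 1) := by
          rw [show (p + 2) / 2 = p / 2 - 1 + 1 + 1 by ring, Real.rpow_add_one hτ.ne',
            Real.rpow_add_one hτ.ne']
          ring
        have e' : τ ^ (p / 2) = τ * τ ^ (p / 2 - 1) := by
          conv_lhs => rw [show p / 2 = p / 2 - 1 + 1 by ring, Real.rpow_add_one hτ.ne']
          ring
        rw [e, e', show 1 / (2 * κ) / 2 = 1 / (4 * κ) by field_simp; norm_num]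
        field_simp

/-! ### Derivatives of Gaussian kernels -/

/-- The coordinate functionals on `Vec d`. -/
abbrev coord {d : ℕ} (i : Fin d) : Vec d →L[ℝ] ℝ := EuclideanSpace.proj i

lemma hasFDerivAt_coord {d : ℕ} (i : Fin d) (z : Vec d) :
    HasFDerivAt (fun z : Vec d => z i) (coord i) z :=
  (coord i).hasFDerivAt

lemma hasFDerivAt_mulVec {d : ℕ} (B : Matrix (Fin d) (Fin d) ℝ) (i : Fin d) (z : Vec d) :
    HasFDerivAt (fun z : Vec d => (B *ᵥ z.ofLp) i) (∑ j, B i j • coord j) z := by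
  unfold mulVec dotProduct
  exact HasFDerivAt.fun_sum fun j _ => (hasFDerivAt_coord j z).const_mul (B i j)

section

variable {d : ℕ} {A : Matrix (Fin d) (Fin d) ℝ}

lemma hasFDerivAt_gaussDens (hA : (A⁻¹)ᵀ = A⁻¹) (z : Vec d) :
    HasFDerivAt (gaussDens A) (∑ i, gaussDens₁ A z i • coord i) z := by
  have h1 : HasFDerivAt (fun z : Vec d => A⁻¹ *ᵥ z.ofLp ⬝ᵥ z.ofLp)
      (∑ i, ((A⁻¹ *ᵥ z.ofLp) i • coord i + z i • ∑ j, A⁻¹ i j • coord j)) z := by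
    unfold dotProduct
    exact HasFDerivAt.fun_sum fun i _ =>
      (hasFDerivAt_mulVec A⁻¹ i z).mul (hasFDerivAt_coord i z)
  have h2 := ((h1.const_mul (-(1 / 2))).exp).const_mul (Real.sqrt ((2 * Real.pi) ^ d * A.det))⁻¹
  refine h2.congr_fderiv ?_
  ext v
  have hs : ∑ i, z i * ∑ j, A⁻¹ i j * v j = ∑ i, (A⁻¹ *ᵥ z.ofLp) i * v i := by
    have : ∑ i, z i * ∑ j, A⁻¹ i j * v j = A⁻¹ *ᵥ v.ofLp ⬝ᵥ z.ofLp := by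
      rw [dotProduct_comm]; rfl
    rw [this, dotProduct_comm, dotProduct_mulVec, ← mulVec_transpose, hA]
    rfl
  simp only [_root_.smul_apply, _root_.add_apply,
    _root_.sum_apply, smul_eq_mul, Finset.sum_add_distrib, 
    PiLp.proj_apply, hs, gaussDens₁, gaussDens]
  have e : ∀ c : ℝ, ∑ i, -(A⁻¹ *ᵥ z.ofLp) i * c * v i = -c * ∑ i, (A⁻¹ *ᵥ z.ofLp) i * v i := by
    intro c
    rw [Finset.mul_sum]
    exact Finset.sum_congr rfl fun i _ => by ring
  rw [e]
  ring

lemma hasFDerivAt_gaussDens₁ (hA : (A⁻¹)ᵀ = A⁻¹) (z : Vec d) (i : Fin d) :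
    HasFDerivAt (fun z => gaussDens₁ A z i) (∑ j, gaussDens₂ A z i j • coord j) z := by
  have h := (hasFDerivAt_mulVec A⁻¹ i z).neg.mul (hasFDerivAt_gaussDens hA z)
  refine h.congr_fderiv ?_
  ext v
  simp only [_root_.smul_apply, _root_.add_apply,
    _root_.sum_apply, smul_eq_mul, 
    _root_.neg_apply, PiLp.proj_apply, gaussDens₁, gaussDens₂, Finset.mul_sum, Pi.neg_apply,
    ← Finset.sum_neg_distrib]
  rw [← Finset.sum_add_distrib]
  exact Finset.sum_congr rfl fun j _ => by ring

lemma contDiff_gaussDens (A : Matrix (Fin d) (Fin d) ℝ) : ContDiff ℝ (⊤ : ℕ∞) (gaussDens A) := by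
  unfold gaussDens mulVec dotProduct
  fun_prop


end

lemma tendsto_det {ι : Type*} {d : ℕ} {l : Filter ι} {B : ι → Matrix (Fin d) (Fin d) ℝ}
    {B₀ : Matrix (Fin d) (Fin d) ℝ} (hB : ∀ i j, Filter.Tendsto (fun x => B x i j) l (nhds (B₀ i j))) :
    Filter.Tendsto (fun x => (B x).det) l (nhds B₀.det) := by
  simp only [det_apply']
  exact tendsto_finsetSum _ fun σ _ =>
    (tendsto_finsetProd _ fun i _ => hB (σ i) i).const_mul _

lemma tendsto_inv_apply {ι : Type*} {d : ℕ} {l : Filter ι} {B : ι → Matrix (Fin d) (Fin d) ℝ}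
    {B₀ : Matrix (Fin d) (Fin d) ℝ} (hB : ∀ i j, Filter.Tendsto (fun x => B x i j) l (nhds (B₀ i j)))
    (h0 : B₀.det ≠ 0) (i j : Fin d) :
    Filter.Tendsto (fun x => (B x)⁻¹ i j) l (nhds (B₀⁻¹ i j)) := by
  simp only [inv_def, Matrix.smul_apply, adjugate_apply, Ring.inverse_eq_inv', smul_eq_mul]
  refine ((tendsto_det hB).inv₀ h0).mul (tendsto_det fun a b => ?_)
  simp only [updateRow_apply]
  split_ifs
  · exact tendsto_const_nhds
  · exact hB a b

lemma tendsto_ofLp_apply {ι : Type*} {d : ℕ} {l : Filter ι} {z : ι → Vec d} {z₀ : Vec d}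
    (hz : Filter.Tendsto z l (nhds z₀)) (i : Fin d) :
    Filter.Tendsto (fun x => z x i) l (nhds (z₀ i)) :=
  ((coord i).continuous.tendsto z₀).comp hz

section

variable {ι : Type*} {d : ℕ} {l : Filter ι} {B : ι → Matrix (Fin d) (Fin d) ℝ}
  {B₀ : Matrix (Fin d) (Fin d) ℝ} {z : ι → Vec d} {z₀ : Vec d}

lemma tendsto_inv_mulVec (hB : ∀ i j, Filter.Tendsto (fun x => B x i j) l (nhds (B₀ i j)))
    (h0 : B₀.det ≠ 0) (hz : Filter.Tendsto z l (nhds z₀)) (i : Fin d) :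
    Filter.Tendsto (fun x => ((B x)⁻¹ *ᵥ (z x).ofLp) i) l (nhds ((B₀⁻¹ *ᵥ z₀.ofLp) i)) := by
  simp only [mulVec, dotProduct]
  exact tendsto_finsetSum _ fun j _ =>
    (tendsto_inv_apply hB h0 i j).mul (tendsto_ofLp_apply hz j)

lemma tendsto_gaussDens (hB : ∀ i j, Filter.Tendsto (fun x => B x i j) l (nhds (B₀ i j)))
    (h0 : 0 < B₀.det) (hz : Filter.Tendsto z l (nhds z₀)) :
    Filter.Tendsto (fun x => gaussDens (B x) (z x)) l (nhds (gaussDens B₀ z₀)) := by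
  unfold gaussDens
  refine Filter.Tendsto.mul (Filter.Tendsto.inv₀ ?_ ?_) ?_
  · exact ((tendsto_det hB).const_mul _).sqrt
  · positivity
  · refine Filter.Tendsto.rexp (Filter.Tendsto.const_mul _ ?_)
    simp only [dotProduct]
    exact tendsto_finsetSum _ fun i _ =>
      (tendsto_inv_mulVec hB h0.ne' hz i).mul (tendsto_ofLp_apply hz i)

lemma tendsto_gaussDens₁ (hB : ∀ i j, Filter.Tendsto (fun x => B x i j) l (nhds (B₀ i j)))
    (h0 : 0 < B₀.det) (hz : Filter.Tendsto z l (nhds z₀)) (i : Fin d) :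
    Filter.Tendsto (fun x => gaussDens₁ (B x) (z x) i) l (nhds (gaussDens₁ B₀ z₀ i)) :=
  (tendsto_inv_mulVec hB h0.ne' hz i).neg.mul (tendsto_gaussDens hB h0 hz)

lemma tendsto_gaussDens₂ (hB : ∀ i j, Filter.Tendsto (fun x => B x i j) l (nhds (B₀ i j)))
    (h0 : 0 < B₀.det) (hz : Filter.Tendsto z l (nhds z₀)) (i j : Fin d) :
    Filter.Tendsto (fun x => gaussDens₂ (B x) (z x) i j) l (nhds (gaussDens₂ B₀ z₀ i j)) :=
  (((tendsto_inv_mulVec hB h0.ne' hz i).mul (tendsto_inv_mulVec hB h0.ne' hz j)).sub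
    (tendsto_inv_apply hB h0.ne' i j)).mul (tendsto_gaussDens hB h0 hz)

end

section

variable {β : Type*} [MeasurableSpace β] {d : ℕ} {B : β → Matrix (Fin d) (Fin d) ℝ} {z : β → Vec d}

lemma measurable_det (hB : ∀ i j, Measurable fun x => B x i j) :
    Measurable fun x => (B x).det := by
  simp only [det_apply']
  exact Finset.measurable_fun_sum _ fun σ _ =>
    (Finset.measurable_fun_prod _ fun i _ => hB (σ i) i).const_mul _

lemma measurable_inv_apply (hB : ∀ i j, Measurable fun x => B x i j) (i j : Fin d) :
    Measurable fun x => (B x)⁻¹ i j := by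
  simp only [inv_def, Matrix.smul_apply, adjugate_apply, Ring.inverse_eq_inv', smul_eq_mul]
  refine (measurable_det hB).inv.mul (measurable_det fun a b => ?_)
  simp only [updateRow_apply]
  split_ifs
  · exact measurable_const
  · exact hB a b

lemma measurable_ofLp_apply (hz : Measurable z) (i : Fin d) : Measurable fun x => z x i :=
  (coord i).continuous.measurable.comp hz

lemma measurable_inv_mulVec (hB : ∀ i j, Measurable fun x => B x i j) (hz : Measurable z)
    (i : Fin d) : Measurable fun x => ((B x)⁻¹ *ᵥ (z x).ofLp) i := by
  simp only [mulVec, dotProduct]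
  exact Finset.measurable_fun_sum _ fun j _ =>
    (measurable_inv_apply hB i j).mul (measurable_ofLp_apply hz j)

lemma measurable_gaussDens (hB : ∀ i j, Measurable fun x => B x i j) (hz : Measurable z) :
    Measurable fun x => gaussDens (B x) (z x) := by
  unfold gaussDens
  refine ((measurable_det hB).const_mul _).sqrt.inv.mul (Measurable.exp (Measurable.const_mul ?_ _))
  simp only [dotProduct]
  exact Finset.measurable_fun_sum _ fun i _ =>
    (measurable_inv_mulVec hB hz i).mul (measurable_ofLp_apply hz i)

lemma measurable_gaussDens₁ (hB : ∀ i j, Measurable fun x => B x i j) (hz : Measurable z)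
    (i : Fin d) : Measurable fun x => gaussDens₁ (B x) (z x) i :=
  (measurable_inv_mulVec hB hz i).neg.mul (measurable_gaussDens hB hz)

lemma measurable_gaussDens₂ (hB : ∀ i j, Measurable fun x => B x i j) (hz : Measurable z)
    (i j : Fin d) : Measurable fun x => gaussDens₂ (B x) (z x) i j :=
  (((measurable_inv_mulVec hB hz i).mul (measurable_inv_mulVec hB hz j)).sub
    (measurable_inv_apply hB i j)).mul (measurable_gaussDens hB hz)

end

section TimeDerivative

variable {d : ℕ} {B : ℝ → Matrix (Fin d) (Fin d) ℝ} {B' : Matrix (Fin d) (Fin d) ℝ} {r : ℝ}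

/-- Jacobi's formula. -/
lemma hasDerivAt_det (hB : ∀ i j, HasDerivAt (fun x => B x i j) (B' i j) r) :
    HasDerivAt (fun x => (B x).det) (∑ i, ∑ j, (B r).adjugate i j * B' j i) r := by
  have h1 : HasDerivAt (fun x => (B x).det) (∑ σ : Equiv.Perm (Fin d),
      ((Equiv.Perm.sign σ : ℤ) : ℝ) *
        ∑ i, (∏ j ∈ Finset.univ.erase i, B r (σ j) j) • B' (σ i) i) r := by
    simp only [det_apply']
    exact HasDerivAt.fun_sum fun σ _ =>
      (HasDerivAt.fun_finsetProd fun i _ => hB (σ i) i).const_mul _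
  refine h1.congr_deriv ?_
  have h2 : ∀ i, ∑ j, (B r).adjugate i j * B' j i = ((B r).updateCol i (B'.col i)).det := by
    intro i
    rw [← cramer_apply, cramer_eq_adjugate_mulVec]
    rfl
  simp only [h2, det_apply', Finset.mul_sum]
  rw [Finset.sum_comm]
  refine Finset.sum_congr rfl fun i _ => Finset.sum_congr rfl fun σ _ => ?_
  congr 1
  rw [← Finset.mul_prod_erase _ _ (Finset.mem_univ i), smul_eq_mul, mul_comm]
  congr 1
  · simp
  · refine Finset.prod_congr rfl fun j hj => ?_
    simp [(Finset.mem_erase.1 hj).1]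

lemma hasDerivAt_inv_apply (hB : ∀ i j, HasDerivAt (fun x => B x i j) (B' i j) r)
    (h0 : 0 < (B r).det) (i j : Fin d) :
    HasDerivAt (fun x => (B x)⁻¹ i j) (-((B r)⁻¹ * B' * (B r)⁻¹) i j) r := by
  have hex : ∀ i j, ∃ D, HasDerivAt (fun x => (B x)⁻¹ i j) D r := by
    intro i j
    simp only [inv_def, Matrix.smul_apply, adjugate_apply, Ring.inverse_eq_inv', smul_eq_mul]
    have hd : ∀ a b, HasDerivAt (fun x => (B x).updateRow j (Pi.single i 1) a b)
        ((if a = j then 0 else B' a b)) r := by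
      intro a b
      simp only [updateRow_apply]
      split_ifs
      · exact hasDerivAt_const _ _
      · exact hB a b
    exact ⟨_, ((hasDerivAt_det hB).inv h0.ne').mul
      (hasDerivAt_det (B' := Matrix.of fun a b => if a = j then 0 else B' a b) hd)⟩
  choose D hD using hex
  have hu : IsUnit (B r).det := h0.ne'.isUnit
  have hloc : ∀ᶠ x in nhds r, 0 < (B x).det :=
    (hasDerivAt_det hB).continuousAt.eventually (lt_mem_nhds h0)
  have key : Matrix.of D * B r + (B r)⁻¹ * B' = 0 := by
    ext i k
    have h1 : HasDerivAt (fun x => ∑ j, (B x)⁻¹ i j * B x j k)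
        (∑ j, (D i j * B r j k + (B r)⁻¹ i j * B' j k)) r :=
      HasDerivAt.fun_sum fun j _ => (hD i j).mul (hB j k)
    have h2 : HasDerivAt (fun x => ∑ j, (B x)⁻¹ i j * B x j k) 0 r := by
      refine (hasDerivAt_const r ((1 : Matrix (Fin d) (Fin d) ℝ) i k)).congr_of_eventuallyEq ?_
      filter_upwards [hloc] with x hx
      have := congrFun (congrFun (nonsing_inv_mul (B x) hx.ne'.isUnit) i) k
      rw [mul_apply] at this
      exact this
    have h3 := h1.unique h2
    rw [Finset.sum_add_distrib] at h3
    simpa [mul_apply] using h3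
  have hDe : Matrix.of D = -((B r)⁻¹ * B' * (B r)⁻¹) := by
    have h4 : Matrix.of D * B r = -((B r)⁻¹ * B') := eq_neg_of_add_eq_zero_left key
    have h5 := congrArg (· * (B r)⁻¹) h4
    simpa [mul_assoc, mul_nonsing_inv _ hu] using h5
  have := hD i j
  have e : D i j = -((B r)⁻¹ * B' * (B r)⁻¹) i j := congrFun (congrFun hDe i) j
  rwa [e] at this

lemma hasDerivAt_gaussDens {m : ℝ → Vec d} {m' : Vec d}
    (hB : ∀ i j, HasDerivAt (fun x => B x i j) (B' i j) r) (h0 : 0 < (B r).det)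
    (hs : ((B r)⁻¹)ᵀ = (B r)⁻¹) (hm : HasDerivAt m m' r) :
    HasDerivAt (fun x => gaussDens (B x) (m x))
      ((1 / 2) * (∑ i, ∑ j, B' i j * gaussDens₂ (B r) (m r) i j) +
        ∑ i, m' i * gaussDens₁ (B r) (m r) i) r := by
  have hmi : ∀ i, HasDerivAt (fun x => m x i) (m' i) r := fun i =>
    (coord i).hasFDerivAt.comp_hasDerivAt r hm
  have hdet := hasDerivAt_det hB
  have h1 := (hdet.const_mul ((2 * Real.pi) ^ d)).sqrt (by positivity)
  have h2 := h1.inv (by positivity)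
  have hq : HasDerivAt (fun x => (B x)⁻¹ *ᵥ (m x).ofLp ⬝ᵥ (m x).ofLp)
      (∑ i, ((∑ j, (-((B r)⁻¹ * B' * (B r)⁻¹) i j * m r j + (B r)⁻¹ i j * m' j)) * m r i +
        (∑ j, (B r)⁻¹ i j * m r j) * m' i)) r := by
    simp only [mulVec, dotProduct]
    exact HasDerivAt.fun_sum fun i _ => (HasDerivAt.fun_sum fun j _ =>
      (hasDerivAt_inv_apply hB h0 i j).mul (hmi j)).mul (hmi i)
  have h3 := h2.mul (hq.const_mul (-(1 / 2))).exp
  refine h3.congr_deriv ?_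
  set w : Fin d → ℝ := (B r)⁻¹ *ᵥ (m r).ofLp with hw
  have hsum1 : ∑ i, ∑ j, (B r).adjugate i j * B' j i = (B r).det * ∑ i, ∑ j, (B r)⁻¹ i j * B' i j := by
    have : ∀ i j, (B r)⁻¹ j i = (B r)⁻¹ i j := fun i j => congrFun (congrFun hs i) j
    rw [Finset.mul_sum]
    rw [Finset.sum_comm]
    refine Finset.sum_congr rfl fun i _ => ?_
    rw [Finset.mul_sum]
    refine Finset.sum_congr rfl fun j _ => ?_
    rw [← this i j, inv_def, Matrix.smul_apply, Ring.inverse_eq_inv', smul_eq_mul]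
    field_simp
  have hsum2 : ∑ i, ((∑ j, (-((B r)⁻¹ * B' * (B r)⁻¹) i j * m r j + (B r)⁻¹ i j * m' j)) * m r i +
        (∑ j, (B r)⁻¹ i j * m r j) * m' i)
      = -(∑ i, ∑ j, B' i j * (w i * w j)) + 2 * ∑ i, w i * m' i := by
    have e1 : (((B r)⁻¹ * B' * (B r)⁻¹) *ᵥ (m r).ofLp) ⬝ᵥ (m r).ofLp
        = ∑ i, ∑ j, B' i j * (w i * w j) := by
      rw [← mulVec_mulVec, ← mulVec_mulVec, dotProduct_comm, dotProduct_mulVec, ← mulVec_transpose,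
        hs, ← hw]
      simp only [dotProduct, mulVec, Finset.mul_sum]
      exact Finset.sum_congr rfl fun i _ => Finset.sum_congr rfl fun j _ => by ring
    have e2 : ((B r)⁻¹ *ᵥ m'.ofLp) ⬝ᵥ (m r).ofLp = ∑ i, w i * m' i := by
      rw [dotProduct_comm, dotProduct_mulVec, ← mulVec_transpose, hs, ← hw]
      rfl
    have e3 : ∑ i, (∑ j, (B r)⁻¹ i j * m r j) * m' i = ∑ i, w i * m' i := rfl
    rw [Finset.sum_add_distrib, e3, two_mul, ← add_assoc, ← e2, ← e1]
    congr 1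
    simp only [dotProduct, mulVec, ← Finset.sum_neg_distrib, ← Finset.sum_add_distrib]
    refine Finset.sum_congr rfl fun i _ => ?_
    rw [← neg_mul, ← add_mul, ← Finset.sum_neg_distrib, ← Finset.sum_add_distrib]
    simp only [neg_mul]
  have hG2 : ∑ i, ∑ j, B' i j * gaussDens₂ (B r) (m r) i j =
      (∑ i, ∑ j, B' i j * (w i * w j) - ∑ i, ∑ j, (B r)⁻¹ i j * B' i j) * gaussDens (B r) (m r) := by
    rw [← Finset.sum_sub_distrib, Finset.sum_mul]
    refine Finset.sum_congr rfl fun i _ => ?_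
    rw [← Finset.sum_sub_distrib, Finset.sum_mul]
    refine Finset.sum_congr rfl fun j _ => ?_
    unfold gaussDens₂
    rw [← hw]; ring
  have hG1 : ∑ i, m' i * gaussDens₁ (B r) (m r) i = -(∑ i, w i * m' i) * gaussDens (B r) (m r) := by
    rw [← Finset.sum_neg_distrib, Finset.sum_mul]
    refine Finset.sum_congr rfl fun i _ => ?_
    unfold gaussDens₁
    rw [← hw]; ring
  rw [hG2, hG1, hsum1, hsum2]
  unfold gaussDens
  have hS : 0 < (2 * Real.pi) ^ d * (B r).det := by positivity
  have hsq := Real.sq_sqrt hS.le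
  set S := Real.sqrt ((2 * Real.pi) ^ d * (B r).det) with hSdef
  have hSpos : 0 < S := Real.sqrt_pos.2 hS
  simp only [Pi.inv_apply]
  have e5 : (2 * Real.pi) ^ d * ((B r).det * ∑ i, ∑ j, (B r)⁻¹ i j * B' i j)
      = S ^ 2 * ∑ i, ∑ j, (B r)⁻¹ i j * B' i j := by rw [hsq]; ring
  rw [e5]
  field_simp
  ring

end TimeDerivative

/-! ### Gaussian kernels along Lipschitz paths, total mass, approximate identity -/

lemma contDiffAt_gaussDens {d : ℕ} {q : (Fin d → Fin d → ℝ) × Vec d}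
    (h0 : 0 < (Matrix.of q.1).det) :
    ContDiffAt ℝ 1 (fun q : (Fin d → Fin d → ℝ) × Vec d => gaussDens (Matrix.of q.1) q.2) q := by
  have he : ∀ i j, ContDiffAt ℝ 1 (fun q : (Fin d → Fin d → ℝ) × Vec d => q.1 i j) q := by
    intro i j; fun_prop
  have hz : ∀ i, ContDiffAt ℝ 1 (fun q : (Fin d → Fin d → ℝ) × Vec d => q.2 i) q := by
    intro i; fun_prop
  have hdet : ∀ M : (Fin d → Fin d → ℝ) × Vec d → Matrix (Fin d) (Fin d) ℝ,
      (∀ i j, ContDiffAt ℝ 1 (fun q => M q i j) q) → ContDiffAt ℝ 1 (fun q => (M q).det) q := by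
    intro M hM
    simp only [det_apply']
    exact ContDiffAt.sum fun σ _ => contDiffAt_const.mul (contDiffAt_prod fun i _ => hM _ _)
  have hinv : ∀ i j, ContDiffAt ℝ 1
      (fun q : (Fin d → Fin d → ℝ) × Vec d => (Matrix.of q.1)⁻¹ i j) q := by
    intro i j
    simp only [inv_def, Matrix.smul_apply, adjugate_apply, Ring.inverse_eq_inv', smul_eq_mul]
    refine ((hdet _ he).inv h0.ne').mul (hdet _ fun a b => ?_)
    simp only [updateRow_apply]
    split_ifs
    · exact contDiffAt_const
    · exact he a b
  unfold gaussDens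
  refine ContDiffAt.mul (ContDiffAt.inv (ContDiffAt.sqrt (contDiffAt_const.mul (hdet _ he)) ?_) ?_)
    (ContDiffAt.exp (contDiffAt_const.mul ?_))
  · positivity
  · positivity
  · simp only [mulVec, dotProduct]
    exact ContDiffAt.sum fun i _ => (ContDiffAt.sum fun j _ => (hinv i j).mul (hz j)).mul (hz i)

lemma exists_lipschitzOnWith_gaussDens {d : ℕ} {u t K : ℝ} {B : ℝ → Matrix (Fin d) (Fin d) ℝ}
    {m : ℝ → Vec d} (h0 : ∀ r ∈ Icc u t, 0 < (B r).det)
    (hB : ∀ r ∈ Icc u t, ∀ r' ∈ Icc u t, ∀ i j, |B r i j - B r' i j| ≤ K * |r - r'|)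
    (hm : ∀ r ∈ Icc u t, ∀ r' ∈ Icc u t, ‖m r - m r'‖ ≤ K * |r - r'|) :
    ∃ K', LipschitzOnWith K' (fun r => gaussDens (B r) (m r)) (Icc u t) := by
  set γ : ℝ → (Fin d → Fin d → ℝ) × Vec d := fun r => (fun i j => B r i j, m r) with hγ
  have hγL : LipschitzOnWith K.toNNReal γ (Icc u t) := by
    refine LipschitzOnWith.of_dist_le_mul fun r hr r' hr' => ?_
    have hc : ∀ x : ℝ, 0 ≤ x → K * x ≤ K.toNNReal * x := fun x hx =>
      mul_le_mul_of_nonneg_right (Real.le_coe_toNNReal K) hx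
    have hnn : 0 ≤ (K.toNNReal : ℝ) * dist r r' := by positivity
    rw [Prod.dist_eq]
    refine max_le ?_ ?_
    · refine (dist_pi_le_iff hnn).2 fun i => (dist_pi_le_iff hnn).2 fun j => ?_
      rw [Real.dist_eq, Real.dist_eq]
      exact (hB r hr r' hr' i j).trans (hc _ (abs_nonneg _))
    · rw [dist_eq_norm, Real.dist_eq]
      exact (hm r hr r' hr').trans (hc _ (abs_nonneg _))
  refine LocallyLipschitzOn.exists_lipschitzOnWith_of_compact isCompact_Icc ?_
  intro r hr
  have hof : ∀ r, Matrix.of (γ r).1 = B r := fun r => rfl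
  have hdet : 0 < (Matrix.of (γ r).1).det := by rw [hof]; exact h0 r hr
  obtain ⟨K', V, hV, hL⟩ := (contDiffAt_gaussDens hdet).exists_lipschitzOnWith
  refine ⟨K' * K.toNNReal, γ ⁻¹' V ∩ Icc u t,
    Filter.inter_mem (hγL.continuousOn r hr hV) self_mem_nhdsWithin, ?_⟩
  have h1 := hL.comp (hγL.mono inter_subset_right) (s := γ ⁻¹' V ∩ Icc u t) fun x hx => hx.1
  have h2 : (fun r => gaussDens (B r) (m r)) = 
      (fun q : (Fin d → Fin d → ℝ) × Vec d => gaussDens (Matrix.of q.1) q.2) ∘ γ := by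
    funext r
    simp only [Function.comp_apply, hof]
    rfl
  rw [h2]
  exact h1

lemma integrable_gaussk (d : ℕ) {l t : ℝ} (hl : 0 < l) (ht : 0 < t) :
    Integrable (fun z : Vec d => gaussk d l t z) := by
  have h := (GaussianFourier.integrable_cexp_neg_mul_sq_norm_add (V := Vec d) (b := ((l / t : ℝ) : ℂ))
    (by simpa using div_pos hl ht) 0 0).re
  unfold gaussk
  refine (h.const_mul (t ^ (-(d : ℝ) / 2))).congr (Filter.Eventually.of_forall fun z => ?_)
  simp only [RCLike.re_to_complex]
  congr 1
  have : Complex.exp (-((l / t : ℝ) : ℂ) * (‖z‖ : ℂ) ^ 2 + 0 * ((inner ℝ (0 : Vec d) z : ℝ) : ℂ))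
      = ((Real.exp (-l * ‖z‖ ^ 2 / t) : ℝ) : ℂ) := by
    rw [Complex.ofReal_exp]; congr 1; push_cast; ring
  rw [this, Complex.ofReal_re]

lemma integral_gaussk (d : ℕ) {l t : ℝ} (hl : 0 < l) (ht : 0 < t) :
    ∫ z : Vec d, gaussk d l t z = (Real.pi / l) ^ ((d : ℝ) / 2) := by
  unfold gaussk
  rw [integral_const_mul]
  have h := GaussianFourier.integral_rexp_neg_mul_sq_norm (V := Vec d) (b := l / t) (by positivity)
  have e : ∀ z : Vec d, -l * ‖z‖ ^ 2 / t = -(l / t) * ‖z‖ ^ 2 := fun z => by ring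
  simp only [e]
  rw [h, finrank_euclideanSpace_fin, show Real.pi / (l / t) = Real.pi / l * t by field_simp,
    Real.mul_rpow (by positivity) ht.le, neg_div, Real.rpow_neg ht.le]
  field_simp

lemma lintegral_gaussk (d : ℕ) {l t : ℝ} (hl : 0 < l) (ht : 0 < t) :
    ∫⁻ z : Vec d, ENNReal.ofReal (gaussk d l t z)
      = ENNReal.ofReal ((Real.pi / l) ^ ((d : ℝ) / 2)) := by
  rw [← ofReal_integral_eq_lintegral_ofReal (integrable_gaussk d hl ht)
    (Filter.Eventually.of_forall fun z => gaussk_nonneg ht.le z), integral_gaussk d hl ht]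

lemma gaussDens_smul_one {d : ℕ} {ε : ℝ} (hε : 0 < ε) (z : Vec d) :
    gaussDens (ε • (1 : Matrix (Fin d) (Fin d) ℝ)) z
      = (2 * Real.pi) ^ (-(d : ℝ) / 2) * gaussk d (1 / 2) ε z := by
  unfold gaussDens gaussk
  have e := dotProduct_self_ofLp z
  have hinv : (ε • (1 : Matrix (Fin d) (Fin d) ℝ))⁻¹ = ε⁻¹ • 1 := by
    apply inv_eq_left_inv
    rw [smul_mul_smul_comm, inv_mul_cancel₀ hε.ne', one_mul, one_smul]
  rw [det_smul, det_one, mul_one, Fintype.card_fin, ← mul_pow, sqrt_pow_eq_rpow (by positivity),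
    Real.mul_rpow (by positivity) hε.le, hinv, smul_mulVec, one_mulVec, smul_dotProduct, e, neg_div,
    Real.rpow_neg (by positivity), Real.rpow_neg (by positivity), smul_eq_mul, mul_inv]
  rw [mul_assoc]
  congr 3
  field_simp

lemma measurable_gaussk {d : ℕ} (l t : ℝ) : Measurable fun z : Vec d => gaussk d l t z := by
  unfold gaussk
  fun_prop

lemma tendsto_integral_mul_gaussDens {d : ℕ} {f : Vec d → ℝ} {M : ℝ} (hf : Continuous f)
    (hM : ∀ x, |f x| ≤ M) (x : Vec d) :
    Filter.Tendsto (fun ε : ℝ => ∫ y, f y * gaussDens (ε • (1 : Matrix (Fin d) (Fin d) ℝ)) (x - y))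
      (nhdsWithin 0 (Ioi 0)) (nhds (f x)) := by
  set c := (2 * Real.pi) ^ (-(d : ℝ) / 2) with hc
  have hc0 : 0 ≤ c := by positivity
  have h1 : ∀ ε : ℝ, 0 < ε →
      ∫ y, f y * gaussDens (ε • (1 : Matrix (Fin d) (Fin d) ℝ)) (x - y)
        = ∫ w : Vec d, f (x - Real.sqrt ε • w) * (c * gaussk d (1 / 2) 1 w) := by
    intro ε hε
    have hs : 0 < Real.sqrt ε := Real.sqrt_pos.2 hε
    have e1 := integral_sub_left_eq_self
      (fun y => f (x - y) * gaussDens (ε • (1 : Matrix (Fin d) (Fin d) ℝ)) y) volume x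
    simp only [sub_sub_cancel] at e1
    rw [e1]
    have e2 := Measure.integral_comp_smul volume
      (fun y : Vec d => f (x - y) * gaussDens (ε • (1 : Matrix (Fin d) (Fin d) ℝ)) y) (Real.sqrt ε)
    rw [finrank_euclideanSpace_fin, abs_of_pos (by positivity), smul_eq_mul,
      eq_inv_mul_iff_mul_eq₀ (by positivity)] at e2
    rw [← e2, ← integral_const_mul]
    refine integral_congr_ae (Filter.Eventually.of_forall fun w => ?_)
    simp only
    rw [gaussDens_smul_one hε, ← hc]
    unfold gaussk
    have e3 : ε ^ (-(d : ℝ) / 2) * Real.sqrt ε ^ d = 1 := by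
      rw [Real.sqrt_eq_rpow, ← Real.rpow_natCast, ← Real.rpow_mul hε.le, ← Real.rpow_add hε]
      rw [show -(d : ℝ) / 2 + 1 / 2 * d = 0 by ring, Real.rpow_zero]
    have e4 : -(1 / 2 : ℝ) * ‖Real.sqrt ε • w‖ ^ 2 / ε = -(1 / 2) * ‖w‖ ^ 2 / 1 := by
      rw [norm_smul, mul_pow, Real.norm_eq_abs, sq_abs, Real.sq_sqrt hε.le]
      field_simp
    rw [e4, Real.one_rpow]
    linear_combination (f (x - Real.sqrt ε • w) * c * Real.exp (-(1 / 2) * ‖w‖ ^ 2 / 1)) * e3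
  have h2 : f x = ∫ w : Vec d, f (x - Real.sqrt 0 • w) * (c * gaussk d (1 / 2) 1 w) := by
    simp only [Real.sqrt_zero, zero_smul, sub_zero]
    rw [integral_const_mul, integral_const_mul, integral_gaussk d (by norm_num) one_pos, hc, neg_div,
      Real.rpow_neg (by positivity), show Real.pi / (1 / 2) = 2 * Real.pi by ring,
      inv_mul_cancel₀ (by positivity), mul_one]
  rw [h2]
  have h3 : Filter.Tendsto
      (fun ε : ℝ => ∫ w : Vec d, f (x - Real.sqrt ε • w) * (c * gaussk d (1 / 2) 1 w))
      (nhds 0) (nhds (∫ w : Vec d, f (x - Real.sqrt 0 • w) * (c * gaussk d (1 / 2) 1 w))) := by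
    refine tendsto_integral_filter_of_dominated_convergence
      (fun w => M * (c * gaussk d (1 / 2) 1 w)) ?_ ?_ ?_ ?_
    · refine Filter.Eventually.of_forall fun ε => ?_
      exact ((by fun_prop : Continuous fun w : Vec d => f (x - Real.sqrt ε • w)).measurable.mul
        ((measurable_gaussk _ _).const_mul c)).aestronglyMeasurable
    · refine Filter.Eventually.of_forall fun ε => Filter.Eventually.of_forall fun w => ?_
      rw [norm_mul, Real.norm_eq_abs, Real.norm_eq_abs,
        abs_of_nonneg (mul_nonneg hc0 (gaussk_nonneg zero_le_one w))]
      exact mul_le_mul_of_nonneg_right (hM _) (mul_nonneg hc0 (gaussk_nonneg zero_le_one w))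
    · exact ((integrable_gaussk d (by norm_num) one_pos).const_mul c).const_mul M
    · refine Filter.Eventually.of_forall fun w => ?_
      have : Continuous fun ε : ℝ => f (x - Real.sqrt ε • w) * (c * gaussk d (1 / 2) 1 w) := by
        fun_prop
      exact this.tendsto 0
  refine (h3.mono_left nhdsWithin_le_nhds).congr' ?_
  filter_upwards [self_mem_nhdsWithin] with ε hε
  exact (h1 ε hε).symm

/-! ### Functions with explicit partial derivatives -/

/-- `f₁` and `f₂` are the first and second order partial derivatives of `f`. -/
structure HasPartials {d : ℕ} (f : Vec d → ℝ) (f₁ : Vec d → Fin d → ℝ)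
    (f₂ : Vec d → Fin d → Fin d → ℝ) : Prop where
  fst : ∀ z, HasFDerivAt f (∑ i, f₁ z i • coord i) z
  snd : ∀ z i, HasFDerivAt (fun w => f₁ w i) (∑ j, f₂ z i j • coord j) z

/-- The second order operator with drift `β` and diffusion matrix `A`, evaluated on the partial
derivatives `f₁`, `f₂`. -/
def genForm {d : ℕ} (β : Vec d) (A : Matrix (Fin d) (Fin d) ℝ) (f₁ : Fin d → ℝ)
    (f₂ : Fin d → Fin d → ℝ) : ℝ :=
  ∑ i, β i * f₁ i + (1 / 2) * ∑ i, ∑ j, A i j * f₂ i j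

lemma sum_smul_coord_single {d : ℕ} (c : Fin d → ℝ) (i : Fin d) :
    (∑ j, c j • coord j : Vec d →L[ℝ] ℝ) (EuclideanSpace.single i 1) = c i := by
  simp [PiLp.single_apply]

lemma eq_sum_smul_coord {d : ℕ} (L : Vec d →L[ℝ] ℝ) :
    L = ∑ j, L (EuclideanSpace.single j 1) • coord j := by
  refine ContinuousLinearMap.coe_injective ((EuclideanSpace.basisFun (Fin d) ℝ).toBasis.ext fun i => ?_)
  simp only [OrthonormalBasis.coe_toBasis, EuclideanSpace.basisFun_apply,
    ContinuousLinearMap.coe_coe]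
  rw [sum_smul_coord_single]

namespace HasPartials

variable {d : ℕ} {f g : Vec d → ℝ} {f₁ g₁ : Vec d → Fin d → ℝ} {f₂ g₂ : Vec d → Fin d → Fin d → ℝ}

lemma fderiv_single (h : HasPartials f f₁ f₂) (z : Vec d) (i : Fin d) :
    fderiv ℝ f z (EuclideanSpace.single i 1) = f₁ z i := by
  rw [(h.fst z).fderiv, sum_smul_coord_single]

lemma iteratedFDeriv_single (h : HasPartials f f₁ f₂) (z : Vec d) (i j : Fin d) :
    iteratedFDeriv ℝ 2 f z ![EuclideanSpace.single i (1 : ℝ), EuclideanSpace.single j (1 : ℝ)]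
      = f₂ z j i := by
  rw [iteratedFDeriv_two_apply]
  have e : fderiv ℝ f = fun w => ∑ k, f₁ w k • coord k := funext fun w => (h.fst w).fderiv
  have h2 : HasFDerivAt (fderiv ℝ f)
      (∑ k, (∑ l, f₂ z k l • coord l : Vec d →L[ℝ] ℝ).smulRight (coord k : Vec d →L[ℝ] ℝ)) z := by
    rw [e]
    exact HasFDerivAt.fun_sum fun k _ => (h.snd z k).smul_const (coord k : Vec d →L[ℝ] ℝ)
  have e2 : (∑ k, (∑ l, f₂ z k l • coord l : Vec d →L[ℝ] ℝ).smulRight (coord k : Vec d →L[ℝ] ℝ))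
      (EuclideanSpace.single i 1) = ∑ k, f₂ z k i • coord k := by
    rw [_root_.sum_apply]
    exact Finset.sum_congr rfl fun k _ => by
      rw [ContinuousLinearMap.smulRight_apply, sum_smul_coord_single]
  rw [h2.fderiv, cons_val_zero, cons_val_one, e2]
  exact sum_smul_coord_single (fun k => f₂ z k i) j

lemma continuous_fst (h : HasPartials f f₁ f₂) (i : Fin d) : Continuous fun z => f₁ z i :=
  continuous_iff_continuousAt.2 fun z => (h.snd z i).continuousAt

lemma measurable_snd (h : HasPartials f f₁ f₂) (i j : Fin d) : Measurable fun z => f₂ z i j := by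
  have e : (fun z => f₂ z i j)
      = fun z => fderiv ℝ (fun w => f₁ w i) z (EuclideanSpace.single j 1) := by
    funext z
    rw [(h.snd z i).fderiv, sum_smul_coord_single]
  rw [e]
  exact measurable_fderiv_apply_const ℝ _ _

lemma mul (hf : HasPartials f f₁ f₂) (hg : HasPartials g g₁ g₂) :
    HasPartials (fun z => f z * g z) (fun z i => f z * g₁ z i + g z * f₁ z i)
      (fun z i j => f z * g₂ z i j + g₁ z i * f₁ z j + (g z * f₂ z i j + f₁ z i * g₁ z j)) := by
  refine ⟨fun z => ?_, fun z i => ?_⟩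
  · refine ((hf.fst z).mul (hg.fst z)).congr_fderiv ?_
    simp only [Finset.smul_sum, ← Finset.sum_add_distrib, add_smul, smul_smul]
  · refine (((hf.fst z).mul (hg.snd z i)).add ((hg.fst z).mul (hf.snd z i))).congr_fderiv ?_
    simp only [Finset.smul_sum, ← Finset.sum_add_distrib, add_smul, smul_smul]

lemma comp_sub (hf : HasPartials f f₁ f₂) (c : Vec d) :
    HasPartials (fun z => f (z - c)) (fun z => f₁ (z - c)) (fun z => f₂ (z - c)) :=
  ⟨fun z => ((hf.fst (z - c)).comp z (hasFDerivAt_sub_const c)).congr_fderiv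
      (ContinuousLinearMap.comp_id _),
    fun z i => (HasFDerivAt.comp (g := fun w => f₁ w i) z (hf.snd (z - c) i)
      (hasFDerivAt_sub_const c)).congr_fderiv (ContinuousLinearMap.comp_id _)⟩

lemma comp_smul (hf : HasPartials f f₁ f₂) (k : ℝ) :
    HasPartials (fun z => f (k • z)) (fun z i => k * f₁ (k • z) i)
      (fun z i j => k * (k * f₂ (k • z) i j)) := by
  have hk : ∀ z : Vec d, HasFDerivAt (fun z : Vec d => k • z) (k • ContinuousLinearMap.id ℝ (Vec d)) z :=
    fun z => (hasFDerivAt_id z).const_smul k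
  refine ⟨fun z => ?_, fun z i => ?_⟩
  · refine ((hf.fst (k • z)).comp z (hk z)).congr_fderiv ?_
    ext v
    simp only [ContinuousLinearMap.comp_apply, _root_.smul_apply, _root_.sum_apply,
      ContinuousLinearMap.id_apply, map_smul, smul_eq_mul, Finset.mul_sum]
    exact Finset.sum_congr rfl fun i _ => by ring
  · refine (((hf.snd (k • z) i).comp z (hk z)).const_mul k).congr_fderiv ?_
    ext v
    simp only [ContinuousLinearMap.comp_apply, _root_.smul_apply, _root_.sum_apply,
      ContinuousLinearMap.id_apply, map_smul, smul_eq_mul, Finset.mul_sum]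
    exact Finset.sum_congr rfl fun i _ => by ring

lemma of_contDiff (hf : ContDiff ℝ (⊤ : ℕ∞) f) :
    HasPartials f (fun z i => fderiv ℝ f z (EuclideanSpace.single i 1))
      (fun z i j => fderiv ℝ (fun w => fderiv ℝ f w (EuclideanSpace.single i 1)) z
        (EuclideanSpace.single j 1)) := by
  refine ⟨fun z => ?_, fun z i => ?_⟩
  · rw [← eq_sum_smul_coord]
    exact ((hf.differentiable (by simp)) z).hasFDerivAt
  · rw [← eq_sum_smul_coord]
    have : ContDiff ℝ 1 fun w => fderiv ℝ f w (EuclideanSpace.single i 1) :=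
      (hf.fderiv_right (m := 1) (by norm_cast)).clm_apply contDiff_const
    exact ((this.differentiable (by simp)) z).hasFDerivAt

lemma gaussDens {A : Matrix (Fin d) (Fin d) ℝ} (hA : (A⁻¹)ᵀ = A⁻¹) :
    HasPartials (gaussDens A) (gaussDens₁ A) (gaussDens₂ A) :=
  ⟨hasFDerivAt_gaussDens hA, hasFDerivAt_gaussDens₁ hA⟩

lemma genApply_eq (h : HasPartials f f₁ f₂) (b : ℝ → Vec d → Vec d)
    (σ : ℝ → Vec d → Matrix (Fin d) (Fin d) ℝ) (r : ℝ) (z : Vec d) :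
    genApply d b σ r f z = genForm (b r z) (sqMat d σ r z) (f₁ z) (f₂ z) := by
  unfold genApply genForm
  have hs : ∀ i j, sqMat d σ r z i j = sqMat d σ r z j i := by
    intro i j
    simp only [sqMat, mul_apply, transpose_apply]
    exact Finset.sum_congr rfl fun k _ => mul_comm _ _
  congr 1
  · exact Finset.sum_congr rfl fun i _ => by rw [h.fderiv_single]
  · congr 1
    rw [Finset.sum_comm]
    exact Finset.sum_congr rfl fun i _ => Finset.sum_congr rfl fun j _ => by
      rw [h.iteratedFDeriv_single, hs]

end HasPartials

lemma abs_genForm_le {d : ℕ} {β : Vec d} {A : Matrix (Fin d) (Fin d) ℝ} {f₁ : Fin d → ℝ}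
    {f₂ : Fin d → Fin d → ℝ} {m₁ m₂ : ℝ} (h₁ : ∀ i, ‖β‖ * |f₁ i| ≤ m₁)
    (h₂ : ∀ i j, |A i j| * |f₂ i j| ≤ m₂) : |genForm β A f₁ f₂| ≤ d * m₁ + d ^ 2 * m₂ := by
  unfold genForm
  have e1 : |∑ i, β i * f₁ i| ≤ d * m₁ := by
    calc _ ≤ ∑ i, |β i * f₁ i| := Finset.abs_sum_le_sum_abs _ _
      _ ≤ ∑ _i : Fin d, m₁ := Finset.sum_le_sum fun i _ => by
        rw [abs_mul]
        exact (mul_le_mul_of_nonneg_right (abs_apply_le_norm β i) (abs_nonneg _)).trans (h₁ i)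
      _ = _ := by simp
  have e2 : |∑ i, ∑ j, A i j * f₂ i j| ≤ d ^ 2 * m₂ := by
    calc _ ≤ ∑ i, |∑ j, A i j * f₂ i j| := Finset.abs_sum_le_sum_abs _ _
      _ ≤ ∑ i, ∑ j, |A i j * f₂ i j| :=
        Finset.sum_le_sum fun i _ => Finset.abs_sum_le_sum_abs _ _
      _ ≤ ∑ _i : Fin d, ∑ _j : Fin d, m₂ := Finset.sum_le_sum fun i _ =>
        Finset.sum_le_sum fun j _ => by rw [abs_mul]; exact h₂ i j
      _ = _ := by simp; ring
  have e3 := abs_add_le (∑ i, β i * f₁ i) (1 / 2 * ∑ i, ∑ j, A i j * f₂ i j)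
  rw [abs_mul, abs_of_pos (by norm_num : (0 : ℝ) < 1 / 2)] at e3
  have := abs_nonneg (∑ i, ∑ j, A i j * f₂ i j)
  linarith

lemma measurable_genForm {ι : Type*} [MeasurableSpace ι] {d : ℕ} {β : ι → Vec d}
    {A : ι → Matrix (Fin d) (Fin d) ℝ} {f₁ : ι → Fin d → ℝ} {f₂ : ι → Fin d → Fin d → ℝ}
    (hβ : Measurable β) (hA : ∀ i j, Measurable fun x => A x i j)
    (h₁ : ∀ i, Measurable fun x => f₁ x i) (h₂ : ∀ i j, Measurable fun x => f₂ x i j) :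
    Measurable fun x => genForm (β x) (A x) (f₁ x) (f₂ x) := by
  unfold genForm
  exact (Finset.measurable_fun_sum _ fun i _ => (measurable_ofLp_apply hβ i).mul (h₁ i)).add
    ((Finset.measurable_fun_sum _ fun i _ => Finset.measurable_fun_sum _ fun j _ =>
      (hA i j).mul (h₂ i j)).const_mul _)

lemma tendsto_genForm {ι : Type*} {d : ℕ} {l : Filter ι} {β : ι → Vec d} {β₀ : Vec d}
    {A : ι → Matrix (Fin d) (Fin d) ℝ} {A₀ : Matrix (Fin d) (Fin d) ℝ} {f₁ : ι → Fin d → ℝ}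
    {f₁₀ : Fin d → ℝ} {f₂ : ι → Fin d → Fin d → ℝ} {f₂₀ : Fin d → Fin d → ℝ}
    (hβ : Filter.Tendsto β l (nhds β₀))
    (hA : ∀ i j, Filter.Tendsto (fun x => A x i j) l (nhds (A₀ i j)))
    (h₁ : ∀ i, Filter.Tendsto (fun x => f₁ x i) l (nhds (f₁₀ i)))
    (h₂ : ∀ i j, Filter.Tendsto (fun x => f₂ x i j) l (nhds (f₂₀ i j))) :
    Filter.Tendsto (fun x => genForm (β x) (A x) (f₁ x) (f₂ x)) l
      (nhds (genForm β₀ A₀ f₁₀ f₂₀)) := by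
  unfold genForm
  exact (tendsto_finsetSum _ fun i _ => (tendsto_ofLp_apply hβ i).mul (h₁ i)).add
    ((tendsto_finsetSum _ fun i _ => tendsto_finsetSum _ fun j _ =>
      (hA i j).mul (h₂ i j)).const_mul _)

lemma genForm_sub {d : ℕ} (β : Vec d) (A : Matrix (Fin d) (Fin d) ℝ) (f₁ g₁ : Fin d → ℝ)
    (f₂ g₂ : Fin d → Fin d → ℝ) :
    genForm β A (fun i => f₁ i - g₁ i) (fun i j => f₂ i j - g₂ i j)
      = genForm β A f₁ f₂ - genForm β A g₁ g₂ := by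
  unfold genForm
  simp only [mul_sub, Finset.sum_sub_distrib]
  ring

/-- Smooth cutoffs with first derivatives decaying like `(1 + ‖z‖)⁻¹`. -/
lemma exists_cutoff (d : ℕ) : ∃ (C : ℝ) (χ : ℕ → Vec d → ℝ) (χ₁ : ℕ → Vec d → Fin d → ℝ)
    (χ₂ : ℕ → Vec d → Fin d → Fin d → ℝ), 1 ≤ C ∧ ∀ n, ContDiff ℝ (⊤ : ℕ∞) (χ n) ∧
      HasCompactSupport (χ n) ∧ HasPartials (χ n) (χ₁ n) (χ₂ n) ∧ (∀ z, |χ n z| ≤ 1) ∧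
      (∀ z i, (1 + ‖z‖) * |χ₁ n z i| ≤ C) ∧ (∀ z i j, |χ₂ n z i j| ≤ C) ∧
      ∀ z, ‖z‖ < n + 1 → χ n z = 1 ∧ (∀ i, χ₁ n z i = 0) ∧ ∀ i j, χ₂ n z i j = 0 := by
  let χ : ContDiffBump (0 : Vec d) := ⟨1, 2, one_pos, one_lt_two⟩
  have hχ : ContDiff ℝ (⊤ : ℕ∞) χ := χ.contDiff
  have hχs : HasCompactSupport χ := χ.hasCompactSupport
  have hp := HasPartials.of_contDiff hχ
  set χ₁ := fun (z : Vec d) (i : Fin d) => fderiv ℝ χ z (EuclideanSpace.single i 1) with hχ₁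
  set χ₂ := fun (z : Vec d) (i j : Fin d) =>
    fderiv ℝ (fun w => fderiv ℝ χ w (EuclideanSpace.single i 1)) z (EuclideanSpace.single j 1)
    with hχ₂
  have c1 : ∀ i, Continuous fun z => χ₁ z i := fun i => hp.continuous_fst i
  have c1' : ∀ i, ContDiff ℝ 1 fun z => χ₁ z i := fun i =>
    (hχ.fderiv_right (m := 1) (by norm_cast)).clm_apply contDiff_const
  have c2 : ∀ i j, Continuous fun z => χ₂ z i j := fun i j =>
    ((c1' i).continuous_fderiv (by simp)).clm_apply continuous_const
  have s1 : ∀ i, HasCompactSupport fun z => χ₁ z i := fun i => hχs.fderiv_apply ℝ _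
  have s2 : ∀ i j, HasCompactSupport fun z => χ₂ z i j := fun i j => (s1 i).fderiv_apply ℝ _
  have b1 : ∀ i, ∃ C, ∀ z, ‖(1 + ‖z‖) * χ₁ z i‖ ≤ C := fun i => by
    have hc : HasCompactSupport fun z : Vec d => (1 + ‖z‖) * χ₁ z i := (s1 i).mul_left
    exact hc.exists_bound_of_continuous (by have := c1 i; fun_prop)
  have b2 : ∀ i j, ∃ C, ∀ z, ‖χ₂ z i j‖ ≤ C := fun i j =>
    (s2 i j).exists_bound_of_continuous (c2 i j)
  choose C₁ hC₁ using b1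
  choose C₂ hC₂ using b2
  have n1 : ∀ i, 0 ≤ C₁ i := fun i => (norm_nonneg _).trans (hC₁ i 0)
  have n2 : ∀ i j, 0 ≤ C₂ i j := fun i j => (norm_nonneg _).trans (hC₂ i j 0)
  have t1 : ∀ i, C₁ i ≤ 1 + ∑ i, C₁ i + ∑ i, ∑ j, C₂ i j := fun i => by
    have := Finset.single_le_sum (f := C₁) (fun i _ => n1 i) (Finset.mem_univ i)
    have : 0 ≤ ∑ i, ∑ j, C₂ i j := Finset.sum_nonneg fun i _ => Finset.sum_nonneg fun j _ => n2 i j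
    linarith
  have t2 : ∀ i j, C₂ i j ≤ 1 + ∑ i, C₁ i + ∑ i, ∑ j, C₂ i j := fun i j => by
    have h1 := Finset.single_le_sum (f := fun j => C₂ i j) (fun j _ => n2 i j) (Finset.mem_univ j)
    have h2 := Finset.single_le_sum (f := fun i => ∑ j, C₂ i j)
      (fun i _ => Finset.sum_nonneg fun j _ => n2 i j) (Finset.mem_univ i)
    have h3 : 0 ≤ ∑ i, C₁ i := Finset.sum_nonneg fun i _ => n1 i
    linarith
  refine ⟨1 + ∑ i, C₁ i + ∑ i, ∑ j, C₂ i j, fun n z => χ (((n : ℝ) + 1)⁻¹ • z),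
    fun n z i => ((n : ℝ) + 1)⁻¹ * χ₁ (((n : ℝ) + 1)⁻¹ • z) i,
    fun n z i j => ((n : ℝ) + 1)⁻¹ * (((n : ℝ) + 1)⁻¹ * χ₂ (((n : ℝ) + 1)⁻¹ • z) i j), ?_,
    fun n => ?_⟩
  · have h3 : 0 ≤ ∑ i, C₁ i := Finset.sum_nonneg fun i _ => n1 i
    have : 0 ≤ ∑ i, ∑ j, C₂ i j := Finset.sum_nonneg fun i _ => Finset.sum_nonneg fun j _ => n2 i j
    linarith
  set k := ((n : ℝ) + 1)⁻¹ with hk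
  have hk0 : 0 < k := by positivity
  have hk1 : k ≤ 1 := inv_le_one_of_one_le₀ (by linarith [(Nat.cast_nonneg n : (0 : ℝ) ≤ n)])
  refine ⟨hχ.comp (contDiff_const_smul k), hχs.comp_smul hk0.ne', hp.comp_smul k, fun z => ?_,
    fun z i => ?_, fun z i j => ?_, fun z hz => ?_⟩
  · rw [abs_of_nonneg χ.nonneg]; exact χ.le_one
  · rw [abs_mul, abs_of_pos hk0]
    refine le_trans ?_ (t1 i)
    refine le_trans ?_ (hC₁ i (k • z))
    rw [norm_mul, Real.norm_eq_abs, Real.norm_eq_abs, abs_of_nonneg (by positivity : 0 ≤ 1 + ‖k • z‖),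
      ← mul_assoc, norm_smul, Real.norm_eq_abs, abs_of_pos hk0]
    refine mul_le_mul_of_nonneg_right ?_ (abs_nonneg _)
    linarith
  · rw [abs_mul, abs_mul, abs_of_pos hk0]
    refine le_trans ?_ (t2 i j)
    have := hC₂ i j (k • z)
    rw [Real.norm_eq_abs] at this
    calc _ ≤ 1 * (1 * |χ₂ (k • z) i j|) := by gcongr
      _ ≤ _ := by linarith
  · have hlt : ‖k • z‖ < 1 := by
      rw [norm_smul, Real.norm_eq_abs, abs_of_pos hk0, hk, inv_mul_lt_iff₀ (by positivity)]
      linarith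
    have hev : ∀ᶠ w in nhds (k • z), χ w = 1 := by
      have hmem : Metric.ball (0 : Vec d) 1 ∈ nhds (k • z) :=
        Metric.isOpen_ball.mem_nhds (by simpa using hlt)
      filter_upwards [hmem] with w hw
      exact χ.one_of_mem_closedBall (Metric.ball_subset_closedBall hw)
    have hev1 : ∀ i, (fun w => χ₁ w i) =ᶠ[nhds (k • z)] fun _ => 0 := by
      intro i
      filter_upwards [hev.eventually_nhds] with w hw
      have : (χ : Vec d → ℝ) =ᶠ[nhds w] fun _ => 1 := hw
      rw [hχ₁]
      simp only
      rw [this.fderiv_eq, fderiv_const_apply]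
      rfl
    refine ⟨hev.self_of_nhds, fun i => ?_, fun i j => ?_⟩
    · have : χ₁ (k • z) i = 0 := (hev1 i).self_of_nhds
      show k * χ₁ (k • z) i = 0
      rw [this, mul_zero]
    · have h2 : χ₂ (k • z) i j = 0 := by
        have := (hev1 i).fderiv_eq (𝕜 := ℝ)
        rw [hχ₂]
        simp only
        rw [show (fun w => fderiv ℝ χ w (EuclideanSpace.single i 1)) = fun w => χ₁ w i from rfl,
          this, fderiv_const_apply]
        rfl
      show k * (k * χ₂ (k • z) i j) = 0
      rw [h2, mul_zero, mul_zero]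

/-! ### Forward equations for processes -/

/-- The process `Y` satisfies, in expectation under `μ` and from time `u` on, Dynkin's formula for
the operator with drift `B` and diffusion matrix `A`, whose coefficients have at most linear,
respectively constant, growth. -/
structure ForwardEq {d : ℕ} {Ω : Type*} [MeasurableSpace Ω] (c : ℝ) (B : ℝ → Vec d → Vec d)
    (A : ℝ → Vec d → Matrix (Fin d) (Fin d) ℝ) (u : ℝ) (μ : Measure Ω) (Y : ℝ → Ω → Vec d) :
    Prop where
  finite : IsFiniteMeasure μ
  measurable_drift : Measurable (Function.uncurry B)
  measurable_diff : ∀ i j, Measurable fun p : ℝ × Vec d => A p.1 p.2 i j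
  measurable_path : Measurable (Function.uncurry Y)
  continuous_path : ∀ ω, Continuous fun r => Y r ω
  growth_nonneg : 0 ≤ c
  drift_le : ∀ r z, ‖B r z‖ ≤ c * (1 + ‖z‖)
  diff_le : ∀ r z i j, |A r z i j| ≤ c
  forward : ∀ f f₁ f₂, ContDiff ℝ (⊤ : ℕ∞) f → HasCompactSupport f → HasPartials f f₁ f₂ →
    ∀ v w, u ≤ v → v ≤ w → ∫ ω, f (Y w ω) ∂μ - ∫ ω, f (Y v ω) ∂μ
      = ∫ r in v..w, ∫ ω, genForm (B r (Y r ω)) (A r (Y r ω)) (f₁ (Y r ω)) (f₂ (Y r ω)) ∂μ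

lemma abs_genForm_le_growth {d : ℕ} {c M : ℝ} {β : Vec d} {A : Matrix (Fin d) (Fin d) ℝ}
    {f₁ : Fin d → ℝ} {f₂ : Fin d → Fin d → ℝ} {z : Vec d} (hc : 0 ≤ c) (hβ : ‖β‖ ≤ c * (1 + ‖z‖))
    (hA : ∀ i j, |A i j| ≤ c) (h₁ : ∀ i, (1 + ‖z‖) * |f₁ i| ≤ M) (h₂ : ∀ i j, |f₂ i j| ≤ M) :
    |genForm β A f₁ f₂| ≤ d * (c * M) + d ^ 2 * (c * M) := by
  refine abs_genForm_le (fun i => ?_) fun i j => ?_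
  · calc _ ≤ c * (1 + ‖z‖) * |f₁ i| := by gcongr
      _ ≤ c * M := by rw [mul_assoc]; exact mul_le_mul_of_nonneg_left (h₁ i) hc
  · exact mul_le_mul (hA i j) (h₂ i j) (abs_nonneg _) hc

lemma abs_genForm_le_sum {d : ℕ} {b a : ℝ} {β : Vec d} {A : Matrix (Fin d) (Fin d) ℝ}
    (hβ : ‖β‖ ≤ b) (hA : ∀ i j, |A i j| ≤ a) (f₁ : Fin d → ℝ) (f₂ : Fin d → Fin d → ℝ) :
    |genForm β A f₁ f₂| ≤ b * ∑ i, |f₁ i| + a * ∑ i, ∑ j, |f₂ i j| := by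
  unfold genForm
  have e1 : |∑ i, β i * f₁ i| ≤ b * ∑ i, |f₁ i| := by
    rw [Finset.mul_sum]
    refine (Finset.abs_sum_le_sum_abs _ _).trans (Finset.sum_le_sum fun i _ => ?_)
    rw [abs_mul]
    exact mul_le_mul_of_nonneg_right ((abs_apply_le_norm β i).trans hβ) (abs_nonneg _)
  have e2 : |∑ i, ∑ j, A i j * f₂ i j| ≤ a * ∑ i, ∑ j, |f₂ i j| := by
    rw [Finset.mul_sum]
    refine (Finset.abs_sum_le_sum_abs _ _).trans (Finset.sum_le_sum fun i _ => ?_)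
    rw [Finset.mul_sum]
    refine (Finset.abs_sum_le_sum_abs _ _).trans (Finset.sum_le_sum fun j _ => ?_)
    rw [abs_mul]
    exact mul_le_mul_of_nonneg_right (hA i j) (abs_nonneg _)
  have e3 := abs_add_le (∑ i, β i * f₁ i) (1 / 2 * ∑ i, ∑ j, A i j * f₂ i j)
  rw [abs_mul, abs_of_pos (by norm_num : (0 : ℝ) < 1 / 2)] at e3
  have := abs_nonneg (∑ i, ∑ j, A i j * f₂ i j)
  linarith

lemma intervalIntegrable_of_abs_le {g : ℝ → ℝ} {C : ℝ} (hg : Measurable g) (hb : ∀ x, |g x| ≤ C)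
    (a b : ℝ) : IntervalIntegrable g volume a b := by
  exact (intervalIntegrable_const (c := C)).mono_fun hg.aestronglyMeasurable
    (Filter.Eventually.of_forall fun x => (hb x).trans (le_abs_self C))

lemma integrable_of_abs_le {Ω : Type*} [MeasurableSpace Ω] {μ : Measure Ω} [IsFiniteMeasure μ]
    {g : Ω → ℝ} {C : ℝ} (hg : Measurable g) (hb : ∀ x, |g x| ≤ C) : Integrable g μ :=
  Integrable.of_bound hg.aestronglyMeasurable C (Filter.Eventually.of_forall hb)

lemma abs_integral_le_of_abs_le {Ω : Type*} [MeasurableSpace Ω] {μ : Measure Ω} [IsFiniteMeasure μ]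
    {g : Ω → ℝ} {C : ℝ} (hb : ∀ x, |g x| ≤ C) : |∫ x, g x ∂μ| ≤ C * μ.real univ :=
  (Real.norm_eq_abs _).symm.le.trans
    (norm_integral_le_of_norm_le_const (Filter.Eventually.of_forall hb))

lemma intervalIntegral_integral_swap_of_abs_le {Ω : Type*} [MeasurableSpace Ω] {μ : Measure Ω}
    [IsFiniteMeasure μ] {g : ℝ → Ω → ℝ} {C : ℝ} (hg : Measurable (Function.uncurry g))
    (hb : ∀ r x, |g r x| ≤ C) {a b : ℝ} (hab : a ≤ b) :
    ∫ r in a..b, ∫ x, g r x ∂μ = ∫ x, (∫ r in a..b, g r x) ∂μ := by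
  simp only [intervalIntegral.integral_of_le hab]
  exact integral_integral_swap (integrable_of_abs_le hg fun p => hb p.1 p.2)

lemma measurable_integral_right {ι Ω : Type*} [MeasurableSpace ι] [MeasurableSpace Ω]
    {μ : Measure Ω} [SFinite μ] {g : ι → Ω → ℝ} (hg : Measurable (Function.uncurry g)) :
    Measurable fun r => ∫ x, g r x ∂μ :=
  (hg.stronglyMeasurable.integral_prod_right (ν := μ)).measurable

/-- A function whose increments are integrals of approximations of `G` is a primitive of `G`. -/
lemma sub_eq_integral_of_increments {m G : ℝ → ℝ} {g : ℝ → ℝ → ℝ → ℝ} {u t N : ℝ} (hut : u ≤ t)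
    (hg : ∀ r r', Measurable fun ρ => g ρ r r') (hG : Measurable G)
    (bg : ∀ ρ r r', |g ρ r r'| ≤ N) (bG : ∀ ρ, |G ρ| ≤ N)
    (hm : ∀ r r', u ≤ r → r ≤ r' → r' ≤ t → m r' - m r = ∫ ρ in r..r', g ρ r r')
    (hlim : ∀ r, ∀ ε > 0, ∃ δ > 0, ∀ r' ρ, r ≤ ρ → ρ ≤ r' → r' < r + δ → |g ρ r r' - G ρ| ≤ ε) :
    m t - m u = ∫ ρ in u..t, G ρ := by
  have iG : ∀ a b, IntervalIntegrable G volume a b := intervalIntegrable_of_abs_le hG bG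
  have ig : ∀ r r' a b, IntervalIntegrable (fun ρ => g ρ r r') volume a b := fun r r' =>
    intervalIntegrable_of_abs_le (hg r r') fun ρ => bg ρ r r'
  set D : ℝ → ℝ := fun r => m r - ∫ ρ in u..r, G ρ with hD
  have key : ∀ r r', u ≤ r → r ≤ r' → r' ≤ t → ∀ ε, (∀ ρ, r ≤ ρ → ρ ≤ r' → |g ρ r r' - G ρ| ≤ ε) →
      |D r' - D r| ≤ ε * (r' - r) := by
    intro r r' h1 h2 h3 ε hε
    have e : D r' - D r = ∫ ρ in r..r', (g ρ r r' - G ρ) := by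
      rw [intervalIntegral.integral_sub (ig r r' r r') (iG r r'), ← hm r r' h1 h2 h3,
        ← intervalIntegral.integral_interval_sub_left (iG u r') (iG u r), hD]
      ring
    rw [e]
    have := intervalIntegral.norm_integral_le_of_norm_le_const (a := r) (b := r') (C := ε)
      (f := fun ρ => g ρ r r' - G ρ) fun ρ hρ => by
        rw [uIoc_of_le h2] at hρ
        exact hε ρ hρ.1.le hρ.2
    rwa [abs_of_nonneg (by linarith), Real.norm_eq_abs] at this
  have lip : ∀ r r', u ≤ r → r ≤ r' → r' ≤ t → |D r' - D r| ≤ (N + N) * (r' - r) :=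
    fun r r' h1 h2 h3 => key r r' h1 h2 h3 _ fun ρ _ _ =>
      (abs_sub _ _).trans (add_le_add (bg _ _ _) (bG _))
  have hN : 0 ≤ N := (abs_nonneg _).trans (bG 0)
  have hcont : ContinuousOn D (Icc u t) := by
    refine LipschitzOnWith.continuousOn (K := (N + N).toNNReal) ?_
    refine LipschitzOnWith.of_dist_le_mul fun x hx y hy => ?_
    rw [Real.coe_toNNReal _ (by linarith), Real.dist_eq, Real.dist_eq]
    rcases le_total x y with h | h
    · rw [abs_sub_comm, abs_sub_comm x y, abs_of_nonneg (sub_nonneg.2 h)]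
      exact lip x y hx.1 h hy.2
    · rw [abs_of_nonneg (sub_nonneg.2 h)]
      exact lip y x hy.1 h hx.2
  have hder : ∀ r ∈ Ico u t, HasDerivWithinAt D 0 (Ici r) r := by
    intro r hr
    rw [hasDerivWithinAt_iff_isLittleO, Asymptotics.isLittleO_iff]
    intro ε hε
    obtain ⟨δ, hδ, h⟩ := hlim r ε hε
    have hmem : Ico r (min t (r + δ)) ∈ nhdsWithin r (Ici r) :=
      Ico_mem_nhdsGE (lt_min hr.2 (by linarith))
    filter_upwards [hmem] with r' hr'
    rw [smul_zero, sub_zero, Real.norm_eq_abs, Real.norm_eq_abs,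
      abs_of_nonneg (sub_nonneg.2 hr'.1)]
    exact key r r' hr.1 hr'.1 (hr'.2.le.trans (min_le_left _ _)) ε fun ρ h1 h2 =>
      h r' ρ h1 h2 (hr'.2.trans_le (min_le_right _ _))
  have := constant_of_has_deriv_right_zero hcont hder t ⟨hut, le_rfl⟩
  rw [hD] at this
  simp only [intervalIntegral.integral_same] at this
  linarith

namespace ForwardEq

variable {d : ℕ} {Ω : Type*} [MeasurableSpace Ω] {c : ℝ} {B : ℝ → Vec d → Vec d}
  {A : ℝ → Vec d → Matrix (Fin d) (Fin d) ℝ} {u : ℝ} {μ : Measure Ω} {Y : ℝ → Ω → Vec d}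

lemma measurable_drift_path (h : ForwardEq c B A u μ Y) :
    Measurable fun p : ℝ × Ω => B p.1 (Y p.1 p.2) :=
  h.measurable_drift.comp (measurable_fst.prodMk h.measurable_path)

lemma measurable_diff_path (h : ForwardEq c B A u μ Y) (i j : Fin d) :
    Measurable fun p : ℝ × Ω => A p.1 (Y p.1 p.2) i j :=
  (h.measurable_diff i j).comp (measurable_fst.prodMk h.measurable_path)

lemma measurable_at (h : ForwardEq c B A u μ Y) (r : ℝ) : Measurable (Y r) :=
  h.measurable_path.comp measurable_prodMk_left

lemma forward_of_bounded (h : ForwardEq c B A u μ Y) {f : Vec d → ℝ} {f₁ : Vec d → Fin d → ℝ}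
    {f₂ : Vec d → Fin d → Fin d → ℝ} {M : ℝ} (hf : ContDiff ℝ (⊤ : ℕ∞) f)
    (hp : HasPartials f f₁ f₂) (b₀ : ∀ z, |f z| ≤ M) (b₁ : ∀ z i, (1 + ‖z‖) * |f₁ z i| ≤ M)
    (b₂ : ∀ z i j, |f₂ z i j| ≤ M) {v w : ℝ} (huv : u ≤ v) (hvw : v ≤ w) :
    ∫ ω, f (Y w ω) ∂μ - ∫ ω, f (Y v ω) ∂μ
      = ∫ r in v..w, ∫ ω, genForm (B r (Y r ω)) (A r (Y r ω)) (f₁ (Y r ω)) (f₂ (Y r ω)) ∂μ := by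
  have := h.finite
  have hM : 0 ≤ M := (abs_nonneg _).trans (b₀ 0)
  obtain ⟨C, χ, χ₁, χ₂, hC, hχ⟩ := exists_cutoff d
  have hC0 : 0 ≤ C := by linarith
  have b₁' : ∀ z i, |f₁ z i| ≤ M := fun z i =>
    le_trans (le_mul_of_one_le_left (abs_nonneg _) (by linarith [norm_nonneg z])) (b₁ z i)
  have hMC : M ≤ M * C := le_mul_of_one_le_right hM hC
  set g₁ : ℕ → Vec d → Fin d → ℝ := fun n z i => f z * χ₁ n z i + χ n z * f₁ z i with hg₁
  set g₂ : ℕ → Vec d → Fin d → Fin d → ℝ := fun n z i j =>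
    f z * χ₂ n z i j + χ₁ n z i * f₁ z j + (χ n z * f₂ z i j + f₁ z i * χ₁ n z j) with hg₂
  have hpn : ∀ n, HasPartials (fun z => f z * χ n z) (g₁ n) (g₂ n) := fun n =>
    hp.mul (hχ n).2.2.1
  have B0 : ∀ n z, |f z * χ n z| ≤ M := fun n z => by
    rw [abs_mul]
    calc _ ≤ M * 1 := mul_le_mul (b₀ z) ((hχ n).2.2.2.1 z) (abs_nonneg _) hM
      _ = M := mul_one M
  have c₁ : ∀ n z i, |χ₁ n z i| ≤ C := fun n z i =>
    le_trans (le_mul_of_one_le_left (abs_nonneg _) (by linarith [norm_nonneg z]))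
      ((hχ n).2.2.2.2.1 z i)
  have B1 : ∀ n z i, (1 + ‖z‖) * |g₁ n z i| ≤ 4 * (M * C) := fun n z i => by
    have hz : 0 ≤ 1 + ‖z‖ := by positivity
    have e1 : |f z| * ((1 + ‖z‖) * |χ₁ n z i|) ≤ M * C :=
      mul_le_mul (b₀ z) ((hχ n).2.2.2.2.1 z i) (by positivity) hM
    have e2 : |χ n z| * ((1 + ‖z‖) * |f₁ z i|) ≤ 1 * M :=
      mul_le_mul ((hχ n).2.2.2.1 z) (b₁ z i) (by positivity) zero_le_one
    calc (1 + ‖z‖) * |g₁ n z i| ≤ (1 + ‖z‖) * (|f z| * |χ₁ n z i| + |χ n z| * |f₁ z i|) := by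
          gcongr
          rw [hg₁, ← abs_mul, ← abs_mul]
          exact abs_add_le _ _
      _ ≤ 4 * (M * C) := by linarith
  have B2 : ∀ n z i j, |g₂ n z i j| ≤ 4 * (M * C) := fun n z i j => by
    have e1 : |f z * χ₂ n z i j| ≤ M * C := by
      rw [abs_mul]; exact mul_le_mul (b₀ z) ((hχ n).2.2.2.2.2.1 z i j) (abs_nonneg _) hM
    have e2 : |χ₁ n z i * f₁ z j| ≤ M * C := by
      rw [abs_mul, mul_comm]; exact mul_le_mul (b₁' z j) (c₁ n z i) (abs_nonneg _) hM
    have e3 : |χ n z * f₂ z i j| ≤ 1 * M := by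
      rw [abs_mul]; exact mul_le_mul ((hχ n).2.2.2.1 z) (b₂ z i j) (abs_nonneg _) zero_le_one
    have e4 : |f₁ z i * χ₁ n z j| ≤ M * C := by
      rw [abs_mul]; exact mul_le_mul (b₁' z i) (c₁ n z j) (abs_nonneg _) hM
    have h1 := abs_add_le (f z * χ₂ n z i j) (χ₁ n z i * f₁ z j)
    have h2 := abs_add_le (χ n z * f₂ z i j) (f₁ z i * χ₁ n z j)
    have h3 := abs_add_le (f z * χ₂ n z i j + χ₁ n z i * f₁ z j)
      (χ n z * f₂ z i j + f₁ z i * χ₁ n z j)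
    rw [hg₂]
    simp only
    linarith
  set N := d * (c * (4 * (M * C))) + (d : ℝ) ^ 2 * (c * (4 * (M * C))) with hN
  have bN : ∀ n r ω, |genForm (B r (Y r ω)) (A r (Y r ω)) (g₁ n (Y r ω)) (g₂ n (Y r ω))| ≤ N :=
    fun n r ω => abs_genForm_le_growth h.growth_nonneg (h.drift_le _ _) (h.diff_le _ _)
      (B1 n _) (B2 n _)
  have mJ : ∀ n, Measurable fun p : ℝ × Ω =>
      genForm (B p.1 (Y p.1 p.2)) (A p.1 (Y p.1 p.2)) (g₁ n (Y p.1 p.2)) (g₂ n (Y p.1 p.2)) :=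
    fun n => measurable_genForm h.measurable_drift_path h.measurable_diff_path
      (fun i => ((hpn n).continuous_fst i).measurable.comp h.measurable_path)
      (fun i j => ((hpn n).measurable_snd i j).comp h.measurable_path)
  have mR : ∀ n r, Measurable fun ω =>
      genForm (B r (Y r ω)) (A r (Y r ω)) (g₁ n (Y r ω)) (g₂ n (Y r ω)) :=
    fun n r => (mJ n).comp measurable_prodMk_left
  have ev : ∀ z : Vec d, ∀ᶠ n in Filter.atTop, χ n z = 1 ∧ (∀ i, χ₁ n z i = 0) ∧
      ∀ i j, χ₂ n z i j = 0 := fun z => by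
    obtain ⟨n₀, hn₀⟩ := exists_nat_gt ‖z‖
    filter_upwards [Filter.eventually_ge_atTop n₀] with n hn
    have : (n₀ : ℝ) ≤ n := by exact_mod_cast hn
    exact (hχ n).2.2.2.2.2.2 z (by linarith)
  have t0 : ∀ r, Filter.Tendsto (fun n => ∫ ω, f (Y r ω) * χ n (Y r ω) ∂μ) Filter.atTop
      (nhds (∫ ω, f (Y r ω) ∂μ)) := fun r => by
    refine tendsto_integral_of_dominated_convergence (fun _ => M) (fun n => ?_)
      (integrable_const _) (fun n => Filter.Eventually.of_forall fun ω => B0 n _)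
      (Filter.Eventually.of_forall fun ω => ?_)
    · exact (((hf.continuous.mul (hχ n).1.continuous).measurable).comp
        (h.measurable_at r)).aestronglyMeasurable
    · refine tendsto_nhds_of_eventually_eq ?_
      filter_upwards [ev (Y r ω)] with n hn
      rw [hn.1, mul_one]
  have t1 : Filter.Tendsto (fun n => ∫ r in v..w, ∫ ω,
      genForm (B r (Y r ω)) (A r (Y r ω)) (g₁ n (Y r ω)) (g₂ n (Y r ω)) ∂μ) Filter.atTop
      (nhds (∫ r in v..w, ∫ ω,
        genForm (B r (Y r ω)) (A r (Y r ω)) (f₁ (Y r ω)) (f₂ (Y r ω)) ∂μ)) := by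
    refine intervalIntegral.tendsto_integral_filter_of_dominated_convergence
      (fun _ => N * μ.real univ) (Filter.Eventually.of_forall fun n => ?_)
      (Filter.Eventually.of_forall fun n => Filter.Eventually.of_forall fun r _ => ?_)
      intervalIntegrable_const (Filter.Eventually.of_forall fun r _ => ?_)
    · exact (measurable_integral_right (mJ n)).aestronglyMeasurable
    · exact abs_integral_le_of_abs_le (bN n r)
    · refine tendsto_integral_of_dominated_convergence (fun _ => N)
        (fun n => (mR n r).aestronglyMeasurable)
        (integrable_const _) (fun n => Filter.Eventually.of_forall fun ω => bN n r ω)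
        (Filter.Eventually.of_forall fun ω => ?_)
      refine tendsto_nhds_of_eventually_eq ?_
      filter_upwards [ev (Y r ω)] with n hn
      simp only [hg₁, hg₂, hn.1, hn.2.1, hn.2.2, mul_zero, zero_mul, one_mul, zero_add, add_zero]
  refine tendsto_nhds_unique ((t0 w).sub (t0 v)) (t1.congr fun n => ?_)
  exact (h.forward _ _ _ (hf.mul (hχ n).1) ((hχ n).2.1.mul_left) (hpn n) v w huv hvw).symm

end ForwardEq

namespace ForwardEq

variable {d : ℕ} {Ω : Type*} [MeasurableSpace Ω] {c : ℝ} {B : ℝ → Vec d → Vec d}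
  {A : ℝ → Vec d → Matrix (Fin d) (Fin d) ℝ} {u : ℝ} {μ : Measure Ω} {Y : ℝ → Ω → Vec d}

/-- Dynkin's formula for time dependent functions solving a perturbed backward equation. -/
lemma forward_of_time_dependent (h : ForwardEq c B A u μ Y) {F : ℝ → Vec d → ℝ}
    {F₁ : ℝ → Vec d → Fin d → ℝ} {F₂ : ℝ → Vec d → Fin d → Fin d → ℝ} {β : ℝ → Vec d}
    {a : ℝ → Matrix (Fin d) (Fin d) ℝ} {M : ℝ} {t : ℝ} (hut : u ≤ t)
    (hF : ∀ r, ContDiff ℝ (⊤ : ℕ∞) (F r)) (hp : ∀ r, HasPartials (F r) (F₁ r) (F₂ r))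
    (b₀ : ∀ r z, |F r z| ≤ M) (b₁ : ∀ r z i, (1 + ‖z‖) * |F₁ r z i| ≤ M)
    (b₂ : ∀ r z i j, |F₂ r z i j| ≤ M)
    (c₁ : ∀ i, Continuous fun p : ℝ × Vec d => F₁ p.1 p.2 i)
    (c₂ : ∀ i j, Continuous fun p : ℝ × Vec d => F₂ p.1 p.2 i j)
    (mβ : Measurable β) (ma : ∀ i j, Measurable fun r => a r i j)
    (bβ : ∀ r, ‖β r‖ ≤ c) (ba : ∀ r i j, |a r i j| ≤ c)
    (hpde : ∀ r r' z, u ≤ r → r ≤ r' → r' ≤ t →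
      F r' z - F r z = ∫ ρ in r..r', genForm (β ρ) (a ρ) (F₁ ρ z) (F₂ ρ z)) :
    ∫ ω, F t (Y t ω) ∂μ - ∫ ω, F u (Y u ω) ∂μ = ∫ ρ in u..t, ∫ ω,
      (genForm (B ρ (Y ρ ω)) (A ρ (Y ρ ω)) (F₁ ρ (Y ρ ω)) (F₂ ρ (Y ρ ω)) +
        genForm (β ρ) (a ρ) (F₁ ρ (Y ρ ω)) (F₂ ρ (Y ρ ω))) ∂μ := by
  have := h.finite
  have hc := h.growth_nonneg
  have hM : 0 ≤ M := (abs_nonneg _).trans (b₀ 0 0)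
  have b₁' : ∀ r z i, |F₁ r z i| ≤ M := fun r z i =>
    le_trans (le_mul_of_one_le_left (abs_nonneg _) (by linarith [norm_nonneg z])) (b₁ r z i)
  set K := d * (c * M) + (d : ℝ) ^ 2 * (c * M) with hK
  have hK0 : 0 ≤ K := by positivity
  set g1 : ℝ → ℝ → Ω → ℝ := fun ρ r ω =>
    genForm (B ρ (Y ρ ω)) (A ρ (Y ρ ω)) (F₁ r (Y ρ ω)) (F₂ r (Y ρ ω)) with hg1
  set g2 : ℝ → ℝ → Ω → ℝ := fun ρ r ω =>
    genForm (β ρ) (a ρ) (F₁ ρ (Y r ω)) (F₂ ρ (Y r ω)) with hg2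
  have bd1 : ∀ ρ r ω, |g1 ρ r ω| ≤ K := fun ρ r ω =>
    abs_genForm_le_growth hc (h.drift_le _ _) (h.diff_le _ _) (b₁ r _) (b₂ r _)
  have bd2 : ∀ ρ r ω, |g2 ρ r ω| ≤ K := fun ρ r ω =>
    abs_genForm_le_growth hc ((bβ _).trans (le_mul_of_one_le_right hc
      (by linarith [norm_nonneg (Y r ω)]))) (ba _) (b₁ ρ _) (b₂ ρ _)
  have m1 : ∀ φ : ℝ × Ω → ℝ, Measurable φ →
      Measurable fun p : ℝ × Ω => g1 p.1 (φ p) p.2 := fun φ hφ =>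
    measurable_genForm h.measurable_drift_path h.measurable_diff_path
      (fun i => (c₁ i).measurable.comp (hφ.prodMk h.measurable_path))
      fun i j => (c₂ i j).measurable.comp (hφ.prodMk h.measurable_path)
  have m2 : ∀ φ : ℝ × Ω → ℝ, Measurable φ →
      Measurable fun p : ℝ × Ω => g2 p.1 (φ p) p.2 := fun φ hφ => by
    have hY : Measurable fun p : ℝ × Ω => Y (φ p) p.2 :=
      h.measurable_path.comp (hφ.prodMk measurable_snd)
    exact measurable_genForm (mβ.comp measurable_fst) (fun i j => (ma i j).comp measurable_fst)
      (fun i => (c₁ i).measurable.comp (measurable_fst.prodMk hY))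
      fun i j => (c₂ i j).measurable.comp (measurable_fst.prodMk hY)
  have i1 : ∀ ρ r, Integrable (g1 ρ r) μ := fun ρ r =>
    integrable_of_abs_le ((m1 (fun _ => r) measurable_const).comp measurable_prodMk_left)
      (bd1 ρ r)
  have i2 : ∀ ρ r, Integrable (g2 ρ r) μ := fun ρ r =>
    integrable_of_abs_le ((m2 (fun _ => r) measurable_const).comp measurable_prodMk_left)
      (bd2 ρ r)
  have I1 : ∀ ρ r, |∫ ω, g1 ρ r ω ∂μ| ≤ K * μ.real univ := fun ρ r =>
    abs_integral_le_of_abs_le (bd1 ρ r)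
  have I2 : ∀ ρ r, |∫ ω, g2 ρ r ω ∂μ| ≤ K * μ.real univ := fun ρ r =>
    abs_integral_le_of_abs_le (bd2 ρ r)
  have M1 : ∀ φ : ℝ → ℝ, Measurable φ → Measurable fun ρ => ∫ ω, g1 ρ (φ ρ) ω ∂μ := fun φ hφ =>
    measurable_integral_right (m1 (fun p => φ p.1) (hφ.comp measurable_fst))
  have M2 : ∀ φ : ℝ → ℝ, Measurable φ → Measurable fun ρ => ∫ ω, g2 ρ (φ ρ) ω ∂μ := fun φ hφ =>
    measurable_integral_right (m2 (fun p => φ p.1) (hφ.comp measurable_fst))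
  have iF : ∀ r r', Integrable (fun ω => F r (Y r' ω)) μ := fun r r' =>
    integrable_of_abs_le ((hF r).continuous.measurable.comp (h.measurable_at r')) fun ω => b₀ r _
  set Ξ : ℝ → ℝ × ℝ → Ω → ℝ := fun r p ω =>
    c * ((1 + ‖Y p.1 ω‖) * ∑ i, |F₁ r (Y p.1 ω) i - F₁ p.1 (Y p.1 ω) i|) +
      c * ∑ i, ∑ j, |F₂ r (Y p.1 ω) i j - F₂ p.1 (Y p.1 ω) i j| +
      (c * ∑ i, |F₁ p.1 (Y p.2 ω) i - F₁ p.1 (Y p.1 ω) i| +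
      c * ∑ i, ∑ j, |F₂ p.1 (Y p.2 ω) i j - F₂ p.1 (Y p.1 ω) i j|) with hΞ
  set N := c * ∑ _i : Fin d, (M + M) + c * ∑ _i : Fin d, ∑ _j : Fin d, (M + M) +
    (c * ∑ _i : Fin d, (M + M) + c * ∑ _i : Fin d, ∑ _j : Fin d, (M + M)) with hN
  have hcont : ∀ r ω, Continuous fun p : ℝ × ℝ =>
      Ξ r p ω := fun r ω => by
    have hY := h.continuous_path ω
    have y1 : Continuous fun p : ℝ × ℝ => Y p.1 ω := hY.comp continuous_fst
    have y2 : Continuous fun p : ℝ × ℝ => Y p.2 ω := hY.comp continuous_snd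
    have k1 : ∀ i, Continuous fun p : ℝ × ℝ => F₁ r (Y p.1 ω) i := fun i =>
      (c₁ i).comp (continuous_const.prodMk y1)
    have k2 : ∀ i, Continuous fun p : ℝ × ℝ => F₁ p.1 (Y p.1 ω) i := fun i =>
      (c₁ i).comp (continuous_fst.prodMk y1)
    have k3 : ∀ i, Continuous fun p : ℝ × ℝ => F₁ p.1 (Y p.2 ω) i := fun i =>
      (c₁ i).comp (continuous_fst.prodMk y2)
    have k4 : ∀ i j, Continuous fun p : ℝ × ℝ => F₂ r (Y p.1 ω) i j := fun i j =>
      (c₂ i j).comp (continuous_const.prodMk y1)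
    have k5 : ∀ i j, Continuous fun p : ℝ × ℝ => F₂ p.1 (Y p.1 ω) i j := fun i j =>
      (c₂ i j).comp (continuous_fst.prodMk y1)
    have k6 : ∀ i j, Continuous fun p : ℝ × ℝ => F₂ p.1 (Y p.2 ω) i j := fun i j =>
      (c₂ i j).comp (continuous_fst.prodMk y2)
    fun_prop
  have hmeas : ∀ r, ∀ p : ℝ × ℝ, Measurable fun ω =>
      Ξ r p ω := fun r p => by
    have y := h.measurable_at
    have k1 : ∀ r r' i, Measurable fun ω => F₁ r (Y r' ω) i := fun r r' i =>
      ((hp r).continuous_fst i).measurable.comp (y r')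
    have k2 : ∀ r r' i j, Measurable fun ω => F₂ r (Y r' ω) i j := fun r r' i j =>
      ((hp r).measurable_snd i j).comp (y r')
    have y1 := y p.1
    fun_prop
  have bΞ : ∀ r p ω, |Ξ r p ω| ≤ N := fun r p ω => by
    have s : ∀ x y : ℝ, |x| ≤ M → |y| ≤ M → |x - y| ≤ M + M := fun x y hx hy =>
      (abs_sub x y).trans (add_le_add hx hy)
    rw [hΞ, abs_of_nonneg (by positivity)]
    simp only [hN]
    rw [Finset.mul_sum]
    gcongr with i _ i _ j _ i _ i _ j _
    · calc _ ≤ (1 + ‖Y p.1 ω‖) * (|F₁ r (Y p.1 ω) i| + |F₁ p.1 (Y p.1 ω) i|) := by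
            gcongr; exact abs_sub _ _
        _ ≤ M + M := by rw [mul_add]; exact add_le_add (b₁ _ _ _) (b₁ _ _ _)
    · exact s _ _ (b₂ _ _ _ _) (b₂ _ _ _ _)
    · exact s _ _ (b₁' _ _ _) (b₁' _ _ _)
    · exact s _ _ (b₂ _ _ _ _) (b₂ _ _ _ _)
  have lim : ∀ r, Filter.Tendsto (fun p : ℝ × ℝ => ∫ ω, Ξ r p ω ∂μ) (nhds (r, r)) (nhds 0) := by
    intro r
    rw [show (0 : ℝ) = ∫ _ω, (0 : ℝ) ∂μ by simp]
    refine tendsto_integral_filter_of_dominated_convergence (fun _ => N)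
      (Filter.Eventually.of_forall fun p => (hmeas r p).aestronglyMeasurable)
      (Filter.Eventually.of_forall fun p => Filter.Eventually.of_forall fun ω => bΞ r p ω)
      (integrable_const _) (Filter.Eventually.of_forall fun ω => ?_)
    have := (hcont r ω).tendsto (r, r)
    simpa [hΞ] using this
  have cmp : ∀ ρ r r' ω, |(g1 ρ r ω + g2 ρ r' ω) - (g1 ρ ρ ω + g2 ρ ρ ω)| ≤
      Ξ r (ρ, r') ω := fun ρ r r' ω => by
    rw [add_sub_add_comm]
    refine (abs_add_le _ _).trans (add_le_add ?_ ?_)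
    · rw [hg1, ← genForm_sub, ← mul_assoc]
      exact abs_genForm_le_sum (h.drift_le _ _) (h.diff_le _ _) _ _
    · rw [hg2, ← genForm_sub]
      exact abs_genForm_le_sum (bβ _) (ba _) _ _
  have split : ∀ ρ r r', ∫ ω, g1 ρ r ω ∂μ + ∫ ω, g2 ρ r' ω ∂μ = ∫ ω, (g1 ρ r ω + g2 ρ r' ω) ∂μ :=
    fun ρ r r' => (integral_add (i1 ρ r) (i2 ρ r')).symm
  refine sub_eq_integral_of_increments (m := fun r => ∫ ω, F r (Y r ω) ∂μ)
    (g := fun ρ r r' => ∫ ω, (g1 ρ r ω + g2 ρ r' ω) ∂μ)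
    (N := K * μ.real univ + K * μ.real univ) hut (fun r r' => ?_) ?_ (fun ρ r r' => ?_)
    (fun ρ => ?_) (fun r r' h1 h2 h3 => ?_) fun r ε hε => ?_
  · simp only [← split]
    exact (M1 _ measurable_const).add (M2 _ measurable_const)
  · show Measurable fun ρ => ∫ ω, (g1 ρ ρ ω + g2 ρ ρ ω) ∂μ
    simp only [← split]
    exact (M1 _ measurable_id).add (M2 _ measurable_id)
  · rw [← split]
    exact (abs_add_le _ _).trans (add_le_add (I1 _ _) (I2 _ _))
  · show |∫ ω, (g1 ρ ρ ω + g2 ρ ρ ω) ∂μ| ≤ _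
    rw [← split]
    exact (abs_add_le _ _).trans (add_le_add (I1 _ _) (I2 _ _))
  · simp only [← split]
    rw [intervalIntegral.integral_add
      (intervalIntegrable_of_abs_le (M1 (fun _ => r) measurable_const) (fun ρ => I1 ρ r) r r')
      (intervalIntegrable_of_abs_le (M2 (fun _ => r') measurable_const) (fun ρ => I2 ρ r') r r')]
    have e1 := h.forward_of_bounded (hF r) (hp r) (b₀ r) (b₁ r) (b₂ r) h1 h2
    have e2 : ∫ ω, F r' (Y r' ω) ∂μ - ∫ ω, F r (Y r' ω) ∂μ = ∫ ρ in r..r', ∫ ω, g2 ρ r' ω ∂μ := by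
      rw [intervalIntegral_integral_swap_of_abs_le
        (m2 (fun _ => r') measurable_const) (fun ρ ω => bd2 ρ r' ω) h2,
        ← integral_sub (iF _ _) (iF _ _)]
      exact integral_congr_ae (Filter.Eventually.of_forall fun ω => hpde r r' _ h1 h2 h3)
    have e1' : ∫ ω, F r (Y r' ω) ∂μ - ∫ ω, F r (Y r ω) ∂μ = ∫ ρ in r..r', ∫ ω, g1 ρ r ω ∂μ := e1
    linarith
  · have hev := (lim r).eventually (Iio_mem_nhds hε)
    obtain ⟨δ, hδ, hball⟩ := Metric.eventually_nhds_iff.1 hev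
    refine ⟨δ, hδ, fun r' ρ h1 h2 h3 => ?_⟩
    have hd : dist (ρ, r') (r, r) < δ := by
      rw [Prod.dist_eq, max_lt_iff, Real.dist_eq, Real.dist_eq, abs_lt, abs_lt]
      refine ⟨⟨?_, ?_⟩, ?_, ?_⟩ <;> simp only <;> linarith
    have e : ∫ ω, (g1 ρ r ω + g2 ρ r' ω) ∂μ - ∫ ω, (g1 ρ ρ ω + g2 ρ ρ ω) ∂μ
        = ∫ ω, ((g1 ρ r ω + g2 ρ r' ω) - (g1 ρ ρ ω + g2 ρ ρ ω)) ∂μ :=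
      (integral_sub ((i1 ρ r).add (i2 ρ r')) ((i1 ρ ρ).add (i2 ρ ρ))).symm
    show |∫ ω, (g1 ρ r ω + g2 ρ r' ω) ∂μ - ∫ ω, (g1 ρ ρ ω + g2 ρ ρ ω) ∂μ| ≤ ε
    rw [e]
    refine (abs_integral_le_integral_abs).trans (le_trans ?_ (hball hd).le)
    exact integral_mono_of_nonneg (Filter.Eventually.of_forall fun ω => abs_nonneg _)
      (integrable_of_abs_le (hmeas r (ρ, r')) (bΞ r (ρ, r')))
      (Filter.Eventually.of_forall fun ω => cmp ρ r r' ω)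

end ForwardEq

/-! ### The coefficients, and solutions of the martingale problem -/

lemma EllipticHolder.isElliptic {d : ℕ} {σ : ℝ → Vec d → Matrix (Fin d) (Fin d) ℝ} {κ₀ α : ℝ}
    (h : EllipticHolder d σ κ₀ α) {t : ℝ} (ht : 0 ≤ t) (x : Vec d) :
    IsElliptic κ₀ 1 (sqMat d σ t x) := by
  refine ⟨?_, fun ξ => ?_, fun ξ => ?_⟩
  · rw [sqMat, transpose_mul, transpose_transpose]
  · rw [mul_one]; exact (h.2.1 t ht x ξ).1
  · rw [mul_one]; exact (h.2.1 t ht x ξ).2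

lemma EllipticHolder.measurable_sqMat {d : ℕ} {σ : ℝ → Vec d → Matrix (Fin d) (Fin d) ℝ}
    {κ₀ α : ℝ} (h : EllipticHolder d σ κ₀ α) (i j : Fin d) :
    Measurable fun p : ℝ × Vec d => sqMat d σ p.1 p.2 i j := by
  simp only [sqMat, mul_apply, transpose_apply]
  exact Finset.measurable_fun_sum _ fun k _ => (h.1 i k).mul (h.1 j k)

lemma EllipticHolder.abs_sub_le {d : ℕ} {σ : ℝ → Vec d → Matrix (Fin d) (Fin d) ℝ} {κ₀ α : ℝ}
    (h : EllipticHolder d σ κ₀ α) (hκ : 1 ≤ κ₀) {t : ℝ} (ht : 0 ≤ t) (x y : Vec d) (i j : Fin d) :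
    |sqMat d σ t x i j - sqMat d σ t y i j| ≤ 2 * d * κ₀ ^ 2 * ‖x - y‖ ^ α := by
  have hb : ∀ x i k, |σ t x i k| ≤ κ₀ := fun x i k => by
    have h1 := (le_abs_self _).trans ((h.isElliptic ht x).abs_apply_le hκ one_pos i i)
    simp only [sqMat, mul_apply, transpose_apply, mul_one] at h1
    have h2 := Finset.single_le_sum (f := fun k => σ t x i k * σ t x i k)
      (fun k _ => mul_self_nonneg _) (Finset.mem_univ k)
    exact abs_le_of_sq_le_sq (by nlinarith) (by linarith)
  simp only [sqMat, mul_apply, transpose_apply, ← Finset.sum_sub_distrib]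
  have hκ0 : 0 ≤ κ₀ := by linarith
  calc _ ≤ ∑ k, |σ t x i k * σ t x j k - σ t y i k * σ t y j k| := Finset.abs_sum_le_sum_abs _ _
    _ ≤ ∑ _k : Fin d, 2 * κ₀ ^ 2 * ‖x - y‖ ^ α := Finset.sum_le_sum fun k _ => by
      have e : σ t x i k * σ t x j k - σ t y i k * σ t y j k
          = σ t x i k * (σ t x j k - σ t y j k) + σ t y j k * (σ t x i k - σ t y i k) := by ring
      rw [e]
      refine (abs_add_le _ _).trans ?_
      rw [abs_mul, abs_mul]
      have e1 := mul_le_mul (hb x i k) (h.2.2 t ht x y j k) (abs_nonneg _) hκ0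
      have e2 := mul_le_mul (hb y j k) (h.2.2 t ht x y i k) (abs_nonneg _) hκ0
      linarith
    _ = _ := by simp; ring

lemma HolderDrift.norm_le {d : ℕ} {b : ℝ → Vec d → Vec d} {κ₁ : ℝ} (h : HolderDrift d b κ₁ 0)
    (hκ : 0 < κ₁) {t : ℝ} (ht : 0 ≤ t) (x : Vec d) : ‖b t x‖ ≤ 2 * κ₁ * (1 + ‖x‖) := by
  have h1 := h.2.1 t ht
  have h2 := h.2.2 t ht x 0
  rw [sub_zero, Real.rpow_zero] at h2
  have h3 : max 1 ‖x‖ ≤ 1 + ‖x‖ := max_le (by linarith [norm_nonneg x]) (by linarith)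
  have h4 : ‖b t x‖ ≤ ‖b t x - b t 0‖ + ‖b t 0‖ := by simpa using norm_add_le (b t x - b t 0) (b t 0)
  have := mul_le_mul_of_nonneg_left h3 hκ.le
  have := mul_nonneg hκ.le (norm_nonneg x)
  linarith

lemma pathSigma_mono (d : ℕ) {Ω : Type*} [MeasurableSpace Ω] (X : ℝ → Ω → Vec d) (s : ℝ)
    {u v : ℝ} (huv : u ≤ v) : pathSigma d X s u ≤ pathSigma d X s v :=
  iSup₂_mono' fun r hr => ⟨r, ⟨hr.1, hr.2.trans huv⟩, le_rfl⟩

lemma measurable_pathSigma (d : ℕ) {Ω : Type*} [MeasurableSpace Ω] (X : ℝ → Ω → Vec d) {s u : ℝ}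
    (hu : s ≤ u) : Measurable[pathSigma d X s u] (X u) := by
  have h1 : MeasurableSpace.comap (X u) inferInstance ≤ pathSigma d X s u :=
    le_iSup₂_of_le (f := fun r _ => MeasurableSpace.comap (X r) inferInstance) u ⟨hu, le_rfl⟩ le_rfl
  exact measurable_iff_comap_le.2 h1

lemma MartingaleProblemSolution.forwardEq {d : ℕ} {b : ℝ → Vec d → Vec d}
    {σ : ℝ → Vec d → Matrix (Fin d) (Fin d) ℝ} {κ₀ κ₁ α s u : ℝ} {x : Vec d} {Ω : Type*}
    [MeasurableSpace Ω] {P : Measure Ω} {X : ℝ → Ω → Vec d}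
    (h : MartingaleProblemSolution d b σ s x P X) (hκ₀ : 1 ≤ κ₀) (hκ₁ : 0 < κ₁)
    (hσ : EllipticHolder d σ κ₀ α) (hb : HolderDrift d b κ₁ 0) (hs : 0 ≤ s) (hu : s ≤ u)
    {E : Set Ω} (hE : MeasurableSet[pathSigma d X s u] E) :
    ForwardEq (κ₀ + 2 * κ₁) (fun r => b (max r 0)) (fun r => sqMat d σ (max r 0)) u (P.restrict E)
      (fun r => X (max r s)) := by
  have := h.isProb
  have hmax : Measurable fun p : ℝ × Vec d => (max p.1 0, p.2) := by fun_prop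
  have hpos : ∀ r : ℝ, 0 ≤ max r 0 := fun r => le_max_right _ _
  have hY : ∀ ω, Continuous fun r => X (max r s) ω := fun ω =>
    (h.cont_paths ω).comp_continuous (by fun_prop) fun r => mem_Ici.2 (le_max_right _ _)
  have mY : Measurable (Function.uncurry fun r => X (max r s)) :=
    measurable_uncurry_of_continuous_of_measurable (fun ω => hY ω)
      fun r => h.measurable_X _
  have mB : Measurable (Function.uncurry fun r => b (max r 0)) := hb.1.comp hmax
  have mA : ∀ i j, Measurable fun p : ℝ × Vec d => sqMat d σ (max p.1 0) p.2 i j := fun i j =>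
    (hσ.measurable_sqMat i j).comp hmax
  have bB : ∀ r z, ‖b (max r 0) z‖ ≤ (κ₀ + 2 * κ₁) * (1 + ‖z‖) := fun r z =>
    (hb.norm_le hκ₁ (hpos r) z).trans (by gcongr; linarith)
  have bA : ∀ r z i j, |sqMat d σ (max r 0) z i j| ≤ κ₀ + 2 * κ₁ := fun r z i j =>
    ((hσ.isElliptic (hpos r) z).abs_apply_le hκ₀ one_pos i j).trans (by linarith)
  have hEm : MeasurableSet E := by
    have : pathSigma d X s u ≤ ‹MeasurableSpace Ω› :=
      iSup₂_le fun r _ => (h.measurable_X r).comap_le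
    exact this E hE
  refine ⟨inferInstance, mB, mA, mY, hY, by linarith, bB, bA, fun f f₁ f₂ hf hfs hp v w huv hvw => ?_⟩
  have hv := hu.trans huv
  obtain ⟨M₀, hM₀⟩ := hfs.exists_bound_of_continuous hf.continuous
  have b1 : ∀ i, ∃ C, ∀ z, ‖(1 + ‖z‖) * f₁ z i‖ ≤ C := fun i => by
    have e : (fun z => f₁ z i) = fun z => fderiv ℝ f z (EuclideanSpace.single i 1) :=
      funext fun z => (hp.fderiv_single z i).symm
    have hc : HasCompactSupport fun z : Vec d => (1 + ‖z‖) * f₁ z i := by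
      refine HasCompactSupport.mul_left ?_
      rw [e]
      exact hfs.fderiv_apply ℝ _
    exact hc.exists_bound_of_continuous (by have := hp.continuous_fst i; fun_prop)
  have b2 : ∀ i j, ∃ C, ∀ z, ‖f₂ z i j‖ ≤ C := fun i j => by
    have e : (fun z => f₂ z i j) = fun z => iteratedFDeriv ℝ 2 f z
        ![EuclideanSpace.single j (1 : ℝ), EuclideanSpace.single i (1 : ℝ)] :=
      funext fun z => (hp.iteratedFDeriv_single z j i).symm
    obtain ⟨C, hC⟩ := (hfs.iteratedFDeriv (𝕜 := ℝ) 2).exists_bound_of_continuous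
      (hf.continuous_iteratedFDeriv (m := 2) (by norm_cast))
    refine ⟨C, fun z => ?_⟩
    rw [congrFun e z]
    refine (ContinuousMultilinearMap.le_opNorm _ _).trans ?_
    simpa using hC z
  choose C₁ hC₁ using b1
  choose C₂ hC₂ using b2
  have n1 : ∀ i, 0 ≤ C₁ i := fun i => (norm_nonneg _).trans (hC₁ i 0)
  have n2 : ∀ i j, 0 ≤ C₂ i j := fun i j => (norm_nonneg _).trans (hC₂ i j 0)
  set M := ∑ i, C₁ i + ∑ i, ∑ j, C₂ i j with hM
  have t1 : ∀ i, C₁ i ≤ M := fun i => by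
    have := Finset.single_le_sum (f := C₁) (fun i _ => n1 i) (Finset.mem_univ i)
    have : 0 ≤ ∑ i, ∑ j, C₂ i j := Finset.sum_nonneg fun i _ => Finset.sum_nonneg fun j _ => n2 i j
    linarith
  have t2 : ∀ i j, C₂ i j ≤ M := fun i j => by
    have h1 := Finset.single_le_sum (f := fun j => C₂ i j) (fun j _ => n2 i j) (Finset.mem_univ j)
    have h2 := Finset.single_le_sum (f := fun i => ∑ j, C₂ i j)
      (fun i _ => Finset.sum_nonneg fun j _ => n2 i j) (Finset.mem_univ i)
    have h3 : 0 ≤ ∑ i, C₁ i := Finset.sum_nonneg fun i _ => n1 i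
    linarith
  set g : ℝ → Ω → ℝ := fun r ω => genForm (b (max r 0) (X (max r s) ω))
    (sqMat d σ (max r 0) (X (max r s) ω)) (f₁ (X (max r s) ω)) (f₂ (X (max r s) ω)) with hg
  obtain ⟨N, hN⟩ : ∃ N, ∀ r ω, |g r ω| ≤ N := ⟨_, fun r ω =>
    abs_genForm_le_growth (by linarith) (bB _ _) (bA _ _)
      (fun i => by
        have := (hC₁ i (X (max r s) ω)).trans (t1 i)
        rwa [Real.norm_eq_abs, abs_mul, abs_of_nonneg (by positivity)] at this)
      (fun i j => (hC₂ i j (X (max r s) ω)).trans (t2 i j))⟩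
  have mg : Measurable (Function.uncurry g) :=
    measurable_genForm (mB.comp (measurable_fst.prodMk mY))
      (fun i j => (mA i j).comp (measurable_fst.prodMk mY))
      (fun i => (hp.continuous_fst i).measurable.comp mY)
      (fun i j => (hp.measurable_snd i j).comp mY)
  have ge : ∀ ω v, s ≤ v → ∫ r in s..v, genApply d b σ r f (X r ω) = ∫ r in s..v, g r ω := by
    intro ω v hv
    refine intervalIntegral.integral_congr fun r hr => ?_
    rw [uIcc_of_le hv] at hr
    simp only [hg]
    rw [hp.genApply_eq, max_eq_left hr.1, max_eq_left (hs.trans hr.1)]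
  have hvw' : s ≤ w := hv.trans hvw
  have ifX : ∀ r, Integrable (fun ω => f (X r ω)) (P.restrict E) := fun r =>
    integrable_of_abs_le (hf.continuous.measurable.comp (h.measurable_X r)) fun ω => hM₀ _
  have mI : ∀ a c, Integrable (fun ω => ∫ r in a..c, g r ω) (P.restrict E) := by
    intro a c
    have e : Measurable fun ω => ∫ r in a..c, g r ω := by
      simp only [intervalIntegral]
      exact (measurable_integral_right (g := fun ω r => g r ω) (mg.comp measurable_swap)).sub
        (measurable_integral_right (g := fun ω r => g r ω) (mg.comp measurable_swap))
    refine integrable_of_abs_le (C := N * |c - a|) e fun ω => ?_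
    exact intervalIntegral.norm_integral_le_of_norm_le_const (f := fun r => g r ω)
      fun r _ => hN r ω
  have key := h.martingale f hf hfs v w hv hvw E (pathSigma_mono d X s huv E hE)
  simp only [ge _ w hvw', ge _ v hv] at key
  rw [integral_sub (ifX w) (mI s w), integral_sub (ifX v) (mI s v)] at key
  have e3 : ∫ ω, (∫ r in s..w, g r ω) ∂(P.restrict E) - ∫ ω, (∫ r in s..v, g r ω) ∂(P.restrict E)
      = ∫ ω, (∫ r in v..w, g r ω) ∂(P.restrict E) := by
    rw [← integral_sub (mI s w) (mI s v)]
    refine integral_congr_ae (Filter.Eventually.of_forall fun ω => ?_)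
    have ii : ∀ a c, IntervalIntegrable (fun r => g r ω) volume a c :=
      intervalIntegrable_of_abs_le (mg.comp measurable_prodMk_right) fun r => hN r ω
    exact intervalIntegral.integral_interval_sub_left (ii s w) (ii s v)
  rw [max_eq_left hv, max_eq_left hvw', intervalIntegral_integral_swap_of_abs_le mg hN hvw, ← e3]
  linarith

/-! ### Carathéodory flows of Lipschitz drifts -/

lemma le_mul_exp_of_le_add_integral {v : ℝ → ℝ} {A K s r : ℝ} (hsr : s ≤ r) (hK : 0 ≤ K)
    (hv : ContinuousOn v (Icc s r)) (h : ∀ ρ ∈ Icc s r, v ρ ≤ A + K * ∫ x in s..ρ, v x) :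
    v r ≤ A * Real.exp (K * (r - s)) := by
  set w : ℝ → ℝ := fun x => v (max s (min x r)) with hw
  have hwc : Continuous w := hv.comp_continuous (by fun_prop) fun x =>
    ⟨le_max_left _ _, max_le hsr (min_le_right _ _)⟩
  have hwv : ∀ x ∈ Icc s r, w x = v x := fun x hx => by
    rw [hw]; simp only [min_eq_left hx.2, max_eq_right hx.1]
  set U : ℝ → ℝ := fun ρ => A + K * ∫ x in s..ρ, w x with hU
  have hUd : ∀ ρ, HasDerivAt U (K * w ρ) ρ := fun ρ =>
    ((hwc.integral_hasStrictDerivAt s ρ).hasDerivAt.const_mul K).const_add A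
  have hEd : ∀ ρ, HasDerivAt (fun ρ => U ρ * Real.exp (-K * ρ))
      (K * w ρ * Real.exp (-K * ρ) + U ρ * (Real.exp (-K * ρ) * (-K))) ρ := fun ρ =>
    (hUd ρ).mul (by simpa using ((hasDerivAt_id ρ).const_mul (-K)).exp)
  have hwU : ∀ ρ ∈ Icc s r, w ρ ≤ U ρ := fun ρ hρ => by
    rw [hwv ρ hρ, hU]
    refine (h ρ hρ).trans_eq ?_
    have : ∫ x in s..ρ, v x = ∫ x in s..ρ, w x := intervalIntegral.integral_congr fun x hx => by
      rw [uIcc_of_le hρ.1] at hx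
      exact (hwv x ⟨hx.1, hx.2.trans hρ.2⟩).symm
    simp only [this]
  have hanti : AntitoneOn (fun ρ => U ρ * Real.exp (-K * ρ)) (Icc s r) := by
    refine antitoneOn_of_deriv_nonpos (convex_Icc s r)
      (fun ρ _ => (hEd ρ).continuousAt.continuousWithinAt)
      (fun ρ _ => (hEd ρ).differentiableAt.differentiableWithinAt) fun ρ hρ => ?_
    rw [interior_Icc] at hρ
    rw [(hEd ρ).deriv]
    have := mul_le_mul_of_nonneg_left (hwU ρ ⟨hρ.1.le, hρ.2.le⟩) hK
    have hp := (Real.exp_pos (-K * ρ)).le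
    nlinarith
  have h1 := hanti (left_mem_Icc.2 hsr) (right_mem_Icc.2 hsr) hsr
  have h2 : U s = A := by simp [hU]
  simp only [h2] at h1
  have h3 := hwU r (right_mem_Icc.2 hsr)
  rw [hwv r (right_mem_Icc.2 hsr)] at h3
  calc v r ≤ U r := h3
    _ = U r * Real.exp (-K * r) * Real.exp (K * r) := by
      rw [mul_assoc, ← Real.exp_add]; simp
    _ ≤ A * Real.exp (-K * s) * Real.exp (K * r) := by gcongr
    _ = _ := by rw [mul_assoc, ← Real.exp_add]; ring_nf

/-- A solution of an integral equation with linearly growing drift is a genuine solution. -/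
lemma intervalIntegrable_of_integral_equation {d : ℕ} {f : ℝ → Vec d → Vec d} {η : ℝ → Vec d}
    {K c s r : ℝ} {x : Vec d} (hsr : s ≤ r) (hK : 0 ≤ K) (hc : 0 ≤ c)
    (mf : Measurable (Function.uncurry f))
    (bf : ∀ ρ ∈ Icc s r, ∀ z, ‖f ρ z‖ ≤ c + K * ‖z‖)
    (hη : ∀ ρ ∈ Icc s r, η ρ = x + ∫ y in s..ρ, f y (η y)) :
    IntervalIntegrable (fun ρ => f ρ (η ρ)) volume s r := by
  set g : ℝ → Vec d := fun ρ => f ρ (η ρ) with hg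
  set J : Set ℝ := {ρ | ρ ∈ Icc s r ∧ IntervalIntegrable g volume s ρ} with hJ
  have hJs : ∀ ρ ∈ J, ∀ ρ' ∈ Icc s ρ, ρ' ∈ J := fun ρ hρ ρ' h' =>
    ⟨⟨h'.1, h'.2.trans hρ.1.2⟩, hρ.2.mono_set (by
      rw [uIcc_of_le h'.1, uIcc_of_le hρ.1.1]; exact Icc_subset_Icc_right h'.2)⟩
  have hcJ : ∀ ρ ∈ J, ContinuousOn η (Icc s ρ) := fun ρ hρ => by
    have h1 : ContinuousOn (fun ρ' => x + ∫ y in s..ρ', g y) (Icc s ρ) := by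
      have := intervalIntegral.continuousOn_primitive_interval (μ := volume) (f := g) (a := s)
        (b := ρ) (by
          rw [uIcc_of_le hρ.1.1, integrableOn_Icc_iff_integrableOn_Ioc]
          exact (intervalIntegrable_iff_integrableOn_Ioc_of_le hρ.1.1).1 hρ.2)
      rw [uIcc_of_le hρ.1.1] at this
      exact continuousOn_const.add this
    exact h1.congr fun ρ' h' => hη ρ' ⟨h'.1, h'.2.trans hρ.1.2⟩
  have hJo : J.OrdConnected := ⟨fun a ha b hb y hy => hJs b hb y ⟨ha.1.1.trans hy.1, hy.2⟩⟩
  have mJ : MeasurableSet J := hJo.measurableSet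
  set M := (‖x‖ + c * (r - s)) * Real.exp (K * (r - s)) with hM
  have hM0 : ‖x‖ ≤ M := by
    have h1 : 0 ≤ c * (r - s) := mul_nonneg hc (by linarith)
    have h2 : 1 ≤ Real.exp (K * (r - s)) := Real.one_le_exp (mul_nonneg hK (by linarith))
    calc ‖x‖ ≤ ‖x‖ + c * (r - s) := by linarith
      _ ≤ M := le_mul_of_one_le_right (by positivity) h2
  have bJ : ∀ ρ ∈ J, ‖η ρ‖ ≤ M := fun ρ hρ => by
    have hsρ := hρ.1.1
    have h1 := le_mul_exp_of_le_add_integral (v := fun y => ‖η y‖) (A := ‖x‖ + c * (r - s)) hsρ hK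
      (hcJ ρ hρ).norm fun ρ' h' => by
        have hi : IntervalIntegrable (fun y => ‖η y‖) volume s ρ' := by
          refine ContinuousOn.intervalIntegrable ?_
          rw [uIcc_of_le h'.1]
          exact (hcJ ρ hρ).norm.mono (Icc_subset_Icc_right h'.2)
        rw [hη ρ' ⟨h'.1, h'.2.trans hρ.1.2⟩]
        refine (norm_add_le _ _).trans ?_
        have h2 : ‖∫ y in s..ρ', g y‖ ≤ ∫ y in s..ρ', (c + K * ‖η y‖) :=
          intervalIntegral.norm_integral_le_of_norm_le h'.1
            (Filter.Eventually.of_forall fun y hy =>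
              bf y ⟨hy.1.le, hy.2.trans (h'.2.trans hρ.1.2)⟩ _)
            (intervalIntegrable_const.add (hi.const_mul K))
        rw [intervalIntegral.integral_add intervalIntegrable_const (hi.const_mul K),
          intervalIntegral.integral_const_mul, intervalIntegral.integral_const, smul_eq_mul] at h2
        have h3 : (ρ' - s) * c ≤ c * (r - s) := by
          rw [mul_comm]; exact mul_le_mul_of_nonneg_left (by linarith [h'.2, hρ.1.2]) hc
        linarith
    refine h1.trans ?_
    have := hρ.1.2
    have h1 : 0 ≤ c * (r - s) := mul_nonneg hc (by linarith)
    rw [hM]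
    gcongr
  have hoff : ∀ ρ ∈ Icc s r, ρ ∉ J → η ρ = x := fun ρ hρ hn => by
    have : ¬ IntervalIntegrable g volume s ρ := fun hi => hn ⟨hρ, hi⟩
    rw [hη ρ hρ, intervalIntegral.integral_undef this, add_zero]
  have bη : ∀ ρ ∈ Icc s r, ‖η ρ‖ ≤ M := fun ρ hρ => by
    by_cases h : ρ ∈ J
    · exact bJ ρ h
    · rw [hoff ρ hρ h]; exact hM0
  have hcJ' : ContinuousOn η J := fun ρ hρ => by
    by_cases hex : ∃ ρ₁ ∈ J, ρ < ρ₁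
    · obtain ⟨ρ₁, h1, h2⟩ := hex
      refine ((hcJ ρ₁ h1) ρ ⟨hρ.1.1, h2.le⟩).mono_of_mem_nhdsWithin ?_
      filter_upwards [self_mem_nhdsWithin, mem_nhdsWithin_of_mem_nhds (Iio_mem_nhds h2)]
        with y hy hy'
      exact ⟨hy.1.1, (mem_Iio.1 hy').le⟩
    · push Not at hex
      exact ((hcJ ρ hρ) ρ ⟨hρ.1.1, le_rfl⟩).mono fun y hy => ⟨hy.1.1, hex y hy⟩
  classical
  have mη : Measurable (J.piecewise η fun _ => x) :=
    hcJ'.measurable_piecewise continuousOn_const mJ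
  have eη : ∀ ρ ∈ Icc s r, J.piecewise η (fun _ => x) ρ = η ρ := fun ρ hρ => by
    by_cases h : ρ ∈ J
    · rw [piecewise_eq_of_mem _ _ _ h]
    · rw [piecewise_eq_of_notMem _ _ _ h, hoff ρ hρ h]
  have mg : Measurable fun ρ => f ρ (J.piecewise η (fun _ => x) ρ) :=
    mf.comp (measurable_id.prodMk mη)
  have : IntervalIntegrable (fun ρ => f ρ (J.piecewise η (fun _ => x) ρ)) volume s r := by
    refine (intervalIntegrable_const (c := c + K * M)).mono_fun mg.aestronglyMeasurable ?_
    rw [uIoc_of_le hsr]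
    filter_upwards [ae_restrict_mem measurableSet_Ioc] with ρ hρ
    rw [eη ρ ⟨hρ.1.le, hρ.2⟩]
    refine (bf ρ ⟨hρ.1.le, hρ.2⟩ _).trans (le_trans ?_ (le_abs_self _))
    have := mul_le_mul_of_nonneg_left (bη ρ ⟨hρ.1.le, hρ.2⟩) hK
    linarith
  refine this.congr fun ρ hρ => ?_
  rw [uIoc_of_le hsr] at hρ
  simp only [eη ρ ⟨hρ.1.le, hρ.2⟩, hg]

/-! ### The mollified drift -/

namespace IsMollifier

variable {d : ℕ} {ρ : Vec d → ℝ}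

lemma integrable (hρ : IsMollifier d ρ) : Integrable ρ := integrable_of_integral_eq_one hρ.integral_eq_one

lemma hasCompactSupport (hρ : IsMollifier d ρ) : HasCompactSupport ρ :=
  HasCompactSupport.of_support_subset_isCompact (isCompact_closedBall 0 1) hρ.support_subset

lemma eq_zero (hρ : IsMollifier d ρ) {z : Vec d} (hz : 1 < ‖z‖) : ρ z = 0 := by
  by_contra h
  have := hρ.support_subset h
  rw [mem_closedBall_zero_iff] at this
  linarith

lemma integrable_comp (hρ : IsMollifier d ρ) (x : Vec d) :
    Integrable fun y => ρ (x - y) :=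
  hρ.integrable.comp_sub_left x

lemma integral_comp (hρ : IsMollifier d ρ) (x : Vec d) : ∫ y, ρ (x - y) = 1 := by
  rw [integral_sub_left_eq_self ρ volume x, hρ.integral_eq_one]

end IsMollifier

lemma mollifiedDrift_one {d : ℕ} (ρ : Vec d → ℝ) (b : ℝ → Vec d → Vec d) (t : ℝ) (x : Vec d) :
    mollifiedDrift d ρ 1 b t x = ∫ y, ρ (x - y) • b t y := by
  simp [mollifiedDrift]

namespace HolderDrift

variable {d : ℕ} {ρ : Vec d → ℝ} {b : ℝ → Vec d → Vec d} {κ₁ : ℝ}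

lemma norm_sub_le (h : HolderDrift d b κ₁ 0) {t : ℝ} (ht : 0 ≤ t) (x y : Vec d) :
    ‖b t x - b t y‖ ≤ κ₁ * max 1 ‖x - y‖ := by
  simpa using h.2.2 t ht x y

lemma measurable_apply (h : HolderDrift d b κ₁ 0) (t : ℝ) : Measurable (b t) :=
  h.1.comp measurable_prodMk_left

lemma integrable_smul (h : HolderDrift d b κ₁ 0) (hκ₁ : 0 < κ₁) (hρ : IsMollifier d ρ) {t : ℝ}
    (ht : 0 ≤ t) (x : Vec d) : Integrable fun y => ρ (x - y) • b t y := by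
  refine ((hρ.integrable_comp x).mul_const (2 * κ₁ * (2 + ‖x‖))).mono' ?_
    (Filter.Eventually.of_forall fun y => ?_)
  · exact ((hρ.smooth.continuous.measurable.comp (measurable_const.sub measurable_id)).smul
      (h.measurable_apply t)).aestronglyMeasurable
  · rw [norm_smul, Real.norm_eq_abs, abs_of_nonneg (hρ.nonneg _)]
    by_cases hy : 1 < ‖x - y‖
    · rw [hρ.eq_zero hy]; simp
    · refine mul_le_mul_of_nonneg_left ((h.norm_le hκ₁ ht y).trans ?_) (hρ.nonneg _)
      have : ‖y‖ ≤ ‖x‖ + ‖x - y‖ := by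
        simpa using _root_.norm_sub_le x (x - y)
      exact mul_le_mul_of_nonneg_left (by linarith [not_lt.1 hy]) (by positivity)

lemma integrable_smul_const (hρ : IsMollifier d ρ) (x v : Vec d) :
    Integrable fun y => ρ (x - y) • v := (hρ.integrable_comp x).smul_const v

lemma norm_sub_mollifiedDrift_le (h : HolderDrift d b κ₁ 0) (hκ₁ : 0 < κ₁) (hρ : IsMollifier d ρ)
    {t : ℝ} (ht : 0 ≤ t) (z w : Vec d) :
    ‖b t z - mollifiedDrift d ρ 1 b t w‖ ≤ 2 * κ₁ * (1 + ‖z - w‖) := by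
  have h1 : ‖b t w - mollifiedDrift d ρ 1 b t w‖ ≤ κ₁ := by
    have e : b t w - mollifiedDrift d ρ 1 b t w = ∫ y, ρ (w - y) • (b t w - b t y) := by
      simp only [smul_sub]
      rw [integral_sub (integrable_smul_const hρ w _) (h.integrable_smul hκ₁ hρ ht w),
        integral_smul_const, hρ.integral_comp, one_smul, mollifiedDrift_one]
    rw [e]
    calc _ ≤ ∫ y, ρ (w - y) * κ₁ := norm_integral_le_of_norm_le
          ((hρ.integrable_comp w).mul_const κ₁) (Filter.Eventually.of_forall fun y => by
            rw [norm_smul, Real.norm_eq_abs, abs_of_nonneg (hρ.nonneg _)]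
            by_cases hy : 1 < ‖w - y‖
            · rw [hρ.eq_zero hy]; simp
            · refine mul_le_mul_of_nonneg_left ((h.norm_sub_le ht w y).trans ?_) (hρ.nonneg _)
              rw [max_eq_left (not_lt.1 hy), mul_one])
      _ = κ₁ := by rw [integral_mul_const, hρ.integral_comp, one_mul]
  have h2 := h.norm_sub_le ht z w
  have h3 : max 1 ‖z - w‖ ≤ 1 + ‖z - w‖ :=
    max_le (by linarith [norm_nonneg (z - w)]) (by linarith)
  have h4 : ‖b t z - mollifiedDrift d ρ 1 b t w‖ ≤ ‖b t z - b t w‖ +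
      ‖b t w - mollifiedDrift d ρ 1 b t w‖ := by
    simpa using norm_add_le (b t z - b t w) (b t w - mollifiedDrift d ρ 1 b t w)
  have := mul_le_mul_of_nonneg_left h3 hκ₁.le
  have := mul_nonneg hκ₁.le (norm_nonneg (z - w))
  linarith

lemma measurable_mollifiedDrift (h : HolderDrift d b κ₁ 0) (hρ : IsMollifier d ρ) :
    Measurable (Function.uncurry (mollifiedDrift d ρ 1 b)) := by
  have e : Function.uncurry (mollifiedDrift d ρ 1 b)
      = fun p : ℝ × Vec d => ∫ y, ρ (p.2 - y) • b p.1 y :=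
    funext fun p => mollifiedDrift_one ρ b p.1 p.2
  rw [e]
  have hm : Measurable fun q : (ℝ × Vec d) × Vec d => ρ (q.1.2 - q.2) • b q.1.1 q.2 := by
    have h1 : Measurable fun q : (ℝ × Vec d) × Vec d => b q.1.1 q.2 :=
      h.1.comp (by fun_prop : Measurable fun q : (ℝ × Vec d) × Vec d => (q.1.1, q.2))
    have h2 := hρ.smooth.continuous.measurable
    exact (h2.comp (by fun_prop : Measurable fun q : (ℝ × Vec d) × Vec d => q.1.2 - q.2)).smul h1
  exact (hm.stronglyMeasurable.integral_prod_right' (ν := volume)).measurable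

/-- The mollified drift is Lipschitz in space, with a constant that only depends on the mollifier
and on the bounds on the drift. -/
lemma exists_lipschitz_mollifiedDrift (hκ₁ : 0 < κ₁) (hρ : IsMollifier d ρ) :
    ∃ K : ℝ, 0 ≤ K ∧ ∀ b, HolderDrift d b κ₁ 0 → ∀ t, 0 ≤ t → ∀ x y,
      ‖mollifiedDrift d ρ 1 b t x - mollifiedDrift d ρ 1 b t y‖ ≤ K * ‖x - y‖ := by
  obtain ⟨Kρ, hK⟩ := hρ.smooth.lipschitzWith_of_hasCompactSupport hρ.hasCompactSupport (by simp)
  have hvol : ∀ x : Vec d, volume.real (Metric.closedBall x 2) = volume.real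
      (Metric.closedBall (0 : Vec d) 2) := fun x => by
    rw [measureReal_def, measureReal_def, Measure.addHaar_closedBall_center]
  set V := volume.real (Metric.closedBall (0 : Vec d) 2) with hV
  have hV0 : 0 ≤ V := measureReal_nonneg
  refine ⟨κ₁ + Kρ * (2 * κ₁) * V, by positivity, fun b h t ht x y => ?_⟩
  rw [mollifiedDrift_one, mollifiedDrift_one]
  rcases le_or_gt 1 ‖x - y‖ with hxy | hxy
  · have e : ∀ x : Vec d, ∫ z, ρ (x - z) • b t z = ∫ z, ρ z • b t (x - z) := fun x => by
      rw [← integral_sub_left_eq_self _ volume x]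
      simp
    have hi : ∀ x : Vec d, Integrable fun z => ρ z • b t (x - z) := fun x => by
      simpa using (h.integrable_smul hκ₁ hρ ht x).comp_sub_left x
    rw [e, e, ← integral_sub (hi x) (hi y)]
    calc _ ≤ ∫ z, ρ z * (κ₁ * ‖x - y‖) := norm_integral_le_of_norm_le
          (hρ.integrable.mul_const _) (Filter.Eventually.of_forall fun z => by
            rw [← smul_sub, norm_smul, Real.norm_eq_abs, abs_of_nonneg (hρ.nonneg _)]
            refine mul_le_mul_of_nonneg_left ((h.norm_sub_le ht _ _).trans_eq ?_) (hρ.nonneg _)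
            rw [sub_sub_sub_cancel_right, max_eq_right hxy])
      _ = κ₁ * ‖x - y‖ := by rw [integral_mul_const, hρ.integral_eq_one, one_mul]
      _ ≤ _ := by
        gcongr
        have : 0 ≤ Kρ * (2 * κ₁) * V := by positivity
        linarith
  · have e : (∫ z, ρ (x - z) • b t z) - ∫ z, ρ (y - z) • b t z
        = ∫ z, (ρ (x - z) - ρ (y - z)) • (b t z - b t x) := by
      have h1 : ∀ y, ∫ z, ρ (y - z) • (b t z - b t x) = (∫ z, ρ (y - z) • b t z) - b t x :=
        fun y => by
          simp only [smul_sub]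
          rw [integral_sub (h.integrable_smul hκ₁ hρ ht y) (integrable_smul_const hρ y _),
            integral_smul_const, hρ.integral_comp, one_smul]
      have h2 : ∀ y, Integrable fun z => ρ (y - z) • (b t z - b t x) := fun y => by
        simp only [smul_sub]
        exact (h.integrable_smul hκ₁ hρ ht y).sub (integrable_smul_const hρ y _)
      simp only [sub_smul]
      rw [integral_sub (h2 x) (h2 y), h1, h1]
      abel
    rw [e]
    have hb : ∀ z, ‖(ρ (x - z) - ρ (y - z)) • (b t z - b t x)‖ ≤
        (Metric.closedBall x 2).indicator (fun _ => Kρ * ‖x - y‖ * (2 * κ₁)) z := fun z => by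
      by_cases hz : z ∈ Metric.closedBall x 2
      · rw [indicator_of_mem hz, norm_smul]
        have h1 : ‖ρ (x - z) - ρ (y - z)‖ ≤ Kρ * ‖x - y‖ := by
          have := hK.dist_le_mul (x - z) (y - z)
          rwa [dist_eq_norm, dist_eq_norm, sub_sub_sub_cancel_right] at this
        have h2 : ‖b t z - b t x‖ ≤ 2 * κ₁ := by
          rw [mem_closedBall_iff_norm] at hz
          refine (h.norm_sub_le ht z x).trans ?_
          rw [mul_comm 2 κ₁]
          exact mul_le_mul_of_nonneg_left (max_le (by norm_num) hz) hκ₁.le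
        exact mul_le_mul h1 h2 (norm_nonneg _) (by positivity)
      · rw [indicator_of_notMem hz]
        rw [mem_closedBall_iff_norm, not_le, norm_sub_rev] at hz
        have h3 : ‖x - z‖ ≤ ‖x - y‖ + ‖y - z‖ := by simpa using norm_add_le (x - y) (y - z)
        rw [hρ.eq_zero (by linarith : 1 < ‖x - z‖), hρ.eq_zero (by linarith : 1 < ‖y - z‖)]
        simp
    have hfin : volume (Metric.closedBall x 2) ≠ ⊤ := measure_closedBall_lt_top.ne
    calc _ ≤ ∫ z, (Metric.closedBall x 2).indicator (fun _ => Kρ * ‖x - y‖ * (2 * κ₁)) z :=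
          norm_integral_le_of_norm_le ((integrable_indicator_iff measurableSet_closedBall).2
            (integrableOn_const hfin)) (Filter.Eventually.of_forall hb)
      _ = V * (Kρ * ‖x - y‖ * (2 * κ₁)) := by
        rw [integral_indicator_const _ measurableSet_closedBall, hvol, smul_eq_mul]
      _ ≤ _ := by
        have := mul_nonneg hκ₁.le (norm_nonneg (x - y))
        linarith

end HolderDrift

/-! ### Flows of Lipschitz vector fields -/

section Flow

variable {d : ℕ} {f : ℝ → Vec d → Vec d} {K c : ℝ}

lemma norm_le_of_lipschitz {s r : ℝ}
    (lf : ∀ ρ ∈ Icc s r, ∀ z w, ‖f ρ z - f ρ w‖ ≤ K * ‖z - w‖) (f0 : ∀ ρ ∈ Icc s r, ‖f ρ 0‖ ≤ c) :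
    ∀ ρ ∈ Icc s r, ∀ z, ‖f ρ z‖ ≤ c + K * ‖z‖ := fun ρ hρ z => by
  have h1 := lf ρ hρ z 0
  have h2 := f0 ρ hρ
  have h3 : ‖f ρ z‖ ≤ ‖f ρ z - f ρ 0‖ + ‖f ρ 0‖ := by simpa using norm_add_le (f ρ z - f ρ 0) (f ρ 0)
  rw [sub_zero] at h1
  linarith

lemma continuousOn_of_integral_equation {s r : ℝ} {x : Vec d} {η : ℝ → Vec d} (hsr : s ≤ r)
    (hi : IntervalIntegrable (fun ρ => f ρ (η ρ)) volume s r)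
    (hη : ∀ ρ ∈ Icc s r, η ρ = x + ∫ y in s..ρ, f y (η y)) : ContinuousOn η (Icc s r) := by
  have h := intervalIntegral.continuousOn_primitive_interval' hi left_mem_uIcc
  rw [uIcc_of_le hsr] at h
  exact (continuousOn_const.add h).congr hη

/-- Lipschitz dependence of the solution of an integral equation on the initial value. -/
lemma norm_sub_le_of_integral_equation {s r : ℝ} {x x' : Vec d} {η η' : ℝ → Vec d} (hsr : s ≤ r)
    (hK : 0 ≤ K) (hc : 0 ≤ c) (mf : Measurable (Function.uncurry f))
    (lf : ∀ ρ ∈ Icc s r, ∀ z w, ‖f ρ z - f ρ w‖ ≤ K * ‖z - w‖) (f0 : ∀ ρ ∈ Icc s r, ‖f ρ 0‖ ≤ c)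
    (hη : ∀ ρ ∈ Icc s r, η ρ = x + ∫ y in s..ρ, f y (η y))
    (hη' : ∀ ρ ∈ Icc s r, η' ρ = x' + ∫ y in s..ρ, f y (η' y)) :
    ‖η r - η' r‖ ≤ ‖x - x'‖ * Real.exp (K * (r - s)) := by
  have i := intervalIntegrable_of_integral_equation hsr hK hc mf (norm_le_of_lipschitz lf f0) hη
  have i' := intervalIntegrable_of_integral_equation hsr hK hc mf (norm_le_of_lipschitz lf f0) hη'
  have hc1 := continuousOn_of_integral_equation hsr i hη
  have hc2 := continuousOn_of_integral_equation hsr i' hη'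
  refine le_mul_exp_of_le_add_integral (v := fun ρ => ‖η ρ - η' ρ‖) hsr hK (hc1.sub hc2).norm
    fun ρ hρ => ?_
  have sub : uIcc s ρ ⊆ uIcc s r := by
    rw [uIcc_of_le hρ.1, uIcc_of_le hsr]
    exact Icc_subset_Icc_right hρ.2
  have e : η ρ - η' ρ = (x - x') + ∫ y in s..ρ, (f y (η y) - f y (η' y)) := by
    rw [intervalIntegral.integral_sub (i.mono_set sub) (i'.mono_set sub), hη ρ hρ, hη' ρ hρ]
    abel
  have hb : ‖∫ y in s..ρ, (f y (η y) - f y (η' y))‖ ≤ ∫ y in s..ρ, K * ‖η y - η' y‖ := by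
    refine intervalIntegral.norm_integral_le_of_norm_le hρ.1
      (Filter.Eventually.of_forall fun y hy => lf y ⟨hy.1.le, hy.2.trans hρ.2⟩ _ _) ?_
    refine ContinuousOn.intervalIntegrable (continuousOn_const.mul ((hc1.sub hc2).norm.mono ?_))
    rw [uIcc_of_le hρ.1]
    exact Icc_subset_Icc_right hρ.2
  rw [intervalIntegral.integral_const_mul] at hb
  simp only [e]
  exact (norm_add_le _ _).trans (by simpa [← e] using hb)

lemma integral_equation_reflect {s r : ℝ} {x : Vec d} {η : ℝ → Vec d}
    (hη : ∀ ρ ∈ Icc s r, η ρ = x + ∫ y in r..ρ, f y (η y)) :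
    ∀ ρ ∈ Icc s r, η (s + r - ρ)
      = x + ∫ y in s..ρ, (fun y z => -f (s + r - y) z) y (η (s + r - y)) := fun ρ hρ => by
  rw [hη _ ⟨by linarith [hρ.2], by linarith [hρ.1]⟩]
  simp only [intervalIntegral.integral_neg]
  rw [intervalIntegral.integral_comp_sub_left (fun y => f y (η y)) (s + r),
    ← intervalIntegral.integral_symm]
  simp

lemma intervalIntegrable_of_backward_equation {s r : ℝ} {x : Vec d} {η : ℝ → Vec d} (hsr : s ≤ r)
    (hK : 0 ≤ K) (hc : 0 ≤ c) (mf : Measurable (Function.uncurry f))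
    (lf : ∀ ρ ∈ Icc s r, ∀ z w, ‖f ρ z - f ρ w‖ ≤ K * ‖z - w‖) (f0 : ∀ ρ ∈ Icc s r, ‖f ρ 0‖ ≤ c)
    (hη : ∀ ρ ∈ Icc s r, η ρ = x + ∫ y in r..ρ, f y (η y)) :
    IntervalIntegrable (fun ρ => f ρ (η ρ)) volume s r := by
  have hr : ∀ ρ ∈ Icc s r, s + r - ρ ∈ Icc s r := fun ρ hρ =>
    ⟨by linarith [hρ.2], by linarith [hρ.1]⟩
  have h := intervalIntegrable_of_integral_equation (f := fun y z => -f (s + r - y) z)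
    (η := fun ρ => η (s + r - ρ)) (x := x) hsr hK hc
    (mf.comp (by fun_prop : Measurable fun p : ℝ × Vec d => (s + r - p.1, p.2))).neg
    (fun ρ hρ z => by
      rw [norm_neg]
      exact norm_le_of_lipschitz lf f0 _ (hr ρ hρ) z) (integral_equation_reflect hη)
  have h2 := (h.neg.comp_sub_left (s + r)).symm
  simpa using h2

lemma norm_sub_le_of_backward_equation {s r : ℝ} {x x' : Vec d} {η η' : ℝ → Vec d} (hsr : s ≤ r)
    (hK : 0 ≤ K) (hc : 0 ≤ c) (mf : Measurable (Function.uncurry f))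
    (lf : ∀ ρ ∈ Icc s r, ∀ z w, ‖f ρ z - f ρ w‖ ≤ K * ‖z - w‖) (f0 : ∀ ρ ∈ Icc s r, ‖f ρ 0‖ ≤ c)
    (hη : ∀ ρ ∈ Icc s r, η ρ = x + ∫ y in r..ρ, f y (η y))
    (hη' : ∀ ρ ∈ Icc s r, η' ρ = x' + ∫ y in r..ρ, f y (η' y)) :
    ‖η s - η' s‖ ≤ ‖x - x'‖ * Real.exp (K * (r - s)) := by
  have hr : ∀ ρ ∈ Icc s r, s + r - ρ ∈ Icc s r := fun ρ hρ =>
    ⟨by linarith [hρ.2], by linarith [hρ.1]⟩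
  have h := norm_sub_le_of_integral_equation (f := fun y z => -f (s + r - y) z)
    (η := fun ρ => η (s + r - ρ)) (η' := fun ρ => η' (s + r - ρ)) (x := x) (x' := x') hsr hK hc
    (mf.comp (by fun_prop : Measurable fun p : ℝ × Vec d => (s + r - p.1, p.2))).neg
    (fun ρ hρ z w => by
      rw [neg_sub_neg, norm_sub_rev]
      exact lf _ (hr ρ hρ) z w) (fun ρ hρ => by
      rw [norm_neg]
      exact f0 _ (hr ρ hρ)) (integral_equation_reflect hη) (integral_equation_reflect hη')
  simpa using h

/-- The flow of a vector field on `[s, S]`, started at time `s` (the maps `ψ r`), together with the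
inverse maps (the maps `Θ r`); both are bi-Lipschitz with constant `L`. -/
structure IsFlowPair (d : ℕ) (f : ℝ → Vec d → Vec d) (L s S : ℝ) (Θ ψ : ℝ → Vec d → Vec d) :
    Prop where
  continuous_inv : Continuous (Function.uncurry Θ)
  continuous_flow : Continuous (Function.uncurry ψ)
  lip_inv : ∀ r y y', ‖Θ r y - Θ r y'‖ ≤ L * ‖y - y'‖
  lip_flow : ∀ r w w', ‖ψ r w - ψ r w'‖ ≤ L * ‖w - w'‖
  inv_flow : ∀ r w, Θ r (ψ r w) = w
  flow_inv : ∀ r y, ψ r (Θ r y) = y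
  start : ∀ y, Θ s y = y
  ode : ∀ r t w, s ≤ r → r ≤ t → t ≤ S → ψ t w - ψ r w = ∫ ρ in r..t, f ρ (ψ ρ w)

/-- Projection of a time onto `[s, S]`. -/
def clampTime (s S r : ℝ) : ℝ := max s (min r S)

lemma clampTime_mem {s S : ℝ} (h : s ≤ S) (r : ℝ) : clampTime s S r ∈ Icc s S :=
  ⟨le_max_left _ _, max_le h (min_le_right _ _)⟩

lemma clampTime_eq {s S r : ℝ} (h : r ∈ Icc s S) : clampTime s S r = r := by
  rw [clampTime, min_eq_left h.2, max_eq_right h.1]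

lemma continuous_clampTime (s S : ℝ) : Continuous (clampTime s S) := by
  unfold clampTime
  fun_prop

lemma IsFlow.isFlowPair {θ : ℝ → ℝ → Vec d → Vec d} (hθ : IsFlow d f θ) (hK : 0 ≤ K) (hc : 0 ≤ c)
    (mf : Measurable (Function.uncurry f))
    (lf : ∀ ρ, 0 ≤ ρ → ∀ z w, ‖f ρ z - f ρ w‖ ≤ K * ‖z - w‖) (f0 : ∀ ρ, 0 ≤ ρ → ‖f ρ 0‖ ≤ c)
    {s S : ℝ} (hs : 0 ≤ s) (hsS : s ≤ S) :
    IsFlowPair d f (Real.exp (K * (S - s))) s S (fun r y => θ s (clampTime s S r) y)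
      (fun r w => θ (clampTime s S r) s w) := by
  have lf' : ∀ r, ∀ ρ ∈ Icc s r, ∀ z w, ‖f ρ z - f ρ w‖ ≤ K * ‖z - w‖ := fun r ρ hρ =>
    lf ρ (hs.trans hρ.1)
  have f0' : ∀ r, ∀ ρ ∈ Icc s r, ‖f ρ 0‖ ≤ c := fun r ρ hρ => f0 ρ (hs.trans hρ.1)
  have fwd : ∀ r w, ∀ ρ ∈ Icc s r, θ ρ s w = w + ∫ y in s..ρ, f y (θ y s w) := fun r w ρ hρ =>
    hθ s ρ hs (hs.trans hρ.1) w
  have bwd : ∀ r, s ≤ r → ∀ y, ∀ ρ ∈ Icc s r, θ ρ r y = y + ∫ v in r..ρ, f v (θ v r y) :=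
    fun r hr y ρ hρ => hθ r ρ (hs.trans hr) (hs.trans hρ.1) y
  have fint : ∀ r w, s ≤ r → IntervalIntegrable (fun ρ => f ρ (θ ρ s w)) volume s r :=
    fun r w hr => intervalIntegrable_of_integral_equation hr hK hc mf
      (norm_le_of_lipschitz (lf' r) (f0' r)) (fwd r w)
  have fbwd : ∀ r w, s ≤ r → ∀ ρ ∈ Icc s r, θ ρ s w = θ r s w + ∫ v in r..ρ, f v (θ v s w) :=
    fun r w hr ρ hρ => by
      have h := intervalIntegral.integral_add_adjacent_intervals (fint r w hr)
        ((fint r w hr).symm.trans (fint ρ w hρ.1))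
      rw [fwd ρ w ρ ⟨hρ.1, le_rfl⟩, fwd r w r ⟨hr, le_rfl⟩, ← h]
      abel
  have exple : ∀ r, r ∈ Icc s S → Real.exp (K * (r - s)) ≤ Real.exp (K * (S - s)) := fun r hr =>
    Real.exp_le_exp.2 (mul_le_mul_of_nonneg_left (by linarith [hr.2]) hK)
  have lipψ : ∀ r ∈ Icc s S, ∀ w w', ‖θ r s w - θ r s w'‖ ≤ Real.exp (K * (S - s)) * ‖w - w'‖ :=
    fun r hr w w' => by
      refine (norm_sub_le_of_integral_equation hr.1 hK hc mf (lf' r) (f0' r) (fwd r w)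
        (fwd r w')).trans ?_
      rw [mul_comm]
      exact mul_le_mul_of_nonneg_right (exple r hr) (norm_nonneg _)
  have lipψ' : ∀ r ∈ Icc s S, ∀ w w', ‖w - w'‖ ≤ Real.exp (K * (S - s)) * ‖θ r s w - θ r s w'‖ :=
    fun r hr w w' => by
      have h0 : ∀ w, θ s s w = w := fun w => by simpa using fwd s w s ⟨le_rfl, le_rfl⟩
      have := norm_sub_le_of_backward_equation hr.1 hK hc mf (lf' r) (f0' r) (fbwd r w hr.1)
        (fbwd r w' hr.1)
      rw [h0, h0, mul_comm] at this
      exact this.trans (mul_le_mul_of_nonneg_right (exple r hr) (norm_nonneg _))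
  have lipΘ : ∀ r ∈ Icc s S, ∀ y y', ‖θ s r y - θ s r y'‖ ≤ Real.exp (K * (S - s)) * ‖y - y'‖ :=
    fun r hr y y' => by
      refine (norm_sub_le_of_backward_equation hr.1 hK hc mf (lf' r) (f0' r) (bwd r hr.1 y)
        (bwd r hr.1 y')).trans ?_
      rw [mul_comm]
      exact mul_le_mul_of_nonneg_right (exple r hr) (norm_nonneg _)
  have ψΘ : ∀ r ∈ Icc s S, ∀ y, θ r s (θ s r y) = y := fun r hr y => by
    have bi := intervalIntegrable_of_backward_equation hr.1 hK hc mf (lf' r) (f0' r) (bwd r hr.1 y)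
    have hf : ∀ ρ ∈ Icc s r, θ ρ r y = θ s r y + ∫ v in s..ρ, f v (θ v r y) := fun ρ hρ => by
      have sub : uIcc ρ r ⊆ uIcc s r := by
        rw [uIcc_of_le hρ.2, uIcc_of_le hr.1]
        exact Icc_subset_Icc_left hρ.1
      have h := intervalIntegral.integral_add_adjacent_intervals bi.symm
        (bi.trans (bi.mono_set sub).symm)
      rw [bwd r hr.1 y ρ hρ, bwd r hr.1 y s ⟨le_rfl, hr.1⟩, ← h]
      abel
    have h := norm_sub_le_of_integral_equation hr.1 hK hc mf (lf' r) (f0' r)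
      (fwd r (θ s r y)) hf
    have h0 : θ r r y = y := by simpa using bwd r hr.1 y r ⟨hr.1, le_rfl⟩
    rw [sub_self, norm_zero, zero_mul, h0] at h
    exact sub_eq_zero.1 (norm_eq_zero.1 (le_antisymm h (norm_nonneg _)))
  have Θψ : ∀ r ∈ Icc s S, ∀ w, θ s r (θ r s w) = w := fun r hr w => by
    have h := lipψ' r hr (θ s r (θ r s w)) w
    rw [ψΘ r hr, sub_self, norm_zero, mul_zero] at h
    exact sub_eq_zero.1 (norm_eq_zero.1 (le_antisymm h (norm_nonneg _)))
  have cm := clampTime_mem hsS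
  have ctsψ : ∀ w, Continuous fun r => θ (clampTime s S r) s w := fun w =>
    (continuousOn_of_integral_equation hsS (fint S w hsS) (fwd S w)).comp_continuous
      (continuous_clampTime s S) cm
  have ctsΘ : ∀ y, Continuous fun r => θ s (clampTime s S r) y := fun y => by
    rw [continuous_iff_continuousAt]
    intro r₀
    have hr₀ := cm r₀
    rw [ContinuousAt, tendsto_iff_norm_sub_tendsto_zero]
    set w := θ s (clampTime s S r₀) y with hw
    have h1 : Filter.Tendsto (fun r => Real.exp (K * (S - s)) * ‖θ (clampTime s S r₀) s w
        - θ (clampTime s S r) s w‖) (nhds r₀) (nhds 0) := by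
      have := ((continuous_const (y := θ (clampTime s S r₀) s w) |>.sub (ctsψ w)).norm.const_mul
        (Real.exp (K * (S - s)))).tendsto r₀
      simpa using this
    refine squeeze_zero (fun _ => norm_nonneg _) (fun r => ?_) h1
    have h2 := lipΘ _ (cm r) y (θ (clampTime s S r) s w)
    rw [Θψ _ (cm r)] at h2
    rwa [hw, ψΘ _ hr₀]
  have lip : ∀ g : Vec d → Vec d, (∀ x y, ‖g x - g y‖ ≤ Real.exp (K * (S - s)) * ‖x - y‖) →
      LipschitzWith (Real.exp (K * (S - s))).toNNReal g := fun g hg =>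
    LipschitzWith.of_dist_le_mul fun x y => by
      rw [dist_eq_norm, dist_eq_norm, Real.coe_toNNReal _ (Real.exp_pos _).le]
      exact hg x y
  have jΘ : Continuous fun p : ℝ × Vec d => θ s (clampTime s S p.1) p.2 :=
    continuous_prod_of_continuous_lipschitzWith' _ (Real.exp (K * (S - s))).toNNReal
      (fun r => lip (fun y => θ s (clampTime s S r) y) (lipΘ _ (cm r))) ctsΘ
  have jψ : Continuous fun p : ℝ × Vec d => θ (clampTime s S p.1) s p.2 :=
    continuous_prod_of_continuous_lipschitzWith' _ (Real.exp (K * (S - s))).toNNReal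
      (fun r => lip (fun w => θ (clampTime s S r) s w) (lipψ _ (cm r))) ctsψ
  refine ⟨jΘ, jψ, fun r => lipΘ _ (cm r), fun r => lipψ _ (cm r), fun r => Θψ _ (cm r),
    fun r => ψΘ _ (cm r), fun y => ?_, fun r t w hr hrt htS => ?_⟩
  · rw [clampTime_eq ⟨le_rfl, hsS⟩]
    simpa using fwd s y s ⟨le_rfl, le_rfl⟩
  · have e : ∀ ρ ∈ Icc s S, θ (clampTime s S ρ) s w = θ ρ s w := fun ρ hρ => by
      rw [clampTime_eq hρ]
    have hI : ∫ ρ in r..t, f ρ (θ (clampTime s S ρ) s w) = ∫ ρ in r..t, f ρ (θ ρ s w) := by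
      refine intervalIntegral.integral_congr fun ρ hρ => ?_
      rw [uIcc_of_le hrt] at hρ
      exact congrArg (f ρ) (e ρ ⟨hr.trans hρ.1, hρ.2.trans htS⟩)
    rw [hI, e t ⟨hr.trans hrt, htS⟩, e r ⟨hr, hrt.trans htS⟩,
      fbwd t w (hr.trans hrt) r ⟨hr, hrt⟩, intervalIntegral.integral_symm]
    abel

end Flow

/-! ### Convolution estimates for Gaussian majorants along a flow -/

lemma gaussk_mul_gaussk {d : ℕ} (l : ℝ) {a b : ℝ} (ha : 0 < a) (hb : 0 < b) (x y : Vec d) :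
    gaussk d l a x * gaussk d l b y = gaussk d l (a + b) (x + y) *
      gaussk d l (a * b / (a + b)) ((a + b)⁻¹ • (a • y - b • x)) := by
  have hab : 0 < a + b := add_pos ha hb
  unfold gaussk
  rw [mul_mul_mul_comm, mul_mul_mul_comm ((a + b) ^ _), ← Real.mul_rpow ha.le hb.le,
    ← Real.mul_rpow hab.le (by positivity), mul_div_cancel₀ _ hab.ne', ← Real.exp_add,
    ← Real.exp_add]
  congr 2
  rw [norm_smul, mul_pow, norm_add_sq_real, norm_sub_sq_real, norm_smul, norm_smul,
    inner_smul_left, inner_smul_right, real_inner_comm y x]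
  simp only [Real.norm_eq_abs, mul_pow, sq_abs, conj_trivial]
  field_simp
  ring

lemma lintegral_gaussk_mul_gaussk {d : ℕ} {l a b : ℝ} (hl : 0 < l) (ha : 0 < a) (hb : 0 < b)
    (x y : Vec d) :
    ∫⁻ v, ENNReal.ofReal (gaussk d l a (x - v)) * ENNReal.ofReal (gaussk d l b (v - y))
      = ENNReal.ofReal ((Real.pi / l) ^ ((d : ℝ) / 2) * gaussk d l (a + b) (x - y)) := by
  have hab : 0 < a + b := add_pos ha hb
  have e : ∀ v, ENNReal.ofReal (gaussk d l a (x - v)) * ENNReal.ofReal (gaussk d l b (v - y))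
      = ENNReal.ofReal (gaussk d l (a + b) (x - y)) * ENNReal.ofReal
        (gaussk d l (a * b / (a + b)) (v - (a + b)⁻¹ • (a • y + b • x))) := fun v => by
    rw [← ENNReal.ofReal_mul (gaussk_nonneg ha.le _), gaussk_mul_gaussk l ha hb, sub_add_sub_cancel,
      ENNReal.ofReal_mul (gaussk_nonneg hab.le _)]
    congr 3
    have : v = (a + b)⁻¹ • ((a + b) • v) := by rw [inv_smul_smul₀ hab.ne']
    nth_rw 3 [this]
    rw [← smul_sub]
    congr 1
    module
  simp_rw [e]
  rw [lintegral_const_mul' _ _ ENNReal.ofReal_ne_top,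
    lintegral_sub_right_eq_self (fun v => ENNReal.ofReal (gaussk d l (a * b / (a + b)) v)),
    lintegral_gaussk d hl (by positivity), ← ENNReal.ofReal_mul (gaussk_nonneg hab.le _), mul_comm]

lemma volume_image_le {d : ℕ} {L : ℝ} (hL : 0 ≤ L) {g : Vec d → Vec d}
    (hg : ∀ x y, ‖g x - g y‖ ≤ L * ‖x - y‖) (s : Set (Vec d)) :
    volume (g '' s) ≤ ENNReal.ofReal (L ^ d) * volume s := by
  have h : LipschitzWith L.toNNReal g := LipschitzWith.of_dist_le_mul fun x y => by
    rw [dist_eq_norm, dist_eq_norm, Real.coe_toNNReal _ hL]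
    exact hg x y
  have h2 := h.hausdorffMeasure_image_le (Nat.cast_nonneg d) s
  rw [← EuclideanSpace.euclideanHausdorffMeasure_eq_volume, Measure.euclideanHausdorffMeasure_def]
  simp only [Measure.smul_apply]
  rw [ENNReal.ofReal_pow hL, mul_smul_comm]
  refine smul_le_smul_of_nonneg_left (h2.trans_eq ?_) zero_le
  rw [ENNReal.rpow_natCast]
  rfl

/-- A map with a Lipschitz inverse distorts Lebesgue measure at most by a constant. -/
lemma lintegral_comp_le_of_inverse {d : ℕ} {L : ℝ} (hL : 0 ≤ L) {g g' : Vec d → Vec d}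
    (hg : ∀ x y, ‖g x - g y‖ ≤ L * ‖x - y‖) (hg' : Measurable g') (h : ∀ w, g (g' w) = w)
    {f : Vec d → ENNReal} (hf : Measurable f) :
    ∫⁻ w, f (g' w) ≤ ENNReal.ofReal (L ^ d) * ∫⁻ v, f v := by
  rw [← lintegral_map hf hg', ← smul_eq_mul, ← lintegral_smul_measure]
  refine lintegral_mono' (Measure.le_iff.2 fun s hs => ?_) le_rfl
  rw [Measure.map_apply hg' hs, Measure.smul_apply, smul_eq_mul]
  exact (measure_mono (show g' ⁻¹' s ⊆ g '' s from fun w hw => ⟨g' w, hw, h w⟩)).trans (volume_image_le hL hg s)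

lemma lintegral_rpow_mul_rpow_le {p q : ℝ} (hp : 0 < p) (hp1 : p ≤ 1) (hq : 0 < q) (hq1 : q ≤ 1)
    {u t : ℝ} (hut : u < t) :
    ∫⁻ r in Ioo u t, ENNReal.ofReal ((r - u) ^ (p - 1) * (t - r) ^ (q - 1))
      ≤ ENNReal.ofReal (2 * (1 / p + 1 / q) * (t - u) ^ (p + q - 1)) := by
  set τ := t - u with hτ
  have hτ0 : 0 < τ := sub_pos.2 hut
  have ip : ∫ r in u..t, (r - u) ^ (p - 1) = τ ^ p / p := by
    rw [intervalIntegral.integral_comp_sub_right (fun x => x ^ (p - 1)) u,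
      integral_rpow (Or.inl (by linarith)), sub_self, sub_add_cancel, Real.zero_rpow hp.ne', sub_zero]
  have iq : ∫ r in u..t, (t - r) ^ (q - 1) = τ ^ q / q := by
    rw [intervalIntegral.integral_comp_sub_left (fun x => x ^ (q - 1)) t,
      integral_rpow (Or.inl (by linarith)), sub_self, sub_add_cancel, Real.zero_rpow hq.ne', sub_zero]
  have jp : IntervalIntegrable (fun r => (r - u) ^ (p - 1)) volume u t := by
    have := (intervalIntegral.intervalIntegrable_rpow' (a := 0) (b := τ)
      (r := p - 1) (by linarith)).comp_sub_right u
    simpa [hτ] using this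
  have jq : IntervalIntegrable (fun r => (t - r) ^ (q - 1)) volume u t := by
    have := (intervalIntegral.intervalIntegrable_rpow' (a := 0) (b := τ)
      (r := q - 1) (by linarith)).comp_sub_left t
    simpa [hτ] using this.symm
  have hpw : ∀ r ∈ Ioo u t, (r - u) ^ (p - 1) * (t - r) ^ (q - 1)
      ≤ (τ / 2) ^ (q - 1) * (r - u) ^ (p - 1) + (τ / 2) ^ (p - 1) * (t - r) ^ (q - 1) :=
    fun r hr => by
      have h1 : 0 ≤ (r - u) ^ (p - 1) := Real.rpow_nonneg (by linarith [hr.1]) _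
      have h2 : 0 ≤ (t - r) ^ (q - 1) := Real.rpow_nonneg (by linarith [hr.2]) _
      have h3 : 0 ≤ (τ / 2) ^ (q - 1) := Real.rpow_nonneg (by linarith) _
      have h4 : 0 ≤ (τ / 2) ^ (p - 1) := Real.rpow_nonneg (by linarith) _
      rcases le_total (τ / 2) (t - r) with h | h
      · have := Real.rpow_le_rpow_of_nonpos (by linarith) h (by linarith : q - 1 ≤ 0)
        nlinarith [mul_nonneg h4 h2, mul_le_mul_of_nonneg_left this h1]
      · have := Real.rpow_le_rpow_of_nonpos (by linarith) (by linarith : τ / 2 ≤ r - u)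
          (by linarith : p - 1 ≤ 0)
        nlinarith [mul_nonneg h3 h1, mul_le_mul_of_nonneg_right this h2]
  have key : ∀ a : ℝ, a ≤ 1 → (τ / 2) ^ (a - 1) ≤ 2 * τ ^ (a - 1) ∨ a ≤ 0 := fun a ha => by
    by_cases h0 : a ≤ 0
    · exact Or.inr h0
    · left
      rw [Real.div_rpow hτ0.le (by norm_num), div_eq_mul_inv, ← Real.rpow_neg (by norm_num), mul_comm]
      refine mul_le_mul_of_nonneg_right ?_ (Real.rpow_nonneg hτ0.le _)
      calc (2 : ℝ) ^ (-(a - 1)) ≤ 2 ^ (1 : ℝ) :=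
            Real.rpow_le_rpow_of_exponent_le (by norm_num) (by linarith [not_le.1 h0])
        _ = 2 := Real.rpow_one 2
  have kp := (key p hp1).resolve_right (by linarith)
  have kq := (key q hq1).resolve_right (by linarith)
  calc _ ≤ ∫⁻ r in Ioo u t, ENNReal.ofReal
        ((τ / 2) ^ (q - 1) * (r - u) ^ (p - 1) + (τ / 2) ^ (p - 1) * (t - r) ^ (q - 1)) :=
        setLIntegral_mono' measurableSet_Ioo fun r hr => ENNReal.ofReal_le_ofReal (hpw r hr)
    _ = ENNReal.ofReal (∫ r in Ioo u t,
        ((τ / 2) ^ (q - 1) * (r - u) ^ (p - 1) + (τ / 2) ^ (p - 1) * (t - r) ^ (q - 1))) := by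
      rw [ofReal_integral_eq_lintegral_ofReal]
      · exact (((jp.const_mul _).add (jq.const_mul _)).1).mono_set Ioo_subset_Ioc_self
      · refine (ae_restrict_iff' measurableSet_Ioo).2 (Filter.Eventually.of_forall fun r hr => ?_)
        exact (mul_nonneg (Real.rpow_nonneg (by linarith [hr.1]) _)
          (Real.rpow_nonneg (by linarith [hr.2]) _)).trans (hpw r hr)
    _ ≤ _ := by
      refine ENNReal.ofReal_le_ofReal ?_
      rw [← integral_Ioc_eq_integral_Ioo, ← intervalIntegral.integral_of_le hut.le,
        intervalIntegral.integral_add (jp.const_mul _) (jq.const_mul _),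
        intervalIntegral.integral_const_mul, intervalIntegral.integral_const_mul, ip, iq]
      have e1 : τ ^ (p + q - 1) = τ ^ (q - 1) * τ ^ p := by
        rw [← Real.rpow_add hτ0]; ring_nf
      have e2 : τ ^ (p + q - 1) = τ ^ (p - 1) * τ ^ q := by
        rw [← Real.rpow_add hτ0]; ring_nf
      have f1 : (τ / 2) ^ (q - 1) * (τ ^ p / p) ≤ 2 * (1 / p) * τ ^ (p + q - 1) := by
        rw [e1]
        have := mul_le_mul_of_nonneg_right kq (by positivity : 0 ≤ τ ^ p / p)
        calc _ ≤ _ := this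
          _ = _ := by ring
      have f2 : (τ / 2) ^ (p - 1) * (τ ^ q / q) ≤ 2 * (1 / q) * τ ^ (p + q - 1) := by
        rw [e2]
        have := mul_le_mul_of_nonneg_right kp (by positivity : 0 ≤ τ ^ q / q)
        calc _ ≤ _ := this
          _ = _ := by ring
      linarith

/-- The Gaussian majorant of order `e` along the inverse flow `Θ`, with exponential weight `K`,
for a kernel acting on space-time and living on times in `[s, S]`. -/
def majorant (d : ℕ) (s S l K e : ℝ) (Θ : ℝ → Vec d → Vec d) (p q : ℝ × Vec d) : ℝ :=
  if s ≤ p.1 ∧ p.1 < q.1 ∧ q.1 ≤ S then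
    Real.exp (K * (q.1 - p.1)) * (q.1 - p.1) ^ (e - 1) *
      gaussk d l (q.1 - p.1) (Θ p.1 p.2 - Θ q.1 q.2)
  else 0

section Majorant

variable {d : ℕ} {s S l K e : ℝ} {Θ : ℝ → Vec d → Vec d}

lemma majorant_nonneg (p q : ℝ × Vec d) : 0 ≤ majorant d s S l K e Θ p q := by
  unfold majorant
  split_ifs with h
  · have : 0 ≤ q.1 - p.1 := by linarith [h.2.1]
    have := gaussk_nonneg (l := l) this (Θ p.1 p.2 - Θ q.1 q.2)
    positivity
  · exact le_rfl

lemma majorant_of_mem {p q : ℝ × Vec d} (h : s ≤ p.1 ∧ p.1 < q.1 ∧ q.1 ≤ S) :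
    majorant d s S l K e Θ p q = Real.exp (K * (q.1 - p.1)) * (q.1 - p.1) ^ (e - 1) *
      gaussk d l (q.1 - p.1) (Θ p.1 p.2 - Θ q.1 q.2) := if_pos h

lemma majorant_of_not_mem {p q : ℝ × Vec d} (h : ¬(s ≤ p.1 ∧ p.1 < q.1 ∧ q.1 ≤ S)) :
    majorant d s S l K e Θ p q = 0 := if_neg h

lemma measurableSet_timeSimplex (d : ℕ) (s S : ℝ) : MeasurableSet
    {x : (ℝ × Vec d) × (ℝ × Vec d) | s ≤ x.1.1 ∧ x.1.1 < x.2.1 ∧ x.2.1 ≤ S} := by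
  have h1 : Measurable fun x : (ℝ × Vec d) × (ℝ × Vec d) => x.1.1 := by fun_prop
  have h2 : Measurable fun x : (ℝ × Vec d) × (ℝ × Vec d) => x.2.1 := by fun_prop
  exact (measurableSet_le measurable_const h1).inter
    ((measurableSet_lt h1 h2).inter (measurableSet_le h2 measurable_const))

lemma measurable_majorant (hΘ : Measurable (Function.uncurry Θ)) :
    Measurable (Function.uncurry (majorant d s S l K e Θ)) := by
  have m1 : Measurable fun x : (ℝ × Vec d) × (ℝ × Vec d) => Θ x.1.1 x.1.2 :=
    hΘ.comp (by fun_prop : Measurable fun x : (ℝ × Vec d) × (ℝ × Vec d) => (x.1.1, x.1.2))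
  have m2 : Measurable fun x : (ℝ × Vec d) × (ℝ × Vec d) => Θ x.2.1 x.2.2 :=
    hΘ.comp (by fun_prop : Measurable fun x : (ℝ × Vec d) × (ℝ × Vec d) => (x.2.1, x.2.2))
  refine Measurable.ite (measurableSet_timeSimplex d s S) ?_ measurable_const
  unfold gaussk
  fun_prop

/-- The convolution of two majorants is a majorant, without any loss in the Gaussian exponent. -/
lemma lintegral_majorant_mul_majorant_slice_le {L : ℝ} (hl : 0 < l) (hL : 0 ≤ L)
    {ψ : ℝ → Vec d → Vec d} (hΘ : Measurable (Function.uncurry Θ))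
    (lψ : ∀ r w w', ‖ψ r w - ψ r w'‖ ≤ L * ‖w - w'‖) (hψ : ∀ r y, ψ r (Θ r y) = y)
    (e' : ℝ) {u r t : ℝ} (hu : s ≤ u) (hr : r ∈ Ioo u t) (ht : t ≤ S) (z y : Vec d) :
    ∫⁻ w, ENNReal.ofReal (majorant d s S l K e Θ (u, z) (r, w)) *
        ENNReal.ofReal (majorant d s S l K e' Θ (r, w) (t, y))
      ≤ ENNReal.ofReal (L ^ d * (Real.pi / l) ^ ((d : ℝ) / 2) *
          (Real.exp (K * (t - u)) * gaussk d l (t - u) (Θ u z - Θ t y)) *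
        ((r - u) ^ (e - 1) * (t - r) ^ (e' - 1))) := by
  have hru : 0 < r - u := by linarith [hr.1]
  have htr : 0 < t - r := by linarith [hr.2]
  have hp := fun w => majorant_of_mem (l := l) (K := K) (e := e) (Θ := Θ) (p := (u, z))
    (q := (r, w)) (s := s) (S := S) ⟨hu, hr.1, hr.2.le.trans ht⟩
  have hq := fun w => majorant_of_mem (l := l) (K := K) (e := e') (Θ := Θ) (p := (r, w))
    (q := (t, y)) (s := s) (S := S) ⟨hu.trans hr.1.le, hr.2, ht⟩
  set A := Real.exp (K * (t - u)) * ((r - u) ^ (e - 1) * (t - r) ^ (e' - 1)) with hA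
  have hA0 : 0 ≤ A := by positivity
  have e1 : ∀ w, ENNReal.ofReal (majorant d s S l K e Θ (u, z) (r, w)) *
      ENNReal.ofReal (majorant d s S l K e' Θ (r, w) (t, y)) = ENNReal.ofReal A *
        (ENNReal.ofReal (gaussk d l (r - u) (Θ u z - Θ r w)) *
          ENNReal.ofReal (gaussk d l (t - r) (Θ r w - Θ t y))) := fun w => by
    rw [← ENNReal.ofReal_mul (gaussk_nonneg hru.le _), ← ENNReal.ofReal_mul hA0,
      ← ENNReal.ofReal_mul (majorant_nonneg _ _), hp, hq, hA,
      show K * (t - u) = K * (r - u) + K * (t - r) by ring, Real.exp_add]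
    congr 1
    ring
  simp_rw [e1]
  rw [lintegral_const_mul' _ _ ENNReal.ofReal_ne_top]
  have hf : Measurable fun v => ENNReal.ofReal (gaussk d l (r - u) (Θ u z - v)) *
      ENNReal.ofReal (gaussk d l (t - r) (v - Θ t y)) :=
    ((measurable_gaussk l _).comp (measurable_const.sub measurable_id)).ennreal_ofReal.mul
      ((measurable_gaussk l _).comp (measurable_id.sub_const _)).ennreal_ofReal
  have h1 := lintegral_comp_le_of_inverse hL (lψ r)
    (hΘ.comp measurable_prodMk_left : Measurable (Θ r)) (hψ r) hf
  rw [lintegral_gaussk_mul_gaussk hl hru htr, sub_add_sub_cancel',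
    ← ENNReal.ofReal_mul (pow_nonneg hL _)] at h1
  refine (mul_le_mul_right h1 _).trans_eq ?_
  rw [← ENNReal.ofReal_mul hA0, hA]
  congr 1
  ring

lemma lintegral_majorant_mul_majorant_le {L : ℝ} (hl : 0 < l) (hL : 0 ≤ L)
    {ψ : ℝ → Vec d → Vec d} (hΘ : Measurable (Function.uncurry Θ))
    (lψ : ∀ r w w', ‖ψ r w - ψ r w'‖ ≤ L * ‖w - w'‖) (hψ : ∀ r y, ψ r (Θ r y) = y)
    {e' : ℝ} (he : 0 < e) (he1 : e ≤ 1) (he' : 0 < e') (he1' : e' ≤ 1) (p q : ℝ × Vec d) :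
    ∫⁻ m, ENNReal.ofReal (majorant d s S l K e Θ p m) *
        ENNReal.ofReal (majorant d s S l K e' Θ m q)
      ≤ ENNReal.ofReal (L ^ d * (Real.pi / l) ^ ((d : ℝ) / 2) * (2 * (1 / e + 1 / e')) *
        majorant d s S l K (e + e') Θ p q) := by
  obtain ⟨u, z⟩ := p
  obtain ⟨t, y⟩ := q
  have mm := measurable_majorant (d := d) (s := s) (S := S) (l := l) (K := K) (e := e) hΘ
  have mm' := measurable_majorant (d := d) (s := s) (S := S) (l := l) (K := K) (e := e') hΘ
  have m1 : Measurable fun m : ℝ × Vec d => ENNReal.ofReal (majorant d s S l K e Θ (u, z) m) *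
        ENNReal.ofReal (majorant d s S l K e' Θ m (t, y)) :=
    (mm.comp measurable_prodMk_left).ennreal_ofReal.mul
      (mm'.comp measurable_prodMk_right).ennreal_ofReal
  rw [Measure.volume_eq_prod, lintegral_prod _ m1.aemeasurable]
  by_cases h : s ≤ u ∧ u < t ∧ t ≤ S
  swap
  · have h0 : ∀ m : ℝ × Vec d, ENNReal.ofReal (majorant d s S l K e Θ (u, z) m) *
        ENNReal.ofReal (majorant d s S l K e' Θ m (t, y)) = 0 := fun m => by
      by_cases h1 : s ≤ u ∧ u < m.1 ∧ m.1 ≤ S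
      · rw [majorant_of_not_mem (p := m) fun h2 => h ⟨h1.1, h1.2.1.trans h2.2.1, h2.2.2⟩]
        simp
      · rw [majorant_of_not_mem h1]
        simp
    simp [h0]
  set M := L ^ d * (Real.pi / l) ^ ((d : ℝ) / 2) with hM
  have hM0 : 0 ≤ M := mul_nonneg (pow_nonneg hL _) (Real.rpow_nonneg
    (div_nonneg Real.pi_pos.le hl.le) _)
  set G := Real.exp (K * (t - u)) * gaussk d l (t - u) (Θ u z - Θ t y) with hG
  have hG0 : 0 ≤ G := mul_nonneg (Real.exp_pos _).le (gaussk_nonneg (by linarith [h.2.1]) _)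
  have inner : ∀ r, ∫⁻ w, ENNReal.ofReal (majorant d s S l K e Θ (u, z) (r, w)) *
      ENNReal.ofReal (majorant d s S l K e' Θ (r, w) (t, y)) ≤ (Ioo u t).indicator
        (fun r => ENNReal.ofReal (M * G) *
          ENNReal.ofReal ((r - u) ^ (e - 1) * (t - r) ^ (e' - 1))) r := fun r => by
    by_cases hr : r ∈ Ioo u t
    · rw [indicator_of_mem hr]
      refine (lintegral_majorant_mul_majorant_slice_le hl hL hΘ lψ hψ e' h.1 hr h.2.2 z y).trans_eq ?_
      rw [← ENNReal.ofReal_mul (mul_nonneg hM0 hG0), hM, hG]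
    · rw [indicator_of_notMem hr]
      have h0 : ∀ w, ENNReal.ofReal (majorant d s S l K e Θ (u, z) (r, w)) *
          ENNReal.ofReal (majorant d s S l K e' Θ (r, w) (t, y)) = 0 := fun w => by
        by_cases h1 : u < r
        · rw [majorant_of_not_mem (p := (r, w)) fun h2 => hr ⟨h1, h2.2.1⟩]
          simp
        · rw [majorant_of_not_mem (p := (u, z)) fun h2 => h1 h2.2.1]
          simp
      simp [h0]
  refine (lintegral_mono inner).trans ?_
  rw [lintegral_indicator measurableSet_Ioo, lintegral_const_mul' _ _ ENNReal.ofReal_ne_top]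
  refine (mul_le_mul_right (lintegral_rpow_mul_rpow_le he he1 he' he1' h.2.1) _).trans_eq ?_
  rw [← ENNReal.ofReal_mul (mul_nonneg hM0 hG0), majorant_of_mem (p := (u, z)) (q := (t, y)) h, hG]
  congr 1
  simp only
  ring

end Majorant

/-! ### Iterated kernels -/

section IterKernel

variable {E : Type*} [MeasurableSpace E] {ν : Measure E}

lemma integrable_mul_of_lintegral_le {F G f g : E → ℝ} {A B C : ℝ} (mF : Measurable F)
    (mG : Measurable G) (hA : 0 ≤ A) (hB : 0 ≤ B) (hC : 0 ≤ C) (hf : ∀ x, 0 ≤ f x)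
    (hFf : ∀ x, |F x| ≤ A * f x) (hGg : ∀ x, |G x| ≤ B * g x)
    (h : ∫⁻ x, ENNReal.ofReal (f x) * ENNReal.ofReal (g x) ∂ν ≤ ENNReal.ofReal C) :
    Integrable (fun x => F x * G x) ν ∧ ∫ x, |F x * G x| ∂ν ≤ A * B * C := by
  have h1 : ∫⁻ x, ‖F x * G x‖ₑ ∂ν ≤ ENNReal.ofReal (A * B * C) := by
    calc _ ≤ ∫⁻ x, ENNReal.ofReal (A * B) * (ENNReal.ofReal (f x) * ENNReal.ofReal (g x)) ∂ν := by
          refine lintegral_mono fun x => ?_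
          rw [← ENNReal.ofReal_mul (hf x), ← ENNReal.ofReal_mul (mul_nonneg hA hB),
            ← ofReal_norm, Real.norm_eq_abs, abs_mul]
          refine ENNReal.ofReal_le_ofReal ?_
          calc _ ≤ (A * f x) * (B * g x) := mul_le_mul (hFf x) (hGg x) (abs_nonneg _)
                (mul_nonneg hA (hf x))
            _ = _ := by ring
      _ ≤ _ := by
          rw [lintegral_const_mul' _ _ ENNReal.ofReal_ne_top,
            ENNReal.ofReal_mul (p := A * B) (mul_nonneg hA hB)]
          exact mul_le_mul_right h _
  have hi : Integrable (fun x => F x * G x) ν :=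
    ⟨(mF.mul mG).aestronglyMeasurable, lt_of_le_of_lt h1 ENNReal.ofReal_lt_top⟩
  refine ⟨hi, ?_⟩
  have e := integral_norm_eq_lintegral_enorm hi.aestronglyMeasurable
  simp only [Real.norm_eq_abs] at e
  rw [e]
  exact ENNReal.toReal_le_of_le_ofReal (mul_nonneg (mul_nonneg hA hB) hC) h1

/-- The iterates `H`, `H ⊗ H`, `H ⊗ (H ⊗ H)`, … of a kernel `H`. -/
def iterKernel (ν : Measure E) (H : E → E → ℝ) : ℕ → E → E → ℝ
  | 0 => H
  | n + 1 => fun p q => ∫ m, H p m * iterKernel ν H n m q ∂ν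

/-- The sum of the iterates of a kernel. -/
def seriesKernel (ν : Measure E) (H : E → E → ℝ) (p q : E) : ℝ := ∑' n, iterKernel ν H n p q

variable {H W : E → E → ℝ}

lemma measurable_iterKernel [SFinite ν] (mH : Measurable (Function.uncurry H)) (n : ℕ) :
    Measurable (Function.uncurry (iterKernel ν H n)) := by
  induction n with
  | zero => exact mH
  | succ n ih =>
    have h : Measurable fun x : (E × E) × E => H x.1.1 x.2 * iterKernel ν H n x.2 x.1.2 :=
      (mH.comp (by fun_prop : Measurable fun x : (E × E) × E => (x.1.1, x.2))).mul
        (ih.comp (by fun_prop : Measurable fun x : (E × E) × E => (x.2, x.1.2)))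
    exact (h.stronglyMeasurable.integral_prod_right' (ν := ν)).measurable

lemma iterKernel_step [SFinite ν] (mH : Measurable (Function.uncurry H)) (hW : ∀ p q, 0 ≤ W p q)
    (hHW : ∀ p q, |H p q| ≤ W p q)
    (hc : ∀ p q, ∫⁻ m, ENNReal.ofReal (W p m) * ENNReal.ofReal (W m q) ∂ν
      ≤ ENNReal.ofReal (W p q / 2)) (n : ℕ) :
    (∀ p q, |iterKernel ν H n p q| ≤ (1 / 2) ^ n * W p q) ∧
      ∀ p q, Integrable (fun m => H p m * iterKernel ν H n m q) ν ∧
        ∫ m, |H p m * iterKernel ν H n m q| ∂ν ≤ (1 / 2) ^ (n + 1) * W p q := by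
  have key : ∀ n, (∀ p q, |iterKernel ν H n p q| ≤ (1 / 2) ^ n * W p q) →
      ∀ p q, Integrable (fun m => H p m * iterKernel ν H n m q) ν ∧
        ∫ m, |H p m * iterKernel ν H n m q| ∂ν ≤ (1 / 2) ^ (n + 1) * W p q := fun n h p q => by
    have := integrable_mul_of_lintegral_le (ν := ν) (F := fun m => H p m)
      (G := fun m => iterKernel ν H n m q) (A := 1) (B := (1 / 2) ^ n) (C := W p q / 2)
      (mH.comp measurable_prodMk_left) ((measurable_iterKernel mH n).comp measurable_prodMk_right)
      zero_le_one (by positivity) (by linarith [hW p q]) (hW p)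
      (fun m => by simpa using hHW p m) (fun m => h m q) (hc p q)
    refine ⟨this.1, this.2.trans_eq ?_⟩
    ring
  have bd : ∀ n p q, |iterKernel ν H n p q| ≤ (1 / 2) ^ n * W p q := fun n => by
    induction n with
    | zero => simpa [iterKernel] using hHW
    | succ n ih => exact fun p q => abs_integral_le_integral_abs.trans (key n ih p q).2
  exact ⟨bd n, key n (bd n)⟩

lemma abs_iterKernel_le [SFinite ν] (mH : Measurable (Function.uncurry H)) (hW : ∀ p q, 0 ≤ W p q)
    (hHW : ∀ p q, |H p q| ≤ W p q)
    (hc : ∀ p q, ∫⁻ m, ENNReal.ofReal (W p m) * ENNReal.ofReal (W m q) ∂ν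
      ≤ ENNReal.ofReal (W p q / 2)) (n : ℕ) (p q : E) :
    |iterKernel ν H n p q| ≤ (1 / 2) ^ n * W p q :=
  (iterKernel_step mH hW hHW hc n).1 p q

lemma hasSum_seriesKernel [SFinite ν] (mH : Measurable (Function.uncurry H))
    (hW : ∀ p q, 0 ≤ W p q) (hHW : ∀ p q, |H p q| ≤ W p q)
    (hc : ∀ p q, ∫⁻ m, ENNReal.ofReal (W p m) * ENNReal.ofReal (W m q) ∂ν
      ≤ ENNReal.ofReal (W p q / 2)) (p q : E) :
    HasSum (fun n => iterKernel ν H n p q) (seriesKernel ν H p q) :=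
  (Summable.of_norm_bounded (summable_geometric_two.mul_right (W p q))
    (abs_iterKernel_le mH hW hHW hc · p q)).hasSum

lemma abs_seriesKernel_le [SFinite ν] (mH : Measurable (Function.uncurry H))
    (hW : ∀ p q, 0 ≤ W p q) (hHW : ∀ p q, |H p q| ≤ W p q)
    (hc : ∀ p q, ∫⁻ m, ENNReal.ofReal (W p m) * ENNReal.ofReal (W m q) ∂ν
      ≤ ENNReal.ofReal (W p q / 2)) (p q : E) :
    |seriesKernel ν H p q| ≤ 2 * W p q := by
  rw [seriesKernel, ← Real.norm_eq_abs]
  exact tsum_of_norm_bounded (hasSum_geometric_two.mul_right (W p q))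
    (abs_iterKernel_le mH hW hHW hc · p q)

lemma measurable_seriesKernel [SFinite ν] (mH : Measurable (Function.uncurry H))
    (hW : ∀ p q, 0 ≤ W p q) (hHW : ∀ p q, |H p q| ≤ W p q)
    (hc : ∀ p q, ∫⁻ m, ENNReal.ofReal (W p m) * ENNReal.ofReal (W m q) ∂ν
      ≤ ENNReal.ofReal (W p q / 2)) :
    Measurable (Function.uncurry (seriesKernel ν H)) := by
  refine measurable_of_tendsto_metrizable (f := fun n x => ∑ i ∈ Finset.range n,
    Function.uncurry (iterKernel ν H i) x)
    (fun n => Finset.measurable_fun_sum _ fun i _ => measurable_iterKernel mH i)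
    (tendsto_pi_nhds.2 fun x => ?_)
  exact (hasSum_seriesKernel mH hW hHW hc x.1 x.2).tendsto_sum_nat

/-- The series of iterates solves the Volterra equation `Φ = H + H ⊗ Φ`. -/
lemma seriesKernel_eq [SFinite ν] (mH : Measurable (Function.uncurry H))
    (hW : ∀ p q, 0 ≤ W p q) (hHW : ∀ p q, |H p q| ≤ W p q)
    (hc : ∀ p q, ∫⁻ m, ENNReal.ofReal (W p m) * ENNReal.ofReal (W m q) ∂ν
      ≤ ENNReal.ofReal (W p q / 2)) (p q : E) :
    seriesKernel ν H p q = H p q + ∫ m, H p m * seriesKernel ν H m q ∂ν := by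
  have hs := hasSum_seriesKernel mH hW hHW hc
  have h1 := hasSum_integral_of_summable_integral_norm
    (F := fun n m => H p m * iterKernel ν H n m q) (μ := ν)
    (fun n => ((iterKernel_step mH hW hHW hc n).2 p q).1)
    (Summable.of_nonneg_of_le (fun n => integral_nonneg fun _ => norm_nonneg _)
      (fun n => ((iterKernel_step mH hW hHW hc n).2 p q).2)
      (((summable_nat_add_iff 1).2 summable_geometric_two).mul_right (W p q)))
  have h2 : ∀ m, ∑' n, H p m * iterKernel ν H n m q = H p m * seriesKernel ν H m q := fun m =>
    ((hs m q).mul_left (H p m)).tsum_eq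
  simp only [h2] at h1
  have h3 := (hasSum_nat_add_iff' 1).2 (hs p q)
  simp only [Finset.range_one, Finset.sum_singleton] at h3
  have := h1.unique h3
  rw [this]
  simp [iterKernel]

end IterKernel

section FrozenCoefficients

/-- Constraints on the constants governing the frozen-coefficient expansion. -/
structure AdmissibleConstants (κ α c L T : ℝ) : Prop where
  one_le_ellipticity : 1 ≤ κ
  exponent_pos : 0 < α
  exponent_le : α ≤ 1
  one_le_growth : 1 ≤ c
  one_le_lip : 1 ≤ L
  time_pos : 0 < T

/-- Coefficients `a`, `b` on `[s,S]` together with a regularised drift `b₁` at bounded distance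
of `b` and its flow `ψ` (from time `s`) with inverse `Θ`. -/
structure DiffusionData (d : ℕ) (κ α c L T s S : ℝ) (a : ℝ → Vec d → Matrix (Fin d) (Fin d) ℝ)
    (b b₁ Θ ψ : ℝ → Vec d → Vec d) : Prop where
  constants : AdmissibleConstants κ α c L T
  flow : IsFlowPair d b₁ L s S Θ ψ
  elliptic : ∀ r z, IsElliptic κ 1 (a r z)
  holder : ∀ r z w i j, |a r z i j - a r w i j| ≤ c * ‖z - w‖ ^ α
  measurable_diff : ∀ i j, Measurable fun p : ℝ × Vec d => a p.1 p.2 i j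
  measurable_drift : Measurable (Function.uncurry b)
  measurable_flowDrift : Measurable (Function.uncurry b₁)
  continuous_flowDrift : ∀ r, Continuous (b₁ r)
  flowDrift_le : ∀ r z, ‖b₁ r z‖ ≤ c * (1 + ‖z‖)
  drift_sub_le : ∀ r z w, ‖b r z - b₁ r w‖ ≤ c * (1 + ‖z - w‖)
  length_le : S - s ≤ T

/-- The covariance accumulated along the flow line with label `w` between the times `u` and `t`. -/
def flowCov {d : ℕ} (a : ℝ → Vec d → Matrix (Fin d) (Fin d) ℝ) (ψ : ℝ → Vec d → Vec d)
    (u t : ℝ) (w : Vec d) : Matrix (Fin d) (Fin d) ℝ :=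
  Matrix.of fun i j => ∫ ρ in u..t, a ρ (ψ ρ w) i j

/-- The Gaussian density with coefficients frozen along the flow line through the endpoint,
regularised by `ε`. -/
def frozenKernel (d : ℕ) (s S : ℝ) (a : ℝ → Vec d → Matrix (Fin d) (Fin d) ℝ)
    (Θ ψ : ℝ → Vec d → Vec d) (ε : ℝ) (p q : ℝ × Vec d) : ℝ :=
  if s ≤ p.1 ∧ p.1 < q.1 ∧ q.1 ≤ S then
    gaussDens (flowCov a ψ p.1 q.1 (Θ q.1 q.2) + ε • 1) (p.2 - ψ p.1 (Θ q.1 q.2))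
  else 0

/-- The difference of the true and the frozen generator, applied to the frozen Gaussian density. -/
def parametrixKernel (d : ℕ) (s S : ℝ) (a : ℝ → Vec d → Matrix (Fin d) (Fin d) ℝ)
    (b b₁ Θ ψ : ℝ → Vec d → Vec d) (ε : ℝ) (p q : ℝ × Vec d) : ℝ :=
  if s ≤ p.1 ∧ p.1 < q.1 ∧ q.1 ≤ S then
    genForm (b p.1 p.2 - b₁ p.1 (ψ p.1 (Θ q.1 q.2))) (a p.1 p.2 - a p.1 (ψ p.1 (Θ q.1 q.2)))
      (gaussDens₁ (flowCov a ψ p.1 q.1 (Θ q.1 q.2) + ε • 1) (p.2 - ψ p.1 (Θ q.1 q.2)))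
      (gaussDens₂ (flowCov a ψ p.1 q.1 (Θ q.1 q.2) + ε • 1) (p.2 - ψ p.1 (Θ q.1 q.2)))
  else 0

lemma intervalIntegrable_fun_sum {ι : Type*} (I : Finset ι) {f : ι → ℝ → ℝ} {u t : ℝ}
    (h : ∀ i ∈ I, IntervalIntegrable (f i) volume u t) :
    IntervalIntegrable (fun x => ∑ i ∈ I, f i x) volume u t := by
  simpa only [Finset.sum_fn] using IntervalIntegrable.sum I h

lemma gaussk_le_of_norm_le {d : ℕ} {l L τ : ℝ} (hl : 0 ≤ l) (hL : 0 < L) (hτ : 0 ≤ τ)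
    {v v' : Vec d} (h : ‖v'‖ ≤ L * ‖v‖) : gaussk d l τ v ≤ gaussk d (l / L ^ 2) τ v' := by
  unfold gaussk
  gcongr ?_ * Real.exp (?_ / _)
  have h2 : ‖v'‖ ^ 2 ≤ (L * ‖v‖) ^ 2 := by gcongr
  have h3 : l / L ^ 2 * ‖v'‖ ^ 2 ≤ l / L ^ 2 * (L * ‖v‖) ^ 2 := by gcongr
  have h4 : l / L ^ 2 * (L * ‖v‖) ^ 2 = l * ‖v‖ ^ 2 := by field_simp
  linarith

lemma gaussk_le_of_time_le {d : ℕ} {l τ τ' : ℝ} (hl : 0 ≤ l) (hτ : 0 < τ) (h : τ ≤ τ')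
    (h' : τ' ≤ 2 * τ) (v : Vec d) : gaussk d l τ' v ≤ gaussk d (l / 2) τ v := by
  unfold gaussk
  gcongr ?_ * Real.exp ?_
  · exact Real.rpow_le_rpow_of_nonpos hτ h (by simp [neg_div]; positivity)
  · have : 0 < τ' := hτ.trans_le h
    rw [div_le_div_iff₀ this hτ]
    have h2 : 0 ≤ l * ‖v‖ ^ 2 := by positivity
    nlinarith [mul_le_mul_of_nonneg_left h' h2]

lemma abs_genForm_gaussDens_le (d : ℕ) {κ α c L T : ℝ} (hC : AdmissibleConstants κ α c L T) :
    ∃ C : ℝ, 1 ≤ C ∧ ∀ τ (M D : Matrix (Fin d) (Fin d) ℝ) (β v : Vec d), 0 < τ → τ ≤ T + 1 →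
      IsElliptic κ τ M → ‖β‖ ≤ c * (1 + ‖v‖) → (∀ i j, |D i j| ≤ c * ‖v‖ ^ α) →
      |genForm β D (gaussDens₁ M v) (gaussDens₂ M v)|
        ≤ C * τ ^ (α / 2 - 1) * gaussk d (1 / (4 * κ)) τ v := by
  obtain ⟨C₀, hC₀, h₀⟩ := gaussDens₁_weighted d hC.one_le_ellipticity le_rfl
  obtain ⟨C₁, hC₁, h₁⟩ := gaussDens₁_weighted d hC.one_le_ellipticity (zero_le_one)
  obtain ⟨C₂, hC₂, h₂⟩ := gaussDens₂_weighted d hC.one_le_ellipticity hC.exponent_pos.le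
  have hc := hC.one_le_growth
  have hα := hC.exponent_pos
  have hα1 := hC.exponent_le
  have hT := hC.time_pos
  set R := T + 1 with hR
  have hR1 : 1 ≤ R := by linarith
  have hP0 : 0 ≤ c * (C₀ * R + C₁ * R) := by positivity
  have hP1 : 0 ≤ c * C₂ := by positivity
  refine ⟨d * (c * (C₀ * R + C₁ * R)) + d ^ 2 * (c * C₂) + 1, ?_, fun τ M D β v hτ hτT hM hβ hD => ?_⟩
  · have : (0 : ℝ) ≤ d * (c * (C₀ * R + C₁ * R)) + d ^ 2 * (c * C₂) := by positivity
    linarith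
  have hg := gaussk_nonneg (l := 1 / (4 * κ)) hτ.le v
  set g := gaussk d (1 / (4 * κ)) τ v
  have hpow : ∀ e : ℝ, 0 ≤ e → e ≤ 1 → τ ^ e ≤ R := fun e he he1 => by
    calc τ ^ e ≤ R ^ e := by gcongr
      _ ≤ R ^ (1 : ℝ) := Real.rpow_le_rpow_of_exponent_le hR1 he1
      _ = R := Real.rpow_one R
  have e0 : τ ^ (((0 : ℝ) - 1) / 2) ≤ R * τ ^ (α / 2 - 1) := by
    rw [show ((0 : ℝ) - 1) / 2 = (1 / 2 - α / 2) + (α / 2 - 1) by ring, Real.rpow_add hτ]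
    gcongr
    exact hpow _ (by linarith) (by linarith)
  have e1 : τ ^ (((1 : ℝ) - 1) / 2) ≤ R * τ ^ (α / 2 - 1) := by
    rw [show ((1 : ℝ) - 1) / 2 = (1 - α / 2) + (α / 2 - 1) by ring, Real.rpow_add hτ]
    gcongr
    exact hpow _ (by linarith) (by linarith)
  have hm := abs_genForm_le (β := β) (A := D) (f₁ := gaussDens₁ M v) (f₂ := gaussDens₂ M v)
    (m₁ := c * (C₀ * R + C₁ * R) * τ ^ (α / 2 - 1) * g) (m₂ := c * C₂ * τ ^ (α / 2 - 1) * g)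
    (fun i => by
      have a0 := h₀ τ M hτ hM v i
      have a1 := h₁ τ M hτ hM v i
      rw [Real.rpow_zero, one_mul] at a0
      rw [Real.rpow_one] at a1
      calc ‖β‖ * |gaussDens₁ M v i| ≤ c * (1 + ‖v‖) * |gaussDens₁ M v i| := by gcongr
        _ = c * (|gaussDens₁ M v i| + ‖v‖ * |gaussDens₁ M v i|) := by ring
        _ ≤ c * (C₀ * τ ^ (((0 : ℝ) - 1) / 2) * g + C₁ * τ ^ (((1 : ℝ) - 1) / 2) * g) := by gcongr
        _ ≤ c * (C₀ * (R * τ ^ (α / 2 - 1)) * g + C₁ * (R * τ ^ (α / 2 - 1)) * g) := by gcongr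
        _ = _ := by ring)
    (fun i j => by
      calc |D i j| * |gaussDens₂ M v i j| ≤ c * ‖v‖ ^ α * |gaussDens₂ M v i j| := by
            gcongr
            exact hD i j
        _ = c * (‖v‖ ^ α * |gaussDens₂ M v i j|) := by ring
        _ ≤ c * (C₂ * τ ^ (α / 2 - 1) * g) :=
            mul_le_mul_of_nonneg_left (h₂ τ M hτ hM v i j) (by linarith)
        _ = _ := by ring)
  refine hm.trans ?_
  have : 0 ≤ τ ^ (α / 2 - 1) * g := by positivity
  nlinarith

namespace DiffusionData

variable {d : ℕ} {κ α c L T s S : ℝ} {a : ℝ → Vec d → Matrix (Fin d) (Fin d) ℝ}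
  {b b₁ Θ ψ : ℝ → Vec d → Vec d}

lemma abs_diff_le (h : DiffusionData d κ α c L T s S a b b₁ Θ ψ) (r : ℝ) (z : Vec d) (i j : Fin d) :
    |a r z i j| ≤ κ := by
  simpa using (h.elliptic r z).abs_apply_le h.constants.one_le_ellipticity one_pos i j

lemma continuous_diff (h : DiffusionData d κ α c L T s S a b b₁ Θ ψ) (r : ℝ) (i j : Fin d) :
    Continuous fun z => a r z i j := by
  refine continuous_iff_continuousAt.2 fun z => ?_
  rw [ContinuousAt, tendsto_iff_norm_sub_tendsto_zero]
  have h1 : Filter.Tendsto (fun w : Vec d => c * ‖w - z‖ ^ α) (nhds z) (nhds (c * 0)) := by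
    refine Filter.Tendsto.const_mul c ?_
    have : Continuous fun w : Vec d => ‖w - z‖ ^ α :=
      Continuous.rpow_const (by fun_prop) fun _ => Or.inr h.constants.exponent_pos.le
    simpa [Real.zero_rpow h.constants.exponent_pos.ne'] using this.tendsto z
  rw [mul_zero] at h1
  exact squeeze_zero (fun _ => norm_nonneg _) (fun w => h.holder r w z i j) h1

lemma measurable_diff_flow (h : DiffusionData d κ α c L T s S a b b₁ Θ ψ) (i j : Fin d) :
    Measurable fun x : ℝ × Vec d => a x.1 (ψ x.1 x.2) i j :=
  (h.measurable_diff i j).comp (measurable_fst.prodMk h.flow.continuous_flow.measurable)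

lemma intervalIntegrable_diff_flow (h : DiffusionData d κ α c L T s S a b b₁ Θ ψ) (w : Vec d)
    (i j : Fin d) (u t : ℝ) : IntervalIntegrable (fun ρ => a ρ (ψ ρ w) i j) volume u t :=
  intervalIntegrable_of_abs_le ((h.measurable_diff_flow i j).comp measurable_prodMk_right)
    (fun ρ => h.abs_diff_le ρ _ i j) u t

lemma isElliptic_flowCov (h : DiffusionData d κ α c L T s S a b b₁ Θ ψ) {u t : ℝ} (hut : u ≤ t)
    (w : Vec d) : IsElliptic κ (t - u) (flowCov a ψ u t w) := by
  have e : ∀ ξ : Fin d → ℝ, flowCov a ψ u t w *ᵥ ξ ⬝ᵥ ξ =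
      ∫ ρ in u..t, (a ρ (ψ ρ w) *ᵥ ξ ⬝ᵥ ξ) := fun ξ => by
    simp only [mulVec, dotProduct, flowCov, Matrix.of_apply]
    rw [intervalIntegral.integral_finsetSum]
    · refine Finset.sum_congr rfl fun i _ => ?_
      rw [intervalIntegral.integral_mul_const, intervalIntegral.integral_finsetSum]
      · simp_rw [intervalIntegral.integral_mul_const]
      · exact fun j _ => (h.intervalIntegrable_diff_flow w i j u t).mul_const _
    · intro i _
      exact IntervalIntegrable.mul_const (intervalIntegrable_fun_sum _
        fun j _ => (h.intervalIntegrable_diff_flow w i j u t).mul_const _) _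
  have ii : ∀ ξ : Fin d → ℝ, IntervalIntegrable (fun ρ => a ρ (ψ ρ w) *ᵥ ξ ⬝ᵥ ξ) volume u t :=
    fun ξ => by
    simp only [mulVec, dotProduct]
    exact intervalIntegrable_fun_sum _ fun i _ => IntervalIntegrable.mul_const
      (intervalIntegrable_fun_sum _
        fun j _ => (h.intervalIntegrable_diff_flow w i j u t).mul_const _) _
  refine ⟨?_, fun ξ => ?_, fun ξ => ?_⟩
  · ext i j
    simp only [flowCov, transpose_apply, Matrix.of_apply]
    refine intervalIntegral.integral_congr fun ρ _ => ?_
    exact congrFun (congrFun (h.elliptic ρ (ψ ρ w)).symm i) j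
  · rw [e]
    calc κ⁻¹ * (t - u) * (ξ ⬝ᵥ ξ) = ∫ _ρ in u..t, κ⁻¹ * 1 * (ξ ⬝ᵥ ξ) := by
          rw [intervalIntegral.integral_const, smul_eq_mul]; ring
      _ ≤ _ := intervalIntegral.integral_mono_on hut (by simp) (ii ξ)
          fun ρ _ => (h.elliptic ρ _).lower ξ
  · rw [e]
    calc _ ≤ ∫ _ρ in u..t, κ * 1 * (ξ ⬝ᵥ ξ) := intervalIntegral.integral_mono_on hut (ii ξ) (by simp)
          fun ρ _ => (h.elliptic ρ _).upper ξ
      _ = κ * (t - u) * (ξ ⬝ᵥ ξ) := by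
          rw [intervalIntegral.integral_const, smul_eq_mul]; ring

lemma isElliptic_flowCov_add (h : DiffusionData d κ α c L T s S a b b₁ Θ ψ) {u t ε : ℝ} (hut : u ≤ t)
    (hε : 0 ≤ ε) (w : Vec d) : IsElliptic κ (t - u + ε) (flowCov a ψ u t w + ε • 1) :=
  (h.isElliptic_flowCov hut w).add_smul_one h.constants.one_le_ellipticity hε

lemma continuous_flowCov (h : DiffusionData d κ α c L T s S a b b₁ Θ ψ) (u t : ℝ) (i j : Fin d) :
    Continuous fun w => flowCov a ψ u t w i j := by
  simp only [flowCov, Matrix.of_apply]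
  refine intervalIntegral.continuous_of_dominated_interval (bound := fun _ => κ)
    (fun w => ((h.measurable_diff_flow i j).comp measurable_prodMk_right).aestronglyMeasurable)
    (fun w => Filter.Eventually.of_forall fun ρ _ => h.abs_diff_le ρ _ i j) (by simp)
    (Filter.Eventually.of_forall fun ρ _ => ?_)
  exact (h.continuous_diff ρ i j).comp (h.flow.continuous_flow.comp (Continuous.prodMk_right ρ))

lemma measurable_flowCov (h : DiffusionData d κ α c L T s S a b b₁ Θ ψ) (i j : Fin d) :
    Measurable fun x : ℝ × ℝ × Vec d => flowCov a ψ x.1 x.2.1 x.2.2 i j := by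
  have hc : ∀ w, Continuous fun r : ℝ => ∫ ρ in (0 : ℝ)..r, a ρ (ψ ρ w) i j := fun w =>
    intervalIntegral.continuous_primitive (fun u t => h.intervalIntegrable_diff_flow w i j u t) 0
  have m : Measurable (Function.uncurry fun (r : ℝ) (w : Vec d) =>
      ∫ ρ in (0 : ℝ)..r, a ρ (ψ ρ w) i j) := by
    have h0 : ∀ r : ℝ, Measurable fun w : Vec d => ∫ ρ in (0 : ℝ)..r, a ρ (ψ ρ w) i j := fun r => by
      have := (h.continuous_flowCov 0 r i j).measurable
      simpa only [flowCov, Matrix.of_apply] using this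
    exact measurable_uncurry_of_continuous_of_measurable hc h0
  have e : (fun x : ℝ × ℝ × Vec d => flowCov a ψ x.1 x.2.1 x.2.2 i j) = fun x =>
      (∫ ρ in (0 : ℝ)..x.2.1, a ρ (ψ ρ x.2.2) i j) - ∫ ρ in (0 : ℝ)..x.1, a ρ (ψ ρ x.2.2) i j := by
    ext x
    simp only [flowCov, Matrix.of_apply]
    rw [intervalIntegral.integral_interval_sub_left] <;>
      exact h.intervalIntegrable_diff_flow _ i j _ _
  rw [e]
  exact (m.comp (by fun_prop : Measurable fun x : ℝ × ℝ × Vec d => (x.2.1, x.2.2))).sub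
    (m.comp (by fun_prop : Measurable fun x : ℝ × ℝ × Vec d => (x.1, x.2.2)))

end DiffusionData

end FrozenCoefficients

section KernelBounds

/-- The derivative of the frozen Gaussian density in the starting point. -/
def frozenGradient (d : ℕ) (s S : ℝ) (a : ℝ → Vec d → Matrix (Fin d) (Fin d) ℝ)
    (Θ ψ : ℝ → Vec d → Vec d) (ε : ℝ) (p q : ℝ × Vec d) : Vec d →L[ℝ] ℝ :=
  if s ≤ p.1 ∧ p.1 < q.1 ∧ q.1 ≤ S then
    ∑ i, gaussDens₁ (flowCov a ψ p.1 q.1 (Θ q.1 q.2) + ε • 1) (p.2 - ψ p.1 (Θ q.1 q.2)) i • coord i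
  else 0

lemma norm_coord_le {d : ℕ} (i : Fin d) : ‖coord i‖ ≤ 1 :=
  ContinuousLinearMap.opNorm_le_bound _ zero_le_one fun z => by
    rw [one_mul]
    exact abs_apply_le_norm z i

lemma norm_sum_smul_coord_le {d : ℕ} {f : Fin d → ℝ} {m : ℝ} (h : ∀ i, |f i| ≤ m) :
    ‖∑ i, f i • coord i‖ ≤ d * m := by
  calc _ ≤ ∑ i, ‖f i • coord i‖ := norm_sum_le _ _
    _ ≤ ∑ _i : Fin d, m := Finset.sum_le_sum fun i _ => by
        rw [norm_smul, Real.norm_eq_abs]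
        exact (mul_le_of_le_one_right (abs_nonneg _) (norm_coord_le i)).trans (h i)
    _ = d * m := by simp

namespace DiffusionData

variable {d : ℕ} {κ α c L T s S : ℝ} {a : ℝ → Vec d → Matrix (Fin d) (Fin d) ℝ}
  {b b₁ Θ ψ : ℝ → Vec d → Vec d}

lemma norm_inv_sub_le (h : DiffusionData d κ α c L T s S a b b₁ Θ ψ) (u : ℝ) (z w : Vec d) :
    ‖Θ u z - w‖ ≤ L * ‖z - ψ u w‖ := by
  simpa [h.flow.inv_flow] using h.flow.lip_inv u z (ψ u w)

section Measurability

variable {ι : Type*} [MeasurableSpace ι] {u t ε : ι → ℝ} {z y : ι → Vec d}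

lemma measurable_flowPoint (h : DiffusionData d κ α c L T s S a b b₁ Θ ψ) (hu : Measurable u)
    (ht : Measurable t) (hy : Measurable y) : Measurable fun x => ψ (u x) (Θ (t x) (y x)) :=
  h.flow.continuous_flow.measurable.comp
    (hu.prodMk (h.flow.continuous_inv.measurable.comp (ht.prodMk hy)))

lemma measurable_flowCov_add (h : DiffusionData d κ α c L T s S a b b₁ Θ ψ) (hu : Measurable u)
    (ht : Measurable t) (hy : Measurable y) (ε : ℝ) (i j : Fin d) :
    Measurable fun x => (flowCov a ψ (u x) (t x) (Θ (t x) (y x)) + ε • 1 :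
      Matrix (Fin d) (Fin d) ℝ) i j := by
  simp only [Matrix.add_apply]
  exact ((h.measurable_flowCov i j).comp
    (hu.prodMk (ht.prodMk (h.flow.continuous_inv.measurable.comp (ht.prodMk hy))))).add_const _

end Measurability

lemma measurable_coords (d : ℕ) :
    (Measurable fun x : (ℝ × Vec d) × (ℝ × Vec d) => x.1.1) ∧
    (Measurable fun x : (ℝ × Vec d) × (ℝ × Vec d) => x.1.2) ∧
    (Measurable fun x : (ℝ × Vec d) × (ℝ × Vec d) => x.2.1) ∧
    (Measurable fun x : (ℝ × Vec d) × (ℝ × Vec d) => x.2.2) := by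
  refine ⟨?_, ?_, ?_, ?_⟩ <;> fun_prop

lemma measurable_frozenKernel (h : DiffusionData d κ α c L T s S a b b₁ Θ ψ) (ε : ℝ) :
    Measurable (Function.uncurry (frozenKernel d s S a Θ ψ ε)) := by
  obtain ⟨m1, m2, m3, m4⟩ := measurable_coords d
  exact Measurable.ite (measurableSet_timeSimplex d s S) (measurable_gaussDens
    (h.measurable_flowCov_add m1 m3 m4 ε) (m2.sub (h.measurable_flowPoint m1 m3 m4)))
    measurable_const

lemma measurable_frozenGradient (h : DiffusionData d κ α c L T s S a b b₁ Θ ψ) (ε : ℝ) :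
    Measurable (Function.uncurry (frozenGradient d s S a Θ ψ ε)) := by
  obtain ⟨m1, m2, m3, m4⟩ := measurable_coords d
  exact Measurable.ite (measurableSet_timeSimplex d s S) (Finset.measurable_fun_sum _ fun i _ =>
    (measurable_gaussDens₁ (h.measurable_flowCov_add m1 m3 m4 ε)
      (m2.sub (h.measurable_flowPoint m1 m3 m4)) i).smul_const _) measurable_const

lemma measurable_parametrixKernel (h : DiffusionData d κ α c L T s S a b b₁ Θ ψ) (ε : ℝ) :
    Measurable (Function.uncurry (parametrixKernel d s S a b b₁ Θ ψ ε)) := by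
  obtain ⟨m1, m2, m3, m4⟩ := measurable_coords d
  have mc := h.measurable_flowCov_add m1 m3 m4 ε
  have mp := h.measurable_flowPoint m1 m3 m4
  refine Measurable.ite (measurableSet_timeSimplex d s S) (measurable_genForm ?_ (fun i j => ?_)
    (measurable_gaussDens₁ mc (m2.sub mp)) (measurable_gaussDens₂ mc (m2.sub mp))) measurable_const
  · exact (h.measurable_drift.comp (m1.prodMk m2)).sub (h.measurable_flowDrift.comp (m1.prodMk mp))
  · exact ((h.measurable_diff i j).comp (m1.prodMk m2)).sub
      ((h.measurable_diff i j).comp (m1.prodMk mp))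

lemma frozenKernel_nonneg (ε : ℝ) (p q : ℝ × Vec d) : 0 ≤ frozenKernel d s S a Θ ψ ε p q := by
  unfold frozenKernel
  split_ifs
  · exact gaussDens_nonneg _ _
  · exact le_rfl

lemma frozenKernel_le (h : DiffusionData d κ α c L T s S a b b₁ Θ ψ) {ε : ℝ} (hε : 0 ≤ ε)
    {p q : ℝ × Vec d} (hpq : s ≤ p.1 ∧ p.1 < q.1 ∧ q.1 ≤ S) :
    frozenKernel d s S a Θ ψ ε p q ≤ κ ^ ((d : ℝ) / 2) *
      gaussk d (1 / (4 * κ)) (q.1 - p.1 + ε) (p.2 - ψ p.1 (Θ q.1 q.2)) := by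
  have hκ := h.constants.one_le_ellipticity
  have hτ : 0 < q.1 - p.1 + ε := by linarith [hpq.2.1]
  rw [frozenKernel, if_pos hpq]
  refine (gaussDens_le (h.isElliptic_flowCov_add hpq.2.1.le hε _) hκ hτ _).trans ?_
  gcongr
  refine gaussk_mono ?_ hτ.le _
  gcongr
  norm_num

lemma norm_frozenGradient_le (d : ℕ) {κ α c L T : ℝ} (hC : AdmissibleConstants κ α c L T) :
    ∃ C : ℝ, 1 ≤ C ∧ ∀ s S a b b₁ Θ ψ, DiffusionData d κ α c L T s S a b b₁ Θ ψ →
      ∀ p q : ℝ × Vec d, s ≤ p.1 ∧ p.1 < q.1 ∧ q.1 ≤ S →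
        ‖frozenGradient d s S a Θ ψ 0 p q‖ ≤ C * (q.1 - p.1) ^ ((1 : ℝ) / 2 - 1) *
          gaussk d (1 / (4 * κ)) (q.1 - p.1) (p.2 - ψ p.1 (Θ q.1 q.2)) := by
  obtain ⟨C, hC1, hh⟩ := gaussDens₁_weighted d hC.one_le_ellipticity le_rfl
  refine ⟨d * C + 1, by nlinarith [Nat.cast_nonneg (α := ℝ) d], fun s S a b b₁ Θ ψ h p q hpq => ?_⟩
  have hτ : 0 < q.1 - p.1 := by linarith [hpq.2.1]
  rw [frozenGradient, if_pos hpq]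
  have hE := h.isElliptic_flowCov_add hpq.2.1.le le_rfl (Θ q.1 q.2)
  rw [add_zero] at hE
  refine (norm_sum_smul_coord_le fun i => ?_).trans (b := d * (C * (q.1 - p.1) ^ ((1 : ℝ) / 2 - 1) *
    gaussk d (1 / (4 * κ)) (q.1 - p.1) (p.2 - ψ p.1 (Θ q.1 q.2)))) ?_
  · have := hh _ _ hτ hE (p.2 - ψ p.1 (Θ q.1 q.2)) i
    rw [Real.rpow_zero, one_mul] at this
    convert this using 4
    norm_num
  · have h1 := gaussk_nonneg (l := 1 / (4 * κ)) hτ.le (p.2 - ψ p.1 (Θ q.1 q.2))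
    have h2 : 0 ≤ (q.1 - p.1) ^ ((1 : ℝ) / 2 - 1) *
      gaussk d (1 / (4 * κ)) (q.1 - p.1) (p.2 - ψ p.1 (Θ q.1 q.2)) := by positivity
    nlinarith

lemma abs_parametrixKernel_le (d : ℕ) {κ α c L T : ℝ} (hC : AdmissibleConstants κ α c L T) :
    ∃ C : ℝ, 1 ≤ C ∧ ∀ s S a b b₁ Θ ψ, DiffusionData d κ α c L T s S a b b₁ Θ ψ →
      ∀ ε, 0 ≤ ε → ε ≤ 1 → ∀ p q : ℝ × Vec d, s ≤ p.1 ∧ p.1 < q.1 ∧ q.1 ≤ S →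
        |parametrixKernel d s S a b b₁ Θ ψ ε p q| ≤ C * (q.1 - p.1 + ε) ^ (α / 2 - 1) *
          gaussk d (1 / (4 * κ)) (q.1 - p.1 + ε) (p.2 - ψ p.1 (Θ q.1 q.2)) := by
  obtain ⟨C, hC1, hh⟩ := abs_genForm_gaussDens_le d hC
  refine ⟨C, hC1, fun s S a b b₁ Θ ψ h ε hε hε1 p q hpq => ?_⟩
  rw [parametrixKernel, if_pos hpq]
  refine hh _ _ _ _ _ (by linarith [hpq.2.1]) (by linarith [h.length_le, hpq.1, hpq.2.2])
    (h.isElliptic_flowCov_add hpq.2.1.le hε _) (h.drift_sub_le _ _ _) fun i j => ?_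
  rw [Matrix.sub_apply]
  exact h.holder _ _ _ i j

lemma gaussk_displacement_le (h : DiffusionData d κ α c L T s S a b b₁ Θ ψ) {τ : ℝ} (hτ : 0 ≤ τ)
    (u : ℝ) (z w : Vec d) : gaussk d (1 / (4 * κ)) τ (z - ψ u w) ≤
      gaussk d (1 / (4 * κ) / L ^ 2) τ (Θ u z - w) := by
  have hκ := h.constants.one_le_ellipticity
  have hL := h.constants.one_le_lip
  exact gaussk_le_of_norm_le (by positivity) (by linarith) hτ (h.norm_inv_sub_le u z w)

lemma le_majorant (h : DiffusionData d κ α c L T s S a b b₁ Θ ψ) {K : ℝ} (hK : 0 ≤ K) {C e v : ℝ}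
    (hC : 0 ≤ C) {p q : ℝ × Vec d} (hpq : s ≤ p.1 ∧ p.1 < q.1 ∧ q.1 ≤ S)
    (hv : v ≤ C * (q.1 - p.1) ^ (e - 1) *
      gaussk d (1 / (4 * κ)) (q.1 - p.1) (p.2 - ψ p.1 (Θ q.1 q.2))) :
    v ≤ C * majorant d s S (1 / (4 * κ) / L ^ 2) K e Θ p q := by
  have hτ : 0 < q.1 - p.1 := by linarith [hpq.2.1]
  rw [majorant_of_mem hpq]
  have h1 := h.gaussk_displacement_le hτ.le p.1 p.2 (Θ q.1 q.2)
  have h2 : 1 ≤ Real.exp (K * (q.1 - p.1)) := Real.one_le_exp (by positivity)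
  have h3 := gaussk_nonneg (l := 1 / (4 * κ) / L ^ 2) hτ.le (Θ p.1 p.2 - Θ q.1 q.2)
  set E := Real.exp (K * (q.1 - p.1))
  set g := gaussk d (1 / (4 * κ) / L ^ 2) (q.1 - p.1) (Θ p.1 p.2 - Θ q.1 q.2)
  refine hv.trans ?_
  calc _ ≤ C * (q.1 - p.1) ^ (e - 1) * g := by gcongr
    _ = 1 * (C * (q.1 - p.1) ^ (e - 1) * g) := by ring
    _ ≤ E * (C * (q.1 - p.1) ^ (e - 1) * g) := by gcongr
    _ = _ := by ring

lemma abs_frozenKernel_le_majorant (h : DiffusionData d κ α c L T s S a b b₁ Θ ψ) {K : ℝ}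
    (hK : 0 ≤ K) (p q : ℝ × Vec d) : |frozenKernel d s S a Θ ψ 0 p q| ≤
      κ ^ ((d : ℝ) / 2) * majorant d s S (1 / (4 * κ) / L ^ 2) K 1 Θ p q := by
  have hκ := h.constants.one_le_ellipticity
  rw [abs_of_nonneg (frozenKernel_nonneg _ _ _)]
  by_cases hpq : s ≤ p.1 ∧ p.1 < q.1 ∧ q.1 ≤ S
  · refine h.le_majorant hK (by positivity) hpq ?_
    have := h.frozenKernel_le le_rfl hpq
    simpa using this
  · rw [frozenKernel, if_neg hpq]
    exact mul_nonneg (by positivity) (majorant_nonneg _ _)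

lemma norm_frozenGradient_le_majorant (d : ℕ) {κ α c L T : ℝ} (hC : AdmissibleConstants κ α c L T) :
    ∃ C : ℝ, 1 ≤ C ∧ ∀ s S a b b₁ Θ ψ, DiffusionData d κ α c L T s S a b b₁ Θ ψ →
      ∀ K, 0 ≤ K → ∀ p q : ℝ × Vec d, ‖frozenGradient d s S a Θ ψ 0 p q‖ ≤
        C * majorant d s S (1 / (4 * κ) / L ^ 2) K (1 / 2) Θ p q := by
  obtain ⟨C, hC1, hh⟩ := norm_frozenGradient_le d hC
  refine ⟨C, hC1, fun s S a b b₁ Θ ψ h K hK p q => ?_⟩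
  by_cases hpq : s ≤ p.1 ∧ p.1 < q.1 ∧ q.1 ≤ S
  · exact h.le_majorant hK (by linarith) hpq (hh s S a b b₁ Θ ψ h p q hpq)
  · rw [frozenGradient, if_neg hpq, norm_zero]
    exact mul_nonneg (by linarith) (majorant_nonneg _ _)

/-- Discounting in time turns the majorant of the parametrix kernel into a contraction. -/
lemma exists_contracting_majorant (d : ℕ) {κ α c L T : ℝ} (hC : AdmissibleConstants κ α c L T) :
    ∃ B K : ℝ, 0 < B ∧ 0 ≤ K ∧ ∀ s S a b b₁ Θ ψ, DiffusionData d κ α c L T s S a b b₁ Θ ψ →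
      (∀ p q, |parametrixKernel d s S a b b₁ Θ ψ 0 p q| ≤
        B * majorant d s S (1 / (4 * κ) / L ^ 2) K (α / 4) Θ p q) ∧
      ∀ p q, ∫⁻ m, ENNReal.ofReal (B * majorant d s S (1 / (4 * κ) / L ^ 2) K (α / 4) Θ p m) *
          ENNReal.ofReal (B * majorant d s S (1 / (4 * κ) / L ^ 2) K (α / 4) Θ m q)
        ≤ ENNReal.ofReal (B * majorant d s S (1 / (4 * κ) / L ^ 2) K (α / 4) Θ p q / 2) := by
  obtain ⟨A, hA1, hh⟩ := abs_parametrixKernel_le d hC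
  have hκ := hC.one_le_ellipticity
  have hα := hC.exponent_pos
  have hα1 := hC.exponent_le
  have hL := hC.one_le_lip
  have hT := hC.time_pos
  set l := 1 / (4 * κ) / L ^ 2 with hl
  have hl0 : 0 < l := by positivity
  set M := L ^ d * (Real.pi / l) ^ ((d : ℝ) / 2) * (2 * (1 / (α / 4) + 1 / (α / 4))) with hM
  have hM0 : 0 < M := by positivity
  set δ : ℝ := (2 * A * M * T ^ (α / 4))⁻¹ with hδ
  have hδ0 : 0 < δ := by positivity
  set K := δ ^ (-(4 / α)) with hK
  have hK0 : 0 < K := by positivity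
  have hKδ : K ^ (-(α / 4)) = δ := by
    rw [hK, ← Real.rpow_mul hδ0.le, show -(4 / α) * -(α / 4) = 1 by field_simp, Real.rpow_one]
  refine ⟨A * δ, K, by positivity, hK0.le, fun s S a b b₁ Θ ψ h => ⟨fun p q => ?_, fun p q => ?_⟩⟩
  · by_cases hpq : s ≤ p.1 ∧ p.1 < q.1 ∧ q.1 ≤ S
    swap
    · rw [parametrixKernel, if_neg hpq, abs_zero]
      exact mul_nonneg (by positivity) (majorant_nonneg _ _)
    have h1 := hh s S a b b₁ Θ ψ h 0 le_rfl zero_le_one p q hpq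
    rw [add_zero] at h1
    have h2 := h.le_majorant le_rfl (by linarith) hpq h1
    refine h2.trans ?_
    rw [majorant_of_mem hpq, majorant_of_mem hpq, zero_mul, Real.exp_zero, one_mul]
    have hτ : 0 < q.1 - p.1 := by linarith [hpq.2.1]
    set τ := q.1 - p.1
    have h3 := gaussk_nonneg (l := l) hτ.le (Θ p.1 p.2 - Θ q.1 q.2)
    have h4 : (K * τ) ^ (α / 4) ≤ Real.exp (K * τ) := by
      have h5 : K * τ ≤ Real.exp (K * τ) := by linarith [Real.add_one_le_exp (K * τ)]
      calc (K * τ) ^ (α / 4) ≤ (Real.exp (K * τ)) ^ (α / 4) := by gcongr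
        _ ≤ (Real.exp (K * τ)) ^ (1 : ℝ) :=
          Real.rpow_le_rpow_of_exponent_le (Real.one_le_exp (by positivity)) (by linarith)
        _ = _ := Real.rpow_one _
    have h6 : τ ^ (α / 2 - 1) ≤ δ * (Real.exp (K * τ) * τ ^ (α / 4 - 1)) := by
      rw [show α / 2 - 1 = α / 4 + (α / 4 - 1) by ring, Real.rpow_add hτ, ← mul_assoc]
      gcongr
      rw [Real.mul_rpow hK0.le hτ.le] at h4
      calc τ ^ (α / 4) = K ^ (-(α / 4)) * (K ^ (α / 4) * τ ^ (α / 4)) := by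
            rw [← mul_assoc, ← Real.rpow_add hK0]; simp
        _ ≤ δ * Real.exp (K * τ) := by rw [hKδ]; gcongr
    calc _ ≤ A * ((δ * (Real.exp (K * τ) * τ ^ (α / 4 - 1))) *
          gaussk d l τ (Θ p.1 p.2 - Θ q.1 q.2)) := by gcongr
      _ = _ := by ring
  · have h1 := lintegral_majorant_mul_majorant_le (s := s) (S := S) (K := K) (d := d) hl0
      (by linarith : (0 : ℝ) ≤ L) h.flow.continuous_inv.measurable h.flow.lip_flow h.flow.flow_inv
      (by positivity : 0 < α / 4) (by linarith) (by positivity : 0 < α / 4) (by linarith) p q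
    have hAδ : 0 ≤ A * δ := by positivity
    simp only [ENNReal.ofReal_mul hAδ]
    rw [lintegral_congr fun m => mul_mul_mul_comm _ _ _ _]
    rw [lintegral_const_mul' _ _ (ENNReal.mul_ne_top ENNReal.ofReal_ne_top ENNReal.ofReal_ne_top)]
    refine (mul_le_mul_right h1 _).trans ?_
    rw [← ENNReal.ofReal_mul hAδ, ← ENNReal.ofReal_mul (by positivity)]
    refine ENNReal.ofReal_le_ofReal ?_
    have h2 : majorant d s S l K (α / 4 + α / 4) Θ p q ≤
        T ^ (α / 4) * majorant d s S l K (α / 4) Θ p q := by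
      by_cases hpq : s ≤ p.1 ∧ p.1 < q.1 ∧ q.1 ≤ S
      swap
      · rw [majorant_of_not_mem hpq, majorant_of_not_mem hpq, mul_zero]
      rw [majorant_of_mem hpq, majorant_of_mem hpq]
      have hτ : 0 < q.1 - p.1 := by linarith [hpq.2.1]
      have hτT : q.1 - p.1 ≤ T := by linarith [h.length_le, hpq.1, hpq.2.2]
      set τ := q.1 - p.1
      have h3 := gaussk_nonneg (l := l) hτ.le (Θ p.1 p.2 - Θ q.1 q.2)
      rw [show α / 4 + α / 4 - 1 = α / 4 + (α / 4 - 1) by ring, Real.rpow_add hτ]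
      have h4 : τ ^ (α / 4) ≤ T ^ (α / 4) := by gcongr
      calc _ ≤ Real.exp (K * τ) * (T ^ (α / 4) * τ ^ (α / 4 - 1)) *
            gaussk d l τ (Θ p.1 p.2 - Θ q.1 q.2) := by gcongr
        _ = _ := by ring
    calc A * δ * (A * δ) * (M * majorant d s S l K (α / 4 + α / 4) Θ p q)
        ≤ A * δ * (A * δ) * (M * (T ^ (α / 4) * majorant d s S l K (α / 4) Θ p q)) := by gcongr
      _ = A * δ * majorant d s S l K (α / 4) Θ p q * (δ * (A * M * T ^ (α / 4))) := by ring
      _ = _ := by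
          rw [hδ]
          field_simp

end DiffusionData

end KernelBounds

section IteratedDomination

lemma integrable_prod_of_slice_le {d : ℕ} {V : Type*} [NormedAddCommGroup V] {E : ℝ → ℝ}
    {F : ℝ × Vec d → V} (mF : StronglyMeasurable F)
    (hE : Integrable E) (hFE : ∀ r, ∫⁻ w, ‖F (r, w)‖ₑ ≤ ENNReal.ofReal (E r)) : Integrable F := by
  refine ⟨mF.aestronglyMeasurable, ?_⟩
  rw [HasFiniteIntegral, Measure.volume_eq_prod, lintegral_prod _ mF.enorm.aemeasurable]
  exact (lintegral_mono hFE).trans_lt hE.lintegral_lt_top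

variable {X V : Type*} [NormedAddCommGroup V] [NormedSpace ℝ V] {d : ℕ} {F : X → ℝ × Vec d → V}
  {E : ℝ → ℝ}

lemma norm_integral_le_of_lintegral_le {β : Type*} [MeasurableSpace β] {μ : Measure β} {f : β → V}
    {C : ℝ} (hC : 0 ≤ C) (h : ∫⁻ x, ‖f x‖ₑ ∂μ ≤ ENNReal.ofReal C) : ‖∫ x, f x ∂μ‖ ≤ C := by
  have h1 := (enorm_integral_le_lintegral_enorm f).trans h
  rw [← ofReal_norm] at h1
  exact (ENNReal.ofReal_le_ofReal_iff hC).1 h1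

lemma continuous_integral_prod_of_dominated [TopologicalSpace X] [FirstCountableTopology X]
    (mF : ∀ x, StronglyMeasurable (F x)) (hE : Integrable E) (hE0 : ∀ r, 0 ≤ E r)
    (hFE : ∀ x r, ∫⁻ w, ‖F x (r, w)‖ₑ ≤ ENNReal.ofReal (E r))
    (hD : ∀ r, ∃ D : Vec d → ℝ, Integrable D ∧ ∀ x w, ‖F x (r, w)‖ ≤ D w)
    (hc : ∀ m, Continuous fun x => F x m) : Continuous fun x => ∫ m, F x m := by
  have e : (fun x => ∫ m, F x m) = fun x => ∫ r, ∫ w, F x (r, w) := by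
    ext x
    exact integral_prod _ (integrable_prod_of_slice_le (mF x) hE (hFE x))
  rw [e]
  refine continuous_of_dominated (bound := E)
    (fun x => (mF x).integral_prod_right'.aestronglyMeasurable)
    (fun x => Filter.Eventually.of_forall fun r =>
      norm_integral_le_of_lintegral_le (hE0 r) (hFE x r)) hE
    (Filter.Eventually.of_forall fun r => ?_)
  obtain ⟨D, iD, hD⟩ := hD r
  exact continuous_of_dominated
    (fun x => ((mF x).comp_measurable measurable_prodMk_left).aestronglyMeasurable)
    (fun x => Filter.Eventually.of_forall fun w => hD x w) iD
    (Filter.Eventually.of_forall fun w => hc (r, w))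

lemma hasFDerivAt_integral_prod_of_dominated {F : Vec d → ℝ × Vec d → ℝ}
    {F' : Vec d → ℝ × Vec d → Vec d →L[ℝ] ℝ} (mF : ∀ x, Measurable (F x))
    (iF : ∀ x, Integrable (F x)) (mF' : ∀ x, StronglyMeasurable (F' x)) (hE : Integrable E)
    (hE0 : ∀ r, 0 ≤ E r) (hFE : ∀ x r, ∫⁻ w, ‖F' x (r, w)‖ₑ ≤ ENNReal.ofReal (E r))
    (hD : ∀ r, ∃ D : Vec d → ℝ, Integrable D ∧ ∀ x w, ‖F' x (r, w)‖ ≤ D w)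
    (hF : ∀ m x, HasFDerivAt (fun x => F x m) (F' x m) x) (x : Vec d) :
    HasFDerivAt (fun x => ∫ m, F x m) (∫ m, F' x m) x := by
  have e : (fun x => ∫ m, F x m) = fun x => ∫ r, ∫ w, F x (r, w) := by
    ext x
    exact integral_prod _ (iF x)
  have e' : ∫ m, F' x m = ∫ r, ∫ w, F' x (r, w) :=
    integral_prod _ (integrable_prod_of_slice_le (mF' x) hE (hFE x))
  -- Almost every slice is integrable at one point, hence everywhere.
  have hae : ∀ᵐ r, ∀ x', HasFDerivAt (fun x => ∫ w, F x (r, w)) (∫ w, F' x' (r, w)) x' := by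
    have h0 : ∀ᵐ r, Integrable fun w => F x (r, w) := (iF x).prod_right_ae
    filter_upwards [h0] with r hr x'
    obtain ⟨D, iD, hD⟩ := hD r
    have mD : ∀ x', AEStronglyMeasurable (fun w => F' x' (r, w)) := fun x' =>
      ((mF' x').comp_measurable measurable_prodMk_left).aestronglyMeasurable
    have mFr : ∀ x', AEStronglyMeasurable (fun w => F x' (r, w)) := fun x' =>
      ((mF x').comp measurable_prodMk_left).aestronglyMeasurable
    have ix' : Integrable fun w => F x' (r, w) := by
      have h1 : Integrable fun w => D w * ‖x' - x‖ + |F x (r, w)| :=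
        (iD.mul_const _).add hr.abs
      refine h1.mono' (mFr x') (Filter.Eventually.of_forall fun w => ?_)
      have h2 := convex_univ.norm_image_sub_le_of_norm_hasFDerivWithin_le
        (fun y _ => (hF (r, w) y).hasFDerivWithinAt) (fun y _ => hD y w) (mem_univ x) (mem_univ x')
      have h3 := abs_sub_abs_le_abs_sub (F x' (r, w)) (F x (r, w))
      rw [Real.norm_eq_abs] at h2 ⊢
      linarith
    exact hasFDerivAt_integral_of_dominated_of_fderiv_le (bound := D) Filter.univ_mem
      (Filter.Eventually.of_forall mFr) ix' (mD x')
      (Filter.Eventually.of_forall fun w y _ => hD y w) iD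
      (Filter.Eventually.of_forall fun w y _ => hF (r, w) y)
  rw [e, e']
  exact hasFDerivAt_integral_of_dominated_of_fderiv_le (bound := E) Filter.univ_mem
    (Filter.Eventually.of_forall fun y =>
      (mF y).stronglyMeasurable.integral_prod_right'.aestronglyMeasurable)
    (iF x).integral_prod_left (mF' x).integral_prod_right'.aestronglyMeasurable
    (Filter.Eventually.of_forall fun r y _ =>
      norm_integral_le_of_lintegral_le (hE0 r) (hFE y r)) hE
    (hae.mono fun r hr y _ => hr y)

end IteratedDomination

section MajorantSlices

variable {d : ℕ} {s S l K e L : ℝ} {Θ : ℝ → Vec d → Vec d}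

lemma majorant_le (hl : 0 ≤ l) {p q : ℝ × Vec d} (h : s ≤ p.1 ∧ p.1 < q.1 ∧ q.1 ≤ S) :
    majorant d s S l K e Θ p q ≤ Real.exp (K * (q.1 - p.1)) * (q.1 - p.1) ^ (e - 1) *
      (q.1 - p.1) ^ (-(d : ℝ) / 2) := by
  have hτ : 0 < q.1 - p.1 := by linarith [h.2.1]
  rw [majorant_of_mem h]
  gcongr
  exact gaussk_le_rpow hl hτ.le _

lemma lintegral_gaussk_comp_le {ψ : ℝ → Vec d → Vec d} (hl : 0 < l) (hL : 0 ≤ L)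
    (hΘ : Measurable (Function.uncurry Θ))
    (lψ : ∀ r w w', ‖ψ r w - ψ r w'‖ ≤ L * ‖w - w'‖) (hψ : ∀ r y, ψ r (Θ r y) = y)
    {τ : ℝ} (hτ : 0 < τ) (r : ℝ) (v : Vec d) :
    ∫⁻ w, ENNReal.ofReal (gaussk d l τ (v - Θ r w)) ≤
      ENNReal.ofReal (L ^ d * (Real.pi / l) ^ ((d : ℝ) / 2)) := by
  have hf : Measurable fun w => ENNReal.ofReal (gaussk d l τ (v - w)) :=
    ((measurable_gaussk l _).comp (measurable_const.sub measurable_id)).ennreal_ofReal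
  have h1 := lintegral_comp_le_of_inverse hL (lψ r)
    (hΘ.comp measurable_prodMk_left : Measurable (Θ r)) (hψ r) hf
  refine h1.trans_eq ?_
  rw [lintegral_sub_left_eq_self (fun w => ENNReal.ofReal (gaussk d l τ w)) v,
    lintegral_gaussk d hl hτ, ← ENNReal.ofReal_mul (pow_nonneg hL _)]

lemma gaussk_neg {d : ℕ} (l t : ℝ) (z : Vec d) : gaussk d l t (-z) = gaussk d l t z := by
  simp [gaussk]

lemma lintegral_majorant_right_le {ψ : ℝ → Vec d → Vec d} (hl : 0 < l) (hL : 0 ≤ L)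
    (hΘ : Measurable (Function.uncurry Θ))
    (lψ : ∀ r w w', ‖ψ r w - ψ r w'‖ ≤ L * ‖w - w'‖) (hψ : ∀ r y, ψ r (Θ r y) = y)
    (p : ℝ × Vec d) {r : ℝ} (hr : s ≤ p.1 ∧ p.1 < r ∧ r ≤ S) :
    ∫⁻ w, ENNReal.ofReal (majorant d s S l K e Θ p (r, w)) ≤
      ENNReal.ofReal (L ^ d * (Real.pi / l) ^ ((d : ℝ) / 2) *
        (Real.exp (K * (r - p.1)) * (r - p.1) ^ (e - 1))) := by
  have hτ : 0 < r - p.1 := by linarith [hr.2.1]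
  have hA : 0 ≤ Real.exp (K * (r - p.1)) * (r - p.1) ^ (e - 1) := by positivity
  have e1 : ∀ w, ENNReal.ofReal (majorant d s S l K e Θ p (r, w)) =
      ENNReal.ofReal (Real.exp (K * (r - p.1)) * (r - p.1) ^ (e - 1)) *
        ENNReal.ofReal (gaussk d l (r - p.1) (Θ p.1 p.2 - Θ r w)) := fun w => by
    rw [majorant_of_mem (q := (r, w)) hr, ENNReal.ofReal_mul hA]
  simp_rw [e1]
  rw [lintegral_const_mul' _ _ ENNReal.ofReal_ne_top]
  refine (mul_le_mul_right (lintegral_gaussk_comp_le hl hL hΘ lψ hψ hτ r _) _).trans_eq ?_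
  rw [← ENNReal.ofReal_mul hA, mul_comm]

lemma lintegral_majorant_left_le {ψ : ℝ → Vec d → Vec d} (hl : 0 < l) (hL : 0 ≤ L)
    (hΘ : Measurable (Function.uncurry Θ))
    (lψ : ∀ r w w', ‖ψ r w - ψ r w'‖ ≤ L * ‖w - w'‖) (hψ : ∀ r y, ψ r (Θ r y) = y)
    (q : ℝ × Vec d) {r : ℝ} (hr : s ≤ r ∧ r < q.1 ∧ q.1 ≤ S) :
    ∫⁻ w, ENNReal.ofReal (majorant d s S l K e Θ (r, w) q) ≤
      ENNReal.ofReal (L ^ d * (Real.pi / l) ^ ((d : ℝ) / 2) *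
        (Real.exp (K * (q.1 - r)) * (q.1 - r) ^ (e - 1))) := by
  have hτ : 0 < q.1 - r := by linarith [hr.2.1]
  have hA : 0 ≤ Real.exp (K * (q.1 - r)) * (q.1 - r) ^ (e - 1) := by positivity
  have e1 : ∀ w, ENNReal.ofReal (majorant d s S l K e Θ (r, w) q) =
      ENNReal.ofReal (Real.exp (K * (q.1 - r)) * (q.1 - r) ^ (e - 1)) *
        ENNReal.ofReal (gaussk d l (q.1 - r) (Θ q.1 q.2 - Θ r w)) := fun w => by
    rw [majorant_of_mem (p := (r, w)) hr, ENNReal.ofReal_mul hA, ← gaussk_neg, neg_sub]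
  simp_rw [e1]
  rw [lintegral_const_mul' _ _ ENNReal.ofReal_ne_top]
  refine (mul_le_mul_right (lintegral_gaussk_comp_le hl hL hΘ lψ hψ hτ r _) _).trans_eq ?_
  rw [← ENNReal.ofReal_mul hA, mul_comm]

end MajorantSlices

namespace DiffusionData

variable {d : ℕ} {κ α c L T s S : ℝ} {a : ℝ → Vec d → Matrix (Fin d) (Fin d) ℝ}
  {b b₁ Θ ψ : ℝ → Vec d → Vec d}

lemma tendsto_flowPoint {ι : Type*} {f : Filter ι} {y : ι → Vec d} {y₀ : Vec d}
    (h : DiffusionData d κ α c L T s S a b b₁ Θ ψ) (u t : ℝ) (hy : Filter.Tendsto y f (nhds y₀)) :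
    Filter.Tendsto (fun x => ψ u (Θ t (y x))) f (nhds (ψ u (Θ t y₀))) :=
  (((h.flow.continuous_flow.comp (Continuous.prodMk_right u)).comp
    (h.flow.continuous_inv.comp (Continuous.prodMk_right t))).tendsto y₀).comp hy

section Limits

variable {ι : Type*} {f : Filter ι} {y z : ι → Vec d} {y₀ z₀ : Vec d} {ε : ι → ℝ} {ε₀ : ℝ}

lemma tendsto_flowCov_add (h : DiffusionData d κ α c L T s S a b b₁ Θ ψ) (u t : ℝ)
    (hε : Filter.Tendsto ε f (nhds ε₀)) (hy : Filter.Tendsto y f (nhds y₀)) (i j : Fin d) :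
    Filter.Tendsto (fun x => (flowCov a ψ u t (Θ t (y x)) + ε x • 1 :
      Matrix (Fin d) (Fin d) ℝ) i j) f
      (nhds ((flowCov a ψ u t (Θ t y₀) + ε₀ • 1 : Matrix (Fin d) (Fin d) ℝ) i j)) := by
  simp only [Matrix.add_apply, Matrix.smul_apply, smul_eq_mul]
  exact ((((h.continuous_flowCov u t i j).comp
    (h.flow.continuous_inv.comp (Continuous.prodMk_right t))).tendsto y₀).comp hy).add
      (hε.mul_const _)

lemma tendsto_frozenKernel (h : DiffusionData d κ α c L T s S a b b₁ Θ ψ) (u t : ℝ)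
    (hε : Filter.Tendsto ε f (nhds ε₀)) (hε₀ : 0 ≤ ε₀) (hz : Filter.Tendsto z f (nhds z₀))
    (hy : Filter.Tendsto y f (nhds y₀)) :
    Filter.Tendsto (fun x => frozenKernel d s S a Θ ψ (ε x) (u, z x) (t, y x)) f
      (nhds (frozenKernel d s S a Θ ψ ε₀ (u, z₀) (t, y₀))) := by
  by_cases hut : s ≤ u ∧ u < t ∧ t ≤ S
  · simp only [frozenKernel, hut, and_self, if_true]
    exact tendsto_gaussDens (h.tendsto_flowCov_add u t hε hy)
      ((h.isElliptic_flowCov_add hut.2.1.le hε₀ _).det_pos h.constants.one_le_ellipticity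
        (by linarith [hut.2.1])) (hz.sub (h.tendsto_flowPoint u t hy))
  · simp only [frozenKernel, hut, if_false]
    exact tendsto_const_nhds

lemma tendsto_frozenGradient (h : DiffusionData d κ α c L T s S a b b₁ Θ ψ) (u t : ℝ)
    (hε : Filter.Tendsto ε f (nhds ε₀)) (hε₀ : 0 ≤ ε₀) (hz : Filter.Tendsto z f (nhds z₀))
    (hy : Filter.Tendsto y f (nhds y₀)) :
    Filter.Tendsto (fun x => frozenGradient d s S a Θ ψ (ε x) (u, z x) (t, y x)) f
      (nhds (frozenGradient d s S a Θ ψ ε₀ (u, z₀) (t, y₀))) := by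
  by_cases hut : s ≤ u ∧ u < t ∧ t ≤ S
  · simp only [frozenGradient, hut, and_self, if_true]
    exact tendsto_finsetSum _ fun i _ => (tendsto_gaussDens₁ (h.tendsto_flowCov_add u t hε hy)
      ((h.isElliptic_flowCov_add hut.2.1.le hε₀ _).det_pos h.constants.one_le_ellipticity
        (by linarith [hut.2.1])) (hz.sub (h.tendsto_flowPoint u t hy)) i).smul_const _
  · simp only [frozenGradient, hut, if_false]
    exact tendsto_const_nhds

lemma tendsto_parametrixKernel (h : DiffusionData d κ α c L T s S a b b₁ Θ ψ) (u t : ℝ) (z : Vec d)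
    (hε : Filter.Tendsto ε f (nhds ε₀)) (hε₀ : 0 ≤ ε₀) (hy : Filter.Tendsto y f (nhds y₀)) :
    Filter.Tendsto (fun x => parametrixKernel d s S a b b₁ Θ ψ (ε x) (u, z) (t, y x)) f
      (nhds (parametrixKernel d s S a b b₁ Θ ψ ε₀ (u, z) (t, y₀))) := by
  by_cases hut : s ≤ u ∧ u < t ∧ t ≤ S
  · simp only [parametrixKernel, hut, and_self, if_true]
    have hdet := (h.isElliptic_flowCov_add hut.2.1.le hε₀ (Θ t y₀)).det_pos
      h.constants.one_le_ellipticity (by linarith [hut.2.1])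
    have hp := h.tendsto_flowPoint u t hy
    refine tendsto_genForm (tendsto_const_nhds.sub (((h.continuous_flowDrift u).tendsto _).comp hp))
      (fun i j => ?_)
      (tendsto_gaussDens₁ (h.tendsto_flowCov_add u t hε hy) hdet (tendsto_const_nhds.sub hp))
      (tendsto_gaussDens₂ (h.tendsto_flowCov_add u t hε hy) hdet (tendsto_const_nhds.sub hp))
    simp only [Matrix.sub_apply]
    exact tendsto_const_nhds.sub (((h.continuous_diff u i j).tendsto _).comp hp)
  · simp only [parametrixKernel, hut, if_false]
    exact tendsto_const_nhds

end Limits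

lemma hasFDerivAt_frozenKernel (h : DiffusionData d κ α c L T s S a b b₁ Θ ψ) (u : ℝ)
    (q : ℝ × Vec d) (z : Vec d) :
    HasFDerivAt (fun z => frozenKernel d s S a Θ ψ 0 (u, z) q)
      (frozenGradient d s S a Θ ψ 0 (u, z) q) z := by
  by_cases hut : s ≤ u ∧ u < q.1 ∧ q.1 ≤ S
  · simp only [frozenKernel, frozenGradient, hut, and_self, if_true]
    exact (hasFDerivAt_comp_sub _).2
      (hasFDerivAt_gaussDens (h.isElliptic_flowCov_add hut.2.1.le le_rfl _).inv_symm _)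
  · simp only [frozenKernel, frozenGradient, hut, if_false]
    exact hasFDerivAt_const _ _

end DiffusionData

section MajorizedKernels

/-- A flow `Θ` with Lipschitz right inverse, together with a Gaussian rate `l`. -/
structure MajorantFlow {d : ℕ} (l L : ℝ) (Θ ψ : ℝ → Vec d → Vec d) : Prop where
  rate_pos : 0 < l
  lip_nonneg : 0 ≤ L
  measurable_inv : Measurable (Function.uncurry Θ)
  lip_flow : ∀ r w w', ‖ψ r w - ψ r w'‖ ≤ L * ‖w - w'‖
  flow_inv : ∀ r y, ψ r (Θ r y) = y

/-- A measurable space-time kernel bounded by `A` times the Gaussian majorant with exponent `e`. -/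
structure Majorized {V : Type*} [NormedAddCommGroup V] {d : ℕ} (s S l K e A : ℝ)
    (Θ : ℝ → Vec d → Vec d) (F : ℝ × Vec d → ℝ × Vec d → V) : Prop where
  stronglyMeasurable : StronglyMeasurable (Function.uncurry F)
  nonneg : 0 ≤ A
  norm_le : ∀ p q, ‖F p q‖ ≤ A * majorant d s S l K e Θ p q

variable {d : ℕ} {s S l K e e' L A B : ℝ} {Θ ψ : ℝ → Vec d → Vec d}

lemma integrable_rpow_mul_rpow_indicator (he : 0 < e) (he1 : e ≤ 1) (he' : 0 < e') (he1' : e' ≤ 1)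
    (u t : ℝ) :
    Integrable ((Ioo u t).indicator fun r => (r - u) ^ (e - 1) * (t - r) ^ (e' - 1)) := by
  rw [integrable_indicator_iff measurableSet_Ioo]
  rcases le_or_gt t u with htu | hut
  · simp [Ioo_eq_empty_of_le htu]
  refine ⟨by fun_prop, ?_⟩
  rw [hasFiniteIntegral_iff_ofReal]
  · exact (lintegral_rpow_mul_rpow_le he he1 he' he1' hut).trans_lt ENNReal.ofReal_lt_top
  · filter_upwards [ae_restrict_mem measurableSet_Ioo] with r hr
    have h1 : 0 < r - u := sub_pos.2 hr.1
    have h2 : 0 < t - r := sub_pos.2 hr.2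
    simp only [Pi.zero_apply]
    positivity

namespace Majorized

variable {V : Type*} [NormedAddCommGroup V] {F : ℝ × Vec d → ℝ × Vec d → V}
  {G : ℝ × Vec d → ℝ × Vec d → ℝ}

lemma eq_zero (hF : Majorized s S l K e A Θ F) {p q : ℝ × Vec d}
    (h : ¬(s ≤ p.1 ∧ p.1 < q.1 ∧ q.1 ≤ S)) : F p q = 0 := by
  have := hF.norm_le p q
  rw [majorant_of_not_mem h, mul_zero] at this
  exact norm_le_zero_iff.1 this

lemma norm_le_const (hF : Majorized s S l K e A Θ F) (hl : 0 ≤ l) {u t : ℝ} (z y : Vec d) :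
    ‖F (u, z) (t, y)‖ ≤
      A * (Real.exp (K * (t - u)) * |t - u| ^ (e - 1) * |t - u| ^ (-(d : ℝ) / 2)) := by
  by_cases h : s ≤ u ∧ u < t ∧ t ≤ S
  · refine (hF.norm_le _ _).trans (mul_le_mul_of_nonneg_left ?_ hF.nonneg)
    rw [abs_of_pos (sub_pos.2 h.2.1)]
    exact majorant_le hl h
  · rw [hF.eq_zero h, norm_zero]
    have := hF.nonneg
    positivity

lemma stronglyMeasurable_left (hF : Majorized s S l K e A Θ F) (p : ℝ × Vec d) :
    StronglyMeasurable (F p) :=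
  hF.stronglyMeasurable.comp_measurable measurable_prodMk_left

lemma stronglyMeasurable_right (hF : Majorized s S l K e A Θ F) (q : ℝ × Vec d) :
    StronglyMeasurable fun p => F p q :=
  hF.stronglyMeasurable.comp_measurable measurable_prodMk_right

lemma enorm_le (hF : Majorized s S l K e A Θ F) (p q : ℝ × Vec d) :
    ‖F p q‖ₑ ≤ ENNReal.ofReal A * ENNReal.ofReal (majorant d s S l K e Θ p q) := by
  rw [← ofReal_norm, ← ENNReal.ofReal_mul hF.nonneg]
  exact ENNReal.ofReal_le_ofReal (hF.norm_le p q)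

lemma integrable_left (hM : MajorantFlow l L Θ ψ) (hF : Majorized s S l K e A Θ F)
    (p : ℝ × Vec d) (r : ℝ) : Integrable fun w => F p (r, w) := by
  by_cases h : s ≤ p.1 ∧ p.1 < r ∧ r ≤ S
  · refine ⟨((hF.stronglyMeasurable_left p).comp_measurable
      measurable_prodMk_left).aestronglyMeasurable, ?_⟩
    refine (lintegral_mono fun w => hF.enorm_le p (r, w)).trans_lt ?_
    rw [lintegral_const_mul' _ _ ENNReal.ofReal_ne_top]
    exact ENNReal.mul_lt_top ENNReal.ofReal_lt_top ((lintegral_majorant_right_le hM.rate_pos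
      hM.lip_nonneg hM.measurable_inv hM.lip_flow hM.flow_inv p h).trans_lt ENNReal.ofReal_lt_top)
  · simp [hF.eq_zero (q := (r, _)) h]

lemma integrable_right (hM : MajorantFlow l L Θ ψ) (hF : Majorized s S l K e A Θ F)
    (q : ℝ × Vec d) (r : ℝ) : Integrable fun w => F (r, w) q := by
  by_cases h : s ≤ r ∧ r < q.1 ∧ q.1 ≤ S
  · refine ⟨((hF.stronglyMeasurable_right q).comp_measurable
      measurable_prodMk_left).aestronglyMeasurable, ?_⟩
    refine (lintegral_mono fun w => hF.enorm_le (r, w) q).trans_lt ?_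
    rw [lintegral_const_mul' _ _ ENNReal.ofReal_ne_top]
    exact ENNReal.mul_lt_top ENNReal.ofReal_lt_top ((lintegral_majorant_left_le hM.rate_pos
      hM.lip_nonneg hM.measurable_inv hM.lip_flow hM.flow_inv q h).trans_lt ENNReal.ofReal_lt_top)
  · simp [hF.eq_zero (p := (r, _)) h]

lemma slice_const_nonneg (hM : MajorantFlow l L Θ ψ) (hF : Majorized s S l K e A Θ F)
    (hG : Majorized s S l K e' B Θ G) (u t r : ℝ) : 0 ≤ (A * B) *
      (L ^ d * (Real.pi / l) ^ ((d : ℝ) / 2) *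
        (Real.exp (K * (t - u)) * |t - u| ^ (-(d : ℝ) / 2))) *
      (Ioo u t).indicator (fun r => (r - u) ^ (e - 1) * (t - r) ^ (e' - 1)) r := by
  have hA := hF.nonneg
  have hB := hG.nonneg
  have hl := hM.rate_pos
  have hL := hM.lip_nonneg
  refine mul_nonneg (by positivity) (indicator_nonneg (fun r hr => ?_) r)
  have h1 : 0 < r - u := sub_pos.2 hr.1
  have h2 : 0 < t - r := sub_pos.2 hr.2
  positivity

variable [NormedSpace ℝ V]

lemma stronglyMeasurable_smul (hF : Majorized s S l K e A Θ F) (hG : Majorized s S l K e' B Θ G)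
    (p q : ℝ × Vec d) : StronglyMeasurable fun m => G m q • F p m :=
  (hG.stronglyMeasurable_right q).smul (hF.stronglyMeasurable_left p)

lemma enorm_smul_le (hF : Majorized s S l K e A Θ F) (hG : Majorized s S l K e' B Θ G)
    (p m q : ℝ × Vec d) : ‖G m q • F p m‖ₑ ≤ ENNReal.ofReal (A * B) *
      (ENNReal.ofReal (majorant d s S l K e Θ p m) *
        ENNReal.ofReal (majorant d s S l K e' Θ m q)) := by
  rw [enorm_smul, mul_comm, ENNReal.ofReal_mul hF.nonneg, mul_mul_mul_comm]
  exact mul_le_mul' (hF.enorm_le p m) (hG.enorm_le m q)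

lemma lintegral_smul_slice_le (hM : MajorantFlow l L Θ ψ) (hF : Majorized s S l K e A Θ F)
    (hG : Majorized s S l K e' B Θ G) {u t : ℝ} (z y : Vec d) (r : ℝ) :
    ∫⁻ w, ‖G (r, w) (t, y) • F (u, z) (r, w)‖ₑ ≤ ENNReal.ofReal ((A * B) *
      (L ^ d * (Real.pi / l) ^ ((d : ℝ) / 2) *
        (Real.exp (K * (t - u)) * gaussk d l |t - u| (Θ u z - Θ t y))) *
      (Ioo u t).indicator (fun r => (r - u) ^ (e - 1) * (t - r) ^ (e' - 1)) r) := by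
  by_cases h : s ≤ u ∧ r ∈ Ioo u t ∧ t ≤ S
  · have hut : u < t := h.2.1.1.trans h.2.1.2
    have hAB := mul_nonneg hF.nonneg hG.nonneg
    refine (lintegral_mono fun w => hF.enorm_smul_le hG (u, z) (r, w) (t, y)).trans ?_
    rw [lintegral_const_mul' _ _ ENNReal.ofReal_ne_top, mul_assoc, ENNReal.ofReal_mul hAB,
      indicator_of_mem h.2.1, abs_of_pos (sub_pos.2 hut)]
    exact mul_le_mul_right (lintegral_majorant_mul_majorant_slice_le hM.rate_pos hM.lip_nonneg
      hM.measurable_inv hM.lip_flow hM.flow_inv e' h.1 h.2.1 h.2.2 z y) _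
  · have : ∀ w, G (r, w) (t, y) • F (u, z) (r, w) = 0 := by
      intro w
      by_cases h1 : s ≤ u ∧ u < r ∧ r ≤ S
      · rw [hG.eq_zero (fun h2 => h ⟨h1.1, ⟨h1.2.1, h2.2.1⟩, h2.2.2⟩), zero_smul]
      · rw [hF.eq_zero h1, smul_zero]
    simp [this]

lemma integrable_smul (hM : MajorantFlow l L Θ ψ) (hF : Majorized s S l K e A Θ F)
    (hG : Majorized s S l K e' B Θ G) (he : 0 < e) (he1 : e ≤ 1) (he' : 0 < e') (he1' : e' ≤ 1)
    (p q : ℝ × Vec d) : Integrable fun m => G m q • F p m :=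
  integrable_prod_of_slice_le (hF.stronglyMeasurable_smul hG p q)
    ((integrable_rpow_mul_rpow_indicator he he1 he' he1' p.1 q.1).const_mul _)
    (hF.lintegral_smul_slice_le hM hG p.2 q.2)

lemma lintegral_smul_le (hM : MajorantFlow l L Θ ψ) (hF : Majorized s S l K e A Θ F)
    (hG : Majorized s S l K e' B Θ G) (he : 0 < e) (he1 : e ≤ 1) (he' : 0 < e') (he1' : e' ≤ 1)
    (p q : ℝ × Vec d) :
    ∫⁻ m, ‖G m q • F p m‖ₑ ≤ ENNReal.ofReal (A * B *
      (L ^ d * (Real.pi / l) ^ ((d : ℝ) / 2) * (2 * (1 / e + 1 / e'))) *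
        majorant d s S l K (e + e') Θ p q) := by
  refine (lintegral_mono fun m => hF.enorm_smul_le hG p m q).trans ?_
  rw [lintegral_const_mul' _ _ ENNReal.ofReal_ne_top, mul_assoc (A * B),
    ENNReal.ofReal_mul (mul_nonneg hF.nonneg hG.nonneg)]
  exact mul_le_mul_right (lintegral_majorant_mul_majorant_le hM.rate_pos hM.lip_nonneg
    hM.measurable_inv hM.lip_flow hM.flow_inv he he1 he' he1' p q) _

lemma comp (hM : MajorantFlow l L Θ ψ) (hF : Majorized s S l K e A Θ F)
    (hG : Majorized s S l K e' B Θ G) (he : 0 < e) (he1 : e ≤ 1) (he' : 0 < e') (he1' : e' ≤ 1) :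
    Majorized s S l K (e + e') (A * B *
      (L ^ d * (Real.pi / l) ^ ((d : ℝ) / 2) * (2 * (1 / e + 1 / e')))) Θ
      fun p q => ∫ m, G m q • F p m := by
  have hA := hF.nonneg
  have hB := hG.nonneg
  have hl := hM.rate_pos
  have hL := hM.lip_nonneg
  have hpos : 0 ≤ L ^ d * (Real.pi / l) ^ ((d : ℝ) / 2) * (2 * (1 / e + 1 / e')) := by positivity
  refine ⟨?_, by positivity, fun p q => norm_integral_le_of_lintegral_le
    (mul_nonneg (by positivity) (majorant_nonneg _ _))
    (hF.lintegral_smul_le hM hG he he1 he' he1' p q)⟩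
  · refine StronglyMeasurable.integral_prod_right' (f := fun x : ((ℝ × Vec d) × (ℝ × Vec d)) ×
      (ℝ × Vec d) => G x.2 x.1.2 • F x.1.1 x.2) ?_
    exact (hG.stronglyMeasurable.comp_measurable
      (g := fun x : ((ℝ × Vec d) × (ℝ × Vec d)) × (ℝ × Vec d) => (x.2, x.1.2)) (by fun_prop)).smul
      (hF.stronglyMeasurable.comp_measurable
      (g := fun x : ((ℝ × Vec d) × (ℝ × Vec d)) × (ℝ × Vec d) => (x.1.1, x.2)) (by fun_prop))

/-- The slice bound of `lintegral_smul_slice_le`, uniformly in the space variables. -/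
lemma lintegral_smul_slice_le_const (hM : MajorantFlow l L Θ ψ) (hF : Majorized s S l K e A Θ F)
    (hG : Majorized s S l K e' B Θ G) {u t : ℝ} (z y : Vec d) (r : ℝ) :
    ∫⁻ w, ‖G (r, w) (t, y) • F (u, z) (r, w)‖ₑ ≤ ENNReal.ofReal ((A * B) *
      (L ^ d * (Real.pi / l) ^ ((d : ℝ) / 2) *
        (Real.exp (K * (t - u)) * |t - u| ^ (-(d : ℝ) / 2))) *
      (Ioo u t).indicator (fun r => (r - u) ^ (e - 1) * (t - r) ^ (e' - 1)) r) := by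
  refine (hF.lintegral_smul_slice_le hM hG z y r).trans (ENNReal.ofReal_le_ofReal ?_)
  have hA := hF.nonneg
  have hB := hG.nonneg
  have hl := hM.rate_pos
  have hL := hM.lip_nonneg
  gcongr
  · refine indicator_nonneg (fun r hr => ?_) r
    have h1 : 0 < r - u := sub_pos.2 hr.1
    have h2 : 0 < t - r := sub_pos.2 hr.2
    positivity
  · exact gaussk_le_rpow hl.le (abs_nonneg _) _

lemma continuous_comp_right (hM : MajorantFlow l L Θ ψ) (hF : Majorized s S l K e A Θ F)
    (hG : Majorized s S l K e' B Θ G) (he : 0 < e) (he1 : e ≤ 1) (he' : 0 < e') (he1' : e' ≤ 1)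
    (p : ℝ × Vec d) (t : ℝ) (hc : ∀ m, Continuous fun y => G m (t, y)) :
    Continuous fun y => ∫ m, G m (t, y) • F p m := by
  refine continuous_integral_prod_of_dominated
    (fun y => hF.stronglyMeasurable_smul hG p (t, y))
    ((integrable_rpow_mul_rpow_indicator he he1 he' he1' p.1 t).const_mul _)
    (hF.slice_const_nonneg hM hG p.1 t)
    (fun y => hF.lintegral_smul_slice_le_const hM hG p.2 y) (fun r => ?_)
    (fun m => (hc m).smul continuous_const)
  refine ⟨_, ((hF.integrable_left hM p r).norm.const_mul (B * (Real.exp (K * (t - r)) *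
    |t - r| ^ (e' - 1) * |t - r| ^ (-(d : ℝ) / 2)))), fun y w => ?_⟩
  rw [norm_smul]
  exact mul_le_mul_of_nonneg_right (hG.norm_le_const hM.rate_pos.le w y) (norm_nonneg _)

lemma continuous_comp_left (hM : MajorantFlow l L Θ ψ) (hF : Majorized s S l K e A Θ F)
    (hG : Majorized s S l K e' B Θ G) (he : 0 < e) (he1 : e ≤ 1) (he' : 0 < e') (he1' : e' ≤ 1)
    (u : ℝ) (q : ℝ × Vec d) (hc : ∀ m, Continuous fun z => F (u, z) m) :
    Continuous fun z => ∫ m, G m q • F (u, z) m := by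
  refine continuous_integral_prod_of_dominated
    (fun z => hF.stronglyMeasurable_smul hG (u, z) q)
    ((integrable_rpow_mul_rpow_indicator he he1 he' he1' u q.1).const_mul _)
    (hF.slice_const_nonneg hM hG u q.1)
    (fun z => hF.lintegral_smul_slice_le_const hM hG z q.2) (fun r => ?_)
    (fun m => continuous_const.smul (hc m))
  refine ⟨_, ((hG.integrable_right hM q r).norm.mul_const (A * (Real.exp (K * (r - u)) *
    |r - u| ^ (e - 1) * |r - u| ^ (-(d : ℝ) / 2)))), fun z w => ?_⟩
  rw [norm_smul]
  exact mul_le_mul_of_nonneg_left (hF.norm_le_const hM.rate_pos.le z w) (norm_nonneg _)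

end Majorized

lemma Majorized.hasFDerivAt_comp {e₀ A₀ : ℝ} {F : ℝ × Vec d → ℝ × Vec d → ℝ}
    {F' : ℝ × Vec d → ℝ × Vec d → Vec d →L[ℝ] ℝ} {G : ℝ × Vec d → ℝ × Vec d → ℝ}
    (hM : MajorantFlow l L Θ ψ) (hF : Majorized s S l K e₀ A₀ Θ F)
    (hF' : Majorized s S l K e A Θ F') (hG : Majorized s S l K e' B Θ G)
    (he₀ : 0 < e₀) (he1₀ : e₀ ≤ 1) (he : 0 < e) (he1 : e ≤ 1) (he' : 0 < e') (he1' : e' ≤ 1)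
    (u : ℝ) (q : ℝ × Vec d) (hd : ∀ m z, HasFDerivAt (fun z => F (u, z) m) (F' (u, z) m) z)
    (z : Vec d) :
    HasFDerivAt (fun z => ∫ m, G m q • F (u, z) m) (∫ m, G m q • F' (u, z) m) z := by
  refine hasFDerivAt_integral_prod_of_dominated
    (fun z => (hF.stronglyMeasurable_smul hG (u, z) q).measurable)
    (fun z => hF.integrable_smul hM hG he₀ he1₀ he' he1' (u, z) q)
    (fun z => hF'.stronglyMeasurable_smul hG (u, z) q)
    ((integrable_rpow_mul_rpow_indicator he he1 he' he1' u q.1).const_mul _)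
    (hF'.slice_const_nonneg hM hG u q.1)
    (fun z => hF'.lintegral_smul_slice_le_const hM hG z q.2) (fun r => ?_)
    (fun m z => (hd m z).fun_const_smul _) z
  refine ⟨_, ((hG.integrable_right hM q r).norm.mul_const (A * (Real.exp (K * (r - u)) *
    |r - u| ^ (e - 1) * |r - u| ^ (-(d : ℝ) / 2)))), fun z w => ?_⟩
  rw [norm_smul]
  exact mul_le_mul_of_nonneg_left (hF'.norm_le_const hM.rate_pos.le z w) (norm_nonneg _)

end MajorizedKernels

section ContractingKernels

/-- A kernel dominated by a Gaussian majorant that contracts under composition. -/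
structure ContractingKernel {d : ℕ} (s S l K e B : ℝ) (Θ : ℝ → Vec d → Vec d)
    (H : ℝ × Vec d → ℝ × Vec d → ℝ) : Prop where
  measurable : Measurable (Function.uncurry H)
  const_pos : 0 < B
  abs_le : ∀ p q, |H p q| ≤ B * majorant d s S l K e Θ p q
  contraction : ∀ p q, ∫⁻ m, ENNReal.ofReal (B * majorant d s S l K e Θ p m) *
      ENNReal.ofReal (B * majorant d s S l K e Θ m q)
    ≤ ENNReal.ofReal (B * majorant d s S l K e Θ p q / 2)

namespace ContractingKernel

variable {d : ℕ} {s S l K e B L : ℝ} {Θ ψ : ℝ → Vec d → Vec d} {H : ℝ × Vec d → ℝ × Vec d → ℝ}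

lemma majorant_nonneg (h : ContractingKernel s S l K e B Θ H) (p q : ℝ × Vec d) :
    0 ≤ B * majorant d s S l K e Θ p q :=
  mul_nonneg h.const_pos.le (_root_.majorant_nonneg p q)

lemma majorized (h : ContractingKernel s S l K e B Θ H) : Majorized s S l K e B Θ H :=
  ⟨h.measurable.stronglyMeasurable, h.const_pos.le, h.abs_le⟩

lemma majorized_iterKernel (h : ContractingKernel s S l K e B Θ H) (n : ℕ) :
    Majorized s S l K e ((1 / 2) ^ n * B) Θ (iterKernel volume H n) := by
  have hB := h.const_pos
  refine ⟨(measurable_iterKernel h.measurable n).stronglyMeasurable, by positivity,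
    fun p q => ?_⟩
  rw [mul_assoc]
  exact abs_iterKernel_le h.measurable h.majorant_nonneg h.abs_le h.contraction n p q

lemma majorized_seriesKernel (h : ContractingKernel s S l K e B Θ H) :
    Majorized s S l K e (2 * B) Θ (seriesKernel volume H) := by
  have hB := h.const_pos
  refine ⟨(measurable_seriesKernel h.measurable h.majorant_nonneg h.abs_le
    h.contraction).stronglyMeasurable, by positivity, fun p q => ?_⟩
  rw [mul_assoc]
  exact abs_seriesKernel_le h.measurable h.majorant_nonneg h.abs_le h.contraction p q

lemma seriesKernel_eq (h : ContractingKernel s S l K e B Θ H) (p q : ℝ × Vec d) :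
    seriesKernel volume H p q = H p q + ∫ m, seriesKernel volume H m q • H p m := by
  rw [_root_.seriesKernel_eq h.measurable h.majorant_nonneg h.abs_le h.contraction p q]
  simp only [smul_eq_mul, mul_comm]

lemma continuous_iterKernel (h : ContractingKernel s S l K e B Θ H) (hM : MajorantFlow l L Θ ψ)
    (he : 0 < e) (he1 : e ≤ 1) (hc : ∀ m t, Continuous fun y => H m (t, y)) (n : ℕ)
    (p : ℝ × Vec d) (t : ℝ) : Continuous fun y => iterKernel volume H n p (t, y) := by
  induction n generalizing p with
  | zero => exact hc p t
  | succ n ih =>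
    simp only [iterKernel]
    simpa only [smul_eq_mul, mul_comm] using h.majorized.continuous_comp_right hM
      (h.majorized_iterKernel n) he he1 he he1 p t ih

lemma continuous_seriesKernel (h : ContractingKernel s S l K e B Θ H)
    (hM : MajorantFlow l L Θ ψ) (he : 0 < e) (he1 : e ≤ 1)
    (hc : ∀ m t, Continuous fun y => H m (t, y)) (p : ℝ × Vec d) (t : ℝ) :
    Continuous fun y => seriesKernel volume H p (t, y) := by
  refine continuous_tsum (u := fun n => (1 / 2 : ℝ) ^ n * (B * (Real.exp (K * (t - p.1)) *
    |t - p.1| ^ (e - 1) * |t - p.1| ^ (-(d : ℝ) / 2))))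
    (fun n => h.continuous_iterKernel hM he he1 hc n p t)
    (summable_geometric_two.mul_right _) (fun n y => ?_)
  rw [← mul_assoc]
  exact (h.majorized_iterKernel n).norm_le_const hM.rate_pos.le p.2 y

end ContractingKernel

lemma majorant_add_exponent_le {d : ℕ} {s S l K e e' T : ℝ} {Θ : ℝ → Vec d → Vec d} (he' : 0 ≤ e')
    (hT : S - s ≤ T) (p q : ℝ × Vec d) :
    majorant d s S l K (e + e') Θ p q ≤ T ^ e' * majorant d s S l K e Θ p q := by
  by_cases h : s ≤ p.1 ∧ p.1 < q.1 ∧ q.1 ≤ S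
  · have hpos : 0 < q.1 - p.1 := sub_pos.2 h.2.1
    rw [majorant_of_mem h, majorant_of_mem h, show e + e' - 1 = e' + (e - 1) by ring,
      Real.rpow_add hpos]
    have h1 : (q.1 - p.1) ^ e' ≤ T ^ e' :=
      Real.rpow_le_rpow hpos.le (by linarith [h.1, h.2.2]) he'
    have h2 := gaussk_nonneg (d := d) (l := l) hpos.le (Θ p.1 p.2 - Θ q.1 q.2)
    calc _ = (q.1 - p.1) ^ e' * (Real.exp (K * (q.1 - p.1)) * (q.1 - p.1) ^ (e - 1) *
          gaussk d l (q.1 - p.1) (Θ p.1 p.2 - Θ q.1 q.2)) := by ring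
      _ ≤ _ := by gcongr
  · rw [majorant_of_not_mem h, majorant_of_not_mem h, mul_zero]

end ContractingKernels

section TransitionKernel

/-- The parametrix series for the transition density. -/
def transitionKernel (d : ℕ) (s S : ℝ) (a : ℝ → Vec d → Matrix (Fin d) (Fin d) ℝ)
    (b b₁ Θ ψ : ℝ → Vec d → Vec d) (p q : ℝ × Vec d) : ℝ :=
  frozenKernel d s S a Θ ψ 0 p q +
    ∫ m, seriesKernel volume (parametrixKernel d s S a b b₁ Θ ψ 0) m q •
      frozenKernel d s S a Θ ψ 0 p m

/-- The gradient of `transitionKernel` in the backward variable. -/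
def transitionGradient (d : ℕ) (s S : ℝ) (a : ℝ → Vec d → Matrix (Fin d) (Fin d) ℝ)
    (b b₁ Θ ψ : ℝ → Vec d → Vec d) (p q : ℝ × Vec d) : Vec d →L[ℝ] ℝ :=
  frozenGradient d s S a Θ ψ 0 p q +
    ∫ m, seriesKernel volume (parametrixKernel d s S a b b₁ Θ ψ 0) m q •
      frozenGradient d s S a Θ ψ 0 p m

namespace DiffusionData

variable {d : ℕ} {κ α c L T s S B K : ℝ} {a : ℝ → Vec d → Matrix (Fin d) (Fin d) ℝ}
  {b b₁ Θ ψ : ℝ → Vec d → Vec d}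

lemma majorantFlow (h : DiffusionData d κ α c L T s S a b b₁ Θ ψ) :
    MajorantFlow (1 / (4 * κ) / L ^ 2) L Θ ψ := by
  have hκ := zero_lt_one.trans_le h.constants.one_le_ellipticity
  have hL := zero_lt_one.trans_le h.constants.one_le_lip
  exact ⟨by positivity, hL.le, h.flow.continuous_inv.measurable, h.flow.lip_flow, h.flow.flow_inv⟩

lemma majorized_frozenKernel (h : DiffusionData d κ α c L T s S a b b₁ Θ ψ) (hK : 0 ≤ K) :
    Majorized s S (1 / (4 * κ) / L ^ 2) K 1 (κ ^ ((d : ℝ) / 2)) Θ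
      (frozenKernel d s S a Θ ψ 0) := by
  have hκ := zero_lt_one.trans_le h.constants.one_le_ellipticity
  exact ⟨(h.measurable_frozenKernel 0).stronglyMeasurable, by positivity,
    h.abs_frozenKernel_le_majorant hK⟩

lemma continuous_transitionKernel (h : DiffusionData d κ α c L T s S a b b₁ Θ ψ) (hK : 0 ≤ K)
    (hH : ContractingKernel s S (1 / (4 * κ) / L ^ 2) K (α / 4) B Θ
      (parametrixKernel d s S a b b₁ Θ ψ 0)) (p : ℝ × Vec d) (t : ℝ) :
    Continuous fun y => transitionKernel d s S a b b₁ Θ ψ p (t, y) := by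
  have hα := h.constants.exponent_pos
  have hα1 := h.constants.exponent_le
  refine Continuous.add (continuous_iff_continuousAt.2 fun y => ?_)
    ((h.majorized_frozenKernel hK).continuous_comp_right h.majorantFlow hH.majorized_seriesKernel
      one_pos le_rfl (by linarith) (by linarith) p t
      fun m => hH.continuous_seriesKernel h.majorantFlow (by linarith) (by linarith)
        (fun m t => continuous_iff_continuousAt.2 fun y => ?_) m t)
  · exact h.tendsto_frozenKernel p.1 t tendsto_const_nhds le_rfl tendsto_const_nhds
      Filter.tendsto_id
  · exact h.tendsto_parametrixKernel m.1 t m.2 tendsto_const_nhds le_rfl Filter.tendsto_id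

lemma hasFDerivAt_transitionKernel (h : DiffusionData d κ α c L T s S a b b₁ Θ ψ) (hK : 0 ≤ K)
    (hH : ContractingKernel s S (1 / (4 * κ) / L ^ 2) K (α / 4) B Θ
      (parametrixKernel d s S a b b₁ Θ ψ 0)) {A : ℝ}
    (hG : Majorized s S (1 / (4 * κ) / L ^ 2) K (1 / 2) A Θ (frozenGradient d s S a Θ ψ 0))
    (u : ℝ) (q : ℝ × Vec d) (z : Vec d) :
    HasFDerivAt (fun z => transitionKernel d s S a b b₁ Θ ψ (u, z) q)
      (transitionGradient d s S a b b₁ Θ ψ (u, z) q) z := by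
  have hα := h.constants.exponent_pos
  have hα1 := h.constants.exponent_le
  exact (h.hasFDerivAt_frozenKernel u q z).add
    ((h.majorized_frozenKernel hK).hasFDerivAt_comp h.majorantFlow hG hH.majorized_seriesKernel
      one_pos le_rfl (by norm_num) (by norm_num) (by linarith) (by linarith) u q
      (fun m z => h.hasFDerivAt_frozenKernel u m z) z)

lemma contDiff_transitionKernel (h : DiffusionData d κ α c L T s S a b b₁ Θ ψ) (hK : 0 ≤ K)
    (hH : ContractingKernel s S (1 / (4 * κ) / L ^ 2) K (α / 4) B Θ
      (parametrixKernel d s S a b b₁ Θ ψ 0)) {A : ℝ}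
    (hG : Majorized s S (1 / (4 * κ) / L ^ 2) K (1 / 2) A Θ (frozenGradient d s S a Θ ψ 0))
    (u : ℝ) (q : ℝ × Vec d) :
    ContDiff ℝ 1 fun z => transitionKernel d s S a b b₁ Θ ψ (u, z) q := by
  have hα := h.constants.exponent_pos
  have hα1 := h.constants.exponent_le
  have hd := h.hasFDerivAt_transitionKernel hK hH hG u q
  rw [contDiff_one_iff_fderiv]
  refine ⟨fun z => (hd z).differentiableAt, ?_⟩
  rw [funext fun z => (hd z).fderiv]
  have hc : ∀ m : ℝ × Vec d, Continuous fun z => frozenGradient d s S a Θ ψ 0 (u, z) m :=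
    fun m => continuous_iff_continuousAt.2 fun z =>
      h.tendsto_frozenGradient u m.1 tendsto_const_nhds le_rfl Filter.tendsto_id tendsto_const_nhds
  exact (hc q).add (hG.continuous_comp_left h.majorantFlow hH.majorized_seriesKernel
    (by norm_num) (by norm_num) (by linarith) (by linarith) u q hc)

end DiffusionData

lemma norm_transitionGradient_le (d : ℕ) {κ α c L T : ℝ} (hC : AdmissibleConstants κ α c L T)
    {B K : ℝ} (hB : 0 < B) (hK : 0 ≤ K) :
    ∃ C : ℝ, 1 ≤ C ∧ ∀ s S a b b₁ Θ ψ, DiffusionData d κ α c L T s S a b b₁ Θ ψ →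
      ContractingKernel s S (1 / (4 * κ) / L ^ 2) K (α / 4) B Θ
        (parametrixKernel d s S a b b₁ Θ ψ 0) →
      (∃ A, Majorized s S (1 / (4 * κ) / L ^ 2) K (1 / 2) A Θ (frozenGradient d s S a Θ ψ 0)) ∧
      ∀ p q, ‖transitionGradient d s S a b b₁ Θ ψ p q‖ ≤
        C * majorant d s S (1 / (4 * κ) / L ^ 2) K (1 / 2) Θ p q := by
  obtain ⟨C₀, hC₀, hgrad⟩ := DiffusionData.norm_frozenGradient_le_majorant d hC
  have hα := hC.exponent_pos
  have hα1 := hC.exponent_le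
  have hκ := zero_lt_one.trans_le hC.one_le_ellipticity
  have hL := zero_lt_one.trans_le hC.one_le_lip
  have hT := hC.time_pos
  set D := C₀ * (2 * B) * (L ^ d * (Real.pi / (1 / (4 * κ) / L ^ 2)) ^ ((d : ℝ) / 2) *
    (2 * (1 / (1 / 2) + 1 / (α / 4)))) with hD
  have hDpos : 0 ≤ D := by positivity
  refine ⟨C₀ + D * T ^ (α / 4), by nlinarith [mul_nonneg hDpos (Real.rpow_nonneg hT.le (α / 4))],
    fun s S a b b₁ Θ ψ h hH => ?_⟩
  have hG : Majorized s S (1 / (4 * κ) / L ^ 2) K (1 / 2) C₀ Θ (frozenGradient d s S a Θ ψ 0) :=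
    ⟨(h.measurable_frozenGradient 0).stronglyMeasurable, by linarith,
      hgrad s S a b b₁ Θ ψ h K hK⟩
  refine ⟨⟨C₀, hG⟩, fun p q => ?_⟩
  have h1 := (hG.comp h.majorantFlow hH.majorized_seriesKernel (by norm_num) (by norm_num)
    (by linarith) (by linarith)).norm_le p q
  refine (norm_add_le _ _).trans ?_
  rw [add_mul, mul_assoc]
  exact add_le_add (hG.norm_le p q) (h1.trans (mul_le_mul_of_nonneg_left
    (majorant_add_exponent_le (by linarith) h.length_le p q) hDpos))

end TransitionKernel

lemma genForm_add_coeff {d : ℕ} (β β' : Vec d) (A A' : Matrix (Fin d) (Fin d) ℝ) (f₁ : Fin d → ℝ)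
    (f₂ : Fin d → Fin d → ℝ) :
    genForm (β + β') (A + A') f₁ f₂ = genForm β A f₁ f₂ + genForm β' A' f₁ f₂ := by
  simp only [genForm, PiLp.add_apply, Matrix.add_apply, add_mul, Finset.sum_add_distrib]
  ring

lemma ForwardEq.weaken {d : ℕ} {Ω : Type*} [MeasurableSpace Ω] {c c' : ℝ} {B : ℝ → Vec d → Vec d}
    {A : ℝ → Vec d → Matrix (Fin d) (Fin d) ℝ} {u : ℝ} {μ : Measure Ω} {Y : ℝ → Ω → Vec d}
    (h : ForwardEq c B A u μ Y) (hc : c ≤ c') : ForwardEq c' B A u μ Y where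
  finite := h.finite
  measurable_drift := h.measurable_drift
  measurable_diff := h.measurable_diff
  measurable_path := h.measurable_path
  continuous_path := h.continuous_path
  growth_nonneg := h.growth_nonneg.trans hc
  drift_le r z := (h.drift_le r z).trans (mul_le_mul_of_nonneg_right hc (by positivity))
  diff_le r z i j := (h.diff_le r z i j).trans hc
  forward := h.forward

namespace DiffusionData

variable {d : ℕ} {κ α c L T s S : ℝ} {a : ℝ → Vec d → Matrix (Fin d) (Fin d) ℝ}
  {b b₁ Θ ψ : ℝ → Vec d → Vec d} {u t v ε : ℝ}

lemma exists_norm_flow_le (h : DiffusionData d κ α c L T s S a b b₁ Θ ψ) (u t : ℝ) (w : Vec d) :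
    ∃ R : ℝ, 0 ≤ R ∧ ∀ r ∈ Icc u t, ‖ψ r w‖ ≤ R := by
  have hc : Continuous fun r => ψ r w :=
    h.flow.continuous_flow.comp (continuous_id.prodMk continuous_const)
  obtain ⟨R, hR⟩ := (isCompact_Icc (a := u) (b := t)).exists_bound_of_continuousOn hc.continuousOn
  exact ⟨max R 0, le_max_right _ _, fun r hr => (hR r hr).trans (le_max_left _ _)⟩

lemma measurable_flowDrift_flow (h : DiffusionData d κ α c L T s S a b b₁ Θ ψ) (w : Vec d) :
    Measurable fun r => b₁ r (ψ r w) :=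
  h.measurable_flowDrift.comp (measurable_id.prodMk
    (h.flow.continuous_flow.measurable.comp (measurable_id.prodMk measurable_const)))

lemma flowCov_sub (h : DiffusionData d κ α c L T s S a b b₁ Θ ψ) (r r' t : ℝ) (w : Vec d)
    (i j : Fin d) : flowCov a ψ r t w i j - flowCov a ψ r' t w i j =
      ∫ ρ in r..r', a ρ (ψ ρ w) i j := by
  simp only [flowCov, Matrix.of_apply]
  rw [intervalIntegral.integral_interval_sub_interval_comm
    (h.intervalIntegrable_diff_flow w i j _ _) (h.intervalIntegrable_diff_flow w i j _ _)
    (h.intervalIntegrable_diff_flow w i j _ _)]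
  simp

lemma abs_flowCov_sub_le (h : DiffusionData d κ α c L T s S a b b₁ Θ ψ) (r r' t : ℝ) (w : Vec d)
    (i j : Fin d) : |flowCov a ψ r t w i j - flowCov a ψ r' t w i j| ≤ κ * |r - r'| := by
  rw [h.flowCov_sub, ← Real.norm_eq_abs, abs_sub_comm]
  exact intervalIntegral.norm_integral_le_of_norm_le_const fun ρ _ => h.abs_diff_le ρ _ i j

lemma continuous_flowCov_left (h : DiffusionData d κ α c L T s S a b b₁ Θ ψ) (t : ℝ) (w : Vec d)
    (i j : Fin d) : Continuous fun r => flowCov a ψ r t w i j := by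
  have : LipschitzWith κ.toNNReal fun r => flowCov a ψ r t w i j :=
    LipschitzWith.of_dist_le_mul fun r r' => by
      rw [Real.dist_eq, Real.dist_eq]
      exact (h.abs_flowCov_sub_le r r' t w i j).trans
        (mul_le_mul_of_nonneg_right (Real.le_coe_toNNReal _) (abs_nonneg _))
  exact this.continuous

lemma intervalIntegrable_flowDrift_flow (h : DiffusionData d κ α c L T s S a b b₁ Θ ψ) (hut : u ≤ t)
    (w : Vec d) : IntervalIntegrable (fun ρ => b₁ ρ (ψ ρ w)) volume u t := by
  obtain ⟨R, hR0, hR⟩ := h.exists_norm_flow_le u t w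
  have hc := h.constants.one_le_growth
  refine (intervalIntegrable_const (c := c * (1 + R))).mono_fun'
    (h.measurable_flowDrift_flow w).aestronglyMeasurable ?_
  refine (ae_restrict_iff' measurableSet_uIoc).2 (Filter.Eventually.of_forall fun ρ hρ => ?_)
  rw [uIoc_of_le hut] at hρ
  refine (h.flowDrift_le _ _).trans ?_
  have := hR ρ (Ioc_subset_Icc_self hρ)
  simp only
  gcongr

/-- The frozen Gaussian densities solve the backward equation with frozen coefficients. -/
lemma gaussDens_flow_sub (h : DiffusionData d κ α c L T s S a b b₁ Θ ψ) (hu : s ≤ u) (hut : u ≤ t)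
    (htv : t ≤ v)
    (hv : v ≤ S) (hε : 0 < ε) (w z : Vec d) :
    gaussDens (flowCov a ψ t v w + ε • 1) (z - ψ t w) -
      gaussDens (flowCov a ψ u v w + ε • 1) (z - ψ u w) =
      ∫ ρ in u..t, genForm (-b₁ ρ (ψ ρ w)) (-a ρ (ψ ρ w))
        (gaussDens₁ (flowCov a ψ ρ v w + ε • 1) (z - ψ ρ w))
        (gaussDens₂ (flowCov a ψ ρ v w + ε • 1) (z - ψ ρ w)) := by
  have hκ := h.constants.one_le_ellipticity
  have hc := h.constants.one_le_growth
  obtain ⟨R, hR0, hR⟩ := h.exists_norm_flow_le u t w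
  have hell : ∀ r ∈ Icc u t, IsElliptic κ (v - r + ε) (flowCov a ψ r v w + ε • 1) := fun r hr =>
    h.isElliptic_flowCov_add (hr.2.trans htv) hε.le w
  have hpos : ∀ r ∈ Icc u t, 0 < v - r + ε := fun r hr => by linarith [hr.2]
  have hi := h.intervalIntegrable_flowDrift_flow hut w
  have hψ : ∀ r ∈ Icc u t, ∀ r' ∈ Icc u t, ‖ψ r w - ψ r' w‖ ≤ c * (1 + R) * |r - r'| := by
    have key : ∀ r ∈ Icc u t, ∀ r' ∈ Icc u t, r ≤ r' →
        ‖ψ r w - ψ r' w‖ ≤ c * (1 + R) * |r - r'| := fun r hr r' hr' hrr => by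
      rw [norm_sub_rev, h.flow.ode r r' w (hu.trans hr.1) hrr ((hr'.2.trans htv).trans hv), abs_sub_comm]
      refine intervalIntegral.norm_integral_le_of_norm_le_const fun ρ hρ => ?_
      rw [uIoc_of_le hrr] at hρ
      refine (h.flowDrift_le _ _).trans ?_
      have := hR ρ ⟨hr.1.trans hρ.1.le, hρ.2.trans hr'.2⟩
      gcongr
    intro r hr r' hr'
    rcases le_total r r' with hrr | hrr
    · exact key r hr r' hr' hrr
    · rw [norm_sub_rev, abs_sub_comm]
      exact key r' hr' r hr hrr
  obtain ⟨K', hK'⟩ := exists_lipschitzOnWith_gaussDens (u := u) (t := t)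
    (K := max κ (c * (1 + R))) (B := fun r => flowCov a ψ r v w + ε • 1)
    (m := fun r => z - ψ r w) (fun r hr => (hell r hr).det_pos hκ (hpos r hr))
    (fun r _ r' _ i j => by
      simp only [Matrix.add_apply, add_sub_add_right_eq_sub]
      exact (h.abs_flowCov_sub_le r r' v w i j).trans
        (mul_le_mul_of_nonneg_right (le_max_left _ _) (abs_nonneg _)))
    fun r hr r' hr' => by
      rw [sub_sub_sub_cancel_left, norm_sub_rev]
      exact (hψ r hr r' hr').trans (mul_le_mul_of_nonneg_right (le_max_right _ _) (abs_nonneg _))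
  rw [← uIcc_of_le hut] at hK'
  rw [← hK'.absolutelyContinuousOnInterval.integral_deriv_eq_sub]
  refine intervalIntegral.integral_congr_ae ?_
  have e1 : ∀ i j, ∀ᵐ r, r ∈ uIcc u t → HasDerivAt (fun x => flowCov a ψ x v w i j)
      (-a r (ψ r w) i j) r := fun i j => by
    filter_upwards [(h.intervalIntegrable_diff_flow w i j u t).ae_hasDerivAt_integral] with r hr hrm
    have h2 := (hr hrm u left_mem_uIcc).const_sub (flowCov a ψ u v w i j)
    refine h2.congr_of_eventuallyEq (Filter.Eventually.of_forall fun x => ?_)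
    have := h.flowCov_sub u x v w i j
    simp only
    linarith
  have e2 : ∀ᵐ r, r ∈ Ioo u t → HasDerivAt (fun x => ψ x w) (b₁ r (ψ r w)) r := by
    filter_upwards [hi.ae_hasDerivAt_integral] with r hr hrm
    have hrm' : r ∈ uIcc u t := by rw [uIcc_of_le hut]; exact Ioo_subset_Icc_self hrm
    refine ((hr hrm' u left_mem_uIcc).const_add (ψ u w)).congr_of_eventuallyEq ?_
    filter_upwards [Ioo_mem_nhds hrm.1 hrm.2] with x hx
    rw [← h.flow.ode u x w hu hx.1.le ((hx.2.le.trans htv).trans hv)]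
    abel
  have e3 : ∀ᵐ r, r ≠ t := by simp [ae_iff, measure_singleton]
  filter_upwards [ae_all_iff.2 fun i => ae_all_iff.2 fun j => e1 i j, e2, e3] with r h1 h2 h3 hr
  rw [uIoc_of_le hut] at hr
  have hr' : r ∈ Icc u t := Ioc_subset_Icc_self hr
  have hr'' : r ∈ uIcc u t := by rwa [uIcc_of_le hut]
  have key := hasDerivAt_gaussDens (B := fun r => flowCov a ψ r v w + ε • 1)
    (m := fun r => z - ψ r w) (B' := -a r (ψ r w)) (m' := -b₁ r (ψ r w)) (r := r)
    (fun i j => by simpa using (h1 i j hr'').add_const ((ε • (1 : Matrix (Fin d) (Fin d) ℝ)) i j))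
    ((hell r hr').det_pos hκ (hpos r hr')) ((hell r hr').inv_symm)
    ((h2 ⟨hr.1, lt_of_le_of_ne hr.2 h3⟩).const_sub z)
  rw [key.deriv, genForm]
  simp only [PiLp.neg_apply, Matrix.neg_apply]
  ring

/-- Dynkin's formula along the regularised frozen densities. -/
lemma integral_frozen_eq {Ω : Type*} [MeasurableSpace Ω] {c' : ℝ} {μ : Measure Ω}
    {Y : ℝ → Ω → Vec d} (h : DiffusionData d κ α c L T s S a b b₁ Θ ψ)
    (hY : ForwardEq c' b a u μ Y) (hu : s ≤ u) (hut : u < t) (ht : t ≤ S) (hε : 0 < ε) (y : Vec d) :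
    ∫ ω, gaussDens (ε • 1) (Y t ω - y) ∂μ
        - ∫ ω, frozenKernel d s S a Θ ψ ε (u, Y u ω) (t, y) ∂μ =
      ∫ ρ in u..t, ∫ ω, parametrixKernel d s S a b b₁ Θ ψ ε (ρ, Y ρ ω) (t, y) ∂μ := by
  have hκ := h.constants.one_le_ellipticity
  have hc := h.constants.one_le_growth
  have hκ0 : 0 < κ := by linarith
  set w := Θ t y with hw
  set φ := clampTime u t with hφ
  have hφm : ∀ r, φ r ∈ Icc u t := clampTime_mem hut.le
  have hφe : ∀ r ∈ Icc u t, φ r = r := fun r hr => clampTime_eq hr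
  have hφc : Continuous φ := continuous_clampTime u t
  set V : ℝ → Matrix (Fin d) (Fin d) ℝ := fun r => flowCov a ψ (φ r) t w + ε • 1 with hV
  set m : ℝ → Vec d := fun r => ψ (φ r) w with hm
  obtain ⟨R, hR0, hR⟩ := h.exists_norm_flow_le u t w
  have hell : ∀ r, IsElliptic κ (t - φ r + ε) (V r) := fun r =>
    h.isElliptic_flowCov_add (hφm r).2 hε.le w
  have hτ : ∀ r, ε ≤ t - φ r + ε := fun r => by linarith [(hφm r).2]
  have hpos : ∀ r, 0 < t - φ r + ε := fun r => hε.trans_le (hτ r)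
  have hVc : ∀ i j, Continuous fun p : ℝ × Vec d => V p.1 i j := fun i j => by
    simp only [hV, Matrix.add_apply]
    exact ((h.continuous_flowCov_left t w i j).comp (hφc.comp continuous_fst)).add continuous_const
  have hmc : Continuous fun p : ℝ × Vec d => p.2 - m p.1 :=
    continuous_snd.sub (h.flow.continuous_flow.comp
      ((hφc.comp continuous_fst).prodMk continuous_const))
  obtain ⟨C₁, hC₁, k₁⟩ := gaussDens₁_weighted d hκ (p := 0) le_rfl
  obtain ⟨C₁', hC₁', k₁'⟩ := gaussDens₁_weighted d hκ (p := 1) zero_le_one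
  obtain ⟨C₂, hC₂, k₂⟩ := gaussDens₂_weighted d hκ (p := 0) le_rfl
  set D := ε ^ (-(d : ℝ) / 2) with hD
  have hD0 : 0 ≤ D := by positivity
  have hg : ∀ l r z, 0 ≤ l → gaussk d l (t - φ r + ε) z ≤ D := fun l r z hl =>
    (gaussk_le_rpow hl (hpos r).le z).trans (Real.rpow_le_rpow_of_nonpos hε (hτ r)
      (div_nonpos_of_nonpos_of_nonneg (by simp) (by norm_num)))
  have hl2 : 0 ≤ 1 / (2 * κ) := by positivity
  have hl4 : 0 ≤ 1 / (4 * κ) := by positivity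
  have f₀ : ∀ r z, |gaussDens (V r) (z - m r)| ≤ κ ^ ((d : ℝ) / 2) * D := fun r z => by
    rw [abs_of_nonneg (gaussDens_nonneg _ _)]
    refine (gaussDens_le (hell r) hκ (hpos r) _).trans ?_
    gcongr
    exact hg _ _ _ hl2
  have f₁ : ∀ r z i, |gaussDens₁ (V r) (z - m r) i| ≤ C₁ * ε ^ (((0 : ℝ) - 1) / 2) * D :=
    fun r z i => by
      have := k₁ _ _ (hpos r) (hell r) (z - m r) i
      rw [Real.rpow_zero, one_mul] at this
      refine this.trans ?_
      have h1 := Real.rpow_le_rpow_of_nonpos hε (hτ r) (by norm_num : ((0 : ℝ) - 1) / 2 ≤ 0)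
      have h2 := hg _ r (z - m r) hl4
      have h3 := gaussk_nonneg (d := d) (l := 1 / (4 * κ)) (hpos r).le (z - m r)
      gcongr
  have f₁' : ∀ r z i, ‖z - m r‖ * |gaussDens₁ (V r) (z - m r) i| ≤ C₁' * D := fun r z i => by
    have := k₁' _ _ (hpos r) (hell r) (z - m r) i
    rw [Real.rpow_one, sub_self, zero_div, Real.rpow_zero, mul_one] at this
    refine this.trans ?_
    gcongr
    exact hg _ _ _ hl4
  have f₂ : ∀ r z i j, |gaussDens₂ (V r) (z - m r) i j| ≤ C₂ * ε ^ ((0 : ℝ) / 2 - 1) * D :=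
    fun r z i j => by
      have := k₂ _ _ (hpos r) (hell r) (z - m r) i j
      rw [Real.rpow_zero, one_mul] at this
      refine this.trans ?_
      have h1 := Real.rpow_le_rpow_of_nonpos hε (hτ r) (by norm_num : ((0 : ℝ) / 2 - 1) ≤ 0)
      have h2 := hg _ r (z - m r) hl4
      have h3 := gaussk_nonneg (d := d) (l := 1 / (4 * κ)) (hpos r).le (z - m r)
      gcongr
  set M₁ := (1 + R) * (C₁ * ε ^ (((0 : ℝ) - 1) / 2) * D) + C₁' * D with hM₁
  have hM₁0 : 0 ≤ M₁ := by positivity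
  set M₀ := κ ^ ((d : ℝ) / 2) * D with hM₀
  have hM₀0 : 0 ≤ M₀ := by positivity
  set M₂ := C₂ * ε ^ ((0 : ℝ) / 2 - 1) * D with hM₂
  have hM₂0 : 0 ≤ M₂ := by positivity
  set c'' := max c' (max κ (c * (1 + R))) with hc''
  have hmb : ∀ r, ‖m r‖ ≤ R := fun r => hR _ (hφm r)
  have key := (hY.weaken (le_max_left c' (max κ (c * (1 + R))))).forward_of_time_dependent
    (F := fun r z => gaussDens (V r) (z - m r)) (F₁ := fun r z => gaussDens₁ (V r) (z - m r))
    (F₂ := fun r z => gaussDens₂ (V r) (z - m r)) (β := fun r => -b₁ (φ r) (m r))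
    (a := fun r => -a (φ r) (m r)) (M := M₀ + M₁ + M₂) hut.le
    (fun r => (contDiff_gaussDens _).comp (contDiff_id.sub contDiff_const))
    (fun r => (HasPartials.gaussDens (hell r).inv_symm).comp_sub _)
    (fun r z => (f₀ r z).trans (by linarith))
    (fun r z i => by
      have e1 := f₁ r z i
      have e2 := f₁' r z i
      have e3 : ‖z‖ ≤ ‖z - m r‖ + R := by
        have := norm_add_le (z - m r) (m r)
        rw [sub_add_cancel] at this
        exact this.trans (by linarith [hmb r])
      have e4 := abs_nonneg (gaussDens₁ (V r) (z - m r) i)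
      have e5 := mul_le_mul_of_nonneg_right e3 e4
      have e6 : (1 + R) * |gaussDens₁ (V r) (z - m r) i| ≤
        (1 + R) * (C₁ * ε ^ (((0 : ℝ) - 1) / 2) * D) := by gcongr
      nlinarith)
    (fun r z i j => (f₂ r z i j).trans (by linarith))
    (fun i => continuous_iff_continuousAt.2 fun p => tendsto_gaussDens₁
      (fun i j => (hVc i j).continuousAt) ((hell p.1).det_pos hκ (hpos p.1)) hmc.continuousAt i)
    (fun i j => continuous_iff_continuousAt.2 fun p => tendsto_gaussDens₂
      (fun i j => (hVc i j).continuousAt) ((hell p.1).det_pos hκ (hpos p.1)) hmc.continuousAt i j)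
    (((h.measurable_flowDrift_flow w).comp hφc.measurable).neg)
    (fun i j => ((h.measurable_diff_flow i j).comp
      (hφc.measurable.prodMk measurable_const)).neg)
    (fun r => by
      rw [norm_neg]
      refine (h.flowDrift_le _ _).trans (le_trans ?_
        ((le_max_right κ (c * (1 + R))).trans (le_max_right c' _)))
      have := hmb r
      gcongr)
    (fun r i j => by
      rw [Matrix.neg_apply, abs_neg]
      exact (h.abs_diff_le _ _ i j).trans ((le_max_left κ (c * (1 + R))).trans (le_max_right c' _)))
    (fun r r' z hur hrr hrt => by
      have := h.gaussDens_flow_sub (hu.trans hur) hrr hrt ht hε w z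
      simp only [hV, hm]
      rw [hφe r ⟨hur, hrr.trans hrt⟩, hφe r' ⟨hur.trans hrr, hrt⟩, this]
      refine intervalIntegral.integral_congr fun ρ hρ => ?_
      rw [uIcc_of_le hrr] at hρ
      simp only [hφe ρ ⟨hur.trans hρ.1, hρ.2.trans hrt⟩])
  have e0 : ∀ v : Vec d, flowCov a ψ t t v = 0 := fun v => by
    ext i j
    simp [flowCov]
  simp only [hV, hm, hφe t (right_mem_Icc.2 hut.le), hφe u (left_mem_Icc.2 hut.le), e0, zero_add,
    hw, h.flow.flow_inv] at key
  rw [← hw] at key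
  have e1 : ∀ ω, frozenKernel d s S a Θ ψ ε (u, Y u ω) (t, y) =
      gaussDens (flowCov a ψ u t w + ε • 1) (Y u ω - ψ u w) := fun ω => if_pos ⟨hu, hut, ht⟩
  simp only [e1]
  rw [key]
  refine intervalIntegral.integral_congr_ae ?_
  have e3 : ∀ᵐ r, r ≠ t := by simp [ae_iff, measure_singleton]
  filter_upwards [e3] with r hr hrm
  rw [uIoc_of_le hut.le] at hrm
  refine integral_congr_ae (Filter.Eventually.of_forall fun ω => ?_)
  simp only [hφe r (Ioc_subset_Icc_self hrm)]
  rw [parametrixKernel, if_pos ⟨hu.trans hrm.1.le, lt_of_le_of_ne hrm.2 hr, ht⟩,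
    sub_eq_add_neg (b _ _), sub_eq_add_neg (a _ _), genForm_add_coeff]

end DiffusionData

section ParameterIntegrals

variable {X Y : Type*} [MeasurableSpace X] [MeasurableSpace Y] {μ : Measure X} {ν : Measure Y}
  {f : Y → ℝ} {C : ℝ} {W : X → ℝ}

lemma integrable_prod_of_lintegral_le [SFinite ν] {F : X → Y → ℝ}
    (mF : Measurable (Function.uncurry F)) (hW : Integrable W μ)
    (hF : ∀ᵐ x ∂μ, ∫⁻ y, ‖F x y‖ₑ ∂ν ≤ ENNReal.ofReal (W x)) :
    Integrable (Function.uncurry F) (μ.prod ν) := by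
  refine ⟨mF.aestronglyMeasurable, ?_⟩
  rw [HasFiniteIntegral, lintegral_prod _ mF.enorm.aemeasurable]
  exact (lintegral_mono_ae hF).trans_lt hW.lintegral_lt_top

lemma integral_mul_integral_comm [SFinite μ] [SFinite ν] {F : X → Y → ℝ} (mf : Measurable f)
    (hf : ∀ y, |f y| ≤ C) (hF : Integrable (Function.uncurry F) (μ.prod ν)) :
    ∫ y, f y * ∫ x, F x y ∂μ ∂ν = ∫ x, ∫ y, f y * F x y ∂ν ∂μ := by
  have h1 : Integrable (fun p : X × Y => f p.2 * F p.1 p.2) (μ.prod ν) :=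
    hF.bdd_mul (mf.comp measurable_snd).aestronglyMeasurable
      (Filter.Eventually.of_forall fun p => hf p.2)
  rw [integral_integral_swap h1]
  simp only [integral_const_mul]

lemma integrable_mul_integral [SFinite μ] [SFinite ν] {F : X → Y → ℝ} (mf : Measurable f)
    (hf : ∀ y, |f y| ≤ C) (hF : Integrable (Function.uncurry F) (μ.prod ν)) :
    Integrable (fun y => f y * ∫ x, F x y ∂μ) ν :=
  (hF.integral_prod_right : Integrable (fun y => ∫ x, F x y ∂μ) ν).bdd_mul mf.aestronglyMeasurable
    (Filter.Eventually.of_forall hf)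

lemma abs_integral_mul_le_of_lintegral_le {g : Y → ℝ} {w : ℝ} (hC : 0 ≤ C)
    (hf : ∀ y, |f y| ≤ C) (hw : 0 ≤ w) (hg : ∫⁻ y, ‖g y‖ₑ ∂ν ≤ ENNReal.ofReal w) :
    |∫ y, f y * g y ∂ν| ≤ C * w := by
  rw [← Real.norm_eq_abs]
  refine norm_integral_le_of_lintegral_le (mul_nonneg hC hw) ?_
  rw [ENNReal.ofReal_mul hC]
  calc ∫⁻ y, ‖f y * g y‖ₑ ∂ν ≤ ∫⁻ y, ENNReal.ofReal C * ‖g y‖ₑ ∂ν := by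
        refine lintegral_mono fun y => ?_
        rw [enorm_mul, ← ofReal_norm (f y)]
        gcongr
        exact hf y
    _ = ENNReal.ofReal C * ∫⁻ y, ‖g y‖ₑ ∂ν := lintegral_const_mul' _ _ ENNReal.ofReal_ne_top
    _ ≤ _ := by gcongr

/-- Regularised averages converge to the average of the limits. -/
lemma tendsto_integral_mul_integral [SFinite μ] [SFinite ν] {F : ℝ → X → Y → ℝ} {V : X → ℝ}
    (mF : ∀ ε, Measurable (Function.uncurry (F ε))) (mf : Measurable f) (hC : 0 ≤ C)
    (hf : ∀ y, |f y| ≤ C) (hW : Integrable W μ) (hW0 : ∀ᵐ x ∂μ, 0 ≤ W x)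
    (hF : ∀ ε, 0 < ε → ε ≤ 1 → ∀ᵐ x ∂μ, ∫⁻ y, ‖F ε x y‖ₑ ∂ν ≤ ENNReal.ofReal (W x))
    (hV : ∀ᵐ x ∂μ, Filter.Tendsto (fun ε => ∫ y, f y * F ε x y ∂ν) (nhdsWithin 0 (Ioi 0))
      (nhds (V x))) :
    Filter.Tendsto (fun ε => ∫ y, f y * ∫ x, F ε x y ∂μ ∂ν) (nhdsWithin 0 (Ioi 0))
      (nhds (∫ x, V x ∂μ)) := by
  have hev : ∀ᶠ ε : ℝ in nhdsWithin 0 (Ioi 0), 0 < ε ∧ ε ≤ 1 := by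
    filter_upwards [Ioc_mem_nhdsGT one_pos] with ε hε using hε
  have hlim : Filter.Tendsto (fun ε => ∫ x, ∫ y, f y * F ε x y ∂ν ∂μ) (nhdsWithin 0 (Ioi 0))
      (nhds (∫ x, V x ∂μ)) := by
    refine tendsto_integral_filter_of_dominated_convergence (fun x => C * W x) ?_ ?_
      (hW.const_mul C) hV
    · refine Filter.Eventually.of_forall fun ε => ?_
      exact (((mf.comp measurable_snd).mul
        (mF ε)).stronglyMeasurable.integral_prod_right').aestronglyMeasurable
    · filter_upwards [hev] with ε hε
      filter_upwards [hF ε hε.1 hε.2, hW0] with x hx hx0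
      exact abs_integral_mul_le_of_lintegral_le hC hf hx0 hx
  refine hlim.congr' ?_
  filter_upwards [hev] with ε hε
  exact (integral_mul_integral_comm mf hf
    (integrable_prod_of_lintegral_le (mF ε) hW (hF ε hε.1 hε.2))).symm

/-- An identity of integrals against continuous test functions extends to measurable ones. -/
lemma integral_eq_of_forall_continuous {d : ℕ} {ν : Measure (Vec d)} [IsFiniteMeasure ν]
    {k : Vec d → ℝ} (hk : Integrable k)
    (h : ∀ f : Vec d → ℝ, Continuous f → (∃ C, ∀ x, |f x| ≤ C) → ∫ x, f x ∂ν = ∫ x, f x * k x)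
    {f : Vec d → ℝ} {C : ℝ} (mf : Measurable f) (hf : ∀ x, |f x| ≤ C) :
    ∫ x, f x ∂ν = ∫ x, f x * k x := by
  have hpos : Integrable fun x => max (k x) 0 := hk.pos_part
  have hneg : Integrable fun x => max (-k x) 0 := hk.neg_part
  set νp := (volume : Measure (Vec d)).withDensity fun x => ENNReal.ofReal (max (k x) 0) with hνp
  set νn := (volume : Measure (Vec d)).withDensity fun x => ENNReal.ofReal (max (-k x) 0) with hνn
  have : IsFiniteMeasure νp := isFiniteMeasure_withDensity_ofReal hpos.2
  have : IsFiniteMeasure νn := isFiniteMeasure_withDensity_ofReal hneg.2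
  have ip : ∀ g : Vec d → ℝ, ∫ x, g x ∂νp = ∫ x, g x * max (k x) 0 := fun g => by
    rw [hνp, integral_withDensity_eq_integral_toReal_smul₀ hpos.1.aemeasurable.ennreal_ofReal
      (Filter.Eventually.of_forall fun _ => ENNReal.ofReal_lt_top)]
    simp [ENNReal.toReal_ofReal', mul_comm]
  have im : ∀ g : Vec d → ℝ, ∫ x, g x ∂νn = ∫ x, g x * max (-k x) 0 := fun g => by
    rw [hνn, integral_withDensity_eq_integral_toReal_smul₀ hneg.1.aemeasurable.ennreal_ofReal
      (Filter.Eventually.of_forall fun _ => ENNReal.ofReal_lt_top)]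
    simp [ENNReal.toReal_ofReal', mul_comm]
  have hinteg : ∀ (g : Vec d → ℝ) (C : ℝ), Measurable g → (∀ x, |g x| ≤ C) →
      ∀ ν : Measure (Vec d), IsFiniteMeasure ν → Integrable g ν := fun g C mg hg ν _ =>
    .of_bound mg.aestronglyMeasurable C (Filter.Eventually.of_forall hg)
  have hsplit : ∀ (g : Vec d → ℝ) (C : ℝ), Measurable g → (∀ x, |g x| ≤ C) →
      ∫ x, g x * k x = ∫ x, g x ∂νp - ∫ x, g x ∂νn := fun g C mg hg => by
    rw [ip, im, ← integral_sub (hpos.bdd_mul mg.aestronglyMeasurable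
      (Filter.Eventually.of_forall hg)) (hneg.bdd_mul mg.aestronglyMeasurable
      (Filter.Eventually.of_forall hg))]
    refine integral_congr_ae (Filter.Eventually.of_forall fun x => ?_)
    simp only
    rw [← mul_sub]
    congr 1
    rcases le_total (k x) 0 with h | h
    · rw [max_eq_right h, max_eq_left (by linarith)]; ring
    · rw [max_eq_left h, max_eq_right (by linarith)]; ring
  have key : ν + νn = νp := by
    refine ext_of_forall_integral_eq_of_IsFiniteMeasure fun g => ?_
    have hg : ∀ x, |g x| ≤ ‖g‖ := g.norm_coe_le_norm
    have mg := g.continuous.measurable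
    rw [integral_add_measure (hinteg g _ mg hg _ inferInstance) (hinteg g _ mg hg _ inferInstance),
      h g g.continuous ⟨_, hg⟩, hsplit g _ mg hg]
    ring
  rw [hsplit f C mf hf, ← key, integral_add_measure (hinteg f _ mf hf _ inferInstance)
    (hinteg f _ mf hf _ inferInstance)]
  ring

end ParameterIntegrals

section DensityExpansion

lemma lintegral_enorm_gaussDens_smul_one_le {d : ℕ} {ε : ℝ} (hε : 0 < ε) (z : Vec d) :
    ∫⁻ y, ‖gaussDens (ε • (1 : Matrix (Fin d) (Fin d) ℝ)) (z - y)‖ₑ ≤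
      ENNReal.ofReal ((2 * Real.pi) ^ (-(d : ℝ) / 2) * (Real.pi / (1 / 2)) ^ ((d : ℝ) / 2)) := by
  have h0 : (0 : ℝ) ≤ (2 * Real.pi) ^ (-(d : ℝ) / 2) := by positivity
  rw [lintegral_sub_left_eq_self (fun y => ‖gaussDens (ε • (1 : Matrix (Fin d) (Fin d) ℝ)) y‖ₑ) z,
    ENNReal.ofReal_mul h0, ← lintegral_gaussk d (one_half_pos) hε,
    ← lintegral_const_mul' _ _ ENNReal.ofReal_ne_top]
  refine lintegral_mono fun y => ?_
  rw [gaussDens_smul_one hε, ← ENNReal.ofReal_mul h0, Real.enorm_of_nonneg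
    (mul_nonneg h0 (gaussk_nonneg hε.le y))]

namespace DiffusionData

variable {d : ℕ} {κ α c L T s S : ℝ} {a : ℝ → Vec d → Matrix (Fin d) (Fin d) ℝ}
  {b b₁ Θ ψ : ℝ → Vec d → Vec d}

lemma lintegral_gaussk_displacement_le (h : DiffusionData d κ α c L T s S a b b₁ Θ ψ) {l τ : ℝ}
    (hl : 0 < l) (hτ : 0 < τ) (u t : ℝ) (z : Vec d) :
    ∫⁻ y, ENNReal.ofReal (gaussk d l τ (z - ψ u (Θ t y))) ≤
      ENNReal.ofReal (L ^ d * (Real.pi / (l / L ^ 2)) ^ ((d : ℝ) / 2)) := by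
  have hL := zero_lt_one.trans_le h.constants.one_le_lip
  refine (lintegral_mono fun y => ENNReal.ofReal_le_ofReal (gaussk_le_of_norm_le hl.le hL hτ.le
    (h.norm_inv_sub_le u z (Θ t y)))).trans ?_
  exact lintegral_gaussk_comp_le (by positivity) hL.le h.flow.continuous_inv.measurable
    h.flow.lip_flow h.flow.flow_inv hτ t (Θ u z)

lemma lintegral_enorm_le_of_abs_le (h : DiffusionData d κ α c L T s S a b b₁ Θ ψ) {l τ D u t : ℝ}
    {z : Vec d} {F : Vec d → ℝ} (hl : 0 < l) (hτ : 0 < τ) (hD : 0 ≤ D)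
    (hF : ∀ y, |F y| ≤ D * gaussk d l τ (z - ψ u (Θ t y))) :
    ∫⁻ y, ‖F y‖ₑ ≤ ENNReal.ofReal (D * (L ^ d * (Real.pi / (l / L ^ 2)) ^ ((d : ℝ) / 2))) := by
  rw [ENNReal.ofReal_mul hD]
  refine le_trans ?_ (mul_le_mul_right (h.lintegral_gaussk_displacement_le hl hτ u t z) _)
  rw [← lintegral_const_mul' _ _ ENNReal.ofReal_ne_top]
  refine lintegral_mono fun y => ?_
  rw [← ENNReal.ofReal_mul hD, ← ofReal_norm]
  exact ENNReal.ofReal_le_ofReal (hF y)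

lemma integrable_gaussk_displacement (h : DiffusionData d κ α c L T s S a b b₁ Θ ψ) {l τ : ℝ}
    (hl : 0 < l) (hτ : 0 < τ) (u t : ℝ) (z : Vec d) :
    Integrable fun y => gaussk d l τ (z - ψ u (Θ t y)) := by
  refine ⟨((measurable_gaussk l τ).comp (measurable_const.sub (h.measurable_flowPoint
    measurable_const measurable_const measurable_id))).aestronglyMeasurable, ?_⟩
  rw [hasFiniteIntegral_iff_ofReal (Filter.Eventually.of_forall fun y => gaussk_nonneg hτ.le _)]
  exact (h.lintegral_gaussk_displacement_le hl hτ u t z).trans_lt ENNReal.ofReal_lt_top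

lemma tendsto_integral_mul_kernel (h : DiffusionData d κ α c L T s S a b b₁ Θ ψ) {l τ C D u t : ℝ}
    {z : Vec d} {F : ℝ → Vec d → ℝ} {f : Vec d → ℝ} (mF : ∀ ε, Measurable (F ε))
    (mf : Measurable f) (hC : 0 ≤ C) (hf : ∀ y, |f y| ≤ C) (hl : 0 < l) (hτ : 0 < τ) (hD : 0 ≤ D)
    (hF : ∀ ε, 0 < ε → ε ≤ 1 → ∀ y, |F ε y| ≤ D * gaussk d l (τ + ε) (z - ψ u (Θ t y)))
    (hlim : ∀ y, Filter.Tendsto (fun ε => F ε y) (nhds 0) (nhds (F 0 y))) :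
    Filter.Tendsto (fun ε => ∫ y, f y * F ε y) (nhdsWithin 0 (Ioi 0))
      (nhds (∫ y, f y * F 0 y)) := by
  refine tendsto_integral_filter_of_dominated_convergence
    (fun y => C * (D * gaussk d (l / 2) τ (z - ψ u (Θ t y))))
    (Filter.Eventually.of_forall fun ε => (mf.mul (mF ε)).aestronglyMeasurable) ?_
    (((h.integrable_gaussk_displacement (half_pos hl) hτ u t z).const_mul D).const_mul C)
    (Filter.Eventually.of_forall fun y => ((hlim y).mono_left nhdsWithin_le_nhds).const_mul _)
  filter_upwards [Ioc_mem_nhdsGT one_pos, Ioc_mem_nhdsGT hτ] with ε hε hετ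
  refine Filter.Eventually.of_forall fun y => ?_
  rw [norm_mul]
  exact mul_le_mul (hf y) ((hF ε hε.1 hε.2 y).trans (mul_le_mul_of_nonneg_left
    (gaussk_le_of_time_le hl.le hτ (by linarith [hετ.1]) (by linarith [hετ.2]) _) hD))
    (norm_nonneg _) hC

lemma abs_frozenKernel_le (h : DiffusionData d κ α c L T s S a b b₁ Θ ψ) {ε u t : ℝ}
    (hε : 0 ≤ ε) (hut : u < t) (z y : Vec d) :
    |frozenKernel d s S a Θ ψ ε (u, z) (t, y)| ≤
      κ ^ ((d : ℝ) / 2) * gaussk d (1 / (4 * κ)) (t - u + ε) (z - ψ u (Θ t y)) := by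
  have hκ := h.constants.one_le_ellipticity
  rw [abs_of_nonneg (frozenKernel_nonneg ε _ _)]
  by_cases hpq : s ≤ u ∧ u < t ∧ t ≤ S
  · exact h.frozenKernel_le hε hpq
  · rw [frozenKernel, if_neg hpq]
    exact mul_nonneg (by positivity) (gaussk_nonneg (by linarith) _)

lemma exists_abs_parametrixKernel_le (h : DiffusionData d κ α c L T s S a b b₁ Θ ψ) :
    ∃ C, 0 ≤ C ∧ ∀ ε u t, 0 ≤ ε → ε ≤ 1 → u < t → ∀ z y : Vec d,
      |parametrixKernel d s S a b b₁ Θ ψ ε (u, z) (t, y)| ≤ C * (t - u + ε) ^ (α / 2 - 1) *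
        gaussk d (1 / (4 * κ)) (t - u + ε) (z - ψ u (Θ t y)) := by
  obtain ⟨C, hC, hh⟩ := abs_parametrixKernel_le d h.constants
  refine ⟨C, by linarith, fun ε u t hε hε1 hut z y => ?_⟩
  by_cases hpq : s ≤ u ∧ u < t ∧ t ≤ S
  · exact hh s S a b b₁ Θ ψ h ε hε hε1 (u, z) (t, y) hpq
  · rw [parametrixKernel, if_neg hpq, abs_zero]
    have h1 : 0 < t - u + ε := by linarith
    exact mul_nonneg (by positivity) (gaussk_nonneg h1.le _)

variable {Ω : Type*} [MeasurableSpace Ω] {c' u t : ℝ} {μ : Measure Ω} {Y : ℝ → Ω → Vec d}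

/-- The law at time `t` expanded around the frozen densities, for continuous test functions. -/
lemma integral_eq_frozen_add_parametrix_of_continuous
    (h : DiffusionData d κ α c L T s S a b b₁ Θ ψ) (hY : ForwardEq c' b a u μ Y)
    (hu : s ≤ u) (hut : u < t) (ht : t ≤ S) {f : Vec d → ℝ} {C : ℝ}
    (cf : Continuous f) (hf : ∀ y, |f y| ≤ C) :
    ∫ ω, f (Y t ω) ∂μ =
      (∫ ω, (∫ y, f y * frozenKernel d s S a Θ ψ 0 (u, Y u ω) (t, y)) ∂μ) +
      ∫ x : ℝ × Ω, (∫ y, f y * parametrixKernel d s S a b b₁ Θ ψ 0 (x.1, Y x.1 x.2) (t, y))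
        ∂((volume.restrict (Ioc u t)).prod μ) := by
  have := hY.finite
  have hκ := zero_lt_one.trans_le h.constants.one_le_ellipticity
  have hL := zero_lt_one.trans_le h.constants.one_le_lip
  have hα := h.constants.exponent_pos
  have hα1 := h.constants.exponent_le
  have hC : 0 ≤ C := (abs_nonneg _).trans (hf 0)
  have mf := cf.measurable
  have hl : 0 < 1 / (4 * κ) := by positivity
  have hτ : 0 < t - u := sub_pos.2 hut
  obtain ⟨D, hD, hpar⟩ := h.exists_abs_parametrixKernel_le
  set A := L ^ d * (Real.pi / (1 / (4 * κ) / L ^ 2)) ^ ((d : ℝ) / 2) with hA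
  have hA0 : 0 ≤ A := by positivity
  set M := (volume.restrict (Ioc u t)).prod μ with hM
  have mpath := hY.measurable_path
  have mG : ∀ ε : ℝ, Measurable (Function.uncurry fun ω y =>
      gaussDens (ε • (1 : Matrix (Fin d) (Fin d) ℝ)) (Y t ω - y)) := fun ε =>
    (contDiff_gaussDens _).continuous.measurable.comp
      (((hY.measurable_at t).comp measurable_fst).sub measurable_snd)
  have mP : ∀ ε : ℝ, Measurable (Function.uncurry fun ω y =>
      frozenKernel d s S a Θ ψ ε (u, Y u ω) (t, y)) := fun ε =>
    (h.measurable_frozenKernel ε).comp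
      ((measurable_const.prodMk ((hY.measurable_at u).comp measurable_fst)).prodMk
        (measurable_const.prodMk measurable_snd))
  have mH : ∀ ε : ℝ, Measurable (Function.uncurry fun (x : ℝ × Ω) y =>
      parametrixKernel d s S a b b₁ Θ ψ ε (x.1, Y x.1 x.2) (t, y)) := fun ε =>
    (h.measurable_parametrixKernel ε).comp
      (((measurable_fst.comp measurable_fst).prodMk (mpath.comp measurable_fst)).prodMk
        (measurable_const.prodMk measurable_snd))
  have hmem : ∀ᵐ x ∂M, x.1 ∈ Ioc u t :=
    Measure.quasiMeasurePreserving_fst.ae (ae_restrict_mem measurableSet_Ioc)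
  have hlt : ∀ᵐ x ∂M, x.1 < t := by
    have hne : ∀ᵐ r : ℝ ∂volume.restrict (Ioc u t), r ≠ t :=
      ae_restrict_of_ae (Measure.ae_ne volume t)
    filter_upwards [hmem, Measure.quasiMeasurePreserving_fst.ae hne] with x h1 h2
    exact lt_of_le_of_ne h1.2 h2
  have sG : ∀ ε : ℝ, 0 < ε → ε ≤ 1 → ∀ᵐ ω ∂μ,
      ∫⁻ y, ‖gaussDens (ε • (1 : Matrix (Fin d) (Fin d) ℝ)) (Y t ω - y)‖ₑ ≤
        ENNReal.ofReal ((2 * Real.pi) ^ (-(d : ℝ) / 2) * (Real.pi / (1 / 2)) ^ ((d : ℝ) / 2)) :=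
    fun ε hε _ => Filter.Eventually.of_forall fun ω => by
      have hg := lintegral_enorm_gaussDens_smul_one_le hε (Y t ω)
      exact hg
  have sP : ∀ ε : ℝ, 0 < ε → ε ≤ 1 → ∀ᵐ ω ∂μ,
      ∫⁻ y, ‖frozenKernel d s S a Θ ψ ε (u, Y u ω) (t, y)‖ₑ ≤
        ENNReal.ofReal (κ ^ ((d : ℝ) / 2) * A) :=
    fun ε hε _ => Filter.Eventually.of_forall fun ω =>
      h.lintegral_enorm_le_of_abs_le hl (by linarith) (by positivity)
        (h.abs_frozenKernel_le hε.le hut (Y u ω))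
  have sH : ∀ ε : ℝ, 0 < ε → ε ≤ 1 → ∀ᵐ x ∂M,
      ∫⁻ y, ‖parametrixKernel d s S a b b₁ Θ ψ ε (x.1, Y x.1 x.2) (t, y)‖ₑ ≤
        ENNReal.ofReal (D * (t - x.1) ^ (α / 2 - 1) * A) := by
    intro ε hε hε1
    filter_upwards [hlt] with x hx
    have h1 : 0 < t - x.1 := sub_pos.2 hx
    refine h.lintegral_enorm_le_of_abs_le hl (τ := t - x.1 + ε) (u := x.1) (t := t)
      (z := Y x.1 x.2) (by linarith) (by positivity)
      fun y => (hpar ε x.1 t hε.le hε1 hx (Y x.1 x.2) y).trans ?_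
    refine mul_le_mul_of_nonneg_right ?_ (gaussk_nonneg (by linarith) _)
    exact mul_le_mul_of_nonneg_left (Real.rpow_le_rpow_of_nonpos h1 (by linarith) (by linarith)) hD
  have hW : Integrable (fun x : ℝ × Ω => D * (t - x.1) ^ (α / 2 - 1) * A) M := by
    have h1 : IntervalIntegrable (fun r : ℝ => (t - r) ^ (α / 2 - 1)) volume u t := by
      have := (intervalIntegral.intervalIntegrable_rpow' (a := t - u) (b := t - t)
        (r := α / 2 - 1) (by linarith)).comp_sub_left t
      simpa using this
    have h2 : Integrable (fun r : ℝ => (t - r) ^ (α / 2 - 1)) (volume.restrict (Ioc u t)) := by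
      rw [intervalIntegrable_iff_integrableOn_Ioc_of_le hut.le] at h1
      exact h1
    exact ((h2.comp_fst μ).const_mul D).mul_const A
  have hW0 : ∀ᵐ x ∂M, 0 ≤ D * (t - x.1) ^ (α / 2 - 1) * A := by
    filter_upwards [hlt] with x hx
    have h1 : 0 < t - x.1 := sub_pos.2 hx
    positivity
  have vG : ∀ ω, Filter.Tendsto (fun ε : ℝ => ∫ y, f y *
      gaussDens (ε • (1 : Matrix (Fin d) (Fin d) ℝ)) (Y t ω - y))
      (nhdsWithin 0 (Ioi 0)) (nhds (f (Y t ω))) := fun ω => by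
    have hg := tendsto_integral_mul_gaussDens cf hf (Y t ω)
    exact hg
  set Q : ℝ := (2 * Real.pi) ^ (-(d : ℝ) / 2) * (Real.pi / (1 / 2)) ^ ((d : ℝ) / 2) with hQ
  have hQ0 : 0 ≤ Q := by positivity
  have l1 := tendsto_integral_mul_integral (μ := μ)
    (F := fun ε ω y => gaussDens (ε • (1 : Matrix (Fin d) (Fin d) ℝ)) (Y t ω - y))
    (W := fun _ => Q) (V := fun ω => f (Y t ω)) mG mf hC hf (integrable_const Q)
    (Filter.Eventually.of_forall fun _ => hQ0) sG (Filter.Eventually.of_forall vG)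
  have hκd : 0 ≤ κ ^ ((d : ℝ) / 2) := by positivity
  have mP' : ∀ ε ω, Measurable fun y => frozenKernel d s S a Θ ψ ε (u, Y u ω) (t, y) :=
    fun ε ω => Measurable.of_uncurry_left
      (f := fun ω y => frozenKernel d s S a Θ ψ ε (u, Y u ω) (t, y)) (mP ε)
  have vP : ∀ ω, Filter.Tendsto (fun ε => ∫ y, f y * frozenKernel d s S a Θ ψ ε (u, Y u ω) (t, y))
      (nhdsWithin 0 (Ioi 0))
      (nhds (∫ y, f y * frozenKernel d s S a Θ ψ 0 (u, Y u ω) (t, y))) := fun ω => by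
    refine h.tendsto_integral_mul_kernel
      (F := fun ε y => frozenKernel d s S a Θ ψ ε (u, Y u ω) (t, y))
      (D := κ ^ ((d : ℝ) / 2)) (τ := t - u) (u := u) (t := t) (z := Y u ω)
      (fun ε => mP' ε ω) mf hC hf hl hτ hκd
      (fun ε hε _ => h.abs_frozenKernel_le hε.le hut (Y u ω)) fun y => ?_
    exact h.tendsto_frozenKernel u t Filter.tendsto_id le_rfl tendsto_const_nhds tendsto_const_nhds
  have hR0 : 0 ≤ κ ^ ((d : ℝ) / 2) * A := by positivity
  have l2 := tendsto_integral_mul_integral (μ := μ)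
    (F := fun ε ω y => frozenKernel d s S a Θ ψ ε (u, Y u ω) (t, y))
    (W := fun _ => κ ^ ((d : ℝ) / 2) * A)
    (V := fun ω => ∫ y, f y * frozenKernel d s S a Θ ψ 0 (u, Y u ω) (t, y))
    mP mf hC hf (integrable_const _)
    (Filter.Eventually.of_forall fun _ => hR0) sP (Filter.Eventually.of_forall vP)
  have mH' : ∀ ε (x : ℝ × Ω), Measurable fun y =>
      parametrixKernel d s S a b b₁ Θ ψ ε (x.1, Y x.1 x.2) (t, y) :=
    fun ε x => Measurable.of_uncurry_left
      (f := fun (x : ℝ × Ω) y =>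
        parametrixKernel d s S a b b₁ Θ ψ ε (x.1, Y x.1 x.2) (t, y)) (mH ε)
  have vH : ∀ᵐ x ∂M, Filter.Tendsto
      (fun ε => ∫ y, f y * parametrixKernel d s S a b b₁ Θ ψ ε (x.1, Y x.1 x.2) (t, y))
      (nhdsWithin 0 (Ioi 0))
      (nhds (∫ y, f y * parametrixKernel d s S a b b₁ Θ ψ 0 (x.1, Y x.1 x.2) (t, y))) := by
    filter_upwards [hlt] with x hx
    have h1 : 0 < t - x.1 := sub_pos.2 hx
    have hDx : 0 ≤ D * (t - x.1) ^ (α / 2 - 1) := by positivity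
    refine h.tendsto_integral_mul_kernel
      (F := fun ε y => parametrixKernel d s S a b b₁ Θ ψ ε (x.1, Y x.1 x.2) (t, y))
      (D := D * (t - x.1) ^ (α / 2 - 1)) (τ := t - x.1) (u := x.1) (t := t) (z := Y x.1 x.2)
      (fun ε => mH' ε x) mf hC hf hl h1 hDx (fun ε hε hε1 y => ?_) fun y => ?_
    · refine (hpar ε x.1 t hε.le hε1 hx (Y x.1 x.2) y).trans ?_
      refine mul_le_mul_of_nonneg_right ?_ (gaussk_nonneg (by linarith) _)
      exact mul_le_mul_of_nonneg_left
        (Real.rpow_le_rpow_of_nonpos h1 (by linarith) (by linarith)) hD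
    · exact h.tendsto_parametrixKernel x.1 t _ Filter.tendsto_id le_rfl tendsto_const_nhds
  have l3 := tendsto_integral_mul_integral (μ := M)
    (F := fun ε x y => parametrixKernel d s S a b b₁ Θ ψ ε (x.1, Y x.1 x.2) (t, y))
    (W := fun x => D * (t - x.1) ^ (α / 2 - 1) * A)
    (V := fun x => ∫ y, f y * parametrixKernel d s S a b b₁ Θ ψ 0 (x.1, Y x.1 x.2) (t, y))
    mH mf hC hf hW hW0 sH vH
  have l4 := l2.add l3
  refine tendsto_nhds_unique l1 (l4.congr' ?_)
  filter_upwards [Ioc_mem_nhdsGT one_pos] with ε hε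
  have iG := integrable_prod_of_lintegral_le (mG ε) (integrable_const _) (sG ε hε.1 hε.2)
  have iP := integrable_prod_of_lintegral_le (mP ε) (integrable_const _) (sP ε hε.1 hε.2)
  have iH := integrable_prod_of_lintegral_le (mH ε) hW (sH ε hε.1 hε.2)
  rw [← integral_add (integrable_mul_integral mf hf iP) (integrable_mul_integral mf hf iH)]
  refine integral_congr_ae (Filter.Eventually.of_forall fun y => ?_)
  simp only
  have hinteg : Integrable (fun x : ℝ × Ω =>
      parametrixKernel d s S a b b₁ Θ ψ ε (x.1, Y x.1 x.2) (t, y)) M := by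
    refine .of_bound (Measurable.of_uncurry_right (f := fun (x : ℝ × Ω) y =>
      parametrixKernel d s S a b b₁ Θ ψ ε (x.1, Y x.1 x.2) (t, y)) (mH ε)).aestronglyMeasurable
      (D * ε ^ (α / 2 - 1) * ε ^ (-(d : ℝ) / 2)) ?_
    filter_upwards [hlt] with x hx
    have h1 : 0 < t - x.1 := sub_pos.2 hx
    refine (hpar ε x.1 t hε.1.le hε.2 hx (Y x.1 x.2) y).trans ?_
    refine mul_le_mul (mul_le_mul_of_nonneg_left (Real.rpow_le_rpow_of_nonpos hε.1 (by linarith)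
      (by linarith)) hD) ((gaussk_le_rpow hl.le (by linarith [hε.1]) _).trans
      (Real.rpow_le_rpow_of_nonpos hε.1 (by linarith) ?_)) (gaussk_nonneg (by linarith [hε.1]) _)
      (mul_nonneg hD (Real.rpow_nonneg hε.1.le _))
    rw [neg_div]
    exact neg_nonpos.2 (by positivity)
  have hid := h.integral_frozen_eq hY hu hut ht hε.1 y
  rw [intervalIntegral.integral_of_le hut.le] at hid
  rw [hM, integral_prod _ hinteg, ← hid]
  ring

end DiffusionData

end DensityExpansion

section TestedKernels

/-- Integration of a kernel against a test function in its final space variable. -/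
def testKernel {d : ℕ} (f : Vec d → ℝ) (t : ℝ) (F : ℝ × Vec d → ℝ × Vec d → ℝ)
    (p : ℝ × Vec d) : ℝ := ∫ y, f y * F p (t, y)

/-- A measurable map to space-time whose time component does not charge any time too much. -/
structure TimeRegular {d : ℕ} {X : Type*} [MeasurableSpace X] (M : Measure X)
    (π : X → ℝ × Vec d) : Prop where
  measurable : Measurable π
  integrable_rpow : ∀ t e : ℝ, 0 < e → Integrable (fun x => |t - (π x).1| ^ (e - 1)) M

variable {d : ℕ} {s S l K e e' L A B C t : ℝ} {Θ ψ : ℝ → Vec d → Vec d}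
  {F G : ℝ × Vec d → ℝ × Vec d → ℝ} {f : Vec d → ℝ}
  {X : Type*} [MeasurableSpace X] {M : Measure X} {π : X → ℝ × Vec d}

namespace Majorized

lemma lintegral_enorm_right_le (hM : MajorantFlow l L Θ ψ) (hF : Majorized s S l K e A Θ F)
    (hK : 0 ≤ K) (p : ℝ × Vec d) (t : ℝ) :
    ∫⁻ y, ‖F p (t, y)‖ₑ ≤ ENNReal.ofReal (A * (L ^ d * (Real.pi / l) ^ ((d : ℝ) / 2) *
      Real.exp (K * (S - s))) * |t - p.1| ^ (e - 1)) := by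
  have hA := hF.nonneg
  have hl := hM.rate_pos
  have hL := hM.lip_nonneg
  by_cases h : s ≤ p.1 ∧ p.1 < t ∧ t ≤ S
  · refine (lintegral_mono fun w => hF.enorm_le p (t, w)).trans ?_
    rw [lintegral_const_mul' _ _ ENNReal.ofReal_ne_top, mul_assoc A, ENNReal.ofReal_mul hA,
      abs_of_pos (sub_pos.2 h.2.1)]
    refine mul_le_mul_right ((lintegral_majorant_right_le hM.rate_pos hM.lip_nonneg
      hM.measurable_inv hM.lip_flow hM.flow_inv p h).trans (ENNReal.ofReal_le_ofReal ?_)) _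
    rw [mul_assoc (L ^ d * _)]
    have h1 : 0 < t - p.1 := sub_pos.2 h.2.1
    gcongr
    · exact h.2.2
    · exact h.1
  · simp [hF.eq_zero (q := (t, _)) h]

lemma abs_testKernel_le (hM : MajorantFlow l L Θ ψ) (hF : Majorized s S l K e A Θ F)
    (hK : 0 ≤ K) (hC : 0 ≤ C) (hf : ∀ y, |f y| ≤ C) (p : ℝ × Vec d) :
    |testKernel f t F p| ≤ C * (A * (L ^ d * (Real.pi / l) ^ ((d : ℝ) / 2) *
      Real.exp (K * (S - s))) * |t - p.1| ^ (e - 1)) := by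
  have hA := hF.nonneg
  have hl := hM.rate_pos
  have hL := hM.lip_nonneg
  exact abs_integral_mul_le_of_lintegral_le hC hf (by positivity)
    (hF.lintegral_enorm_right_le hM hK p t)

lemma measurable_testKernel (hF : Majorized s S l K e A Θ F) (mf : Measurable f) :
    Measurable (testKernel f t F) := by
  refine (StronglyMeasurable.integral_prod_right' (f := fun x : (ℝ × Vec d) × Vec d =>
    f x.2 * F x.1 (t, x.2)) ?_).measurable
  exact (mf.comp measurable_snd).stronglyMeasurable.mul (hF.stronglyMeasurable.comp_measurable
    (g := fun x : (ℝ × Vec d) × Vec d => (x.1, (t, x.2))) (by fun_prop))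

lemma integrable_path (hM : MajorantFlow l L Θ ψ) (hF : Majorized s S l K e A Θ F) (hK : 0 ≤ K)
    (he : 0 < e) (hπ : TimeRegular M π) (t : ℝ) :
    Integrable (Function.uncurry fun x y => F (π x) (t, y)) (M.prod volume) :=
  integrable_prod_of_lintegral_le (hF.stronglyMeasurable.comp_measurable
    (g := fun z : X × Vec d => (π z.1, (t, z.2)))
    ((hπ.measurable.comp measurable_fst).prodMk (measurable_const.prodMk measurable_snd))).measurable
    ((hπ.integrable_rpow t e he).const_mul _)
    (Filter.Eventually.of_forall fun x => hF.lintegral_enorm_right_le hM hK (π x) t)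

lemma integrable_testKernel_path (hM : MajorantFlow l L Θ ψ) (hF : Majorized s S l K e A Θ F)
    (hK : 0 ≤ K) (he : 0 < e) (hπ : TimeRegular M π) (mf : Measurable f)
    (hC : 0 ≤ C) (hf : ∀ y, |f y| ≤ C) : Integrable (fun x => testKernel f t F (π x)) M :=
  ((hπ.integrable_rpow t e he).const_mul _ |>.const_mul C).mono'
    ((hF.measurable_testKernel mf).comp hπ.measurable).aestronglyMeasurable
    (Filter.Eventually.of_forall fun x => hF.abs_testKernel_le hM hK hC hf (π x))

lemma integrable_prod_smul (hM : MajorantFlow l L Θ ψ) (hF : Majorized s S l K e A Θ F)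
    (hG : Majorized s S l K e' B Θ G) (he : 0 < e) (he1 : e ≤ 1) (he' : 0 < e') (he1' : e' ≤ 1)
    (p : ℝ × Vec d) (t : ℝ) :
    Integrable (Function.uncurry fun y m => G m (t, y) • F p m)
      ((volume : Measure (Vec d)).prod volume) := by
  have hmaj : Majorized s S l K (e + e') 1 Θ (majorant d s S l K (e + e') Θ) :=
    ⟨(measurable_majorant hM.measurable_inv).stronglyMeasurable, zero_le_one, fun p q => by
      rw [one_mul, Real.norm_of_nonneg (majorant_nonneg p q)]⟩
  refine integrable_prod_of_lintegral_le ?_ ((hmaj.integrable_left hM p t).const_mul _)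
    (Filter.Eventually.of_forall fun y => hF.lintegral_smul_le hM hG he he1 he' he1' p (t, y))
  exact ((hG.stronglyMeasurable.comp_measurable
      (g := fun x : Vec d × (ℝ × Vec d) => (x.2, (t, x.1))) (by fun_prop)).smul
      (hF.stronglyMeasurable.comp_measurable
      (g := fun x : Vec d × (ℝ × Vec d) => (p, x.2)) (by fun_prop))).measurable

lemma testKernel_comp (hM : MajorantFlow l L Θ ψ) (hF : Majorized s S l K e A Θ F)
    (hG : Majorized s S l K e' B Θ G) (he : 0 < e) (he1 : e ≤ 1) (he' : 0 < e') (he1' : e' ≤ 1)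
    (mf : Measurable f) (hf : ∀ y, |f y| ≤ C) (p : ℝ × Vec d) :
    testKernel f t (fun p q => ∫ m, G m q • F p m) p = ∫ m, testKernel f t G m * F p m := by
  have h1 := integral_mul_integral_comm (F := fun m y => G m (t, y) • F p m) mf hf
    (hF.integrable_prod_smul hM hG he he1 he' he1' p t).swap
  rw [testKernel, h1]
  refine integral_congr_ae (Filter.Eventually.of_forall fun m => ?_)
  simp only [testKernel, smul_eq_mul]
  rw [← integral_mul_const]
  simp only [mul_assoc]

lemma lintegral_testKernel_mul_le (hM : MajorantFlow l L Θ ψ) (hF : Majorized s S l K e A Θ F)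
    (hG : Majorized s S l K e' B Θ G) (hK : 0 ≤ K) (he : 0 < e) (he1 : e ≤ 1) (he' : 0 < e')
    (he1' : e' ≤ 1) (hC : 0 ≤ C) (hf : ∀ y, |f y| ≤ C) (p : ℝ × Vec d) :
    ∫⁻ m, ‖testKernel f t G m * F p m‖ₑ ≤ ENNReal.ofReal (C * (A * B *
      (L ^ d * (Real.pi / l) ^ ((d : ℝ) / 2) * (2 * (1 / e + 1 / e'))) *
      (L ^ d * (Real.pi / l) ^ ((d : ℝ) / 2) * Real.exp (K * (S - s))) *
        |t - p.1| ^ (e + e' - 1))) := by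
  have h1 : ∀ m, ‖testKernel f t G m * F p m‖ₑ ≤
      ENNReal.ofReal C * ∫⁻ y, ‖G m (t, y) • F p m‖ₑ := by
    intro m
    rw [← lintegral_const_mul' _ _ ENNReal.ofReal_ne_top, testKernel, ← integral_mul_const]
    refine (enorm_integral_le_lintegral_enorm _).trans (lintegral_mono fun y => ?_)
    rw [mul_assoc, enorm_mul, smul_eq_mul]
    refine mul_le_mul_left ?_ _
    rw [← ofReal_norm]
    exact ENNReal.ofReal_le_ofReal (hf y)
  have mK : Measurable (Function.uncurry fun (m : ℝ × Vec d) y => ‖G m (t, y) • F p m‖ₑ) :=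
    ((hG.stronglyMeasurable.comp_measurable
      (g := fun x : (ℝ × Vec d) × Vec d => (x.1, (t, x.2))) (by fun_prop)).smul
      (hF.stronglyMeasurable.comp_measurable
      (g := fun x : (ℝ × Vec d) × Vec d => (p, x.1)) (by fun_prop))).measurable.enorm
  have hcomp := hF.comp hM hG he he1 he' he1'
  have hmaj : Majorized s S l K (e + e') (A * B *
      (L ^ d * (Real.pi / l) ^ ((d : ℝ) / 2) * (2 * (1 / e + 1 / e')))) Θ
      (fun p q => (A * B * (L ^ d * (Real.pi / l) ^ ((d : ℝ) / 2) * (2 * (1 / e + 1 / e')))) *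
        majorant d s S l K (e + e') Θ p q) :=
    ⟨((measurable_majorant hM.measurable_inv).const_mul _).stronglyMeasurable, hcomp.nonneg,
      fun p q => by
        rw [Real.norm_of_nonneg (mul_nonneg hcomp.nonneg (majorant_nonneg p q))]⟩
  refine (lintegral_mono h1).trans ?_
  rw [lintegral_const_mul' _ _ ENNReal.ofReal_ne_top, ENNReal.ofReal_mul hC,
    lintegral_lintegral_swap mK.aemeasurable]
  refine mul_le_mul_right ((lintegral_mono fun y => ?_).trans
    (hmaj.lintegral_enorm_right_le hM hK p t)) _
  refine (hF.lintegral_smul_le hM hG he he1 he' he1' p (t, y)).trans ?_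
  rw [Real.enorm_of_nonneg (mul_nonneg hcomp.nonneg (majorant_nonneg _ _))]

lemma integrable_testKernel_mul_path (hM : MajorantFlow l L Θ ψ) (hF : Majorized s S l K e A Θ F)
    (hG : Majorized s S l K e' B Θ G) (hK : 0 ≤ K) (he : 0 < e) (he1 : e ≤ 1) (he' : 0 < e')
    (he1' : e' ≤ 1) (hπ : TimeRegular M π) (mf : Measurable f) (hC : 0 ≤ C)
    (hf : ∀ y, |f y| ≤ C) :
    Integrable (Function.uncurry fun x m => testKernel f t G m * F (π x) m) (M.prod volume) := by
  refine integrable_prod_of_lintegral_le ?_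
    (((hπ.integrable_rpow t (e + e') (by linarith)).const_mul _).const_mul C)
    (Filter.Eventually.of_forall fun x =>
      hF.lintegral_testKernel_mul_le hM hG hK he he1 he' he1' hC hf (π x))
  exact ((hG.measurable_testKernel mf).comp measurable_snd).mul
    (hF.stronglyMeasurable.comp_measurable
    (g := fun z : X × (ℝ × Vec d) => (π z.1, z.2))
    ((hπ.measurable.comp measurable_fst).prodMk measurable_snd)).measurable

lemma integral_testKernel_mul_path_eq [SFinite M] (hM : MajorantFlow l L Θ ψ)
    (hF : Majorized s S l K e A Θ F)
    (hG : Majorized s S l K e' B Θ G) (hK : 0 ≤ K) (he : 0 < e)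
    (hπ : TimeRegular M π) (mf : Measurable f) (hC : 0 ≤ C)
    (hf : ∀ y, |f y| ≤ C) (r : ℝ) :
    ∫ w, (∫ x, testKernel f t G (r, w) * F (π x) (r, w) ∂M) =
      ∫ x, testKernel (fun w => testKernel f t G (r, w)) r F (π x) ∂M := by
  have hb : ∀ w, |testKernel f t G (r, w)| ≤ C * (B * (L ^ d * (Real.pi / l) ^ ((d : ℝ) / 2) *
      Real.exp (K * (S - s))) * |t - r| ^ (e' - 1)) := fun w =>
    hG.abs_testKernel_le hM hK hC hf (r, w)
  have h1 := integral_mul_integral_comm (F := fun x w => F (π x) (r, w))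
    ((hG.measurable_testKernel (t := t) mf).comp (measurable_prodMk_left (x := r))) hb
      (hF.integrable_path hM hK he hπ r)
  simp only [Function.comp] at h1
  simp only [testKernel, integral_const_mul] at h1 ⊢
  exact h1

/-- Testing the composition of two kernels along a path, sliced in the intermediate time. -/
lemma integral_testKernel_comp_path [SFinite M] (hM : MajorantFlow l L Θ ψ)
    (hF : Majorized s S l K e A Θ F)
    (hG : Majorized s S l K e' B Θ G) (hK : 0 ≤ K) (he : 0 < e) (he1 : e ≤ 1) (he' : 0 < e')
    (he1' : e' ≤ 1) (hπ : TimeRegular M π) (mf : Measurable f) (hC : 0 ≤ C)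
    (hf : ∀ y, |f y| ≤ C) :
    (Integrable fun r => ∫ x, testKernel (fun w => testKernel f t G (r, w)) r F (π x) ∂M) ∧
    ∫ x, testKernel f t (fun p q => ∫ m, G m q • F p m) (π x) ∂M =
      ∫ r, (∫ x, testKernel (fun w => testKernel f t G (r, w)) r F (π x) ∂M) := by
  have hinteg := hF.integrable_testKernel_mul_path (t := t) hM hG hK he he1 he' he1' hπ mf hC hf
  have hr := hinteg.integral_prod_right
  simp only [← hF.integral_testKernel_mul_path_eq (t := t) hM hG hK he hπ mf hC hf]
  refine ⟨hr.integral_prod_left, ?_⟩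
  simp only [hF.testKernel_comp hM hG he he1 he' he1' mf hf]
  rw [integral_integral_swap hinteg]
  exact integral_prod _ hr

end Majorized

end TestedKernels

section DensityFormula

variable {d : ℕ} {c u t : ℝ} {a : ℝ → Vec d → Matrix (Fin d) (Fin d) ℝ}
  {b : ℝ → Vec d → Vec d} {Ω : Type*} [MeasurableSpace Ω] {μ : Measure Ω}
  {Y : ℝ → Ω → Vec d}

lemma ForwardEq.timeRegular_initial (hY : ForwardEq c b a u μ Y) :
    TimeRegular μ fun ω => (u, Y u ω) := by
  have := hY.finite
  exact ⟨measurable_const.prodMk (hY.measurable_at u), fun t e _ =>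
    integrable_const (|t - u| ^ (e - 1))⟩

lemma integrableOn_abs_sub_rpow (u t t₀ : ℝ) {e : ℝ} (he : 0 < e) :
    IntegrableOn (fun r : ℝ => |t₀ - r| ^ (e - 1)) (Ioc u t) := by
  have key : ∀ x : ℝ, 0 ≤ x → IntervalIntegrable (fun r : ℝ => |r| ^ (e - 1)) volume 0 x := by
    intro x hx
    refine (intervalIntegral.intervalIntegrable_rpow' (r := e - 1) (by linarith)).congr
      fun r hr => ?_
    rw [uIoc_of_le hx] at hr
    simp only [abs_of_pos hr.1]
  have h1 : IntervalIntegrable (fun r : ℝ => |r| ^ (e - 1)) volume (t₀ - u) (t₀ - t) := by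
    have h2 : ∀ x : ℝ, IntervalIntegrable (fun r : ℝ => |r| ^ (e - 1)) volume 0 x := by
      intro x
      rcases le_total 0 x with hx | hx
      · exact key x hx
      · have := IntervalIntegrable.comp_sub_left (f := fun r : ℝ => |r| ^ (e - 1))
          (key (-x) (by linarith)) 0
        simpa using this
    exact (h2 _).symm.trans (h2 _)
  have h2 := h1.comp_sub_left t₀
  simp only [sub_sub_cancel] at h2
  exact h2.1

lemma ForwardEq.timeRegular_path (hY : ForwardEq c b a u μ Y) (t : ℝ) :
    TimeRegular ((volume.restrict (Ioc u t)).prod μ) fun x : ℝ × Ω => (x.1, Y x.1 x.2) := by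
  have := hY.finite
  exact ⟨measurable_fst.prodMk hY.measurable_path, fun t₀ e he =>
    (integrableOn_abs_sub_rpow u t t₀ he).integrable.comp_fst μ⟩

lemma Majorized.testKernel_add {l K e e' L A B s S t C : ℝ} {Θ ψ : ℝ → Vec d → Vec d}
    {F G : ℝ × Vec d → ℝ × Vec d → ℝ} {f : Vec d → ℝ} (hM : MajorantFlow l L Θ ψ)
    (hF : Majorized s S l K e A Θ F) (hG : Majorized s S l K e' B Θ G)
    (mf : Measurable f) (hf : ∀ y, |f y| ≤ C) (p : ℝ × Vec d) :
    testKernel f t (fun p q => F p q + G p q) p = testKernel f t F p + testKernel f t G p := by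
  simp only [testKernel]
  rw [← integral_add]
  · simp only [mul_add]
  · exact (hF.integrable_left hM p t).bdd_mul mf.aestronglyMeasurable
      (Filter.Eventually.of_forall hf)
  · exact (hG.integrable_left hM p t).bdd_mul mf.aestronglyMeasurable
      (Filter.Eventually.of_forall hf)

namespace DiffusionData

variable {κ α L T s S B K c' C : ℝ} {b₁ Θ ψ : ℝ → Vec d → Vec d} {f : Vec d → ℝ}

/-- The law at time `t` expanded around the frozen densities. -/
lemma integral_eq_frozen_add_parametrix (h : DiffusionData d κ α c L T s S a b b₁ Θ ψ)
    (hY : ForwardEq c' b a u μ Y) (hK : 0 ≤ K)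
    (hH : ContractingKernel s S (1 / (4 * κ) / L ^ 2) K (α / 4) B Θ
      (parametrixKernel d s S a b b₁ Θ ψ 0))
    (hu : s ≤ u) (hut : u < t) (ht : t ≤ S) (mf : Measurable f) (hf : ∀ y, |f y| ≤ C) :
    ∫ ω, f (Y t ω) ∂μ =
      (∫ ω, testKernel f t (frozenKernel d s S a Θ ψ 0) (u, Y u ω) ∂μ) +
      ∫ x : ℝ × Ω, testKernel f t (parametrixKernel d s S a b b₁ Θ ψ 0) (x.1, Y x.1 x.2)
        ∂((volume.restrict (Ioc u t)).prod μ) := by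
  have := hY.finite
  have hα := h.constants.exponent_pos
  have iP := (h.majorized_frozenKernel hK).integrable_path h.majorantFlow hK one_pos
    hY.timeRegular_initial t
  have iH := hH.majorized.integrable_path h.majorantFlow hK (by linarith)
    (hY.timeRegular_path t) t
  have hk : Integrable fun y => (∫ ω, frozenKernel d s S a Θ ψ 0 (u, Y u ω) (t, y) ∂μ) +
      ∫ x : ℝ × Ω, parametrixKernel d s S a b b₁ Θ ψ 0 (x.1, Y x.1 x.2) (t, y)
        ∂((volume.restrict (Ioc u t)).prod μ) :=
    iP.integral_prod_right.add iH.integral_prod_right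
  have key : ∀ (g : Vec d → ℝ) (D : ℝ), Measurable g → (∀ y, |g y| ≤ D) →
      (∫ ω, testKernel g t (frozenKernel d s S a Θ ψ 0) (u, Y u ω) ∂μ) +
      ∫ x : ℝ × Ω, testKernel g t (parametrixKernel d s S a b b₁ Θ ψ 0) (x.1, Y x.1 x.2)
        ∂((volume.restrict (Ioc u t)).prod μ) =
      ∫ y, g y * ((∫ ω, frozenKernel d s S a Θ ψ 0 (u, Y u ω) (t, y) ∂μ) +
      ∫ x : ℝ × Ω, parametrixKernel d s S a b b₁ Θ ψ 0 (x.1, Y x.1 x.2) (t, y)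
        ∂((volume.restrict (Ioc u t)).prod μ)) := by
    intro g D mg hg
    simp only [testKernel, mul_add]
    rw [integral_add (integrable_mul_integral mg hg iP) (integrable_mul_integral mg hg iH),
      ← integral_mul_integral_comm mg hg iP, ← integral_mul_integral_comm mg hg iH]
  have mY := hY.measurable_at t
  have hmap : ∀ g : Vec d → ℝ, Measurable g → ∫ y, g y ∂(μ.map (Y t)) = ∫ ω, g (Y t ω) ∂μ :=
    fun g mg => integral_map mY.aemeasurable mg.aestronglyMeasurable
  rw [key f C mf hf, ← hmap f mf]
  refine integral_eq_of_forall_continuous hk (fun g cg ⟨D, hg⟩ => ?_) mf hf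
  rw [hmap g cg.measurable, ← key g D cg.measurable hg]
  exact h.integral_eq_frozen_add_parametrix_of_continuous hY hu hut ht cg hg

/-- The law at time `t` is obtained by integrating the transition kernel. -/
theorem integral_eq_testKernel_transitionKernel (h : DiffusionData d κ α c L T s S a b b₁ Θ ψ)
    (hY : ForwardEq c' b a u μ Y) (hK : 0 ≤ K)
    (hH : ContractingKernel s S (1 / (4 * κ) / L ^ 2) K (α / 4) B Θ
      (parametrixKernel d s S a b b₁ Θ ψ 0))
    (hu : s ≤ u) (hut : u < t) (ht : t ≤ S) (mf : Measurable f) (hf : ∀ y, |f y| ≤ C) :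
    ∫ ω, f (Y t ω) ∂μ =
      ∫ ω, testKernel f t (transitionKernel d s S a b b₁ Θ ψ) (u, Y u ω) ∂μ := by
  have := hY.finite
  have hC : 0 ≤ C := (abs_nonneg _).trans (hf 0)
  have hα := h.constants.exponent_pos
  have hα1 := h.constants.exponent_le
  have hM := h.majorantFlow
  have e0 : 0 < α / 4 := by linarith
  have e1 : α / 4 ≤ 1 := by linarith
  have hP := h.majorized_frozenKernel hK
  set P := frozenKernel d s S a Θ ψ 0 with hPdef
  set H := parametrixKernel d s S a b b₁ Θ ψ 0 with hHdef
  set Φ := seriesKernel volume H with hΦdef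
  set N := (volume.restrict (Ioc u t)).prod μ with hN
  have mH : Majorized s S (1 / (4 * κ) / L ^ 2) K (α / 4) B Θ H := hH.majorized
  have mΦ : Majorized s S (1 / (4 * κ) / L ^ 2) K (α / 4) (2 * B) Θ Φ := hH.majorized_seriesKernel
  have rμ := hY.timeRegular_initial
  have rN := hY.timeRegular_path t
  have hcompH := mH.comp hM mΦ e0 e1 e0 e1
  have hcompP := hP.comp hM mΦ one_pos le_rfl e0 e1
  have hΦeq : Φ = fun p q => H p q + ∫ m, Φ m q • H p m := by
    funext p q
    exact hH.seriesKernel_eq p q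
  have hsplit : ∀ p, testKernel f t Φ p = testKernel f t H p +
      testKernel f t (fun p q => ∫ m, Φ m q • H p m) p := by
    intro p
    rw [← mH.testKernel_add hM hcompH mf hf p, ← hΦeq]
  have hq : ∀ p, testKernel f t (transitionKernel d s S a b b₁ Θ ψ) p = testKernel f t P p +
      testKernel f t (fun p q => ∫ m, Φ m q • P p m) p := by
    intro p
    rw [← hP.testKernel_add hM hcompP mf hf p]
    rfl
  have iΦ := mΦ.integrable_testKernel_path (t := t) hM hK e0 rN mf hC hf
  have iH := mH.integrable_testKernel_path (t := t) hM hK e0 rN mf hC hf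
  have iHΦ := hcompH.integrable_testKernel_path (t := t) hM hK (by linarith) rN mf hC hf
  have iP := hP.integrable_testKernel_path (t := t) hM hK one_pos rμ mf hC hf
  have iPΦ := hcompP.integrable_testKernel_path (t := t) hM hK (by linarith) rμ mf hC hf
  obtain ⟨i1, c1⟩ := hP.integral_testKernel_comp_path (t := t) hM mΦ hK one_pos le_rfl e0 e1 rμ
    mf hC hf
  obtain ⟨i2, c2⟩ := mH.integral_testKernel_comp_path (t := t) hM mΦ hK e0 e1 e0 e1 rN mf hC hf
  have hslice : ∀ r, (∫ ω, testKernel (fun w => testKernel f t Φ (r, w)) r P (u, Y u ω) ∂μ) +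
      (∫ x, testKernel (fun w => testKernel f t Φ (r, w)) r H (x.1, Y x.1 x.2) ∂N) =
      (Ioo u t).indicator (fun r => ∫ ω, testKernel f t Φ (r, Y r ω) ∂μ) r := by
    intro r
    by_cases hr : r ∈ Ioo u t
    · have hb : ∀ w, |testKernel f t Φ (r, w)| ≤ C * ((2 * B) * (L ^ d *
          (Real.pi / (1 / (4 * κ) / L ^ 2)) ^ ((d : ℝ) / 2) * Real.exp (K * (S - s))) *
          |t - r| ^ (α / 4 - 1)) := fun w => mΦ.abs_testKernel_le hM hK hC hf (r, w)
      have hm : Measurable fun w => testKernel f t Φ (r, w) :=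
        (mΦ.measurable_testKernel mf).comp measurable_prodMk_left
      rw [indicator_of_mem hr,
        h.integral_eq_frozen_add_parametrix hY hK hH hu hr.1 (hr.2.le.trans ht) hm hb]
      congr 1
      have hres : ∀ v, (volume.restrict (Ioc u v)).prod μ =
          ((volume : Measure ℝ).prod μ).restrict (Ioc u v ×ˢ univ) := fun v => by
        rw [← Measure.prod_restrict, Measure.restrict_univ]
      rw [hN, hres, hres]
      refine setIntegral_eq_of_subset_of_forall_sdiff_eq_zero
        (measurableSet_Ioc.prod MeasurableSet.univ)
        (prod_mono (Ioc_subset_Ioc_right hr.2.le) subset_rfl) fun x hx => ?_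
      have hx1 : ¬ x.1 < r := fun hlt => hx.2 ⟨⟨hx.1.1.1, hlt.le⟩, mem_univ _⟩
      simp only [testKernel]
      simp [mH.eq_zero (p := (x.1, Y x.1 x.2)) (q := (r, _)) fun hh => hx1 hh.2.1]
    · rw [indicator_of_notMem hr]
      rcases le_or_gt r u with hru | hru
      · have z1 : ∀ ω, testKernel (fun w => testKernel f t Φ (r, w)) r P (u, Y u ω) = 0 :=
          fun ω => by
            rw [testKernel]
            simp [hP.eq_zero (p := (u, Y u ω)) (q := (r, _)) fun hh => hru.not_gt hh.2.1]
        have hmem : ∀ᵐ x ∂N, x.1 ∈ Ioc u t :=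
          Measure.quasiMeasurePreserving_fst.ae (ae_restrict_mem measurableSet_Ioc)
        have z2 : ∫ x, testKernel (fun w => testKernel f t Φ (r, w)) r H (x.1, Y x.1 x.2) ∂N =
            0 := by
          refine integral_eq_zero_of_ae ?_
          filter_upwards [hmem] with x hx
          rw [testKernel]
          simp [mH.eq_zero (p := (x.1, Y x.1 x.2)) (q := (r, _)) fun hh =>
            (hru.trans hx.1.le).not_gt hh.2.1]
        rw [z2]
        simp [z1]
      · have hrt : t ≤ r := by
          by_contra hlt
          exact hr ⟨hru, not_le.1 hlt⟩
        have z : ∀ w, testKernel f t Φ (r, w) = 0 := fun w => by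
          rw [testKernel]
          simp [mΦ.eq_zero (p := (r, w)) (q := (t, _)) fun hh => hrt.not_gt hh.2.1]
        simp only [z]
        simp [testKernel]
  have htotal : ∫ r, (Ioo u t).indicator (fun r => ∫ ω, testKernel f t Φ (r, Y r ω) ∂μ) r =
      ∫ x, testKernel f t Φ (x.1, Y x.1 x.2) ∂N := by
    rw [integral_indicator measurableSet_Ioo, hN, integral_prod _ iΦ, integral_Ioc_eq_integral_Ioo]
  have hbal : ∫ x, testKernel f t Φ (x.1, Y x.1 x.2) ∂N =
      (∫ ω, testKernel f t (fun p q => ∫ m, Φ m q • P p m) (u, Y u ω) ∂μ) +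
      ∫ x, testKernel f t (fun p q => ∫ m, Φ m q • H p m) (x.1, Y x.1 x.2) ∂N := by
    rw [c1, c2, ← htotal, ← integral_add i1 i2]
    exact integral_congr_ae (Filter.Eventually.of_forall fun r => (hslice r).symm)
  simp only [hsplit] at hbal
  rw [integral_add iH iHΦ] at hbal
  rw [h.integral_eq_frozen_add_parametrix hY hK hH hu hut ht mf hf]
  simp only [hq]
  rw [integral_add iP iPΦ]
  linarith

end DiffusionData

end DensityFormula

section Positivity

lemma le_of_forall_setIntegral_le {X : Type*} [TopologicalSpace X] [MeasurableSpace X]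
    [OpensMeasurableSpace X] {ν : Measure X} [ν.IsOpenPosMeasure] {f g : X → ℝ}
    (cf : Continuous f) (cg : Continuous g) (hf : Integrable f ν) (hg : Integrable g ν)
    (h : ∀ E, MeasurableSet E → ∫ x in E, f x ∂ν ≤ ∫ x in E, g x ∂ν) (x : X) : f x ≤ g x := by
  have h1 := Measure.dense_of_ae (ae_le_of_forall_setIntegral_le hf hg fun E hE _ => h E hE)
  have h2 : {x | f x ≤ g x} = univ := by
    rw [← (isClosed_le cf cg).closure_eq]
    exact h1.closure_eq
  exact h2.ge (mem_univ x)

namespace DiffusionData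

variable {d : ℕ} {κ α c L T s S B K c' u t : ℝ} {a : ℝ → Vec d → Matrix (Fin d) (Fin d) ℝ}
  {b b₁ Θ ψ : ℝ → Vec d → Vec d} {Ω : Type*} [MeasurableSpace Ω] {μ : Measure Ω}
  {Y : ℝ → Ω → Vec d}

lemma majorized_transitionKernel (h : DiffusionData d κ α c L T s S a b b₁ Θ ψ) (hK : 0 ≤ K)
    (hH : ContractingKernel s S (1 / (4 * κ) / L ^ 2) K (α / 4) B Θ
      (parametrixKernel d s S a b b₁ Θ ψ 0)) :
    ∃ A, Majorized s S (1 / (4 * κ) / L ^ 2) K 1 A Θ (transitionKernel d s S a b b₁ Θ ψ) := by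
  have hα := h.constants.exponent_pos
  have hα1 := h.constants.exponent_le
  have hT := h.constants.time_pos
  have hP := h.majorized_frozenKernel hK
  have hc := hP.comp h.majorantFlow hH.majorized_seriesKernel one_pos le_rfl (by linarith)
    (by linarith)
  refine ⟨_, hP.stronglyMeasurable.add hc.stronglyMeasurable,
    add_nonneg hP.nonneg (mul_nonneg hc.nonneg (Real.rpow_nonneg hT.le (α / 4))), fun p q => ?_⟩
  refine (_root_.norm_add_le _ _).trans ?_
  rw [add_mul, mul_assoc (_ * _)]
  exact add_le_add (hP.norm_le p q) ((hc.norm_le p q).trans (mul_le_mul_of_nonneg_left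
    (majorant_add_exponent_le (by linarith) h.length_le p q) hc.nonneg))

/-- The density at time `t` of a path started at time `u` is continuous. -/
lemma continuous_integral_transitionKernel (h : DiffusionData d κ α c L T s S a b b₁ Θ ψ)
    (hY : ForwardEq c' b a u μ Y) (hK : 0 ≤ K)
    (hH : ContractingKernel s S (1 / (4 * κ) / L ^ 2) K (α / 4) B Θ
      (parametrixKernel d s S a b b₁ Θ ψ 0)) (t : ℝ) :
    Continuous fun y => ∫ ω, transitionKernel d s S a b b₁ Θ ψ (u, Y u ω) (t, y) ∂μ := by
  have := hY.finite
  obtain ⟨A, hA⟩ := h.majorized_transitionKernel hK hH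
  refine continuous_of_dominated (fun y => ?_) (fun y => Filter.Eventually.of_forall fun ω =>
    hA.norm_le_const h.majorantFlow.rate_pos.le (Y u ω) y) (integrable_const _)
    (Filter.Eventually.of_forall fun ω => h.continuous_transitionKernel hK hH (u, Y u ω) t)
  exact ((hA.stronglyMeasurable_right (t, y)).comp_measurable
    (measurable_const.prodMk (hY.measurable_at u))).aestronglyMeasurable

lemma integrable_integral_transitionKernel (h : DiffusionData d κ α c L T s S a b b₁ Θ ψ)
    (hY : ForwardEq c' b a u μ Y) (hK : 0 ≤ K)
    (hH : ContractingKernel s S (1 / (4 * κ) / L ^ 2) K (α / 4) B Θ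
      (parametrixKernel d s S a b b₁ Θ ψ 0)) (t : ℝ) :
    Integrable fun y => ∫ ω, transitionKernel d s S a b b₁ Θ ψ (u, Y u ω) (t, y) ∂μ := by
  have := hY.finite
  obtain ⟨A, hA⟩ := h.majorized_transitionKernel hK hH
  exact (hA.integrable_path h.majorantFlow hK one_pos hY.timeRegular_initial t).integral_prod_right

lemma setIntegral_integral_transitionKernel (h : DiffusionData d κ α c L T s S a b b₁ Θ ψ)
    (hY : ForwardEq c' b a u μ Y) (hK : 0 ≤ K)
    (hH : ContractingKernel s S (1 / (4 * κ) / L ^ 2) K (α / 4) B Θ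
      (parametrixKernel d s S a b b₁ Θ ψ 0)) (hu : s ≤ u) (hut : u < t) (ht : t ≤ S)
    {E : Set (Vec d)} (hE : MeasurableSet E) :
    ∫ y in E, (∫ ω, transitionKernel d s S a b b₁ Θ ψ (u, Y u ω) (t, y) ∂μ) =
      μ.real (Y t ⁻¹' E) := by
  have := hY.finite
  obtain ⟨A, hA⟩ := h.majorized_transitionKernel hK hH
  have mf : Measurable (E.indicator fun _ => (1 : ℝ)) := measurable_const.indicator hE
  have hf : ∀ y, |E.indicator (fun _ => (1 : ℝ)) y| ≤ 1 := fun y => by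
    by_cases hy : y ∈ E <;> simp [hy]
  have h1 := h.integral_eq_testKernel_transitionKernel hY hK hH hu hut ht mf hf
  simp only [testKernel] at h1
  rw [← integral_mul_integral_comm mf hf
    (hA.integrable_path h.majorantFlow hK one_pos hY.timeRegular_initial t)] at h1
  have h2 : (fun ω => E.indicator (fun _ => (1 : ℝ)) (Y t ω)) =
      (Y t ⁻¹' E).indicator fun _ => (1 : ℝ) := rfl
  rw [h2, integral_indicator ((hY.measurable_at t) hE)] at h1
  simp only [integral_const, smul_eq_mul, mul_one, measureReal_restrict_apply MeasurableSet.univ,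
    univ_inter] at h1
  rw [h1, ← integral_indicator hE]
  congr 1
  ext y
  by_cases hy : y ∈ E <;> simp [hy]

lemma exists_transitionKernel_pos (h : DiffusionData d κ α c L T s S a b b₁ Θ ψ) (hK : 0 ≤ K)
    (hH : ContractingKernel s S (1 / (4 * κ) / L ^ 2) K (α / 4) B Θ
      (parametrixKernel d s S a b b₁ Θ ψ 0)) :
    ∃ δ > 0, ∀ u t z y, s ≤ u → u < t → t ≤ S → t - u < δ → ‖z - ψ u (Θ t y)‖ ≤ √(t - u) →
      0 < transitionKernel d s S a b b₁ Θ ψ (u, z) (t, y) := by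
  have hα := h.constants.exponent_pos
  have hα1 := h.constants.exponent_le
  have hκ := h.constants.one_le_ellipticity
  have hκ0 := zero_lt_one.trans_le hκ
  have hc := (h.majorized_frozenKernel hK).comp h.majorantFlow hH.majorized_seriesKernel one_pos
    le_rfl (by linarith) (by linarith)
  set A := κ ^ ((d : ℝ) / 2) * (2 * B) * (L ^ d * (Real.pi / (1 / (4 * κ) / L ^ 2)) ^
    ((d : ℝ) / 2) * (2 * (1 / 1 + 1 / (α / 4)))) with hA
  set m := (2 * Real.pi * κ) ^ (-(d : ℝ) / 2) * Real.exp (-(κ / 2)) with hm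
  have hm0 : 0 < m := by positivity
  have hcont : ContinuousAt (fun τ : ℝ => A * (Real.exp (K * τ) * |τ| ^ (1 + α / 4 - 1))) 0 := by
    have h1 : ContinuousAt (fun τ : ℝ => |τ| ^ (1 + α / 4 - 1)) 0 :=
      continuous_abs.continuousAt.rpow_const (Or.inr (by linarith))
    have h2 : ContinuousAt (fun τ : ℝ => Real.exp (K * τ)) 0 := by fun_prop
    exact (h2.mul h1).const_mul A
  have h0 : A * (Real.exp (K * 0) * |(0 : ℝ)| ^ (1 + α / 4 - 1)) < m := by
    rw [abs_zero, Real.zero_rpow (by linarith), mul_zero, mul_zero]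
    exact hm0
  obtain ⟨δ, hδ, hsmall⟩ := Metric.eventually_nhds_iff.1 (hcont.eventually_lt_const h0)
  refine ⟨δ, hδ, fun u t z y hu hut ht htu hz => ?_⟩
  have hτ : 0 < t - u := sub_pos.2 hut
  have hτd : 0 < (t - u) ^ (-(d : ℝ) / 2) := Real.rpow_pos_of_pos hτ _
  have h1 := hsmall (y := t - u) (by rwa [Real.dist_eq, sub_zero, abs_of_pos hτ])
  have h2 := hc.norm_le_const h.majorantFlow.rate_pos.le (u := u) (t := t) z y
  have h3 : m * (t - u) ^ (-(d : ℝ) / 2) ≤ frozenKernel d s S a Θ ψ 0 (u, z) (t, y) := by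
    have h4 := gaussDens_ge (h.isElliptic_flowCov_add hut.le (le_refl 0) (Θ t y))
      hκ (by linarith) (z - ψ u (Θ t y))
    rw [frozenKernel, if_pos ⟨hu, hut, ht⟩]
    refine le_trans ?_ h4
    rw [add_zero, hm, mul_assoc, mul_comm (Real.exp _), gaussk]
    have h5 : ‖z - ψ u (Θ t y)‖ ^ 2 / (t - u) ≤ 1 := by
      rw [div_le_one hτ]
      calc _ ≤ √(t - u) ^ 2 := by gcongr
        _ = _ := Real.sq_sqrt hτ.le
    have h6 : -(κ / 2) ≤ -(κ / 2) * ‖z - ψ u (Θ t y)‖ ^ 2 / (t - u) := by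
      rw [mul_div_assoc]
      nlinarith
    gcongr
  rw [abs_of_pos hτ] at h1 h2
  rw [← mul_assoc, ← mul_assoc, mul_assoc A] at h2
  have h7 := mul_lt_mul_of_pos_right h1 hτd
  rw [transitionKernel]
  have h8 := (abs_le.1 ((Real.norm_eq_abs _).symm.le.trans h2)).1
  linarith

lemma integral_transitionKernel_pos (h : DiffusionData d κ α c L T s S a b b₁ Θ ψ)
    (hY : ForwardEq c' b a u μ Y) (hK : 0 ≤ K)
    (hH : ContractingKernel s S (1 / (4 * κ) / L ^ 2) K (α / 4) B Θ
      (parametrixKernel d s S a b b₁ Θ ψ 0)) (hμ : μ ≠ 0) {y : Vec d}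
    (hpos : ∀ᵐ ω ∂μ, 0 < transitionKernel d s S a b b₁ Θ ψ (u, Y u ω) (t, y)) :
    0 < ∫ ω, transitionKernel d s S a b b₁ Θ ψ (u, Y u ω) (t, y) ∂μ := by
  have := hY.finite
  obtain ⟨A, hA⟩ := h.majorized_transitionKernel hK hH
  have hi : Integrable (fun ω => transitionKernel d s S a b b₁ Θ ψ (u, Y u ω) (t, y)) μ :=
    Integrable.of_bound ((hA.stronglyMeasurable_right (t, y)).comp_measurable
      (measurable_const.prodMk (hY.measurable_at u))).aestronglyMeasurable _
      (Filter.Eventually.of_forall fun ω =>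
        hA.norm_le_const h.majorantFlow.rate_pos.le (Y u ω) y)
  refine (integral_nonneg_of_ae (hpos.mono fun _ => le_of_lt)).lt_of_ne fun h0 => hμ ?_
  have h1 := (integral_eq_zero_iff_of_nonneg_ae (hpos.mono fun _ => le_of_lt) hi).1 h0.symm
  rw [← ae_eq_bot, ← Filter.eventually_false_iff_eq_bot]
  filter_upwards [hpos, h1] with ω h2 h3
  exact h2.ne' h3

lemma measure_preimage_pos (h : DiffusionData d κ α c L T s S a b b₁ Θ ψ)
    (hY : ForwardEq c' b a u μ Y) (hK : 0 ≤ K)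
    (hH : ContractingKernel s S (1 / (4 * κ) / L ^ 2) K (α / 4) B Θ
      (parametrixKernel d s S a b b₁ Θ ψ 0)) (hu : s ≤ u) (hut : u < t) (ht : t ≤ S) (hμ : μ ≠ 0)
    {E : Set (Vec d)} (hE : MeasurableSet E) (hE0 : volume E ≠ 0)
    (hpos : ∀ y ∈ E, ∀ᵐ ω ∂μ, 0 < transitionKernel d s S a b b₁ Θ ψ (u, Y u ω) (t, y)) :
    0 < μ (Y t ⁻¹' E) := by
  have := hY.finite
  have h1 := h.setIntegral_integral_transitionKernel hY hK hH hu hut ht hE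
  have h2 := fun y hy => h.integral_transitionKernel_pos hY hK hH hμ (hpos y hy)
  have h3 : 0 < ∫ y in E, (∫ ω, transitionKernel d s S a b b₁ Θ ψ (u, Y u ω) (t, y) ∂μ) := by
    rw [setIntegral_pos_iff_support_of_nonneg_ae
      ((ae_restrict_mem hE).mono fun y hy => (h2 y hy).le)
      (h.integrable_integral_transitionKernel hY hK hH t).integrableOn]
    refine (pos_iff_ne_zero.2 hE0).trans_le (measure_mono fun y hy => ⟨(h2 y hy).ne', hy⟩)
  rw [h1] at h3
  exact (ENNReal.toReal_pos_iff.1 h3).1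

lemma norm_sub_flow_le (h : DiffusionData d κ α c L T s S a b b₁ Θ ψ) {R : ℝ} {z y w w' : Vec d}
    (hz : z ∈ Metric.closedBall (ψ u w) R) (hy : y ∈ Metric.closedBall (ψ t w') R) :
    ‖z - ψ u (Θ t y)‖ ≤ R + L * ‖w - w'‖ + L ^ 2 * R := by
  have hL := zero_lt_one.trans_le h.constants.one_le_lip
  rw [mem_closedBall_iff_norm] at hz hy
  have h1 := h.flow.lip_flow u w w'
  have h2 := h.flow.lip_flow u w' (Θ t y)
  have h3 := h.flow.lip_inv t (ψ t w') y
  rw [h.flow.inv_flow, _root_.norm_sub_rev (ψ t w')] at h3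
  have h4 : L * ‖w' - Θ t y‖ ≤ L ^ 2 * R := by
    rw [pow_two, mul_assoc]
    exact mul_le_mul_of_nonneg_left (h3.trans (mul_le_mul_of_nonneg_left hy hL.le)) hL.le
  have h5 : z - ψ u (Θ t y) = (z - ψ u w) + (ψ u w - ψ u w') + (ψ u w' - ψ u (Θ t y)) := by abel
  rw [h5]
  refine norm_add₃_le.trans ?_
  linarith

/-- The law of a path conditioned on an event in its past has a density bounded by the transition
kernel. -/
lemma integral_transitionKernel_le {P : Measure Ω} [IsProbabilityMeasure P] {E₀ : Set Ω}
    (h : DiffusionData d κ α c L T s S a b b₁ Θ ψ) (hYs : ForwardEq c' b a s P Y)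
    (hYu : ForwardEq c' b a u (P.restrict E₀) Y) (hK : 0 ≤ K)
    (hH : ContractingKernel s S (1 / (4 * κ) / L ^ 2) K (α / 4) B Θ
      (parametrixKernel d s S a b b₁ Θ ψ 0)) {x : Vec d} (hx : ∀ᵐ ω ∂P, Y s ω = x)
    (hu : s ≤ u) (hut : u < t) (ht : t ≤ S) (y : Vec d) :
    ∫ ω in E₀, transitionKernel d s S a b b₁ Θ ψ (u, Y u ω) (t, y) ∂P ≤
      transitionKernel d s S a b b₁ Θ ψ (s, x) (t, y) := by
  have h1 : ∀ y, ∫ ω, transitionKernel d s S a b b₁ Θ ψ (s, Y s ω) (t, y) ∂P =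
      transitionKernel d s S a b b₁ Θ ψ (s, x) (t, y) := fun y => by
    rw [integral_congr_ae (g := fun _ => transitionKernel d s S a b b₁ Θ ψ (s, x) (t, y))
      (hx.mono fun ω hω => by simp only [hω])]
    simp
  rw [← h1]
  refine le_of_forall_setIntegral_le (h.continuous_integral_transitionKernel hYu hK hH t)
    (h.continuous_integral_transitionKernel hYs hK hH t)
    (h.integrable_integral_transitionKernel hYu hK hH t)
    (h.integrable_integral_transitionKernel hYs hK hH t) (fun E hE => ?_) y
  rw [h.setIntegral_integral_transitionKernel hYu hK hH hu hut ht hE,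
    h.setIntegral_integral_transitionKernel hYs hK hH le_rfl (hu.trans_lt hut) ht hE]
  exact ENNReal.toReal_mono (measure_ne_top _ _) (Measure.restrict_apply_le _ _)

/-- The transition kernel is positive along every solution, by chaining the short-time lower
bound. -/
theorem transitionKernel_pos {P : Measure Ω} [IsProbabilityMeasure P]
    (h : DiffusionData d κ α c L T s S a b b₁ Θ ψ)
    (hY : ∀ r E, s ≤ r → MeasurableSet E → ForwardEq c' b a r (P.restrict (Y r ⁻¹' E)) Y)
    (hK : 0 ≤ K) (hH : ContractingKernel s S (1 / (4 * κ) / L ^ 2) K (α / 4) B Θ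
      (parametrixKernel d s S a b b₁ Θ ψ 0)) {x : Vec d} (hx : ∀ᵐ ω ∂P, Y s ω = x)
    (hst : s < t) (ht : t ≤ S) (y : Vec d) :
    0 < transitionKernel d s S a b b₁ Θ ψ (s, x) (t, y) := by
  have hYs : ForwardEq c' b a s P Y := by simpa using hY s univ le_rfl MeasurableSet.univ
  have hL1 := h.constants.one_le_lip
  have hL := zero_lt_one.trans_le hL1
  have hts : 0 < t - s := sub_pos.2 hst
  obtain ⟨δ, hδ, hpos⟩ := h.exists_transitionKernel_pos hK hH
  obtain ⟨n, hn⟩ := exists_nat_gt (max 1 (max (4 * L ^ 2 * ‖Θ t y - x‖ ^ 2 / (t - s))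
    ((t - s) / δ)))
  have hn1 : (1 : ℝ) < n := (le_max_left _ _).trans_lt hn
  have hn2 := ((le_max_left _ _).trans (le_max_right _ _)).trans_lt hn
  have hn3 := ((le_max_right _ _).trans (le_max_right _ _)).trans_lt hn
  have hn0 : (0 : ℝ) < n := by linarith
  set τ := (t - s) / n with hτ
  have hτ0 : 0 < τ := by positivity
  have hτδ : τ < δ := by
    rw [div_lt_iff₀ hδ] at hn3
    rw [hτ, div_lt_iff₀ hn0]
    linarith
  set R := √τ / (4 * L ^ 2) with hR
  have hR0 : 0 < R := by positivity
  set w : ℕ → Vec d := fun i => x + ((i : ℝ) / n) • (Θ t y - x) with hw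
  set σ : ℕ → ℝ := fun i => s + i * τ with hσ
  have hσn : σ n = t := by
    simp only [hσ, hτ]
    field_simp
    ring
  have hwn : w n = Θ t y := by
    simp only [hw, div_self hn0.ne', one_smul, add_sub_cancel]
  have hσs : ∀ i, s ≤ σ i := fun i => by
    simp only [hσ, le_add_iff_nonneg_right]
    positivity
  have hσsucc : ∀ i, σ (i + 1) = σ i + τ := fun i => by
    simp only [hσ]
    push_cast
    ring
  have hσt : ∀ i ≤ n, σ i ≤ t := fun i hi => by
    rw [← hσn]
    simp only [hσ]
    gcongr
  have hwsucc : ∀ i, L * ‖w i - w (i + 1)‖ ≤ √τ / 2 := fun i => by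
    have h1 : w i - w (i + 1) = (-(1 / n : ℝ)) • (Θ t y - x) := by
      simp only [hw]
      rw [add_sub_add_left_eq_sub, ← sub_smul]
      congr 1
      push_cast
      ring
    rw [h1, norm_smul, norm_neg, Real.norm_of_nonneg (by positivity), le_div_iff₀ two_pos]
    refine Real.le_sqrt_of_sq_le ?_
    rw [div_lt_iff₀ hts] at hn2
    rw [hτ, le_div_iff₀ hn0]
    have h2 : (L * (1 / n * ‖Θ t y - x‖) * 2) ^ 2 * n = 4 * L ^ 2 * ‖Θ t y - x‖ ^ 2 / n := by
      field_simp
      ring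
    rw [h2, div_le_iff₀ hn0]
    linarith
  have hstep : ∀ i < n, ∀ z ∈ Metric.closedBall (ψ (σ i) (w i)) R,
      ∀ y' ∈ Metric.closedBall (ψ (σ (i + 1)) (w (i + 1))) R,
      0 < transitionKernel d s S a b b₁ Θ ψ (σ i, z) (σ (i + 1), y') := fun i hi z hz y' hy' => by
    refine hpos _ _ z y' (hσs i) (by linarith [hσsucc i]) ((hσt (i + 1) hi).trans ht)
      (by rwa [hσsucc, add_sub_cancel_left]) ?_
    rw [hσsucc i, add_sub_cancel_left, ← hσsucc i]
    refine (h.norm_sub_flow_le hz hy').trans ?_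
    have h1 : (1 + L ^ 2) * R ≤ √τ / 2 := by
      rw [hR, mul_div_assoc', div_le_iff₀ (by positivity)]
      nlinarith [Real.sqrt_nonneg τ, mul_nonneg (Real.sqrt_nonneg τ)
        (by nlinarith : 0 ≤ L ^ 2 - 1)]
    linarith [hwsucc i]
  have hrestrict : ∀ i, 0 < P (Y (σ i) ⁻¹' Metric.closedBall (ψ (σ i) (w i)) R) →
      P.restrict (Y (σ i) ⁻¹' Metric.closedBall (ψ (σ i) (w i)) R) ≠ 0 := fun i hi h0 =>
    hi.ne' (Measure.restrict_eq_zero.1 h0)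
  have hmem : ∀ i, ∀ᵐ ω ∂P.restrict (Y (σ i) ⁻¹' Metric.closedBall (ψ (σ i) (w i)) R),
      Y (σ i) ω ∈ Metric.closedBall (ψ (σ i) (w i)) R := fun i =>
    ae_restrict_mem (hYs.measurable_at (σ i) Metric.isClosed_closedBall.measurableSet)
  have hchain : ∀ i < n, 0 < P (Y (σ i) ⁻¹' Metric.closedBall (ψ (σ i) (w i)) R) := by
    intro i
    induction i with
    | zero =>
      intro _
      have h1 : ψ (σ 0) (w 0) = x := by
        have h2 := h.flow.start (ψ s x)
        rw [h.flow.inv_flow] at h2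
        simp [hσ, hw, ← h2]
      rw [h1]
      have h3 : ∀ᵐ ω ∂P, ω ∈ Y (σ 0) ⁻¹' Metric.closedBall x R := hx.mono fun ω hω => by
        simp [hσ, hω, hR0.le]
      have h4 : P (Y (σ 0) ⁻¹' Metric.closedBall x R) = P univ :=
        measure_congr (Filter.eventuallyEq_univ.2 h3)
      rw [h4]
      simp
    | succ i ih =>
      intro hi
      have hi' : i < n := by omega
      refine (h.measure_preimage_pos (hY (σ i) _ (hσs i) Metric.isClosed_closedBall.measurableSet)
        hK hH (hσs i) (by linarith [hσsucc i]) ((hσt (i + 1) hi.le).trans ht)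
        (hrestrict i (ih hi')) Metric.isClosed_closedBall.measurableSet
        (Metric.measure_closedBall_pos volume _ hR0).ne'
        fun y' hy' => (hmem i).mono fun ω hω => hstep i hi' _ hω y' hy').trans_le
        (Measure.restrict_apply_le _ _)
  obtain ⟨k, rfl⟩ : ∃ k, n = k + 1 := ⟨n - 1, by
    have : (0 : ℝ) < n := hn0
    have : 0 < n := by exact_mod_cast this
    omega⟩
  have hyk : y ∈ Metric.closedBall (ψ (σ (k + 1)) (w (k + 1))) R := by
    rw [hwn, hσn, h.flow.flow_inv]
    exact Metric.mem_closedBall_self hR0.le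
  have hk := hY (σ k) _ (hσs k) (Metric.isClosed_closedBall (x := ψ (σ k) (w k)) (ε := R)).measurableSet
  have hkt : σ k < t := by linarith [hσsucc k]
  refine (h.integral_transitionKernel_pos hk hK hH (hrestrict k (hchain k k.lt_succ_self))
    ((hmem k).mono fun ω hω => ?_)).trans_le
    (h.integral_transitionKernel_le hYs hk hK hH hx (hσs k) hkt ht y)
  have := hstep k k.lt_succ_self _ hω y hyk
  rwa [hσn] at this

end DiffusionData

end Positivity

section Density

lemma eq_of_withDensity_ofReal_eq {X : Type*} [TopologicalSpace X] [MeasurableSpace X]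
    [BorelSpace X] {ν : Measure X} [SigmaFinite ν] [ν.IsOpenPosMeasure] {f g : X → ℝ}
    (cf : Continuous f) (cg : Continuous g) (hg : ∀ x, 0 < g x)
    (h : ν.withDensity (fun x => ENNReal.ofReal (f x)) =
      ν.withDensity fun x => ENNReal.ofReal (g x)) : f = g := by
  have cf' : Continuous fun x => ENNReal.ofReal (f x) := ENNReal.continuous_ofReal.comp cf
  have cg' : Continuous fun x => ENNReal.ofReal (g x) := ENNReal.continuous_ofReal.comp cg
  have h1 := (Continuous.ae_eq_iff_eq ν cf' cg').1 ((withDensity_eq_iff_of_sigmaFinite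
    cf'.measurable.aemeasurable cg'.measurable.aemeasurable).1 h)
  funext x
  have h2 := congrFun h1 x
  have h3 : 0 < f x := by
    rw [← ENNReal.ofReal_pos, h2]
    exact ENNReal.ofReal_pos.2 (hg x)
  exact (ENNReal.ofReal_eq_ofReal_iff h3.le (hg x).le).1 h2

namespace DiffusionData

variable {d : ℕ} {κ α c L T s S B K c' t : ℝ} {a : ℝ → Vec d → Matrix (Fin d) (Fin d) ℝ}
  {b b₁ Θ ψ : ℝ → Vec d → Vec d} {Ω : Type*} [MeasurableSpace Ω]
  {Y : ℝ → Ω → Vec d}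

lemma map_eq_withDensity {P : Measure Ω} [IsProbabilityMeasure P]
    (h : DiffusionData d κ α c L T s S a b b₁ Θ ψ)
    (hY : ∀ r E, s ≤ r → MeasurableSet E → ForwardEq c' b a r (P.restrict (Y r ⁻¹' E)) Y)
    (hK : 0 ≤ K) (hH : ContractingKernel s S (1 / (4 * κ) / L ^ 2) K (α / 4) B Θ
      (parametrixKernel d s S a b b₁ Θ ψ 0)) {x : Vec d} (hx : ∀ᵐ ω ∂P, Y s ω = x)
    (hst : s < t) (ht : t ≤ S) :
    Measure.map (Y t) P = volume.withDensity fun y =>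
      ENNReal.ofReal (transitionKernel d s S a b b₁ Θ ψ (s, x) (t, y)) := by
  have hYs : ForwardEq c' b a s P Y := by simpa using hY s univ le_rfl MeasurableSet.univ
  have h1 : (fun y => ∫ ω, transitionKernel d s S a b b₁ Θ ψ (s, Y s ω) (t, y) ∂P) =
      fun y => transitionKernel d s S a b b₁ Θ ψ (s, x) (t, y) := funext fun y => by
    rw [integral_congr_ae (g := fun _ => transitionKernel d s S a b b₁ Θ ψ (s, x) (t, y))
      (hx.mono fun ω hω => by simp only [hω])]
    simp
  have h2 := h.integrable_integral_transitionKernel hYs hK hH t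
  rw [h1] at h2
  ext E hE
  have h3 := h.setIntegral_integral_transitionKernel hYs hK hH le_rfl hst ht hE
  rw [h1] at h3
  rw [Measure.map_apply (hYs.measurable_at t) hE, withDensity_apply _ hE,
    ← ofReal_integral_eq_lintegral_ofReal h2.integrableOn (Filter.Eventually.of_forall fun y =>
      (h.transitionKernel_pos hY hK hH hx hst ht y).le), h3, ofReal_measureReal]

end DiffusionData

/-- Continuous densities of solutions of the martingale problem are given by the transition
kernel. -/
lemma MartingaleProblemSolution.density_eq_transitionKernel {d : ℕ} {b : ℝ → Vec d → Vec d}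
    {σ : ℝ → Vec d → Matrix (Fin d) (Fin d) ℝ}
    {κ₀ κ₁ α c L T s S B K t : ℝ} {b₁ Θ ψ : ℝ → Vec d → Vec d} {x : Vec d} {Ω : Type*}
    [MeasurableSpace Ω] {P : Measure Ω} {X : ℝ → Ω → Vec d} {p : Vec d → ℝ}
    (hX : MartingaleProblemSolution d b σ s x P X) (hκ₀ : 1 ≤ κ₀) (hκ₁ : 0 < κ₁)
    (hσ : EllipticHolder d σ κ₀ α) (hb : HolderDrift d b κ₁ 0) (hs : 0 ≤ s)
    (h : DiffusionData d κ₀ α c L T s S (fun r => sqMat d σ (max r 0)) (fun r => b (max r 0))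
      b₁ Θ ψ) (hK : 0 ≤ K)
    (hH : ContractingKernel s S (1 / (4 * κ₀) / L ^ 2) K (α / 4) B Θ
      (parametrixKernel d s S (fun r => sqMat d σ (max r 0)) (fun r => b (max r 0)) b₁ Θ ψ 0))
    (hst : s < t) (ht : t ≤ S) (cp : Continuous p)
    (hp : Measure.map (X t) P = volume.withDensity fun y => ENNReal.ofReal (p y)) (y : Vec d) :
    p y = transitionKernel d s S (fun r => sqMat d σ (max r 0)) (fun r => b (max r 0)) b₁ Θ ψ
      (s, x) (t, y) := by
  have := hX.isProb
  have hY : ∀ r E, s ≤ r → MeasurableSet E → ForwardEq (κ₀ + 2 * κ₁) (fun r => b (max r 0))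
      (fun r => sqMat d σ (max r 0)) r (P.restrict ((fun ω => X (max r s) ω) ⁻¹' E))
      (fun r => X (max r s)) := fun r E hr hE => by
    refine hX.forwardEq hκ₀ hκ₁ hσ hb hs hr ?_
    rw [max_eq_left hr]
    exact measurable_pathSigma d X hr hE
  have hx : ∀ᵐ ω ∂P, X (max s s) ω = x := by simpa using hX.start
  have h1 := h.map_eq_withDensity hY hK hH hx hst ht
  simp only [max_eq_left hst.le] at h1
  exact congrFun (eq_of_withDensity_ofReal_eq cp (h.continuous_transitionKernel hK hH (s, x) t)
    (h.transitionKernel_pos hY hK hH hx hst ht) (hp.symm.trans h1)) y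

lemma EllipticHolder.diffusionData {d : ℕ} {b : ℝ → Vec d → Vec d}
    {σ : ℝ → Vec d → Matrix (Fin d) (Fin d) ℝ} {θ : ℝ → ℝ → Vec d → Vec d} {ρ : Vec d → ℝ}
    {κ₀ κ₁ α K T s : ℝ} (hσ : EllipticHolder d σ κ₀ α) (hT : 0 < T) (hα : α ∈ Ioc (0 : ℝ) 1)
    (hκ₀ : 1 ≤ κ₀) (hκ₁ : 0 < κ₁) (hρ : IsMollifier d ρ) (hb : HolderDrift d b κ₁ 0) (hK : 0 ≤ K)
    (lf : ∀ t, 0 ≤ t → ∀ x y,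
      ‖mollifiedDrift d ρ 1 b t x - mollifiedDrift d ρ 1 b t y‖ ≤ K * ‖x - y‖)
    (hθ : IsFlow d (mollifiedDrift d ρ 1 b) θ) (hs : 0 ≤ s) :
    DiffusionData d κ₀ α (1 + 2 * d * κ₀ ^ 2 + 3 * κ₁ + K) (Real.exp (K * T)) T s (s + T)
      (fun r => sqMat d σ (max r 0)) (fun r => b (max r 0))
      (fun r => mollifiedDrift d ρ 1 b (max r 0)) (fun r y => θ s (clampTime s (s + T) r) y)
      (fun r w => θ (clampTime s (s + T) r) s w) := by
  have hpos : ∀ r : ℝ, 0 ≤ max r 0 := fun r => le_max_right _ _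
  have hmax : Measurable fun p : ℝ × Vec d => (max p.1 0, p.2) := by fun_prop
  have f0 : ∀ r, 0 ≤ r → ‖mollifiedDrift d ρ 1 b r 0‖ ≤ 3 * κ₁ := fun r hr => by
    have h1 := hb.norm_sub_mollifiedDrift_le hκ₁ hρ hr 0 0
    have h2 := hb.2.1 r hr
    have h3 := norm_le_norm_add_norm_sub (b r 0) (mollifiedDrift d ρ 1 b r 0)
    simp only [sub_zero, norm_zero, add_zero, mul_one] at h1
    linarith
  have hdκ : 0 ≤ 2 * d * κ₀ ^ 2 := by positivity
  have hflow := hθ.isFlowPair hK (by positivity) (hb.measurable_mollifiedDrift hρ) lf f0 hs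
    (le_add_of_nonneg_right hT.le : s ≤ s + T)
  rw [add_sub_cancel_left] at hflow
  exact
    { constants := ⟨hκ₀, hα.1, hα.2, by linarith, Real.one_le_exp (by positivity), hT⟩
      flow :=
        { hflow with
          ode := fun r t w hr hrt ht => by
            rw [hflow.ode r t w hr hrt ht]
            refine intervalIntegral.integral_congr fun y hy => ?_
            rw [uIcc_of_le hrt] at hy
            simp only [max_eq_left (hs.trans (hr.trans hy.1))] }
      elliptic := fun r z => hσ.isElliptic (hpos r) z
      holder := fun r z w i j => (hσ.abs_sub_le hκ₀ (hpos r) z w i j).trans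
        (mul_le_mul_of_nonneg_right (by linarith) (Real.rpow_nonneg (norm_nonneg _) _))
      measurable_diff := fun i j => (hσ.measurable_sqMat i j).comp hmax
      measurable_drift := hb.1.comp hmax
      measurable_flowDrift := (hb.measurable_mollifiedDrift hρ).comp hmax
      continuous_flowDrift := fun r => (LipschitzWith.of_dist_le_mul (K := ⟨K, hK⟩) fun x y => by
        rw [dist_eq_norm, dist_eq_norm]
        exact lf _ (hpos r) x y).continuous
      flowDrift_le := fun r z => by
        have h1 := lf _ (hpos r) z 0
        have h2 := f0 _ (hpos r)
        have h3 := norm_le_norm_add_norm_sub (mollifiedDrift d ρ 1 b (max r 0) 0)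
          (mollifiedDrift d ρ 1 b (max r 0) z)
        rw [sub_zero] at h1
        have h4 := norm_nonneg z
        rw [_root_.norm_sub_rev] at h3
        nlinarith [mul_nonneg hκ₁.le h4, mul_nonneg hdκ h4]
      drift_sub_le := fun r z w => (hb.norm_sub_mollifiedDrift_le hκ₁ hρ (hpos r) z w).trans
        (mul_le_mul_of_nonneg_right (by linarith) (by positivity))
      length_le := by rw [add_sub_cancel_left] }

end Density

/-- **Gradient estimate in the backward variable.** Under (H^σ_α) and
(H^b_0), for `(s,t) ∈ 𝔻^T_0` and any family of martingale-problem solutions with jointly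
continuous density `p(s,·,t,·)`, the map `x ↦ p(s,x,t,y)` is `C¹` and there are
`λ₁ ∈ (0,1]`, `C₁ ≥ 1` depending only on `Θ = (T,α,0,κ₀,κ₁,d)` with
`|∇_x p(s,x,t,y)| ≤ C₁ (t−s)^{−1/2} g_{λ₁}(t−s, θ^{(1)}_{t,s}(x)−y)`. -/
theorem gradient_estimate_backward
    (d : ℕ) (T α κ₀ κ₁ : ℝ) (hT : 0 < T) (hα : α ∈ Set.Ioc (0 : ℝ) 1)
    (hκ₀ : 1 ≤ κ₀) (hκ₁ : 0 < κ₁) (ρ : Vec d → ℝ) (hρ : IsMollifier d ρ) :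
    ∃ l₁ ∈ Set.Ioc (0 : ℝ) 1, ∃ C₁ : ℝ, 1 ≤ C₁ ∧
      ∀ (b : ℝ → Vec d → Vec d) (σ : ℝ → Vec d → Matrix (Fin d) (Fin d) ℝ)
        (θ1 : ℝ → ℝ → Vec d → Vec d),
        EllipticHolder d σ κ₀ α → HolderDrift d b κ₁ 0 →
        IsFlow d (mollifiedDrift d ρ 1 b) θ1 →
      ∀ s t : ℝ, 0 ≤ s → s < t → t - s < T →
      ∀ (Ω : Type) (mΩ : MeasurableSpace Ω)
        (P : Vec d → MeasureTheory.Measure Ω) (X : ℝ → Ω → Vec d),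
        (∀ x : Vec d, MartingaleProblemSolution d b σ s x (P x) X) →
      ∀ p : Vec d → Vec d → ℝ,
        Continuous (fun q : Vec d × Vec d => p q.1 q.2) →
        (∀ x : Vec d,
          MeasureTheory.Measure.map (X t) (P x) =
            MeasureTheory.volume.withDensity fun y => ENNReal.ofReal (p x y)) →
        (∀ y : Vec d, ContDiff ℝ 1 fun x => p x y) ∧
        ∀ x y : Vec d,
          ‖fderiv ℝ (fun x' => p x' y) x‖ ≤
            C₁ * (t - s) ^ (-(1 : ℝ) / 2) * gaussk d l₁ (t - s) (θ1 t s x - y) := by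
  obtain ⟨M, hM, lf⟩ := HolderDrift.exists_lipschitz_mollifiedDrift hκ₁ hρ
  have hC : AdmissibleConstants κ₀ α (1 + 2 * d * κ₀ ^ 2 + 3 * κ₁ + M) (Real.exp (M * T)) T := by
    have hdκ : 0 ≤ 2 * d * κ₀ ^ 2 := by positivity
    exact ⟨hκ₀, hα.1, hα.2, by linarith, Real.one_le_exp (by positivity), hT⟩
  obtain ⟨B, K, hB, hK, hmaj⟩ := DiffusionData.exists_contracting_majorant d hC
  obtain ⟨C, hC1, hgrad⟩ := norm_transitionGradient_le d hC hB hK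
  have hL := hC.one_le_lip
  set L := Real.exp (M * T) with hL'
  set l := 1 / (4 * κ₀) / L ^ 2 with hl
  have hl0 : 0 < l := by positivity
  have hl1 : l ≤ 1 := by
    rw [hl, div_div]
    exact div_le_one_of_le₀ (one_le_mul_of_one_le_of_one_le (by linarith) (one_le_pow₀ hL))
      (by positivity)
  refine ⟨l / L ^ 2, ⟨by positivity, (div_le_self hl0.le (one_le_pow₀ hL)).trans hl1⟩,
    C * Real.exp (K * T), one_le_mul_of_one_le_of_one_le hC1 (Real.one_le_exp (by positivity)),
    fun b σ θ1 hσ hb hθ s t hs hst hts Ω mΩ P X hX p cp hp => ?_⟩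
  have h := hσ.diffusionData hT hα hκ₀ hκ₁ hρ hb hM (lf b hb) hθ hs
  have hbounds := hmaj _ _ _ _ _ _ _ h
  have hH : ContractingKernel s (s + T) l K (α / 4) B _ _ :=
    ⟨h.measurable_parametrixKernel 0, hB, hbounds.1, hbounds.2⟩
  obtain ⟨⟨A, hG⟩, hbound⟩ := hgrad _ _ _ _ _ _ _ h hH
  have ht : t ≤ s + T := by linarith
  have hpq : ∀ y, (fun x => p x y) = fun x => transitionKernel d s (s + T) _ _ _ _ _ (s, x) (t, y) :=
    fun y => funext fun x => (hX x).density_eq_transitionKernel hκ₀ hκ₁ hσ hb hs h hK hH hst ht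
      (cp.comp (Continuous.prodMk_right x)) (hp x) y
  refine ⟨fun y => hpq y ▸ h.contDiff_transitionKernel hK hH hG s (t, y), fun x y => ?_⟩
  have hτ : 0 < t - s := sub_pos.2 hst
  rw [hpq y, (h.hasFDerivAt_transitionKernel hK hH hG s (t, y) x).fderiv]
  refine (hbound (s, x) (t, y)).trans ?_
  have hv := h.flow.lip_flow t x (θ1 s (clampTime s (s + T) t) y)
  have hstart := h.flow.start x
  have hinv := h.flow.flow_inv t y
  simp only [clampTime_eq (show t ∈ Icc s (s + T) from ⟨hst.le, ht⟩)] at hv hinv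
  rw [hinv] at hv
  have hg := gaussk_le_of_norm_le (d := d) hl0.le (zero_lt_one.trans_le hL) hτ.le hv
  rw [majorant_of_mem (p := (s, x)) (q := (t, y)) ⟨le_rfl, hst, ht⟩]
  simp only [hstart, clampTime_eq (show t ∈ Icc s (s + T) from ⟨hst.le, ht⟩)]
  rw [show (1 / 2 - 1 : ℝ) = -1 / 2 by norm_num]
  have hexp : Real.exp (K * (t - s)) ≤ Real.exp (K * T) := by gcongr
  have hg0 := gaussk_nonneg (d := d) (l := l) hτ.le (x - θ1 s t y)
  have hpow : 0 ≤ (t - s) ^ (-1 / 2 : ℝ) := by positivity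
  rw [mul_assoc (C * _), mul_assoc C, mul_assoc (Real.exp (K * (t - s)))]
  gcongr
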